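/- There exists an absolute constant c > 0 such that there exist arbitrarily large finite sets A ⊆ ℝ with max(|A+A|, |AA|) ≤ |A|^{2−c}; that is, for every N there is a finite A ⊆ ℝ with |A| ≥ N and both |A+A| ≤ |A|^{2−c} and |AA| ≤ |A|^{2−c}. -/

import Mathlib

open Pointwise

section

namespace GolodShafarevich

open Module

/-- The augmentation map of the group algebra. -/
noncomputable def aug (k G : Type*) [Field k] [Group G] : MonoidAlgebra k G →ₐ[k] k :=
  MonoidAlgebra.lift k k G 1

/-- The augmentation ideal. -/
noncomputable abbrev augIdeal (k G : Type*) [Field k] [Group G] : Ideal (MonoidAlgebra k G) :=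
  RingHom.ker (aug k G)

section

variable {k G : Type*} [Field k] [Group G]

@[simp]
lemma aug_of (g : G) : aug k G (MonoidAlgebra.of k G g) = 1 := by
  simp [aug]

lemma of_sub_one_mem (g : G) : MonoidAlgebra.of k G g - 1 ∈ augIdeal k G := by
  rw [RingHom.mem_ker, map_sub, aug_of, map_one, sub_self]

variable {M : Type*} [AddCommGroup M] [Module k M] [Module (MonoidAlgebra k G) M]
  [IsScalarTower k (MonoidAlgebra k G) M]

lemma apply_smul_of_invariant (l : Dual k M)
    (hl : ∀ (g : G) (q : M), l (MonoidAlgebra.of k G g • q) = l q)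
    (a : MonoidAlgebra k G) (q : M) : l (a • q) = aug k G a * l q := by
  induction a using MonoidAlgebra.induction_on with
  | of g => rw [hl, aug_of, one_mul]
  | add x y hx hy => rw [add_smul, map_add, hx, hy, map_add, add_mul]
  | smul r x hx => rw [smul_assoc, map_smul, hx, map_smul, smul_eq_mul, smul_eq_mul, mul_assoc]

end

section Nakayama

variable {G : Type*} [Group G] {M : Type*} [AddCommGroup M] [Module (ZMod 2) M]
  [Module (MonoidAlgebra (ZMod 2) G) M]
  [IsScalarTower (ZMod 2) (MonoidAlgebra (ZMod 2) G) M]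

/-- The contragredient action. -/
@[reducible]
noncomputable def dualAction : MulAction G (Dual (ZMod 2) M) where
  smul g l := l ∘ₗ
    { toFun := fun q => MonoidAlgebra.of (ZMod 2) G g⁻¹ • q
      map_add' := fun x y => smul_add _ x y
      map_smul' := fun r x => smul_comm (MonoidAlgebra.of (ZMod 2) G g⁻¹) r x }
  one_smul l := by
    ext q
    change l (MonoidAlgebra.of (ZMod 2) G 1⁻¹ • q) = l q
    rw [inv_one, map_one, one_smul]
  mul_smul g h l := by
    ext q
    change l (MonoidAlgebra.of (ZMod 2) G (g * h)⁻¹ • q) =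
      l (MonoidAlgebra.of (ZMod 2) G h⁻¹ • (MonoidAlgebra.of (ZMod 2) G g⁻¹ • q))
    rw [smul_smul, ← map_mul, mul_inv_rev]

variable (M) in
lemma exists_invariant_dual [Finite M] [Nontrivial M] (hG : IsPGroup 2 G) :
    ∃ l : Dual (ZMod 2) M, l ≠ 0 ∧
      ∀ (g : G) (q : M), l (MonoidAlgebra.of (ZMod 2) G g • q) = l q := by
  let act : MulAction G (Dual (ZMod 2) M) := dualAction
  have : Fact (Nat.Prime 2) := ⟨Nat.prime_two⟩
  have : Finite (Dual (ZMod 2) M) := Module.finite_of_finite (ZMod 2)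
  have h2 : 2 ∣ Nat.card (Dual (ZMod 2) M) := by
    rw [Module.natCard_eq_pow_finrank (K := ZMod 2), Subspace.dual_finrank_eq, Nat.card_zmod]
    exact dvd_pow_self 2 (Module.finrank_pos (R := ZMod 2)).ne'
  have hz : (0 : Dual (ZMod 2) M) ∈ MulAction.fixedPoints G (Dual (ZMod 2) M) := by
    intro g
    ext q
    rfl
  obtain ⟨l, hl, hl0⟩ := hG.exists_fixed_point_of_prime_dvd_card_of_fixed_point _ h2 hz
  refine ⟨l, hl0.symm, fun g q => ?_⟩
  have := LinearMap.congr_fun (hl g⁻¹) q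
  rw [← this]
  exact (congrArg (fun h => l (MonoidAlgebra.of (ZMod 2) G h • q)) (inv_inv g)).symm

lemma eq_top_of_sup_augIdeal_smul [Finite M] (hG : IsPGroup 2 G)
    (S : Submodule (MonoidAlgebra (ZMod 2) G) M)
    (hS : S ⊔ augIdeal (ZMod 2) G • (⊤ : Submodule (MonoidAlgebra (ZMod 2) G) M) = ⊤) : S = ⊤ := by
  by_contra hne
  have hnt : Nontrivial (M ⧸ S) := Submodule.Quotient.nontrivial_iff.2 hne
  have : Finite (M ⧸ S) := Finite.of_surjective _ S.mkQ_surjective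
  obtain ⟨l, hl0, hinv⟩ := exists_invariant_dual (M ⧸ S) hG
  apply hl0
  refine LinearMap.ext fun q => ?_
  obtain ⟨m, rfl⟩ := S.mkQ_surjective q
  have hm : m ∈ S ⊔ augIdeal (ZMod 2) G • (⊤ : Submodule (MonoidAlgebra (ZMod 2) G) M) :=
    by rw [hS]; trivial
  obtain ⟨s, hs, t, ht, rfl⟩ := Submodule.mem_sup.1 hm
  have hs0 : S.mkQ s = 0 := (Submodule.Quotient.mk_eq_zero S).2 hs
  rw [map_add, hs0, zero_add]
  refine Submodule.smul_induction_on ht (fun a ha n _ => ?_) (fun x y hx hy => ?_)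
  · rw [map_smul, apply_smul_of_invariant l hinv, (RingHom.mem_ker).1 ha, zero_mul]
    rfl
  · rw [map_add, map_add, hx, hy, map_add]

end Nakayama

end GolodShafarevich

end

section

namespace GolodShafarevich

open Module

section

variable {k G : Type*} [Field k] [Group G] {d : ℕ}

/-- The map `c ↦ ∑ cᵢ (xᵢ - 1)`. -/
noncomputable def relMap (k : Type*) [Field k] (x : Fin d → G) :
    (Fin d → MonoidAlgebra k G) →ₗ[MonoidAlgebra k G] MonoidAlgebra k G :=
  Fintype.linearCombination (MonoidAlgebra k G) (fun i => MonoidAlgebra.of k G (x i) - 1)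

lemma relMap_apply (x : Fin d → G) (c : Fin d → MonoidAlgebra k G) :
    relMap k x c = ∑ i, c i * (MonoidAlgebra.of k G (x i) - 1) := by
  simp [relMap, Fintype.linearCombination_apply]

lemma relMap_single (x : Fin d → G) (i : Fin d) (a : MonoidAlgebra k G) :
    relMap k x (Pi.single i a) = a * (MonoidAlgebra.of k G (x i) - 1) := by
  rw [relMap_apply, Finset.sum_eq_single i]
  · rw [Pi.single_eq_same]
  · intro j _ hj
    rw [Pi.single_eq_of_ne hj, zero_mul]
  · simp

lemma range_relMap {x : Fin d → G} (hx : Subgroup.closure (Set.range x) = ⊤) :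
    LinearMap.range (relMap k x) = augIdeal k G := by
  have h1 : ∀ g : G, MonoidAlgebra.of k G g - 1 ∈ LinearMap.range (relMap k x) := by
    intro g
    have hg : g ∈ Subgroup.closure (Set.range x) := hx ▸ Subgroup.mem_top g
    induction hg using Subgroup.closure_induction with
    | mem g hg =>
      obtain ⟨i, rfl⟩ := hg
      exact ⟨Pi.single i 1, by rw [relMap_single, one_mul]⟩
    | one => rw [map_one, sub_self]; exact zero_mem _
    | mul g h _ _ hg hh =>
      have : MonoidAlgebra.of k G (g * h) - 1 =
        MonoidAlgebra.of k G g • (MonoidAlgebra.of k G h - 1) + (MonoidAlgebra.of k G g - 1) := by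
        rw [map_mul, smul_eq_mul]; noncomm_ring
      rw [this]
      exact add_mem (Submodule.smul_mem _ _ hh) hg
    | inv g _ hg =>
      have : MonoidAlgebra.of k G g⁻¹ - 1 =
        -(MonoidAlgebra.of k G g⁻¹ • (MonoidAlgebra.of k G g - 1)) := by
        rw [smul_eq_mul, mul_sub, ← map_mul, inv_mul_cancel, map_one, mul_one, neg_sub]
      rw [this]
      exact neg_mem (Submodule.smul_mem _ _ hg)
  have h2 : ∀ a : MonoidAlgebra k G,
      a - algebraMap k _ (aug k G a) ∈ LinearMap.range (relMap k x) := by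
    intro a
    induction a using MonoidAlgebra.induction_on with
    | of g => rw [aug_of, map_one]; exact h1 g
    | add a b ha hb =>
      rw [map_add, map_add, add_sub_add_comm]
      exact add_mem ha hb
    | smul r a ha =>
      rw [map_smul, smul_eq_mul, map_mul, ← Algebra.smul_def, ← smul_sub, Algebra.smul_def]
      exact Submodule.smul_mem _ (algebraMap k (MonoidAlgebra k G) r) ha
  apply le_antisymm
  · rintro _ ⟨c, rfl⟩
    rw [relMap_apply]
    exact sum_mem fun i _ => Ideal.mul_mem_left _ _ (of_sub_one_mem _)
  · intro a ha
    have := h2 a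
    rwa [(RingHom.mem_ker).1 ha, map_zero, sub_zero] at this

/-- Vectors with coordinates in the `n`-th power of the augmentation ideal. -/
noncomputable abbrev piPow (k G : Type*) [Field k] [Group G] (d n : ℕ) :
    Submodule (MonoidAlgebra k G) (Fin d → MonoidAlgebra k G) :=
  Submodule.pi Set.univ fun _ => augIdeal k G ^ n

lemma map_relMap_piPow {x : Fin d → G} (hx : Subgroup.closure (Set.range x) = ⊤) (n : ℕ) :
    (piPow k G d n).map (relMap k x) = augIdeal k G ^ (n + 1) := by
  apply le_antisymm
  · rintro _ ⟨c, hc, rfl⟩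
    rw [relMap_apply, Submodule.pow_succ]
    exact sum_mem fun i _ => Ideal.mul_mem_mul (hc i trivial) (of_sub_one_mem _)
  · rw [Submodule.pow_succ, Ideal.mul_le]
    intro a ha b hb
    rw [← range_relMap hx] at hb
    obtain ⟨c, rfl⟩ := hb
    refine ⟨a • c, fun i _ => ?_, map_smul _ _ _⟩
    exact Ideal.mul_mem_right _ _ ha

lemma ker_relMap_le {x : Fin d → G} (chi : Fin d → G →* Multiplicative k)
    (hchi : ∀ i j, (chi j (x i)).toAdd = if i = j then 1 else 0) :
    LinearMap.ker (relMap k x) ≤ piPow k G d 1 := by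
  intro c hc j _
  let D : MonoidAlgebra k G →ₗ[k] k := Finsupp.linearCombination k (fun g => (chi j g).toAdd) ∘ₗ
    (MonoidAlgebra.coeffLinearEquiv k).toLinearMap
  have hD : ∀ g, D (MonoidAlgebra.of k G g) = (chi j g).toAdd := by
    intro g
    simp [D]
  have key : ∀ (a : MonoidAlgebra k G) (g : G),
      D (a * (MonoidAlgebra.of k G g - 1)) = aug k G a * (chi j g).toAdd := by
    intro a g
    induction a using MonoidAlgebra.induction_on with
    | of h => rw [mul_sub, ← map_mul, mul_one, map_sub, hD, hD, map_mul, toAdd_mul, aug_of]; ring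
    | add a b ha hb => rw [add_mul, map_add, ha, hb, map_add, add_mul]
    | smul r a ha => rw [smul_mul_assoc, map_smul, ha, map_smul, smul_eq_mul, smul_eq_mul, mul_assoc]
  have h := congrArg D ((relMap_apply x c).symm.trans hc)
  rw [map_sum, map_zero] at h
  simp_rw [key, hchi] at h
  simp only [mul_ite, mul_one, mul_zero, Finset.sum_ite_eq', Finset.mem_univ, if_true] at h
  change c j ∈ augIdeal k G ^ 1
  rw [Submodule.pow_one]
  exact h

lemma pow_smul_ker_le {x : Fin d → G} (hK : LinearMap.ker (relMap k x) ≤ piPow k G d 1) (n : ℕ) :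
    augIdeal k G ^ n • LinearMap.ker (relMap k x) ≤
      piPow k G d (n + 1) ⊓ LinearMap.ker (relMap k x) := by
  refine le_inf (Submodule.smul_le.2 fun a ha c hc i _ => ?_)
    (Submodule.smul_le.2 fun a _ c hc => Submodule.smul_mem _ a hc)
  have h : augIdeal k G ^ (n + 1) = augIdeal k G ^ n * augIdeal k G := Submodule.pow_succ _
  change (a • c) i ∈ augIdeal k G ^ (n + 1)
  rw [h]
  have hi : c i ∈ augIdeal k G ^ 1 := hK hc i trivial
  rw [Submodule.pow_one] at hi
  exact Ideal.mul_mem_mul ha hi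

lemma finrank_piPow [Finite G] (n : ℕ) :
    finrank k (piPow k G d n) = d * finrank k ↥(augIdeal k G ^ n) := by
  let e : (piPow k G d n) ≃ₗ[k] (Fin d → ↥(augIdeal k G ^ n)) :=
    { toFun := fun c i => ⟨c.1 i, c.2 i trivial⟩
      invFun := fun c => ⟨fun i => (c i).1, fun i _ => (c i).2⟩
      map_add' := fun _ _ => rfl
      map_smul' := fun _ _ => rfl
      left_inv := fun _ => rfl
      right_inv := fun _ => rfl }
  rw [e.finrank_eq, finrank_pi_fintype, Finset.sum_const, Finset.card_univ, Fintype.card_fin,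
    smul_eq_mul]

lemma finrank_map_add_finrank_inf_ker {R M N : Type*} [Ring R] [Algebra k R] [AddCommGroup M]
    [AddCommGroup N] [Module R M] [Module R N] [Module k M] [Module k N] [IsScalarTower k R M]
    [IsScalarTower k R N] [FiniteDimensional k M] (f : M →ₗ[R] N) (W : Submodule R M) :
    finrank k (W.map f) + finrank k ↥(W ⊓ LinearMap.ker f) = finrank k W := by
  let g : W →ₗ[k] N := (f.restrictScalars k).domRestrict (W.restrictScalars k)
  have : FiniteDimensional k W :=
    inferInstanceAs (FiniteDimensional k (W.restrictScalars k))
  have h := g.finrank_range_add_finrank_ker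
  have h1 : LinearMap.range g = (W.map f).restrictScalars k := by
    ext y
    constructor
    · rintro ⟨w, rfl⟩
      exact ⟨w.1, w.2, rfl⟩
    · rintro ⟨w, hw, rfl⟩
      exact ⟨⟨w, hw⟩, rfl⟩
  have h2 : finrank k (LinearMap.ker g) = finrank k ↥(W ⊓ LinearMap.ker f) := by
    let e : LinearMap.ker g ≃ₗ[k] ↥(W ⊓ LinearMap.ker f) :=
      { toFun := fun c => ⟨c.1.1, c.1.2, c.2⟩
        invFun := fun c => ⟨⟨c.1, c.2.1⟩, c.2.2⟩
        map_add' := fun _ _ => rfl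
        map_smul' := fun _ _ => rfl
        left_inv := fun _ => rfl
        right_inv := fun _ => rfl }
    exact e.finrank_eq
  rw [h1, h2] at h
  exact h

lemma finrank_quotient_pow_le {M : Type*} [AddCommGroup M] [Module k M]
    [Module (MonoidAlgebra k G) M] [IsScalarTower k (MonoidAlgebra k G) M] [Finite G]
    {r : ℕ} (v : Fin r → M) (hv : Submodule.span (MonoidAlgebra k G) (Set.range v) = ⊤) (n : ℕ) :
    finrank k (M ⧸ (augIdeal k G ^ n • (⊤ : Submodule (MonoidAlgebra k G) M))) ≤
      r * finrank k (MonoidAlgebra k G ⧸ augIdeal k G ^ n) := by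
  set J := augIdeal k G ^ n
  let q : Fin r → (MonoidAlgebra k G ⧸ J) →ₗ[MonoidAlgebra k G]
      M ⧸ (J • (⊤ : Submodule (MonoidAlgebra k G) M)) := fun i =>
    Submodule.mapQ J (J • ⊤) (LinearMap.toSpanSingleton (MonoidAlgebra k G) M (v i))
      (fun a ha => Submodule.smul_mem_smul ha trivial)
  let Q : (Fin r → MonoidAlgebra k G ⧸ J) →ₗ[k]
      M ⧸ (J • (⊤ : Submodule (MonoidAlgebra k G) M)) :=
    ∑ i, ((q i).restrictScalars k) ∘ₗ LinearMap.proj i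
  have hQ : Function.Surjective Q := by
    intro y
    obtain ⟨m, rfl⟩ := Submodule.mkQ_surjective _ y
    have hm : m ∈ Submodule.span (MonoidAlgebra k G) (Set.range v) := hv ▸ Submodule.mem_top
    obtain ⟨c, rfl⟩ := (Submodule.mem_span_range_iff_exists_fun _).1 hm
    refine ⟨fun i => J.mkQ (c i), ?_⟩
    rw [LinearMap.sum_apply, map_sum]
    rfl
  have : FiniteDimensional k (MonoidAlgebra k G ⧸ J) :=
    Module.Finite.of_surjective (J.mkQ.restrictScalars k) J.mkQ_surjective
  refine (LinearMap.finrank_le_finrank_of_surjective hQ).trans ?_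
  rw [finrank_pi_fintype, Finset.sum_const, Finset.card_univ, Fintype.card_fin, smul_eq_mul]

end

end GolodShafarevich

end

section

namespace GolodShafarevich

open Module

lemma not_bounded_of_recurrence {d r B : ℕ} (hd : 2 ≤ d) (a : ℕ → ℕ) (h0 : a 0 = 0)
    (h1 : a 1 = 1) (hB : ∀ n, a n ≤ B)
    (h : ∀ n, d * a (n + 1) + 1 ≤ a (n + 2) + r * a n) : d ^ 2 < 4 * r := by
  by_contra! hr
  have key : ∀ n, (d : ℤ) * a n + n + 1 ≤ 2 * a (n + 1) := by
    intro n
    induction n with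
    | zero => simp [h0, h1]
    | succ n ih =>
      have h' : (d : ℤ) * a (n + 1) + 1 ≤ a (n + 2) + r * a n := by exact_mod_cast h n
      have hr' : (4 : ℤ) * r ≤ d ^ 2 := by exact_mod_cast hr
      have hd' : (2 : ℤ) ≤ d := by exact_mod_cast hd
      have ha : (0 : ℤ) ≤ a n := by positivity
      have e1 : (4 : ℤ) * r * a n ≤ d ^ 2 * a n := mul_le_mul_of_nonneg_right hr' ha
      have e2 : (d : ℤ) * (d * a n + n + 1) ≤ d * (2 * a (n + 1)) :=
        mul_le_mul_of_nonneg_left ih (by positivity)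
      have e3 : (2 : ℤ) * (n + 1) ≤ d * (n + 1) := mul_le_mul_of_nonneg_right hd' (by positivity)
      push_cast
      nlinarith
  have hmono : ∀ n, n ≤ a n + 1 := by
    intro n
    induction n with
    | zero => simp
    | succ n ih =>
      have := key n
      have hd' : (2 : ℤ) ≤ d := by exact_mod_cast hd
      have ha : (0 : ℤ) ≤ a n := by positivity
      have e1 : (2 : ℤ) * a n ≤ d * a n := mul_le_mul_of_nonneg_right hd' ha
      have : (n : ℤ) + 1 ≤ a (n + 1) + 1 := by
        have : (n : ℤ) ≤ a n + 1 := by exact_mod_cast ih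
        linarith
      exact_mod_cast this
  have := hmono (B + 2)
  have := hB (B + 2)
  omega

variable {G : Type*} [Group G] {d : ℕ}

lemma exists_span_eq_top {M : Type*} [AddCommGroup M] [Module (ZMod 2) M]
    [Module (MonoidAlgebra (ZMod 2) G) M] [IsScalarTower (ZMod 2) (MonoidAlgebra (ZMod 2) G) M]
    [Finite M] (hG : IsPGroup 2 G) :
    ∃ v : Fin (finrank (ZMod 2) (M ⧸ (augIdeal (ZMod 2) G •
      (⊤ : Submodule (MonoidAlgebra (ZMod 2) G) M)))) → M,
      Submodule.span (MonoidAlgebra (ZMod 2) G) (Set.range v) = ⊤ := by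
  set W := augIdeal (ZMod 2) G • (⊤ : Submodule (MonoidAlgebra (ZMod 2) G) M) with hW
  have : Finite (M ⧸ W) := Finite.of_surjective _ W.mkQ_surjective
  have : Module.Finite (ZMod 2) (M ⧸ W) := inferInstance
  let b := Module.finBasis (ZMod 2) (M ⧸ W)
  choose v hv using fun i => W.mkQ_surjective (b i)
  refine ⟨v, eq_top_of_sup_augIdeal_smul hG _ (eq_top_iff.2 fun m _ => ?_)⟩
  rw [← hW]
  let s : M := ∑ i, algebraMap (ZMod 2) (MonoidAlgebra (ZMod 2) G) (b.repr (W.mkQ m) i) • v i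
  have hs : W.mkQ s = W.mkQ m := by
    refine Eq.trans ?_ (b.sum_repr (W.mkQ m))
    rw [map_sum]
    refine Finset.sum_congr rfl fun i _ => ?_
    rw [map_smul, hv, algebraMap_smul]
  refine Submodule.mem_sup.2 ⟨s, sum_mem fun i _ => Submodule.smul_mem _ _
    (Submodule.subset_span ⟨i, rfl⟩), m - s, ?_, add_sub_cancel s m⟩
  rw [← Submodule.Quotient.mk_eq_zero, ← Submodule.mkQ_apply, map_sub, hs, sub_self]

/-- The **Golod–Shafarevich inequality** for the relation module of a finite `2`-group. -/
theorem sq_lt_four_mul_finrank [Finite G] (hG : IsPGroup 2 G) (hd : 2 ≤ d) {x : Fin d → G}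
    (hx : Subgroup.closure (Set.range x) = ⊤) (chi : Fin d → G →* Multiplicative (ZMod 2))
    (hchi : ∀ i j, (chi j (x i)).toAdd = if i = j then 1 else 0) :
    d ^ 2 < 4 * finrank (ZMod 2) (LinearMap.ker (relMap (ZMod 2) x) ⧸
      (augIdeal (ZMod 2) G •
        (⊤ : Submodule (MonoidAlgebra (ZMod 2) G) (LinearMap.ker (relMap (ZMod 2) x))))) := by
  set k := ZMod 2
  set I := augIdeal k G
  set K := LinearMap.ker (relMap k x) with hKdef
  set r := finrank k (K ⧸ (I • (⊤ : Submodule (MonoidAlgebra k G) K))) with hr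
  have hfinL : Module.Finite k (MonoidAlgebra k G) :=
    Module.Finite.equiv (MonoidAlgebra.coeffLinearEquiv k (S := k) (M := G)).symm
  have hfL : Finite (MonoidAlgebra k G) := Module.finite_of_finite k
  have hfK : Finite K := inferInstance
  obtain ⟨v, hv⟩ := exists_span_eq_top (M := K) hG
  let a : ℕ → ℕ := fun n => finrank k (MonoidAlgebra k G ⧸ I ^ n)
  have hadd : ∀ n, a n + finrank k ↥(I ^ n) = finrank k (MonoidAlgebra k G) := fun n =>
    Submodule.finrank_quotient_add_finrank ((I ^ n).restrictScalars k)
  have ha0 : a 0 = 0 := by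
    have : I ^ 0 = ⊤ := by rw [Submodule.pow_zero, Ideal.one_eq_top]
    have h2 : Subsingleton (MonoidAlgebra k G ⧸ I ^ 0) :=
      Submodule.Quotient.subsingleton_iff.2 this
    exact finrank_zero_of_subsingleton
  have ha1 : a 1 = 1 := by
    have h := LinearMap.finrank_range_add_finrank_ker (aug k G).toLinearMap
    have hs : LinearMap.range (aug k G).toLinearMap = ⊤ :=
      LinearMap.range_eq_top.2 fun c => ⟨algebraMap k _ c, (aug k G).commutes c⟩
    rw [hs, finrank_top, finrank_self] at h
    have h1 := hadd 1
    have h2 : I ^ 1 = I := Submodule.pow_one _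
    rw [h2] at h1
    have h3 : finrank k ↥(LinearMap.ker (aug k G).toLinearMap) = finrank k I := rfl
    omega
  have hKle := ker_relMap_le chi hchi
  refine not_bounded_of_recurrence hd a ha0 ha1 (fun n => (by have := hadd n; omega :
    a n ≤ finrank k (MonoidAlgebra k G))) fun n => ?_
  have e1 := finrank_map_add_finrank_inf_ker (k := k) (relMap k x) (piPow k G d (n + 1))
  have e0 := finrank_map_add_finrank_inf_ker (k := k) (relMap k x) (piPow k G d 0)
  rw [map_relMap_piPow hx, finrank_piPow] at e1 e0
  have e2 : finrank k ↥(I ^ n • K) ≤ finrank k ↥(piPow k G d (n + 1) ⊓ K) :=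
    Submodule.finrank_mono (s := (I ^ n • K).restrictScalars k)
      (t := (piPow k G d (n + 1) ⊓ K).restrictScalars k) (pow_smul_ker_le hKle n)
  have e3 := finrank_quotient_pow_le (k := k) v hv n
  have e4 : finrank k (K ⧸ (I ^ n • (⊤ : Submodule (MonoidAlgebra k G) K))) +
      finrank k ↥(I ^ n • (⊤ : Submodule (MonoidAlgebra k G) K)) = finrank k K :=
    Submodule.finrank_quotient_add_finrank
      ((I ^ n • (⊤ : Submodule (MonoidAlgebra k G) K)).restrictScalars k)
  have e5 : finrank k ↥(I ^ n • (⊤ : Submodule (MonoidAlgebra k G) K)) =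
      finrank k ↥(I ^ n • K) := by
    have h1 : (I ^ n • (⊤ : Submodule (MonoidAlgebra k G) K)).map K.subtype = I ^ n • K := by
      rw [Submodule.map_smul'', Submodule.map_top, Submodule.range_subtype]
    rw [← h1]
    exact ((Submodule.equivMapOfInjective K.subtype K.injective_subtype _).restrictScalars
      k).finrank_eq
  have e6 : piPow k G d 0 ⊓ K = K := by
    refine inf_eq_right.2 fun c _ i _ => ?_
    change c i ∈ I ^ 0
    rw [Submodule.pow_zero, Ideal.one_eq_top]
    trivial
  rw [e6] at e0
  have f0 := hadd 0
  have f1 := hadd 1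
  have fn := hadd n
  have fn1 := hadd (n + 1)
  have fn2 := hadd (n + 2)
  change _ ≤ r * a n at e3
  have g0 : finrank k ↥(I ^ (0 + 1)) = finrank k ↥(I ^ 1) := rfl
  have g1 : d * a (n + 1) + d * finrank k ↥(I ^ (n + 1)) = d * finrank k (MonoidAlgebra k G) := by
    rw [← fn1, mul_add]
  have g2 : d * finrank k ↥(I ^ 0) = d * finrank k (MonoidAlgebra k G) := by
    rw [← f0, ha0, zero_add]
  have g3 : finrank k ↥(I ^ (n + 1 + 1)) = finrank k ↥(I ^ (n + 2)) := rfl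
  have e1' : finrank k ↥(I ^ (n + 2)) + finrank k ↥(piPow k G d (n + 1) ⊓ K) =
    d * finrank k ↥(I ^ (n + 1)) := e1
  have e0' : finrank k ↥(I ^ 1) + finrank k K = d * finrank k ↥(I ^ 0) := e0
  have e3' : finrank k (K ⧸ (I ^ n • (⊤ : Submodule (MonoidAlgebra k G) K))) ≤ r * a n := e3
  have ha : finrank k (MonoidAlgebra k G) = 1 + finrank k ↥(I ^ 1) := by rw [← f1, ha1]
  clear e1 e0 e3
  omega

end GolodShafarevich

end

section

namespace GolodShafarevich

open Module

section

variable {k G : Type*} [Field k] [Group G] {d : ℕ}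

/-- The affine permutation `v ↦ g v + w`. -/
noncomputable def affinePerm (g : G) (w : Fin d → MonoidAlgebra k G) :
    Equiv.Perm (Fin d → MonoidAlgebra k G) where
  toFun v := MonoidAlgebra.of k G g • v + w
  invFun v := MonoidAlgebra.of k G g⁻¹ • (v - w)
  left_inv v := by
    change MonoidAlgebra.of k G g⁻¹ • (MonoidAlgebra.of k G g • v + w - w) = v
    rw [add_sub_cancel_right, smul_smul, ← map_mul, inv_mul_cancel, map_one, one_smul]
  right_inv v := by
    change MonoidAlgebra.of k G g • (MonoidAlgebra.of k G g⁻¹ • (v - w)) + w = v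
    rw [smul_smul, ← map_mul, mul_inv_cancel, map_one, one_smul, sub_add_cancel]

/-- The affine representation of the free group encoding the Fox derivatives. -/
noncomputable def foxHom (k : Type*) [Field k] (x : Fin d → G) :
    FreeGroup (Fin d) →* Equiv.Perm (Fin d → MonoidAlgebra k G) :=
  FreeGroup.lift fun i => affinePerm (x i) (Pi.single i 1)

/-- The Fox derivative. -/
noncomputable def fox (k : Type*) [Field k] (x : Fin d → G) (f : FreeGroup (Fin d)) :
    Fin d → MonoidAlgebra k G :=
  foxHom k x f 0

variable (x : Fin d → G)

lemma foxHom_apply (f : FreeGroup (Fin d)) (v : Fin d → MonoidAlgebra k G) :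
    foxHom k x f v = MonoidAlgebra.of k G (FreeGroup.lift x f) • v + fox k x f := by
  suffices ∃ w, ∀ v, foxHom k x f v = MonoidAlgebra.of k G (FreeGroup.lift x f) • v + w by
    obtain ⟨w, hw⟩ := this
    have h0 := hw 0
    rw [smul_zero, zero_add] at h0
    rw [hw, fox, h0]
  induction f using FreeGroup.induction_on with
  | C1 => exact ⟨0, fun v => by rw [map_one, map_one, map_one, one_smul, add_zero]; rfl⟩
  | of i => exact ⟨Pi.single i 1, fun v => by simp [foxHom, affinePerm]⟩
  | inv_of i ih =>
    refine ⟨MonoidAlgebra.of k G (x i)⁻¹ • (-Pi.single i 1), fun v => ?_⟩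
    rw [map_inv, map_inv, foxHom, FreeGroup.lift_apply_of, FreeGroup.lift_apply_of, ← smul_add,
      ← sub_eq_add_neg]
    rfl
  | mul f g hf hg =>
    obtain ⟨w, hw⟩ := hf
    obtain ⟨w', hw'⟩ := hg
    refine ⟨MonoidAlgebra.of k G (FreeGroup.lift x f) • w' + w, fun v => ?_⟩
    rw [map_mul, Equiv.Perm.mul_apply, hw', hw, map_mul, map_mul, smul_add, mul_smul, add_assoc]

lemma fox_mul (f g : FreeGroup (Fin d)) :
    fox k x (f * g) = fox k x f + MonoidAlgebra.of k G (FreeGroup.lift x f) • fox k x g := by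
  conv_lhs => rw [fox, map_mul, Equiv.Perm.mul_apply]
  rw [foxHom_apply, ← fox, add_comm]

@[simp]
lemma fox_one : fox k x 1 = 0 := by simp [fox]

lemma fox_of (i : Fin d) : fox k x (FreeGroup.of i) = Pi.single i 1 := by
  simp [fox, foxHom, affinePerm]

lemma fox_inv (f : FreeGroup (Fin d)) :
    fox k x f⁻¹ = -(MonoidAlgebra.of k G (FreeGroup.lift x f)⁻¹ • fox k x f) := by
  have h := fox_mul (k := k) x f⁻¹ f
  rw [inv_mul_cancel, fox_one, map_inv] at h
  exact eq_neg_of_add_eq_zero_left h.symm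

lemma relMap_fox (f : FreeGroup (Fin d)) :
    relMap k x (fox k x f) = MonoidAlgebra.of k G (FreeGroup.lift x f) - 1 := by
  induction f using FreeGroup.induction_on with
  | C1 => rw [fox_one, map_zero, map_one, map_one, sub_self]
  | of i => rw [fox_of, relMap_single, one_mul, FreeGroup.lift_apply_of]
  | inv_of i ih =>
    rw [fox_inv, map_neg, map_smul, ih, smul_eq_mul, mul_sub, ← map_mul, inv_mul_cancel, map_one,
      mul_one, neg_sub, map_inv (FreeGroup.lift x)]
  | mul f g hf hg =>
    rw [fox_mul, map_add, map_smul, hf, hg, map_mul, map_mul, smul_eq_mul]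
    noncomm_ring

lemma fox_mem_ker {f : FreeGroup (Fin d)} (hf : f ∈ (FreeGroup.lift x).ker) :
    fox k x f ∈ LinearMap.ker (relMap k x) := by
  rw [LinearMap.mem_ker, relMap_fox, (MonoidHom.mem_ker).1 hf, map_one, sub_self]

/-- The relation module is spanned by the Fox derivatives of the relators. -/
lemma span_fox_eq (hx : Function.Surjective (FreeGroup.lift x)) :
    Submodule.span k (fox k x '' ((FreeGroup.lift x).ker : Set (FreeGroup (Fin d)))) =
      (LinearMap.ker (relMap k x)).restrictScalars k := by
  apply le_antisymm
  · rw [Submodule.span_le]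
    rintro _ ⟨f, hf, rfl⟩
    exact fox_mem_ker x hf
  choose w hw using hx
  let T : MonoidAlgebra k G →ₗ[k] (Fin d → MonoidAlgebra k G) :=
    Finsupp.linearCombination k (fun g => fox k x (w g)) ∘ₗ
      (MonoidAlgebra.coeffLinearEquiv k).toLinearMap
  have hT : ∀ g, T (MonoidAlgebra.of k G g) = fox k x (w g) := by
    intro g
    simp [T]
  set S := Submodule.span k (fox k x '' ((FreeGroup.lift x).ker : Set (FreeGroup (Fin d))))
  have key1 : ∀ (i : Fin d) (a : MonoidAlgebra k G),
      Pi.single i a - T (relMap k x (Pi.single i a)) ∈ S := by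
    intro i a
    rw [relMap_single]
    induction a using MonoidAlgebra.induction_on with
    | of g =>
      have hker : w g * FreeGroup.of i * (w (g * x i))⁻¹ ∈ (FreeGroup.lift x).ker := by
        rw [MonoidHom.mem_ker, map_mul, map_mul, map_inv, hw, hw, FreeGroup.lift_apply_of,
          mul_inv_cancel]
      have hf : fox k x (w g * FreeGroup.of i * (w (g * x i))⁻¹) =
          fox k x (w g) + Pi.single i (MonoidAlgebra.of k G g) - fox k x (w (g * x i)) := by
        rw [fox_mul, fox_mul, fox_inv, map_mul, hw, hw, FreeGroup.lift_apply_of, fox_of, smul_neg,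
          smul_smul, ← map_mul, mul_inv_cancel, map_one, one_smul, ← sub_eq_add_neg,
          ← Pi.single_smul, smul_eq_mul, mul_one]
      rw [mul_sub, ← map_mul, mul_one, map_sub, hT, hT]
      have := Submodule.subset_span (R := k) (Set.mem_image_of_mem (fox k x) hker)
      rw [hf] at this
      have e : ∀ a b c : Fin d → MonoidAlgebra k G, b - (c - a) = a + b - c := fun a b c => by abel
      rw [e]
      exact this
    | add a b ha hb =>
      rw [Pi.single_add, add_mul, map_add, add_sub_add_comm]
      exact add_mem ha hb
    | smul r a ha =>
      rw [Pi.single_smul, smul_mul_assoc, map_smul, ← smul_sub]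
      exact Submodule.smul_mem _ _ ha
  intro v hv
  have h1 : v - T (relMap k x v) ∈ S := by
    have hs : v = ∑ i, Pi.single i (v i) := (Finset.univ_sum_single v).symm
    rw [hs, map_sum, map_sum, ← Finset.sum_sub_distrib]
    exact sum_mem fun i _ => key1 i _
  have h2 : relMap k x v = 0 := hv
  rwa [h2, map_zero, sub_zero] at h1

end

variable {G : Type*} [Group G] {d : ℕ}

/-- There are many conjugation invariant characters of order two on the relation group. -/
theorem exists_invariant_characters [Finite G] (hG : IsPGroup 2 G) (hd : 2 ≤ d) {x : Fin d → G}
    (hx : Function.Surjective (FreeGroup.lift x)) (chi : Fin d → G →* Multiplicative (ZMod 2))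
    (hchi : ∀ i j, (chi j (x i)).toAdd = if i = j then 1 else 0) :
    ∃ r, d ^ 2 < 4 * r ∧ ∃ lam : Fin (2 ^ r) → ((FreeGroup.lift x).ker →* ℤˣ),
      Function.Injective lam ∧ ∀ n (f : FreeGroup (Fin d)) (y : (FreeGroup.lift x).ker),
        lam n ⟨f * y * f⁻¹, (FreeGroup.lift x).normal_ker.conj_mem y y.2 f⟩ = lam n y := by
  have hx' : Subgroup.closure (Set.range x) = ⊤ := by
    rw [← FreeGroup.range_lift_eq_closure, MonoidHom.range_eq_top.2 hx]
  refine ⟨_, sq_lt_four_mul_finrank hG hd hx' chi hchi, ?_⟩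
  set K := LinearMap.ker (relMap (ZMod 2) x) with hK
  set W := augIdeal (ZMod 2) G • (⊤ : Submodule (MonoidAlgebra (ZMod 2) G) K) with hW
  have hfinL : Module.Finite (ZMod 2) (MonoidAlgebra (ZMod 2) G) :=
    Module.Finite.equiv
      (MonoidAlgebra.coeffLinearEquiv (ZMod 2) (S := ZMod 2) (M := G)).symm
  have hfL : Finite (MonoidAlgebra (ZMod 2) G) := Module.finite_of_finite (ZMod 2)
  have : Finite (K ⧸ W) := Finite.of_surjective _ W.mkQ_surjective
  have hfin : Module.Finite (ZMod 2) (K ⧸ W) := inferInstance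
  have hcard : Nat.card (Dual (ZMod 2) (K ⧸ W)) = 2 ^ finrank (ZMod 2) (K ⧸ W) := by
    rw [Module.natCard_eq_pow_finrank (K := ZMod 2), Subspace.dual_finrank_eq, Nat.card_zmod]
  have : Finite (Dual (ZMod 2) (K ⧸ W)) := Module.finite_of_finite (ZMod 2)
  let e := (Finite.equivFinOfCardEq hcard).symm
  let D : (FreeGroup.lift x).ker → K := fun y => ⟨fox (ZMod 2) x y, fox_mem_ker x y.2⟩
  have hDmul : ∀ y z, D (y * z) = D y + D z := by
    intro y z
    apply Subtype.ext
    change fox (ZMod 2) x (y.1 * z.1) = fox (ZMod 2) x y.1 + fox (ZMod 2) x z.1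
    rw [fox_mul, (MonoidHom.mem_ker).1 y.2, map_one, one_smul]
  have hD1 : D 1 = 0 := Subtype.ext (fox_one x)
  let lam : Dual (ZMod 2) (K ⧸ W) → ((FreeGroup.lift x).ker →* ℤˣ) := fun l =>
    { toFun := fun y => (-1 : ℤˣ) ^ (l (W.mkQ (D y)))
      map_one' := by rw [hD1, map_zero, map_zero, uzpow_zero]
      map_mul' := fun y z => by rw [hDmul, map_add, map_add, uzpow_add] }
  have hpow : ∀ a b : ZMod 2, (-1 : ℤˣ) ^ a = (-1 : ℤˣ) ^ b → a = b := by decide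
  have hinv : ∀ (l : Dual (ZMod 2) (K ⧸ W)) (g : G) (q : K ⧸ W),
      l (MonoidAlgebra.of (ZMod 2) G g • q) = l q := by
    intro l g q
    obtain ⟨m, rfl⟩ := W.mkQ_surjective q
    have : W.mkQ ((MonoidAlgebra.of (ZMod 2) G g - 1) • m) = 0 :=
      (Submodule.Quotient.mk_eq_zero W).2 (Submodule.smul_mem_smul (of_sub_one_mem g) trivial)
    rw [map_smul, sub_smul, one_smul, sub_eq_zero] at this
    rw [this]
  refine ⟨fun n => lam (e n), ?_, ?_⟩
  · suffices Function.Injective lam from this.comp e.injective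
    intro l l' h
    have h1 : ∀ y, l (W.mkQ (D y)) = l' (W.mkQ (D y)) := fun y =>
      hpow _ _ (DFunLike.congr_fun h y)
    refine LinearMap.ext fun q => ?_
    obtain ⟨m, rfl⟩ := W.mkQ_surjective q
    obtain ⟨m, hm⟩ := m
    have hm' : m ∈ Submodule.span (ZMod 2)
        (fox (ZMod 2) x '' ((FreeGroup.lift x).ker : Set (FreeGroup (Fin d)))) := by
      rw [span_fox_eq x hx]; exact hm
    induction hm' using Submodule.span_induction with
    | mem v hv =>
      obtain ⟨f, hf, rfl⟩ := hv
      exact h1 ⟨f, hf⟩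
    | zero =>
      have : (⟨0, hm⟩ : K) = 0 := rfl
      rw [this, map_zero, map_zero, map_zero]
    | add a b ha hb iha ihb =>
      rw [span_fox_eq x hx] at ha hb
      have ha' : a ∈ K := ha
      have hb' : b ∈ K := hb
      have : (⟨a + b, hm⟩ : K) = ⟨a, ha'⟩ + ⟨b, hb'⟩ := rfl
      rw [this, map_add, map_add, map_add, iha ha', ihb hb']
    | smul c a ha iha =>
      rw [span_fox_eq x hx] at ha
      have ha' : a ∈ K := ha
      have : (⟨c • a, hm⟩ : K) = c • ⟨a, ha'⟩ := rfl
      have h2 : W.mkQ (c • (⟨a, ha'⟩ : K)) = c • W.mkQ ⟨a, ha'⟩ := rfl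
      rw [this, h2, map_smul, map_smul, iha ha']
  · intro n f y
    change (-1 : ℤˣ) ^ ((e n) (W.mkQ (D _))) = (-1 : ℤˣ) ^ ((e n) (W.mkQ (D y)))
    have h1 : D ⟨f * y * f⁻¹, (FreeGroup.lift x).normal_ker.conj_mem y y.2 f⟩ =
        MonoidAlgebra.of (ZMod 2) G (FreeGroup.lift x f) • D y := by
      apply Subtype.ext
      change fox (ZMod 2) x (f * y.1 * f⁻¹) =
        MonoidAlgebra.of (ZMod 2) G (FreeGroup.lift x f) • fox (ZMod 2) x y.1
      rw [fox_mul, fox_mul, fox_inv, map_mul, (MonoidHom.mem_ker).1 y.2, mul_one, smul_neg,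
        smul_smul, ← map_mul, mul_inv_cancel, map_one, one_smul]
      abel
    rw [h1, map_smul, hinv]

end GolodShafarevich

end

section

namespace InvolutionIndex

open Subgroup

theorem relIndex_eq_relIndex_map_mul {X Y : Type*} [CommGroup X] [Group Y] (φ : X →* Y)
    {T S : Subgroup X} (h : T ≤ S) :
    T.relIndex S = (T.map φ).relIndex (S.map φ) * (T ⊓ φ.ker).relIndex (S ⊓ φ.ker) := by
  have h1 : (φ.ker ⊓ S) ⊔ T = (T ⊔ φ.ker) ⊓ S := by
    rw [sup_comm, ← sup_inf_assoc_of_le _ h]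
  have h2 : T ≤ (T ⊔ φ.ker) ⊓ S := le_inf le_sup_left h
  have h3 : (T.map φ).relIndex (S.map φ) = ((T ⊔ φ.ker) ⊓ S).relIndex S := by
    have : S ⊔ φ.ker = S ⊔ (T ⊔ φ.ker) := by rw [← sup_assoc, sup_eq_left.2 h]
    rw [relIndex_map_map, this, relIndex_sup_right, inf_relIndex_right]
  have h4 : (T ⊓ φ.ker).relIndex (S ⊓ φ.ker) = T.relIndex ((T ⊔ φ.ker) ⊓ S) := by
    have : T ⊓ φ.ker = T ⊓ (φ.ker ⊓ S) := by
      rw [inf_comm φ.ker S, ← inf_assoc, inf_eq_left.2 h]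
    rw [← h1, relIndex_sup_right, this, inf_comm S, inf_relIndex_right]
  rw [h3, h4, mul_comm, relIndex_mul_relIndex T _ S h2 inf_le_right]

variable {A B : Type*} [CommGroup A] [CommGroup B]

/-- The endomorphism `x ↦ x * σ x`. -/
def normHom (σ : A →* A) : A →* A := MonoidHom.id A * σ

/-- The endomorphism `x ↦ x / σ x`. -/
def diffHom (σ : A →* A) : A →* A := MonoidHom.id A / σ

@[simp] theorem normHom_apply (σ : A →* A) (x : A) : normHom σ x = x * σ x := rfl

@[simp] theorem diffHom_apply (σ : A →* A) (x : A) : diffHom σ x = x / σ x := rfl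

theorem range_diffHom_le {σ : A →* A} (hσ : ∀ a, σ (σ a) = a) :
    (diffHom σ).range ≤ (normHom σ).ker := by
  rintro _ ⟨x, rfl⟩
  simp [MonoidHom.mem_ker, hσ]

theorem range_normHom_le {σ : A →* A} (hσ : ∀ a, σ (σ a) = a) :
    (normHom σ).range ≤ (diffHom σ).ker := by
  rintro _ ⟨x, rfl⟩
  simp [MonoidHom.mem_ker, hσ, mul_comm]

/-- Ambiguous class number type index computation: if `f : A → B` has finite cokernel, `A` and `B`
satisfy Hilbert 90, the kernel of `f` has Herbrand quotient `1 / 2`, and the norms together with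
`f (A⁺)` have index at most `2` in `B⁺`, then invariant elements of `A` which are norms after
applying `f` are norms. -/
theorem mem_range_normHom (σ : A →* A) (τ : B →* B) (f : A →* B)
    (hσ : ∀ a, σ (σ a) = a) (hτ : ∀ b, τ (τ b) = b) (hf : ∀ a, f (σ a) = τ (f a))
    (hA : (normHom σ).ker ≤ (diffHom σ).range) (hB : (normHom τ).ker ≤ (diffHom τ).range)
    (hfin : f.range.index ≠ 0)
    (hh : (map f (diffHom σ).ker).relIndex (diffHom τ).ker ≠ 0)
    (hE : 2 * (map (normHom σ) f.ker).relIndex (f.ker ⊓ (diffHom σ).ker) =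
      (map (diffHom σ) f.ker).relIndex (f.ker ⊓ (normHom σ).ker))
    (hj : ((normHom τ).range ⊔ map f (diffHom σ).ker).relIndex (diffHom τ).ker ≤ 2)
    {a : A} (ha : σ a = a) (hfa : f a ∈ (normHom τ).range) : a ∈ (normHom σ).range := by
  set P := map f (diffHom σ).ker with hP
  set NB := (normHom τ).range with hNB
  set NA := (normHom σ).range with hNA
  have hfN : ∀ a, f (normHom σ a) = normHom τ (f a) := fun a => by simp [hf]
  have hfD : ∀ a, f (diffHom σ a) = diffHom τ (f a) := fun a => by simp [hf]
  have hPle : P ≤ (diffHom τ).ker := by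
    rintro _ ⟨x, hx, rfl⟩
    rw [MonoidHom.mem_ker, ← hfD, (MonoidHom.mem_ker).1 hx, map_one]
  have hNBle : NB ≤ (diffHom τ).ker := range_normHom_le hτ
  have hNAle : NA ≤ (diffHom σ).ker := range_normHom_le hσ
  have hfNA : map f NA = map (normHom τ) f.range := by
    rw [hNA, MonoidHom.range_eq_map, MonoidHom.range_eq_map, map_map, map_map]
    congr 1
    ext a
    simp [hf]
  have hfDA : map f (diffHom σ).range = map (diffHom τ) f.range := by
    rw [MonoidHom.range_eq_map, MonoidHom.range_eq_map, map_map, map_map]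
    congr 1
    ext a
    simp [hf]
  -- norms of elements of `B` landing in `P`
  set X := P.comap (normHom τ) with hX
  set Y := (diffHom σ).ker ⊓ NB.comap f with hY
  have hNAY : NA ≤ Y := by
    refine le_inf hNAle ?_
    rintro _ ⟨x, rfl⟩
    rw [mem_comap, hfN]
    exact ⟨_, rfl⟩
  have hNX : map (normHom τ) X = NB ⊓ P := by
    rw [hX, map_comap_eq]
  have hfY : map f Y = NB ⊓ P := by
    ext b
    simp only [hY, hP, mem_map, mem_inf, mem_comap]
    constructor
    · rintro ⟨x, ⟨h1, h2⟩, rfl⟩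
      exact ⟨h2, x, h1, rfl⟩
    · rintro ⟨h2, x, h1, rfl⟩
      exact ⟨x, ⟨h1, h2⟩, rfl⟩
  have e1 : X.index * (NB ⊔ P).relIndex (diffHom τ).ker = P.relIndex (diffHom τ).ker := by
    rw [← relIndex_mul_relIndex P (NB ⊔ P) _ le_sup_right (sup_le hNBle hPle),
      relIndex_sup_right, hX, index_comap]
  have hDBX : (diffHom τ).range ⊔ f.range ≤ X := by
    refine sup_le ?_ ?_
    · rintro _ ⟨x, rfl⟩
      rw [hX, mem_comap, (MonoidHom.mem_ker).1 (range_diffHom_le hτ ⟨x, rfl⟩)]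
      exact one_mem _
    · rintro _ ⟨x, rfl⟩
      rw [hX, mem_comap, ← hfN]
      exact ⟨_, hNAle ⟨x, rfl⟩, rfl⟩
  have e2 : ((diffHom τ).range ⊔ f.range).relIndex X * X.index =
      ((diffHom τ).range ⊔ f.range).index := relIndex_mul_index hDBX
  have e3 : ((diffHom τ).range ⊔ f.range).relIndex X * (NA ⊓ f.ker).relIndex (Y ⊓ f.ker) =
      NA.relIndex Y := by
    rw [relIndex_eq_relIndex_map_mul f hNAY, relIndex_eq_relIndex_map_mul (normHom τ) hDBX, hfY,
      hNX]
    congr 1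
    have h1 : map (normHom τ) ((diffHom τ).range ⊔ f.range) = map f NA := by
      rw [Subgroup.map_sup, hfNA]
      refine sup_eq_right.2 ?_
      rintro _ ⟨x, hx, rfl⟩
      rw [(MonoidHom.mem_ker).1 (range_diffHom_le hτ hx)]
      exact one_mem _
    have h2 : ((diffHom τ).range ⊔ f.range) ⊓ (normHom τ).ker = X ⊓ (normHom τ).ker := by
      refine le_antisymm (inf_le_inf_right _ hDBX) (le_inf ?_ inf_le_right)
      exact inf_le_right.trans (hB.trans le_sup_left)
    rw [h1, h2, relIndex_self, mul_one]
  have hYE : Y ⊓ f.ker = f.ker ⊓ (diffHom σ).ker := by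
    ext x
    simp only [hY, mem_inf, mem_comap]
    constructor
    · rintro ⟨⟨h1, -⟩, h2⟩
      exact ⟨h2, h1⟩
    · rintro ⟨h2, h1⟩
      refine ⟨⟨h1, ?_⟩, h2⟩
      rw [(MonoidHom.mem_ker).1 h2]
      exact one_mem _
  have hNE : map (normHom σ) f.ker ≤ NA ⊓ f.ker := by
    rintro _ ⟨x, hx, rfl⟩
    refine ⟨⟨x, rfl⟩, ?_⟩
    change f (normHom σ x) = 1
    rw [hfN, (MonoidHom.mem_ker).1 hx, map_one]
  have e5 : (map (normHom σ) f.ker).relIndex (NA ⊓ f.ker) *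
      (NA ⊓ f.ker).relIndex (f.ker ⊓ (diffHom σ).ker) =
      (map (normHom σ) f.ker).relIndex (f.ker ⊓ (diffHom σ).ker) := by
    refine relIndex_mul_relIndex _ _ _ hNE ?_
    rw [inf_comm]
    exact inf_le_inf_left _ hNAle
  -- the invariants of the cokernel
  set φ : B →* B ⧸ f.range := (QuotientGroup.mk' f.range).comp (diffHom τ) with hφ
  have hfφ : f.range ≤ φ.ker := by
    rintro _ ⟨x, rfl⟩
    rw [hφ, MonoidHom.mem_ker, MonoidHom.comp_apply, ← hfD, ← MonoidHom.mem_ker,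
      QuotientGroup.ker_mk']
    exact ⟨_, rfl⟩
  have e4a : f.range.relIndex φ.ker * Nat.card φ.range = f.range.index := by
    rw [← index_ker, relIndex_mul_index hfφ]
  have e4b : φ.range.index = ((diffHom τ).range ⊔ f.range).index := by
    have : φ.range = map (QuotientGroup.mk' f.range) (diffHom τ).range := by
      rw [hφ, MonoidHom.range_comp]
    rw [this, ← index_comap_of_surjective _ (QuotientGroup.mk'_surjective f.range),
      comap_map_eq, QuotientGroup.ker_mk']
  have e4c : φ.range.index * Nat.card φ.range = f.range.index := by
    rw [index_mul_card, index_eq_card]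
  have hc0 : Nat.card φ.range ≠ 0 := by
    intro h
    rw [h, mul_zero] at e4a
    exact hfin e4a.symm
  have e4 : f.range.relIndex φ.ker = ((diffHom τ).range ⊔ f.range).index := by
    rw [← e4b]
    exact Nat.eq_of_mul_eq_mul_right (Nat.pos_of_ne_zero hc0) (e4a.trans e4c.symm)
  set Z := (normHom σ).comp (MonoidHom.id A) with hZ
  -- elements whose norm is a unit
  set V := f.ker.comap (normHom σ) with hV
  set W := f.ker.comap (diffHom σ) with hW
  have hfV : map f V = (diffHom τ).range ⊓ f.range := by
    ext b
    simp only [hV, mem_map, mem_inf, mem_comap]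
    constructor
    · rintro ⟨x, h1, rfl⟩
      refine ⟨hB ?_, x, rfl⟩
      rw [MonoidHom.mem_ker, ← hfN]
      exact h1
    · rintro ⟨h1, x, rfl⟩
      refine ⟨x, ?_, rfl⟩
      rw [MonoidHom.mem_ker, hfN]
      exact range_diffHom_le hτ h1
  have hDφ : map (diffHom τ) φ.ker = (diffHom τ).range ⊓ f.range := by
    rw [hφ, ← MonoidHom.comap_ker, QuotientGroup.ker_mk', map_comap_eq]
  have hDV : (diffHom σ).range ≤ V := by
    rintro _ ⟨x, rfl⟩
    rw [hV, mem_comap, (MonoidHom.mem_ker).1 (range_diffHom_le hσ ⟨x, rfl⟩)]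
    exact one_mem _
  have hEV : f.ker ≤ V := by
    intro x hx
    rw [hV, mem_comap, MonoidHom.mem_ker, hfN, (MonoidHom.mem_ker).1 hx, map_one]
  have hEW : f.ker ≤ W := by
    intro x hx
    rw [hW, mem_comap, MonoidHom.mem_ker, hfD, (MonoidHom.mem_ker).1 hx, map_one]
  have e6 : f.range.relIndex φ.ker =
      (map (normHom σ) f.ker).relIndex (NA ⊓ f.ker) *
        (f.range ⊓ (diffHom τ).ker).relIndex (diffHom τ).ker := by
    rw [relIndex_eq_relIndex_map_mul (diffHom τ) hfφ, hDφ, ← hfDA, ← hfV, relIndex_map_map]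
    congr 1
    · rw [sup_eq_left.2 hEV, relIndex_eq_relIndex_map_mul (normHom σ) (sup_le hDV hEV)]
      have h1 : map (normHom σ) ((diffHom σ).range ⊔ f.ker) = map (normHom σ) f.ker := by
        rw [Subgroup.map_sup]
        refine sup_eq_right.2 ?_
        rintro _ ⟨x, hx, rfl⟩
        rw [(MonoidHom.mem_ker).1 (range_diffHom_le hσ hx)]
        exact one_mem _
      have h2 : ((diffHom σ).range ⊔ f.ker) ⊓ (normHom σ).ker = V ⊓ (normHom σ).ker := by
        refine le_antisymm (inf_le_inf_right _ (sup_le hDV hEV)) (le_inf ?_ inf_le_right)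
        exact inf_le_right.trans (hA.trans le_sup_left)
      rw [h1, h2, relIndex_self, mul_one, hV, map_comap_eq]
    · congr 1
      refine inf_eq_right.2 ?_
      intro b hb
      rw [hφ, MonoidHom.mem_ker, MonoidHom.comp_apply, (MonoidHom.mem_ker).1 hb, map_one]
  have hfW : map f W = f.range ⊓ (diffHom τ).ker := by
    ext b
    simp only [hW, mem_map, mem_inf, mem_comap]
    constructor
    · rintro ⟨x, h1, rfl⟩
      refine ⟨⟨x, rfl⟩, ?_⟩
      rw [MonoidHom.mem_ker, ← hfD]
      exact h1
    · rintro ⟨⟨x, rfl⟩, h1⟩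
      refine ⟨x, ?_, rfl⟩
      rw [MonoidHom.mem_ker, hfD]
      exact h1
  have hAW : (diffHom σ).ker ≤ W := by
    intro x hx
    rw [hW, mem_comap, (MonoidHom.mem_ker).1 hx]
    exact one_mem _
  have e7 : (map (diffHom σ) f.ker).relIndex (f.ker ⊓ (normHom σ).ker) *
      (f.range ⊓ (diffHom τ).ker).relIndex (diffHom τ).ker = P.relIndex (diffHom τ).ker := by
    have hPle' : P ≤ f.range ⊓ (diffHom τ).ker := by
      refine le_inf ?_ hPle
      rintro _ ⟨x, -, rfl⟩
      exact ⟨x, rfl⟩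
    rw [← relIndex_mul_relIndex P _ _ hPle' inf_le_right]
    congr 1
    rw [← hfW, hP, relIndex_map_map, sup_eq_left.2 hEW,
      relIndex_eq_relIndex_map_mul (diffHom σ) (sup_le hAW hEW)]
    have h1 : map (diffHom σ) ((diffHom σ).ker ⊔ f.ker) = map (diffHom σ) f.ker := by
      rw [Subgroup.map_sup]
      refine sup_eq_right.2 ?_
      rintro _ ⟨x, hx, rfl⟩
      rw [(MonoidHom.mem_ker).1 hx]
      exact one_mem _
    have h2 : ((diffHom σ).ker ⊔ f.ker) ⊓ (diffHom σ).ker = W ⊓ (diffHom σ).ker :=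
      le_antisymm (inf_le_inf_right _ (sup_le hAW hEW)) (le_inf (inf_le_right.trans le_sup_left)
        inf_le_right)
    have h3 : map (diffHom σ) W = f.ker ⊓ (normHom σ).ker := by
      rw [hW, map_comap_eq, inf_comm]
      congr 1
      exact le_antisymm (range_diffHom_le hσ) hA
    rw [h1, h2, relIndex_self, mul_one, h3]
  rw [hYE] at e3
  -- combine
  set ob := NA.relIndex Y
  set q := (map (normHom σ) f.ker).relIndex (NA ⊓ f.ker)
  set u := (NA ⊓ f.ker).relIndex (f.ker ⊓ (diffHom σ).ker)
  set w := (f.range ⊓ (diffHom τ).ker).relIndex (diffHom τ).ker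
  set xD := ((diffHom τ).range ⊔ f.range).relIndex X
  set j := (NB ⊔ P).relIndex (diffHom τ).ker
  set h := P.relIndex (diffHom τ).ker
  have hXj : X.index * j ≠ 0 := by rwa [e1]
  have hX0 : X.index ≠ 0 := left_ne_zero_of_mul hXj
  have hj0 : j ≠ 0 := right_ne_zero_of_mul hXj
  have key : X.index * (2 * ob) = X.index * j := by
    calc X.index * (2 * ob) = 2 * (u * (xD * X.index)) := by rw [← e3]; ring
      _ = (2 * (q * u)) * w := by rw [e2, ← e4, e6]; ring
      _ = X.index * j := by rw [e5, hE, e7, e1]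
  have key2 : 2 * ob = j := Nat.eq_of_mul_eq_mul_left (Nat.pos_of_ne_zero hX0) key
  have hob : ob = 1 := by omega
  exact relIndex_eq_one.1 hob ⟨by simp [ha], hfa⟩

end InvolutionIndex

end

section

namespace InvolutionIndex

open Subgroup

variable {A : Type*} [CommGroup A]

/-- A subgroup `U` with `2`-torsion `{1, e}` whose square index is the square of that of its
invariants has Herbrand quotient `1 / 2`. -/
theorem two_mul_relIndex_norm_eq (σ : A →* A) (hσ : ∀ a, σ (σ a) = a) (U : Subgroup A)
    (hU : ∀ x ∈ U, σ x ∈ U) {e : A} (he : e ∈ U) (hσe : σ e = e) (he2 : e * e = 1)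
    (he1 : e ≠ 1) (htor : ∀ x ∈ U, x * x = 1 → x = 1 ∨ x = e) (hns : ∀ x ∈ U, x * x ≠ e)
    {c : ℕ} (hc : c ≠ 0) (h1 : (map (powMonoidHom 2) U).relIndex U = c * c)
    (h2 : (map (powMonoidHom 2) (U ⊓ (diffHom σ).ker)).relIndex (U ⊓ (diffHom σ).ker) = c) :
    2 * (map (normHom σ) U).relIndex (U ⊓ (diffHom σ).ker) =
      (map (diffHom σ) U).relIndex (U ⊓ (normHom σ).ker) := by
  set p : A →* A := powMonoidHom 2 with hp
  have hpa : ∀ x, p x = x * x := fun x => by simp [hp, pow_two]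
  set Up := U ⊓ (diffHom σ).ker with hUp
  set Um := U ⊓ (normHom σ).ker with hUm
  have hUp' : ∀ {x}, x ∈ Up ↔ x ∈ U ∧ σ x = x := by
    intro x
    rw [hUp, mem_inf, MonoidHom.mem_ker, diffHom_apply, div_eq_one]
    exact and_congr_right fun _ => eq_comm
  have hUm' : ∀ {x}, x ∈ Um ↔ x ∈ U ∧ σ x = x⁻¹ := by
    intro x
    rw [hUm, mem_inf, MonoidHom.mem_ker, normHom_apply, mul_eq_one_iff_inv_eq]
    exact and_congr_right fun _ => eq_comm
  have hple : ∀ S : Subgroup A, map p S ≤ S := by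
    rintro S _ ⟨x, hx, rfl⟩
    rw [hpa]
    exact mul_mem hx hx
  set Y := Up ⊔ Um with hY
  have hYU : Y ≤ U := sup_le inf_le_left inf_le_left
  -- images of `U` and `Y`
  have hNY : map (normHom σ) Y = map p Up := by
    ext z
    constructor
    · rintro ⟨y, hy, rfl⟩
      obtain ⟨u, hu, v, hv, rfl⟩ := mem_sup.1 hy
      refine ⟨u, hu, ?_⟩
      have hv' := (hUm'.1 hv).2
      have hu' := (hUp'.1 hu).2
      simp only [hpa, normHom_apply, map_mul, hv', hu']
      rw [mul_inv_cancel, mul_one]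
    · rintro ⟨u, hu, rfl⟩
      refine ⟨u, mem_sup_left hu, ?_⟩
      simp [hpa, (hUp'.1 hu).2]
  have hDY : map (diffHom σ) Y = map p Um := by
    ext z
    constructor
    · rintro ⟨y, hy, rfl⟩
      obtain ⟨u, hu, v, hv, rfl⟩ := mem_sup.1 hy
      refine ⟨v, hv, ?_⟩
      have hv' := (hUm'.1 hv).2
      have hu' := (hUp'.1 hu).2
      simp only [hpa, diffHom_apply, map_mul, hv', hu', div_inv_eq_mul]
      rw [div_self', one_mul]
    · rintro ⟨u, hu, rfl⟩
      refine ⟨u, mem_sup_right hu, ?_⟩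
      simp [hpa, (hUm'.1 hu).2]
  have hN : map p Up ≤ map (normHom σ) U := by rw [← hNY]; exact map_mono hYU
  have hD : map p Um ≤ map (diffHom σ) U := by rw [← hDY]; exact map_mono hYU
  have hNU : map (normHom σ) U ≤ Up := by
    rintro _ ⟨x, hx, rfl⟩
    exact hUp'.2 ⟨mul_mem hx (hU x hx), by simp [hσ, mul_comm]⟩
  have hDU : map (diffHom σ) U ≤ Um := by
    rintro _ ⟨x, hx, rfl⟩
    exact hUm'.2 ⟨div_mem hx (hU x hx), by simp [hσ]⟩
  have e1 : Y.relIndex U * (map (normHom σ) U).relIndex Up = c := by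
    rw [relIndex_eq_relIndex_map_mul (normHom σ) hYU, hNY, ← h2,
      ← relIndex_mul_relIndex _ _ _ hN hNU]
    have : Y ⊓ (normHom σ).ker = U ⊓ (normHom σ).ker :=
      le_antisymm (inf_le_inf_right _ hYU) (le_inf le_sup_right inf_le_right)
    rw [this, relIndex_self, mul_one]
  have e2 : Y.relIndex U * (map (diffHom σ) U).relIndex Um = (map p Um).relIndex Um := by
    rw [relIndex_eq_relIndex_map_mul (diffHom σ) hYU, hDY,
      ← relIndex_mul_relIndex _ _ _ hD hDU]
    have : Y ⊓ (diffHom σ).ker = U ⊓ (diffHom σ).ker :=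
      le_antisymm (inf_le_inf_right _ hYU) (le_inf le_sup_left inf_le_right)
    rw [this, relIndex_self, mul_one]
  have hY0 : Y.relIndex U ≠ 0 := by
    intro h
    rw [h, zero_mul] at e1
    exact hc e1.symm
  have hpker : ∀ {x}, x ∈ p.ker ↔ x * x = 1 := by
    intro x
    rw [MonoidHom.mem_ker, hpa]
  have heUp : e ∈ Up := hUp'.2 ⟨he, hσe⟩
  have heUm : e ∈ Um := hUm'.2 ⟨he, by rw [hσe]; exact eq_inv_of_mul_eq_one_left he2⟩
  -- squares in `U` and in `Y`
  have e3 : (map p Y).relIndex Y = c * c := by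
    have h3 : Y.relIndex U = (map p Y).relIndex (map p U) := by
      rw [relIndex_eq_relIndex_map_mul p hYU]
      have : Y ⊓ p.ker = U ⊓ p.ker := by
        refine le_antisymm (inf_le_inf_right _ hYU) (le_inf ?_ inf_le_right)
        rintro x ⟨hx, hx2⟩
        rcases htor x hx (hpker.1 hx2) with rfl | rfl
        · exact one_mem _
        · exact mem_sup_left heUp
      rw [this, relIndex_self, mul_one]
    have h4 : (map p Y).relIndex Y * Y.relIndex U =
        (map p Y).relIndex (map p U) * (map p U).relIndex U := by
      rw [relIndex_mul_relIndex _ _ _ (hple Y) hYU,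
        relIndex_mul_relIndex _ _ _ (map_mono hYU) (hple U)]
    rw [h1, ← h3, mul_comm] at h4
    exact Nat.eq_of_mul_eq_mul_left (Nat.pos_of_ne_zero hY0) h4
  have e4 : (map p Um).relIndex Um = (map p (map p Um)).relIndex (map p Um) * 2 := by
    rw [relIndex_eq_relIndex_map_mul p (hple Um)]
    congr 1
    have h3 : map p Um ⊓ p.ker = ⊥ := by
      rw [eq_bot_iff]
      rintro _ ⟨⟨x, hx, rfl⟩, hx2⟩
      have hxU := (hUm'.1 hx).1
      replace hx2 := hpker.1 hx2
      rcases htor _ (by rw [hpa]; exact mul_mem hxU hxU) hx2 with h | h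
      · exact h
      · exact absurd (by rw [← hpa, h]) (hns x hxU)
    have h4 : (Um : Set A) ∩ (p.ker : Set A) = {1, e} := by
      ext x
      constructor
      · rintro ⟨hx, hx2⟩
        exact htor x (hUm'.1 hx).1 (hpker.1 hx2)
      · rintro (rfl | rfl)
        · exact ⟨one_mem _, one_mem _⟩
        · exact ⟨heUm, hpker.2 he2⟩
    rw [h3, relIndex_bot_left]
    change Nat.card ((Um ⊓ p.ker : Subgroup A) : Set A) = 2
    rw [coe_inf, h4, Nat.card_coe_set_eq, Set.ncard_pair he1.symm]
  have e5 : (map p Y).relIndex Y = (map p (map p Um)).relIndex (map p Um) * c := by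
    rw [relIndex_eq_relIndex_map_mul (diffHom σ) (hple Y), hDY]
    have h3 : map (diffHom σ) (map p Y) = map p (map p Um) := by
      rw [← hDY, map_map, map_map]
      congr 1
      ext x
      simp [hpa, mul_div_mul_comm]
    have h4 : Y ⊓ (diffHom σ).ker = Up :=
      le_antisymm (inf_le_inf_right _ hYU) (le_inf le_sup_left inf_le_right)
    have h5 : map p Y ⊓ (diffHom σ).ker = map p Up := by
      refine le_antisymm ?_ (le_inf (map_mono le_sup_left) ((hple Up).trans inf_le_right))
      rintro _ ⟨⟨y, hy, rfl⟩, hz⟩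
      obtain ⟨u, hu, v, hv, rfl⟩ := mem_sup.1 hy
      have hv' := (hUm'.1 hv)
      have hu' := (hUp'.1 hu)
      have h6 : (v * v) * (v * v) = 1 := by
        replace hz := MonoidHom.mem_ker.1 hz
        rw [diffHom_apply, div_eq_one, hpa] at hz
        simp only [map_mul, hu'.2, hv'.2] at hz
        have : u * u * (v * v) = u * u * (v⁻¹ * v⁻¹) := by
          calc u * u * (v * v) = u * v * (u * v) := by rw [mul_mul_mul_comm]
            _ = u * v⁻¹ * (u * v⁻¹) := hz
            _ = u * u * (v⁻¹ * v⁻¹) := by rw [mul_mul_mul_comm]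
        rw [mul_right_inj] at this
        calc v * v * (v * v) = v⁻¹ * v⁻¹ * (v * v) := by rw [← this]
          _ = 1 := by group
      have h7 : v * v = 1 := by
        rcases htor _ (mul_mem hv'.1 hv'.1) h6 with h | h
        · exact h
        · exact absurd h (hns v hv'.1)
      refine ⟨u, hu, ?_⟩
      rw [hpa, hpa, mul_mul_mul_comm, h7, mul_one]
    rw [h3, h4, h5, h2]
  have e6 : (map p (map p Um)).relIndex (map p Um) = c := by
    rw [e3] at e5
    exact (Nat.eq_of_mul_eq_mul_right (Nat.pos_of_ne_zero hc) e5).symm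
  rw [e6] at e4
  rw [e4, ← e1] at e2
  refine Nat.eq_of_mul_eq_mul_left (Nat.pos_of_ne_zero hY0) ?_
  rw [e2]
  ring

end InvolutionIndex

namespace TotallyRealUnits

open NumberField NumberField.Units Module

variable (F : Type*) [Field F] [NumberField F] [IsTotallyReal F]

/-- A totally real field embeds into `ℝ`. -/
theorem exists_realEmbedding : Nonempty (F →+* ℝ) := by
  obtain ⟨φ⟩ : Nonempty (F →+* ℂ) := inferInstance
  exact ⟨(IsTotallyReal.complexEmbedding_isReal φ).embedding⟩

variable {F}

theorem eq_one_or_eq_neg_one_of_mem_torsion {x : (𝓞 F)ˣ} (hx : x ∈ torsion F) :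
    x = 1 ∨ x = -1 := by
  obtain ⟨φ⟩ := exists_realEmbedding F
  obtain ⟨n, hn, h⟩ := isOfFinOrder_iff_pow_eq_one.1 ((CommGroup.mem_torsion _).1 hx)
  have h1 : (φ (x : F)) ^ n = 1 := by
    have := congrArg (fun u : (𝓞 F)ˣ => φ ((u : 𝓞 F) : F)) h
    simpa using this
  rcases (pow_eq_one_iff_of_ne_zero hn.ne').1 h1 with h2 | ⟨h2, -⟩
  · left
    ext
    exact φ.injective (by simpa using h2)
  · right
    ext
    exact φ.injective (by simpa using h2)

variable (F)

theorem index_range_pow_two :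
    (powMonoidHom 2 : (𝓞 F)ˣ →* (𝓞 F)ˣ).range.index = 2 ^ finrank ℚ F := by
  have h0 : (QuotientGroup.mk' (torsion F)).ker = torsion F := QuotientGroup.ker_mk' _
  have htc : Nat.card (torsion F) = 2 := by
    have : ((torsion F : Subgroup (𝓞 F)ˣ) : Set (𝓞 F)ˣ) = {1, -1} := by
      ext x
      constructor
      · exact fun hx => eq_one_or_eq_neg_one_of_mem_torsion hx
      · rintro (rfl | rfl)
        · exact one_mem _
        · exact (CommGroup.mem_torsion _).2 (isOfFinOrder_iff_pow_eq_one.2 ⟨2, by simp⟩)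
    change Nat.card ((torsion F : Subgroup (𝓞 F)ˣ) : Set (𝓞 F)ˣ) = 2
    rw [this, Nat.card_coe_set_eq, Set.ncard_pair]
    intro h
    have := congrArg (fun u : (𝓞 F)ˣ => ((u : 𝓞 F) : F)) h
    simp at this
    have h3 : (1 : F) + 1 = 0 := by nth_rw 2 [this]; ring
    norm_num at h3
  rw [← Subgroup.relIndex_top_right,
    InvolutionIndex.relIndex_eq_relIndex_map_mul (QuotientGroup.mk' (torsion F)) le_top, h0,
    top_inf_eq]
  have h1 : (powMonoidHom 2 : (𝓞 F)ˣ →* (𝓞 F)ˣ).range ⊓ torsion F = ⊥ := by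
    rw [eq_bot_iff]
    rintro _ ⟨⟨x, rfl⟩, hx⟩
    have hx' : x ∈ torsion F := by
      replace hx := (CommGroup.mem_torsion _).1 hx
      refine (CommGroup.mem_torsion _).2 ?_
      exact (isOfFinOrder_pow.1 hx).resolve_right (by norm_num)
    rcases eq_one_or_eq_neg_one_of_mem_torsion hx' with rfl | rfl <;> simp
  have h2 : Subgroup.map (QuotientGroup.mk' (torsion F)) ⊤ = ⊤ := by
    rw [← MonoidHom.range_eq_map, MonoidHom.range_eq_top]
    exact QuotientGroup.mk'_surjective _
  have h3 : (powMonoidHom 2 : (𝓞 F)ˣ →* (𝓞 F)ˣ).range.map (QuotientGroup.mk' (torsion F)) =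
      (powMonoidHom (α := (𝓞 F)ˣ ⧸ torsion F) 2).range := by
    rw [MonoidHom.range_eq_map, MonoidHom.range_eq_map, ← h2, Subgroup.map_map, Subgroup.map_map]
    congr 1
  have h4 : (powMonoidHom (α := (𝓞 F)ˣ ⧸ torsion F) 2).range.index = 2 ^ rank F := by
    rw [← finrank_modTorsion, ← Subgroup.index_toAddSubgroup]
    exact AddSubgroup.index_range_nsmul (Additive ((𝓞 F)ˣ ⧸ torsion F)) 2
  have hr : rank F + 1 = finrank ℚ F := by
    have h5 := Fintype.card_pos (α := InfinitePlace F)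
    have h6 := InfinitePlace.card_eq_nrRealPlaces_add_nrComplexPlaces F
    rw [IsTotallyReal.nrComplexPlaces_eq_zero, add_zero] at h6
    rw [IsTotallyReal.finrank F, rank, ← h6]
    omega
  rw [h1, h2, h3, Subgroup.relIndex_bot_left, htc, Subgroup.relIndex_top_right, h4, ← pow_succ, hr]

end TotallyRealUnits

end

section

namespace FracAct

open NumberField FractionalIdeal
open scoped nonZeroDivisors

variable {L : Type*} [Field L] [NumberField L]

/-- The action of a field automorphism on fractional ideals. -/
noncomputable def act (g : L ≃+* L) : FractionalIdeal (𝓞 L)⁰ L ≃+* FractionalIdeal (𝓞 L)⁰ L :=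
  ringEquivOfRingEquiv L L (RingOfIntegers.mapRingEquiv g)

theorem ringEquivOfRingEquiv_mapRingEquiv (g : L ≃+* L) (x : L) :
    IsFractionRing.ringEquivOfRingEquiv (K := L) (L := L) (RingOfIntegers.mapRingEquiv g) x =
      g x := by
  have : (IsFractionRing.ringEquivOfRingEquiv (K := L) (L := L)
      (RingOfIntegers.mapRingEquiv g) : L →+* L) = (g : L →+* L) := by
    refine IsLocalization.ringHom_ext (𝓞 L)⁰ (RingHom.ext fun y => ?_)
    simp only [RingHom.comp_apply, RingHom.coe_coe,
      IsFractionRing.ringEquivOfRingEquiv_algebraMap]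
    rfl
  exact RingHom.congr_fun this x

theorem mem_act_of_mem (g : L ≃+* L) {I : FractionalIdeal (𝓞 L)⁰ L} {x : L} (hx : x ∈ I) :
    g x ∈ act g I :=
  ⟨x, hx, ringEquivOfRingEquiv_mapRingEquiv g x⟩

theorem act_mul (g h : L ≃+* L) (I : FractionalIdeal (𝓞 L)⁰ L) :
    act (g * h) I = act g (act h I) :=
  ringEquivOfRingEquiv_trans_apply L L L (RingOfIntegers.mapRingEquiv h)
    (RingOfIntegers.mapRingEquiv g) I

theorem act_one (I : FractionalIdeal (𝓞 L)⁰ L) : act (1 : L ≃+* L) I = I := by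
  have := ringEquivOfRingEquiv_refl L (R := 𝓞 L)
  exact RingEquiv.congr_fun this I

theorem mem_act_iff (g : L ≃+* L) {I : FractionalIdeal (𝓞 L)⁰ L} {x : L} :
    x ∈ act g I ↔ g.symm x ∈ I := by
  constructor
  · intro h
    have := mem_act_of_mem g.symm h
    rw [← act_mul] at this
    have h1 : g.symm * g = 1 := RingEquiv.ext fun y => g.symm_apply_apply y
    rwa [h1, act_one] at this
  · intro h
    have := mem_act_of_mem g h
    rwa [g.apply_symm_apply] at this

theorem act_spanSingleton (g : L ≃+* L) (x : L) :
    act g (spanSingleton (𝓞 L)⁰ x) = spanSingleton (𝓞 L)⁰ (g x) := by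
  rw [act, ringEquivOfRingEquiv_spanSingleton, ringEquivOfRingEquiv_mapRingEquiv]

end FracAct

end

section

open NumberField FractionalIdeal FracAct
open scoped nonZeroDivisors

variable {K M : Type*} [Field K] [NumberField K] [Field M] [NumberField M] [Algebra K M]

/-- A quadratic extension of number fields with conjugation `σ`, unramified at all finite
places. -/
structure IsUnramifiedQuadratic (σ : M ≃ₐ[K] M) : Prop where
  invol : ∀ x, σ (σ x) = x
  fixed : ∀ x, σ x = x → ∃ y, algebraMap K M y = x
  exists_ne : ∃ x, σ x ≠ x
  etale : ∃ (m : ℕ) (x y : Fin m → 𝓞 M), ∑ i, (x i : M) * (y i : M) = 1 ∧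
    ∑ i, (x i : M) * σ (y i : M) = 0

namespace IsUnramifiedQuadratic

variable {σ : M ≃ₐ[K] M} (h : IsUnramifiedQuadratic σ)

theorem isIntegral_apply (σ : M ≃ₐ[K] M) {x : M} (hx : IsIntegral ℤ x) : IsIntegral ℤ (σ x) :=
  hx.map (σ.toRingEquiv.toRingHom.toIntAlgHom)

include h

theorem fixed_int {x : M} (hx : IsIntegral ℤ x) (hσ : σ x = x) :
    ∃ y : 𝓞 K, algebraMap K M y = x := by
  obtain ⟨y, rfl⟩ := h.fixed x hσ
  exact ⟨⟨y, (isIntegral_algebraMap_iff (algebraMap K M).injective).1 hx⟩, rfl⟩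

theorem map_comap_eq {J : Ideal (𝓞 M)} (hJ : ∀ z ∈ J, ∀ w : 𝓞 M, (w : M) = σ z → w ∈ J) :
    (J.comap (algebraMap (𝓞 K) (𝓞 M))).map (algebraMap (𝓞 K) (𝓞 M)) = J := by
  refine le_antisymm Ideal.map_comap_le fun z hz => ?_
  obtain ⟨m, x, y, h1, h2⟩ := h.etale
  have h_int : ∀ i, IsIntegral ℤ ((y i : M) * z) := fun i =>
    (RingOfIntegers.isIntegral_coe _).mul (RingOfIntegers.isIntegral_coe _)
  have hs : ∀ i, ∃ s : 𝓞 M, (s : M) = σ ((y i * z : 𝓞 M) : M) := fun i =>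
    ⟨⟨_, isIntegral_apply σ (h_int i)⟩, rfl⟩
  choose s hs using hs
  have ht : ∀ i, ∃ t : 𝓞 K, algebraMap K M t = (y i : M) * z + σ ((y i : M) * z) := fun i => by
    refine h.fixed_int ((h_int i).add (isIntegral_apply σ (h_int i))) ?_
    rw [map_add, h.invol, add_comm]
  choose t ht using ht
  have hz' : z = ∑ i, x i * algebraMap (𝓞 K) (𝓞 M) (t i) := by
    apply RingOfIntegers.ext
    have : ∀ i, ((algebraMap (𝓞 K) (𝓞 M) (t i) : 𝓞 M) : M) = (y i : M) * z + σ ((y i : M) * z) :=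
      fun i => by rw [← ht]; rfl
    have e : ((∑ i, x i * algebraMap (𝓞 K) (𝓞 M) (t i) : 𝓞 M) : M) =
        ∑ i, (x i : M) * ((algebraMap (𝓞 K) (𝓞 M) (t i) : 𝓞 M) : M) := by
      rw [RingOfIntegers.coe_eq_algebraMap, map_sum]
      rfl
    rw [e]
    simp_rw [this, mul_add, map_mul, ← mul_assoc, Finset.sum_add_distrib, ← Finset.sum_mul, h1, h2]
    ring
  have hmem : ∀ i, t i ∈ J.comap (algebraMap (𝓞 K) (𝓞 M)) := fun i => by
    have : algebraMap (𝓞 K) (𝓞 M) (t i) = y i * z + s i := by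
      apply RingOfIntegers.ext
      have e : ((y i * z + s i : 𝓞 M) : M) = (y i : M) * z + (s i : M) := rfl
      rw [e, hs i]
      exact ht i
    rw [Ideal.mem_comap, this]
    exact J.add_mem (J.mul_mem_left _ hz) (hJ _ (J.mul_mem_left _ hz) _ (hs i))
  rw [hz']
  exact Ideal.sum_mem _ fun i _ => Ideal.mul_mem_left _ _ (Ideal.mem_map_of_mem _ (hmem i))

omit h

theorem extendedHom_spanSingleton (x : K) :
    extendedHom M (𝓞 M) (spanSingleton (𝓞 K)⁰ x) = spanSingleton (𝓞 M)⁰ (algebraMap K M x) := by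
  change extended M _ _ = _
  rw [extended_spanSingleton]
  congr 1
  have : (IsLocalization.map M (algebraMap (𝓞 K) (𝓞 M))
      (nonZeroDivisors_le_comap_nonZeroDivisors_of_injective _
        (FaithfulSMul.algebraMap_injective _ _)) : K →+* M) = algebraMap K M := by
    refine IsLocalization.ringHom_ext (𝓞 K)⁰ (RingHom.ext fun y => ?_)
    simp only [RingHom.comp_apply, IsLocalization.map_eq]
    rfl
  exact RingHom.congr_fun this x

theorem act_extendedHom (σ : M ≃ₐ[K] M) (I : FractionalIdeal (𝓞 K)⁰ K) :
    act σ.toRingEquiv (extendedHom M (𝓞 M) I) = extendedHom M (𝓞 M) I := by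
  have key : ∀ τ : M ≃ₐ[K] M, act τ.toRingEquiv (extendedHom M (𝓞 M) I) ≤
      extendedHom M (𝓞 M) I := by
    intro τ z hz
    rw [mem_act_iff] at hz
    have h1 : ∀ w ∈ extendedHom M (𝓞 M) I, τ w ∈ extendedHom M (𝓞 M) I := by
      intro w hw
      change w ∈ extended M _ I at hw
      change τ w ∈ extended M _ I
      rw [mem_extended_iff] at hw
      induction hw using Submodule.span_induction with
      | mem x hx =>
        obtain ⟨y, hy, rfl⟩ := hx
        rw [mem_extended_iff]
        refine Submodule.subset_span ⟨y, hy, ?_⟩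
        have : (IsLocalization.map M (algebraMap (𝓞 K) (𝓞 M))
            (nonZeroDivisors_le_comap_nonZeroDivisors_of_injective _
              (FaithfulSMul.algebraMap_injective _ _)) : K →+* M) = algebraMap K M := by
          refine IsLocalization.ringHom_ext (𝓞 K)⁰ (RingHom.ext fun y => ?_)
          simp only [RingHom.comp_apply, IsLocalization.map_eq]
          rfl
        rw [this, AlgEquiv.commutes]
      | zero => rw [map_zero]; exact Submodule.zero_mem _
      | add x y _ _ hx hy => rw [map_add]; exact Submodule.add_mem _ hx hy
      | smul a x _ hx =>
        have : τ (a • x) = (⟨τ a, isIntegral_apply τ a.2⟩ : 𝓞 M) • τ x := by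
          rw [Algebra.smul_def, Algebra.smul_def, map_mul]
          rfl
        rw [this]
        exact Submodule.smul_mem _ _ hx
    have := h1 _ hz
    have e : τ (τ.toRingEquiv.symm z) = z := τ.apply_symm_apply z
    rwa [e] at this
  refine le_antisymm (key σ) ?_
  have h2 := key σ.symm
  intro z hz
  rw [mem_act_iff]
  exact h2 (mem_act_of_mem σ.symm.toRingEquiv hz)

include h

theorem exists_extendedHom_eq {I : FractionalIdeal (𝓞 M)⁰ M}
    (hI : act σ.toRingEquiv I = I) : ∃ I' : FractionalIdeal (𝓞 K)⁰ K, extendedHom M (𝓞 M) I' = I := by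
  obtain ⟨a, ha, h_int⟩ := I.isFractional
  have ha0 : (a : M) ≠ 0 := by
    simpa using nonZeroDivisors.ne_zero ha
  obtain ⟨c, hc⟩ := h.fixed_int (x := (a : M) * σ a)
    (a.2.mul (isIntegral_apply σ a.2)) (by rw [map_mul, h.invol, mul_comm])
  have hc0 : algebraMap K M c ≠ 0 := by
    rw [hc]
    exact mul_ne_zero ha0 ((map_ne_zero σ).2 ha0)
  have hle : spanSingleton (𝓞 M)⁰ (algebraMap K M c) * I ≤ 1 := by
    rw [spanSingleton_mul_le_iff]
    intro z hz
    obtain ⟨w, hw⟩ := h_int z hz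
    rw [mem_one_iff]
    refine ⟨⟨σ a, isIntegral_apply σ a.2⟩ * w, ?_⟩
    change σ a * (algebraMap (𝓞 M) M w) = _
    rw [hw, hc, Algebra.smul_def]
    change σ a * (a * z) = a * σ a * z
    ring
  obtain ⟨J, hJ⟩ := le_one_iff_exists_coeIdeal.1 hle
  have hmap : (J.comap (algebraMap (𝓞 K) (𝓞 M))).map (algebraMap (𝓞 K) (𝓞 M)) = J := by
    refine h.map_comap_eq fun z hz w hw => ?_
    have hz' : (z : M) ∈ spanSingleton (𝓞 M)⁰ (algebraMap K M c) * I := by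
      rw [← hJ]
      exact mem_coeIdeal_of_mem (𝓞 M)⁰ hz
    obtain ⟨v, hv, hzv⟩ := mem_singleton_mul.1 hz'
    have hw' : (w : M) ∈ (J : FractionalIdeal (𝓞 M)⁰ M) := by
      rw [hJ, mem_singleton_mul]
      refine ⟨σ v, ?_, ?_⟩
      · have := mem_act_of_mem σ.toRingEquiv hv
        rwa [hI] at this
      · rw [hw, hzv, map_mul, AlgEquiv.commutes]
    obtain ⟨w', hw1, hw2⟩ := (mem_coeIdeal (𝓞 M)⁰).1 hw'
    rwa [← RingOfIntegers.ext hw2]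
  refine ⟨spanSingleton (𝓞 K)⁰ ((c : K)⁻¹) *
    ((J.comap (algebraMap (𝓞 K) (𝓞 M)) : Ideal (𝓞 K)) : FractionalIdeal (𝓞 K)⁰ K), ?_⟩
  rw [map_mul, extendedHom_spanSingleton, extendedHom_coeIdeal_eq_map, hmap, hJ, ← mul_assoc,
    spanSingleton_mul_spanSingleton, map_inv₀, inv_mul_cancel₀ hc0, spanSingleton_one, one_mul]

end IsUnramifiedQuadratic

end

section

open NumberField FractionalIdeal FracAct InvolutionIndex
open scoped nonZeroDivisors

namespace IsUnramifiedQuadratic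

variable {K M : Type*} [Field K] [NumberField K] [Field M] [NumberField M] [Algebra K M]

/-- The group of nonzero fractional ideals. -/
abbrev FI (F : Type*) [Field F] [NumberField F] := (FractionalIdeal (𝓞 F)⁰ F)ˣ

/-- The action of an automorphism on nonzero elements. -/
noncomputable def unitAct (σ : M ≃ₐ[K] M) : Mˣ →* Mˣ := Units.map (σ : M →* M)

/-- The action of an automorphism on nonzero fractional ideals. -/
noncomputable def idealAct (σ : M ≃ₐ[K] M) : FI M →* FI M :=
  Units.map (act σ.toRingEquiv : FractionalIdeal (𝓞 M)⁰ M →* FractionalIdeal (𝓞 M)⁰ M)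

variable (K M) in
/-- Extension of nonzero fractional ideals. -/
noncomputable def idealExt : FI K →* FI M :=
  Units.map ((extendedHom M (𝓞 M) : FractionalIdeal (𝓞 K)⁰ K →+* FractionalIdeal (𝓞 M)⁰ M) :
    FractionalIdeal (𝓞 K)⁰ K →* FractionalIdeal (𝓞 M)⁰ M)

@[simp] theorem unitAct_apply (σ : M ≃ₐ[K] M) (x : Mˣ) : (unitAct σ x : M) = σ x := rfl

@[simp] theorem idealAct_apply (σ : M ≃ₐ[K] M) (I : FI M) :
    (idealAct σ I : FractionalIdeal (𝓞 M)⁰ M) = act σ.toRingEquiv I := rfl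

@[simp] theorem idealExt_apply (I : FI K) :
    (idealExt K M I : FractionalIdeal (𝓞 M)⁰ M) = extendedHom M (𝓞 M) (I : FractionalIdeal (𝓞 K)⁰ K) :=
  rfl

theorem toPrincipalIdeal_unitAct (σ : M ≃ₐ[K] M) (x : Mˣ) :
    toPrincipalIdeal (𝓞 M) M (unitAct σ x) = idealAct σ (toPrincipalIdeal (𝓞 M) M x) := by
  apply Units.ext
  rw [coe_toPrincipalIdeal, idealAct_apply, coe_toPrincipalIdeal, act_spanSingleton]
  rfl

theorem idealExt_toPrincipalIdeal (x : Kˣ) :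
    idealExt K M (toPrincipalIdeal (𝓞 K) K x) =
      toPrincipalIdeal (𝓞 M) M (Units.map (algebraMap K M) x) := by
  apply Units.ext
  rw [coe_toPrincipalIdeal, idealExt_apply, coe_toPrincipalIdeal, extendedHom_spanSingleton]
  rfl

theorem index_range_toPrincipalIdeal_ne_zero (F : Type*) [Field F] [NumberField F] :
    (toPrincipalIdeal (𝓞 F) F).range.index ≠ 0 := by
  have : Finite ((FractionalIdeal (𝓞 F)⁰ F)ˣ ⧸ (toPrincipalIdeal (𝓞 F) F).range) :=
    Finite.of_equiv _ (ClassGroup.equiv F).toEquiv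
  exact Nat.card_pos.ne'

theorem ker_toPrincipalIdeal (F : Type*) [Field F] [NumberField F] :
    (toPrincipalIdeal (𝓞 F) F).ker = (Units.map (algebraMap (𝓞 F) F : 𝓞 F →* F)).range := by
  ext x
  rw [MonoidHom.mem_ker, toPrincipalIdeal_eq_iff, Units.val_one]
  constructor
  · intro hx
    have h1 : (x : F) ∈ (1 : FractionalIdeal (𝓞 F)⁰ F) := hx ▸ mem_spanSingleton_self _ _
    have h2 : ((x⁻¹ : Fˣ) : F) ∈ (1 : FractionalIdeal (𝓞 F)⁰ F) := by
      have : spanSingleton (𝓞 F)⁰ ((x⁻¹ : Fˣ) : F) = 1 := by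
        have := congrArg (spanSingleton (𝓞 F)⁰ ((x⁻¹ : Fˣ) : F) * ·) hx
        simpa [spanSingleton_mul_spanSingleton] using this.symm
      exact this ▸ mem_spanSingleton_self _ _
    obtain ⟨a, ha⟩ := (mem_one_iff _).1 h1
    obtain ⟨b, hb⟩ := (mem_one_iff _).1 h2
    refine ⟨⟨a, b, ?_, ?_⟩, Units.ext ha⟩
    · apply RingOfIntegers.ext
      change algebraMap (𝓞 F) F (a * b) = algebraMap (𝓞 F) F 1
      rw [map_mul, ha, hb, map_one, Units.mul_inv]
    · apply RingOfIntegers.ext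
      change algebraMap (𝓞 F) F (b * a) = algebraMap (𝓞 F) F 1
      rw [map_mul, ha, hb, map_one, Units.inv_mul]
  · rintro ⟨u, rfl⟩
    change spanSingleton (𝓞 F)⁰ (algebraMap (𝓞 F) F u) = 1
    rw [← coeIdeal_span_singleton, Ideal.span_singleton_eq_top.2 u.isUnit]
    exact coeIdeal_top (𝓞 F)⁰

variable {σ : M ≃ₐ[K] M} (h : IsUnramifiedQuadratic σ)

include h

theorem finrank_eq : Module.finrank K M = 2 := by
  have hne : σ ≠ 1 := by
    obtain ⟨x, hx⟩ := h.exists_ne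
    rintro rfl
    exact hx rfl
  have hord : orderOf σ = 2 := orderOf_eq_prime (AlgEquiv.ext fun x => by
    rw [pow_two]; exact h.invol x) hne
  have : FiniteDimensional K M := Module.Finite.of_restrictScalars_finite ℚ K M
  have hbot : IntermediateField.fixedField (Subgroup.zpowers σ) = ⊥ := by
    rw [eq_bot_iff]
    intro x hx
    rw [IntermediateField.mem_fixedField_iff] at hx
    obtain ⟨y, hy⟩ := h.fixed x (hx σ (Subgroup.mem_zpowers σ))
    exact IntermediateField.mem_bot.2 ⟨y, hy⟩
  have := IntermediateField.finrank_fixedField_eq_card (Subgroup.zpowers σ)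
  rwa [hbot, IntermediateField.finrank_bot', Nat.card_zpowers, hord] at this

theorem ker_normHom_unitAct_le :
    (normHom (unitAct σ)).ker ≤ (diffHom (unitAct σ)).range := by
  intro x hx
  have hx : x * unitAct σ x = 1 := hx
  have hx' : (x : M) * σ x = 1 := congrArg Units.val hx
  have key : ∀ y : M, y ≠ 0 → y = x * σ y → x ∈ (diffHom (unitAct σ)).range := by
    intro y hy hyx
    refine ⟨Units.mk0 y hy, ?_⟩
    rw [diffHom_apply, div_eq_iff_eq_mul]
    exact Units.ext hyx
  by_cases h1 : (1 : M) + x = 0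
  · obtain ⟨c, hc⟩ := h.exists_ne
    refine key (c - σ c) (sub_ne_zero.2 (Ne.symm hc)) ?_
    rw [map_sub, h.invol, eq_neg_of_add_eq_zero_right h1]
    ring
  · refine key _ h1 ?_
    rw [map_add, map_one, mul_add, hx']
    ring

theorem ker_normHom_idealAct_le :
    (normHom (idealAct σ)).ker ≤ (diffHom (idealAct σ)).range := by
  intro I hI
  have hI : I * idealAct σ I = 1 := hI
  have hI' : (I : FractionalIdeal (𝓞 M)⁰ M) * act σ.toRingEquiv I = 1 := congrArg Units.val hI
  have h0 : (1 : FractionalIdeal (𝓞 M)⁰ M) + I ≠ 0 := by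
    intro h
    have : (1 : FractionalIdeal (𝓞 M)⁰ M) ≤ 0 := by
      rw [← h, ← sup_eq_add]
      exact le_sup_left
    exact one_ne_zero (FractionalIdeal.le_zero_iff.1 this)
  refine ⟨Units.mk0 _ h0, ?_⟩
  rw [diffHom_apply, div_eq_iff_eq_mul]
  apply Units.ext
  change 1 + (I : FractionalIdeal (𝓞 M)⁰ M) = I * act σ.toRingEquiv (1 + I)
  rw [map_add, map_one, mul_add, hI', mul_one, add_comm]

theorem ker_diffHom_unitAct :
    (diffHom (unitAct σ)).ker = (Units.map (algebraMap K M : K →* M)).range := by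
  ext x
  rw [MonoidHom.mem_ker, diffHom_apply, div_eq_one]
  constructor
  · intro hx
    obtain ⟨y, hy⟩ := h.fixed x (congrArg Units.val hx).symm
    have hy0 : y ≠ 0 := by
      rintro rfl
      exact x.ne_zero (by rw [← hy, map_zero])
    exact ⟨Units.mk0 y hy0, Units.ext hy⟩
  · rintro ⟨y, rfl⟩
    exact Units.ext (σ.commutes y).symm

theorem ker_diffHom_idealAct : (diffHom (idealAct σ)).ker = (idealExt K M).range := by
  ext I
  rw [MonoidHom.mem_ker, diffHom_apply, div_eq_one]
  constructor
  · intro hI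
    obtain ⟨J, hJ⟩ := h.exists_extendedHom_eq (congrArg Units.val hI).symm
    have hJ0 : J ≠ 0 := by
      rintro rfl
      exact I.ne_zero (by rw [← hJ, map_zero])
    exact ⟨Units.mk0 J hJ0, Units.ext hJ⟩
  · rintro ⟨J, rfl⟩
    exact Units.ext (act_extendedHom σ J).symm

end IsUnramifiedQuadratic

end

section

open NumberField FractionalIdeal FracAct InvolutionIndex
open scoped nonZeroDivisors

/-- If a finite abelian group of exponent two has more than two elements, then it has two distinct
nontrivial quadratic characters. -/
theorem exists_two_quadratic_characters {Q : Type*} [CommGroup Q] [Finite Q]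
    (h2 : ∀ x : Q, x * x = 1) (hc : 2 < Nat.card Q) :
    ∃ χ₁ χ₂ : Q →* ℤˣ, χ₁ ≠ 1 ∧ χ₂ ≠ 1 ∧ χ₁ ≠ χ₂ := by
  have hexp : Monoid.exponent Q ∣ 2 :=
    Monoid.exponent_dvd_of_forall_pow_eq_one fun x => by rw [pow_two, h2]
  have hroots : HasEnoughRootsOfUnity ℤ 2 := by
    refine ⟨⟨-1, IsPrimitiveRoot.neg_one 0 (by decide)⟩, ?_⟩
    exact inferInstance
  have := HasEnoughRootsOfUnity.of_dvd ℤ hexp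
  have hcard : Nat.card (Q →* ℤˣ) = Nat.card Q :=
    CommGroup.card_monoidHom_of_hasEnoughRootsOfUnity Q ℤ
  have hfin : Finite (Q →* ℤˣ) := Nat.finite_of_card_ne_zero (by omega)
  have : Fintype (Q →* ℤˣ) := Fintype.ofFinite _
  rw [← hcard, Nat.card_eq_fintype_card, Fintype.two_lt_card_iff] at hc
  obtain ⟨a, b, c, hab, hac, hbc⟩ := hc
  by_cases ha : a = 1
  · exact ⟨b, c, fun h => hab (ha.trans h.symm), fun h => hac (ha.trans h.symm), hbc⟩
  by_cases hb : b = 1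
  · exact ⟨a, c, ha, fun h => hbc (hb.trans h.symm), hac⟩
  · exact ⟨a, b, ha, hb, hab⟩

theorem relIndex_map_pow_two_range {F X : Type*} [Field F] [NumberField F] [IsTotallyReal F]
    [CommGroup X] (g : (𝓞 F)ˣ →* X) (hg : Function.Injective g) :
    (Subgroup.map (powMonoidHom 2) g.range).relIndex g.range = 2 ^ Module.finrank ℚ F := by
  rw [← TotallyRealUnits.index_range_pow_two, ← Subgroup.relIndex_top_right,
    ← Subgroup.relIndex_map_map_of_injective _ _ hg, MonoidHom.range_eq_map,
    MonoidHom.range_eq_map, Subgroup.map_map, Subgroup.map_map]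
  congr 2
  ext x
  simp

namespace IsUnramifiedQuadratic

variable {K M : Type*} [Field K] [NumberField K] [Field M] [NumberField M] [Algebra K M]

/-- A quadratic ideal class character of `K` which is trivial on the norms of ideals of `M`. -/
structure IsNormCharacter (σ : M ≃ₐ[K] M) (χ : FI K →* ℤˣ) : Prop where
  principal : ∀ x, χ (toPrincipalIdeal (𝓞 K) K x) = 1
  norm : ∀ I B, idealExt K M I = B * idealAct σ B → χ I = 1

variable {σ : M ≃ₐ[K] M} (h : IsUnramifiedQuadratic σ)

include h

theorem unitAct_unitAct (x : Mˣ) : unitAct σ (unitAct σ x) = x := Units.ext (h.invol x)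

theorem idealAct_idealAct (I : FI M) : idealAct σ (idealAct σ I) = I := by
  apply Units.ext
  change act σ.toRingEquiv (act σ.toRingEquiv I) = _
  rw [← act_mul]
  have : σ.toRingEquiv * σ.toRingEquiv = 1 := RingEquiv.ext fun x => h.invol x
  rw [this, act_one]

theorem index_norm_le
    (hchar : ∀ χ₁ χ₂, IsNormCharacter σ χ₁ → IsNormCharacter σ χ₂ → χ₁ = 1 ∨ χ₂ = 1 ∨ χ₁ = χ₂) :
    ((normHom (idealAct σ)).range ⊔
      Subgroup.map (toPrincipalIdeal (𝓞 M) M) (diffHom (unitAct σ)).ker).relIndex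
        (diffHom (idealAct σ)).ker ≤ 2 := by
  rw [h.ker_diffHom_idealAct, ← Subgroup.index_comap]
  set S := Subgroup.comap (idealExt K M) ((normHom (idealAct σ)).range ⊔
      Subgroup.map (toPrincipalIdeal (𝓞 M) M) (diffHom (unitAct σ)).ker) with hS
  have hP : (toPrincipalIdeal (𝓞 K) K).range ≤ S := by
    rintro _ ⟨x, rfl⟩
    refine Subgroup.mem_sup_right ⟨Units.map (algebraMap K M) x, ?_,
      (idealExt_toPrincipalIdeal x).symm⟩
    rw [h.ker_diffHom_unitAct]
    exact ⟨x, rfl⟩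
  have hN : ∀ I B, idealExt K M I = B * idealAct σ B → I ∈ S := fun I B hIB =>
    Subgroup.mem_sup_left ⟨B, hIB.symm⟩
  by_contra! hlt
  have hSi : S.index ≠ 0 := by omega
  have : Finite (FI K ⧸ S) := Nat.finite_of_card_ne_zero hSi
  obtain ⟨χ₁, χ₂, h1, h2, h12⟩ := exists_two_quadratic_characters (Q := FI K ⧸ S) (by
    intro x
    obtain ⟨I, rfl⟩ := QuotientGroup.mk_surjective x
    rw [← QuotientGroup.mk_mul, QuotientGroup.eq_one_iff]
    refine hN _ (idealExt K M I) ?_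
    rw [map_mul]
    congr 1
    exact Units.ext (act_extendedHom σ I).symm) hlt
  have hgood : ∀ χ : FI K ⧸ S →* ℤˣ, IsNormCharacter σ (χ.comp (QuotientGroup.mk' S)) := by
    intro χ
    constructor
    · intro x
      rw [MonoidHom.comp_apply, QuotientGroup.mk'_apply,
        (QuotientGroup.eq_one_iff _).2 (hP ⟨x, rfl⟩), map_one]
    · intro I B hIB
      rw [MonoidHom.comp_apply, QuotientGroup.mk'_apply,
        (QuotientGroup.eq_one_iff _).2 (hN I B hIB), map_one]
  have hinj : ∀ χ χ' : FI K ⧸ S →* ℤˣ,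
      χ.comp (QuotientGroup.mk' S) = χ'.comp (QuotientGroup.mk' S) → χ = χ' := fun χ χ' =>
    (MonoidHom.cancel_right (QuotientGroup.mk'_surjective S)).1
  rcases hchar _ _ (hgood χ₁) (hgood χ₂) with h | h | h
  · exact h1 (hinj _ _ h)
  · exact h2 (hinj _ _ h)
  · exact h12 (hinj _ _ h)

theorem relIndex_map_ker_ne_zero :
    (Subgroup.map (toPrincipalIdeal (𝓞 M) M) (diffHom (unitAct σ)).ker).relIndex
      (diffHom (idealAct σ)).ker ≠ 0 := by
  rw [h.ker_diffHom_idealAct, ← Subgroup.index_comap]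
  refine fun h0 => index_range_toPrincipalIdeal_ne_zero K ?_
  have : (toPrincipalIdeal (𝓞 K) K).range ≤ Subgroup.comap (idealExt K M)
      (Subgroup.map (toPrincipalIdeal (𝓞 M) M) (diffHom (unitAct σ)).ker) := by
    rintro _ ⟨x, rfl⟩
    refine ⟨Units.map (algebraMap K M) x, ?_, (idealExt_toPrincipalIdeal x).symm⟩
    rw [h.ker_diffHom_unitAct]
    exact ⟨x, rfl⟩
  exact Nat.eq_zero_of_zero_dvd (h0 ▸ Subgroup.index_dvd_of_le this)

theorem herbrand_units [IsTotallyReal M] :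
    2 * (Subgroup.map (normHom (unitAct σ)) (toPrincipalIdeal (𝓞 M) M).ker).relIndex
        ((toPrincipalIdeal (𝓞 M) M).ker ⊓ (diffHom (unitAct σ)).ker) =
      (Subgroup.map (diffHom (unitAct σ)) (toPrincipalIdeal (𝓞 M) M).ker).relIndex
        ((toPrincipalIdeal (𝓞 M) M).ker ⊓ (normHom (unitAct σ)).ker) := by
  have : IsTotallyReal K := IsTotallyReal.of_algebra K M
  have hK : (toPrincipalIdeal (𝓞 M) M).ker ⊓ (diffHom (unitAct σ)).ker =
      ((Units.map (algebraMap K M : K →* M)).comp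
        (Units.map (algebraMap (𝓞 K) K : 𝓞 K →* K))).range := by
    rw [ker_toPrincipalIdeal, h.ker_diffHom_unitAct]
    apply le_antisymm
    · rintro _ ⟨⟨u, rfl⟩, ⟨y, hy⟩⟩
      have h_int : ∀ v : (𝓞 M)ˣ, ∀ z : K, algebraMap K M z = algebraMap (𝓞 M) M v →
          IsIntegral ℤ z := fun v z hz =>
        (isIntegral_algebraMap_iff (algebraMap K M).injective).1 (hz ▸ (v : 𝓞 M).2)
      have i1 := h_int u y (congrArg Units.val hy)
      have i2 := h_int u⁻¹ ((y⁻¹ : Kˣ) : K) (congrArg (fun t : Mˣ => ((t⁻¹ : Mˣ) : M)) hy)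
      refine ⟨⟨⟨y, i1⟩, ⟨_, i2⟩, ?_, ?_⟩, ?_⟩
      · exact RingOfIntegers.ext (Units.mul_inv y)
      · exact RingOfIntegers.ext (Units.inv_mul y)
      · rw [← hy]
        exact Units.ext rfl
    · rintro _ ⟨u, rfl⟩
      refine ⟨⟨Units.map (algebraMap (𝓞 K) (𝓞 M) : 𝓞 K →* 𝓞 M) u, Units.ext rfl⟩, ⟨_, rfl⟩⟩
  rw [ker_toPrincipalIdeal] at hK ⊢
  have i1 : Function.Injective (Units.map (algebraMap (𝓞 M) M : 𝓞 M →* M)) :=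
    Units.map_injective RingOfIntegers.coe_injective
  have i2 : Function.Injective ((Units.map (algebraMap K M : K →* M)).comp
      (Units.map (algebraMap (𝓞 K) K : 𝓞 K →* K))) :=
    (Units.map_injective (algebraMap K M).injective).comp
      (Units.map_injective RingOfIntegers.coe_injective)
  have hdeg : Module.finrank ℚ M = Module.finrank ℚ K + Module.finrank ℚ K := by
    rw [← Module.finrank_mul_finrank ℚ K M, h.finrank_eq, mul_two]
  refine two_mul_relIndex_norm_eq (e := -1) (c := 2 ^ Module.finrank ℚ K) (unitAct σ)
    h.unitAct_unitAct _ ?_ ⟨-1, ?_⟩ ?_ ?_ ?_ ?_ ?_ (by positivity) ?_ ?_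
  · rintro _ ⟨u, rfl⟩
    exact ⟨Units.map (RingOfIntegers.mapRingHom (σ : M →+* M) : 𝓞 M →* 𝓞 M) u, Units.ext rfl⟩
  · exact Units.ext (by simp)
  · exact Units.ext (by simp)
  · simp
  · intro h1
    have : ((-1 : Mˣ) : M) = 1 := congrArg Units.val h1
    rw [Units.val_neg, Units.val_one] at this
    have h2 : (2 : M) = 0 := by linear_combination -this
    exact two_ne_zero h2
  · rintro x - hx
    have : (x : M) * x = 1 := congrArg Units.val hx
    rcases mul_self_eq_one_iff.1 this with h1 | h1
    · exact Or.inl (Units.ext h1)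
    · exact Or.inr (Units.ext h1)
  · rintro x - hx
    have hx : (x : M) * x = -1 := congrArg Units.val hx
    obtain ⟨φ⟩ := TotallyRealUnits.exists_realEmbedding M
    have := congrArg φ hx
    rw [map_mul, map_neg, map_one] at this
    nlinarith [mul_self_nonneg (φ x)]
  · rw [relIndex_map_pow_two_range _ i1, hdeg, pow_add]
  · rw [hK, relIndex_map_pow_two_range _ i2]

/-- **Hasse norm theorem**, in a totally real unramified quadratic extension, assuming
the index inequality in the form of a statement about characters. -/
theorem exists_mul_apply_eq [IsTotallyReal M]
    (hchar : ∀ χ₁ χ₂, IsNormCharacter σ χ₁ → IsNormCharacter σ χ₂ → χ₁ = 1 ∨ χ₂ = 1 ∨ χ₁ = χ₂)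
    {a : Mˣ} (ha : unitAct σ a = a) {I : FI M}
    (hI : I * idealAct σ I = toPrincipalIdeal (𝓞 M) M a) : ∃ b : Mˣ, b * unitAct σ b = a :=
  mem_range_normHom (unitAct σ) (idealAct σ) (toPrincipalIdeal (𝓞 M) M) h.unitAct_unitAct
    h.idealAct_idealAct (toPrincipalIdeal_unitAct σ) h.ker_normHom_unitAct_le
    h.ker_normHom_idealAct_le (index_range_toPrincipalIdeal_ne_zero M)
    h.relIndex_map_ker_ne_zero h.herbrand_units (h.index_norm_le hchar) ha ⟨I, hI⟩

end IsUnramifiedQuadratic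

end

section

open Filter Topology IsDedekindDomain

/-- Euler products for completely multiplicative functions on the ideals of a Dedekind domain. -/
theorem hasProd_one_sub_ideal {R : Type*} [CommRing R] [IsDedekindDomain R]
    (f : Ideal R →*₀ ℝ) (hf : Summable f) :
    Tendsto (fun T : Finset (HeightOneSpectrum R) => (∏ p ∈ T, (1 - f p.asIdeal)) * ∑' I, f I)
      atTop (𝓝 1) := by
  classical
  set A : Finset (HeightOneSpectrum R) → Set (Ideal R) := fun T => {I | ∀ p ∈ T, ¬ p.asIdeal ∣ I}
    with hA
  have key : ∀ T : Finset (HeightOneSpectrum R),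
      (∏ p ∈ T, (1 - f p.asIdeal)) * ∑' I, f I = ∑' I, (A T).indicator f I := by
    intro T
    induction T using Finset.induction_on with
    | empty => simp [hA]
    | insert p T hp ih =>
      rw [Finset.prod_insert hp, mul_assoc, ih, sub_mul, one_mul, sub_eq_iff_eq_add]
      have hs : ∀ S : Set (Ideal R), Summable (S.indicator f) := fun S => hf.indicator S
      have hdec : ∀ I, (A T).indicator f I =
          (A (insert p T)).indicator f I + (A T ∩ {I | p.asIdeal ∣ I}).indicator f I := by
        intro I
        by_cases h1 : I ∈ A T <;> by_cases h2 : p.asIdeal ∣ I <;>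
          simp_all [Set.indicator]
      have hsum : ∑' I, (A T).indicator f I = ∑' I, (A (insert p T)).indicator f I +
          ∑' I, (A T ∩ {I | p.asIdeal ∣ I}).indicator f I := by
        rw [tsum_congr hdec, (hs _).tsum_add (hs _)]
      suffices hmul : ∑' I, (A T ∩ {I | p.asIdeal ∣ I}).indicator f I =
          f p.asIdeal * ∑' I, (A T).indicator f I by
        rw [← hmul, hsum]
      have hinj : Function.Injective (fun I : Ideal R => p.asIdeal * I) := fun I J h =>
        mul_left_cancel₀ p.ne_bot h
      rw [← tsum_mul_left]
      rw [← hinj.tsum_eq]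
      · refine tsum_congr fun I => ?_
        have : p.asIdeal * I ∈ A T ∩ {I | p.asIdeal ∣ I} ↔ I ∈ A T := by
          simp only [hA, Set.mem_inter_iff, Set.mem_ofPred_eq, dvd_mul_right, and_true]
          refine forall₂_congr fun q hq => not_congr ⟨fun h => ?_, fun h => h.mul_left _⟩
          rcases q.prime.dvd_or_dvd h with h | h
          · have e : p = q := HeightOneSpectrum.ext
              (p.isMaximal.eq_of_le q.isPrime.ne_top (Ideal.dvd_iff_le.1 h))
            exact absurd (e ▸ hq) hp
          · exact h
        by_cases hI : I ∈ A T
        · rw [Set.indicator_of_mem (this.2 hI), Set.indicator_of_mem hI, map_mul]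
        · rw [Set.indicator_of_notMem (fun h => hI (this.1 h)), Set.indicator_of_notMem hI,
            mul_zero]
      · intro I hI
        obtain ⟨-, J, rfl⟩ := Set.mem_of_indicator_ne_zero hI
        exact ⟨J, rfl⟩
  simp_rw [key]
  have : (1 : ℝ) = ∑' I, ({⊤} : Set (Ideal R)).indicator f I := by
    rw [tsum_eq_single ⊤]
    · rw [Set.indicator_of_mem (Set.mem_singleton _), ← Ideal.one_eq_top, map_one]
    · intro I hI
      exact Set.indicator_of_notMem (by simpa using hI) _
  rw [this]
  refine tendsto_tsum_of_dominated_convergence (bound := fun I => |f I|) hf.abs ?_ ?_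
  · intro I
    by_cases hI : I = ⊤
    · subst hI
      refine tendsto_const_nhds.congr' ?_
      filter_upwards with T
      rw [Set.indicator_of_mem (Set.mem_singleton _), Set.indicator_of_mem]
      intro p _ hp
      exact p.isPrime.ne_top (top_le_iff.1 (Ideal.dvd_iff_le.1 hp))
    · obtain ⟨m, hm, hIm⟩ := Ideal.exists_le_maximal I hI
      rw [Set.indicator_of_notMem (by simpa using hI)]
      by_cases hI0 : I = ⊥
      · have : f I = 0 := by rw [hI0]; exact map_zero f
        refine tendsto_const_nhds.congr fun T => ?_
        by_cases h : I ∈ A T <;> simp [h, this]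
      · have hm0 : m ≠ ⊥ := fun h => hI0 (le_bot_iff.1 (h ▸ hIm))
        refine tendsto_const_nhds.congr' ?_
        filter_upwards [eventually_ge_atTop ({⟨m, hm.isPrime, hm0⟩} : Finset (HeightOneSpectrum R))]
          with T hT
        rw [Set.indicator_of_notMem]
        intro h
        exact h ⟨m, hm.isPrime, hm0⟩ (hT (Finset.mem_singleton_self _)) (Ideal.dvd_iff_le.2 hIm)
  · filter_upwards with T I
    by_cases h : I ∈ A T <;> simp [h]

end

section

open NumberField FractionalIdeal FracAct IsDedekindDomain
open scoped nonZeroDivisors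

namespace IsUnramifiedQuadratic

variable {K M : Type*} [Field K] [NumberField K] [Field M] [NumberField M] [Algebra K M]

local notation "η" => algebraMap (𝓞 K) (𝓞 M)

variable {σ : M ≃ₐ[K] M} (h : IsUnramifiedQuadratic σ)

include h

theorem absNorm_map (I : Ideal (𝓞 K)) :
    Ideal.absNorm (I.map η) = Ideal.absNorm I ^ 2 := by
  rw [Ideal.absNorm_algebraMap]
  congr 1
  rw [← h.finrank_eq]
  exact (IsFractionRing.finrank_eq (𝓞 K) K (𝓞 M) M).symm

omit h in
theorem comap_eq_iff_dvd (p : HeightOneSpectrum (𝓞 K)) (Q : HeightOneSpectrum (𝓞 M)) :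
    Q.asIdeal.comap η = p.asIdeal ↔ Q.asIdeal ∣ p.asIdeal.map η := by
  rw [Ideal.dvd_iff_le, Ideal.map_le_iff_le_comap]
  refine ⟨fun e => e.ge, fun hle => ?_⟩
  exact (p.isMaximal.eq_of_le (Ideal.comap_ne_top _ Q.isPrime.ne_top) hle).symm

omit h in
theorem exists_absNorm_eq_pow {p : HeightOneSpectrum (𝓞 K)} {Q : HeightOneSpectrum (𝓞 M)}
    (hQ : Q.asIdeal ∣ p.asIdeal.map η) :
    ∃ f, Ideal.absNorm Q.asIdeal = Ideal.absNorm p.asIdeal ^ (f + 1) := by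
  have : Q.asIdeal.LiesOver p.asIdeal := ⟨((comap_eq_iff_dvd p Q).2 hQ).symm⟩
  have h1 := Ideal.absNorm_eq_pow_inertiaDeg'_of_liesOver Q.asIdeal p.asIdeal p.isPrime p.ne_bot
  have h0 : Ideal.absNorm Q.asIdeal ≠ 1 := fun e => Q.isPrime.ne_top (Ideal.absNorm_eq_one_iff.1 e)
  obtain ⟨f, hf⟩ := Nat.exists_eq_succ_of_ne_zero (n := p.asIdeal.inertiaDeg' Q.asIdeal)
    (fun e => h0 (by rw [h1, e, pow_zero]))
  exact ⟨f, by rw [h1, hf]⟩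

omit h in
theorem one_lt_absNorm {F : Type*} [Field F] [NumberField F] (p : HeightOneSpectrum (𝓞 F)) :
    1 < Ideal.absNorm p.asIdeal := by
  have h0 : Ideal.absNorm p.asIdeal ≠ 0 := fun e => p.ne_bot (Ideal.absNorm_eq_zero_iff.1 e)
  have h1 : Ideal.absNorm p.asIdeal ≠ 1 := fun e => p.isPrime.ne_top (Ideal.absNorm_eq_one_iff.1 e)
  omega

omit h in
theorem exists_dvd_of_ne_top {F : Type*} [Field F] [NumberField F] {I : Ideal (𝓞 F)} (hI : I ≠ ⊤)
    (h0 : I ≠ ⊥) : ∃ P : HeightOneSpectrum (𝓞 F), P.asIdeal ∣ I := by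
  obtain ⟨m, hm, hle⟩ := Ideal.exists_le_maximal I hI
  exact ⟨⟨m, hm.isPrime, fun e => h0 (le_bot_iff.1 (e ▸ hle))⟩, Ideal.dvd_iff_le.2 hle⟩

omit h in
theorem eq_of_dvd {F : Type*} [Field F] [NumberField F] {P Q : HeightOneSpectrum (𝓞 F)}
    (hd : P.asIdeal ∣ Q.asIdeal) : P = Q :=
  (HeightOneSpectrum.ext (Q.isMaximal.eq_of_le P.isPrime.ne_top (Ideal.dvd_iff_le.1 hd))).symm

theorem inert_or_split (p : HeightOneSpectrum (𝓞 K)) :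
    (∃ P : HeightOneSpectrum (𝓞 M), (∀ Q : HeightOneSpectrum (𝓞 M),
      Q.asIdeal.comap η = p.asIdeal ↔ Q = P) ∧
      Ideal.absNorm P.asIdeal = Ideal.absNorm p.asIdeal ^ 2) ∨
    ∃ P P' : HeightOneSpectrum (𝓞 M), P ≠ P' ∧ (∀ Q : HeightOneSpectrum (𝓞 M),
      Q.asIdeal.comap η = p.asIdeal ↔ Q = P ∨ Q = P') ∧
      Ideal.absNorm P.asIdeal = Ideal.absNorm p.asIdeal ∧
      Ideal.absNorm P'.asIdeal = Ideal.absNorm p.asIdeal ∧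
      p.asIdeal.map η = P.asIdeal * P'.asIdeal ∧
      P'.asIdeal = P.asIdeal.comap (RingOfIntegers.mapRingEquiv σ.toRingEquiv) := by
  have hN := h.absNorm_map p.asIdeal
  have hq := one_lt_absNorm p
  set q := Ideal.absNorm p.asIdeal
  have htop : p.asIdeal.map η ≠ ⊤ := fun e => by
    rw [e, Ideal.absNorm_top] at hN
    nlinarith
  have hbot : p.asIdeal.map η ≠ ⊥ := fun e => by
    rw [e, Ideal.absNorm_bot] at hN
    nlinarith
  simp_rw [comap_eq_iff_dvd]
  obtain ⟨P, Q, hPQ⟩ := exists_dvd_of_ne_top htop hbot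
  have hPd : P.asIdeal ∣ p.asIdeal.map η := ⟨Q, hPQ⟩
  obtain ⟨f, hf⟩ := exists_absNorm_eq_pow hPd
  have hNN : q ^ (f + 1) * Ideal.absNorm Q = q ^ 2 := by
    rw [← hf, ← map_mul, ← hPQ, hN]
  by_cases hQ : Q = ⊤
  · left
    have hQ1 : Q = 1 := by rw [hQ, Ideal.one_eq_top]
    rw [hQ1, mul_one] at hPQ
    refine ⟨P, fun R => ?_, ?_⟩
    · rw [hPQ]
      exact ⟨eq_of_dvd, fun e => e ▸ dvd_rfl⟩
    · rw [← hN, hPQ]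
  right
  have hQ1 : Ideal.absNorm Q ≠ 1 := fun e => hQ (Ideal.absNorm_eq_one_iff.1 e)
  have hQ0 : Ideal.absNorm Q ≠ 0 := fun e => by
    rw [e, mul_zero] at hNN
    exact (pow_pos (by omega : 0 < q) 2).ne hNN
  have hf0 : f = 0 := by
    by_contra hf0
    have : q ^ 2 ≤ q ^ (f + 1) := Nat.pow_le_pow_right (by omega) (by omega)
    have h2 : 2 ≤ Ideal.absNorm Q := by omega
    have := Nat.mul_le_mul this h2
    have := pow_pos (by omega : 0 < q) 2
    omega
  have hQq : Ideal.absNorm Q = q := by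
    rw [hf0, zero_add, pow_one, pow_two] at hNN
    exact Nat.eq_of_mul_eq_mul_left (by omega) hNN
  rw [hf0, zero_add, pow_one] at hf
  obtain ⟨P', R, hP'⟩ := exists_dvd_of_ne_top hQ
    (fun e => hQ0 (by rw [e, Ideal.absNorm_bot]))
  obtain ⟨f', hf'⟩ := exists_absNorm_eq_pow (p := p) (Q := P')
    (hPQ ▸ (Dvd.intro _ hP'.symm).mul_left _)
  have hR : Ideal.absNorm P'.asIdeal * Ideal.absNorm R = q := by rw [← map_mul, ← hP', hQq]
  have hR1 : Ideal.absNorm R = 1 := by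
    have h1 : q ≤ Ideal.absNorm P'.asIdeal := by
      rw [hf']
      exact Nat.le_self_pow (by omega) q
    have h2 : Ideal.absNorm R ≠ 0 := fun e => by rw [e] at hR; omega
    by_contra h3
    have h4 : 2 ≤ Ideal.absNorm R := by omega
    have := Nat.mul_le_mul h1 h4
    omega
  have hRe : R = 1 := by rw [Ideal.one_eq_top]; exact Ideal.absNorm_eq_one_iff.1 hR1
  rw [hRe, mul_one] at hP'
  rw [hR1, mul_one] at hR
  rw [hP'] at hPQ
  have hfac : ∀ S : HeightOneSpectrum (𝓞 M), S.asIdeal ∣ p.asIdeal.map η ↔ S = P ∨ S = P' := by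
    intro S
    rw [hPQ, S.prime.dvd_mul]
    exact or_congr ⟨eq_of_dvd, fun e => e ▸ dvd_rfl⟩ ⟨eq_of_dvd, fun e => e ▸ dvd_rfl⟩
  set τ := RingOfIntegers.mapRingEquiv σ.toRingEquiv with hτ
  have hττ : ∀ z, τ (τ z) = z := fun z => RingOfIntegers.ext (h.invol z)
  have hτη : ∀ z, τ (η z) = η z := fun z => RingOfIntegers.ext (σ.commutes z)
  have hcb : P.asIdeal.comap τ ≠ ⊥ := fun e => P.ne_bot <| by
    rw [eq_bot_iff]
    intro z hz
    have : τ z ∈ P.asIdeal.comap τ := by rw [Ideal.mem_comap, hττ]; exact hz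
    rw [e] at this
    have h0 := Ideal.mem_bot.1 this
    rw [Ideal.mem_bot, ← hττ z, h0, map_zero]
  let P'' : HeightOneSpectrum (𝓞 M) := ⟨P.asIdeal.comap τ, P.isPrime.comap τ, hcb⟩
  have hP''P : P'' ≠ P := by
    intro e
    have e' : P.asIdeal.comap τ = P.asIdeal := congrArg HeightOneSpectrum.asIdeal e
    have := h.map_comap_eq (J := P.asIdeal) (fun z hz w hw => by
      have : w = τ z := RingOfIntegers.ext hw
      rw [this]
      rw [← e'] at hz
      exact hz)
    rw [(comap_eq_iff_dvd p P).2 hPd] at this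
    rw [this, hf] at hN
    nlinarith
  have hPP : P'' = P' := by
    refine ((hfac P'').1 ?_).resolve_left hP''P
    rw [Ideal.dvd_iff_le, Ideal.map_le_iff_le_comap]
    intro z hz
    change τ (η z) ∈ P.asIdeal
    rw [hτη]
    exact Ideal.dvd_iff_le.1 hPd (Ideal.mem_map_of_mem _ hz)
  exact ⟨P, P', fun e => hP''P (hPP.trans e.symm), hfac, hf, hR, hPQ,
    (congrArg HeightOneSpectrum.asIdeal hPP).symm⟩

end IsUnramifiedQuadratic

end

section

open NumberField Filter Topology
open scoped nonZeroDivisors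

namespace IdealZeta

variable (F : Type*) [Field F] [NumberField F]

theorem tendsto_sum_card_div :
    Tendsto (fun n : ℕ ↦ (∑ k ∈ Finset.Icc 1 n,
      (Nat.card {I : Ideal (𝓞 F) // Ideal.absNorm I = k} : ℝ)) / (n : ℝ)) atTop
      (𝓝 (dedekindZeta_residue F)) := by
  refine ((Ideal.tendsto_norm_le_div_atTop₀ F).comp tendsto_natCast_atTop_atTop).congr fun n ↦ ?_
  simp only [Function.comp_apply, Nat.cast_le, ← Nat.cast_sum]
  congr
  rw [← add_left_inj 1, ← Ideal.card_norm_le_eq_card_norm_le_add_one,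
    show Finset.Icc 1 n = Finset.Ioc 0 n from Finset.Icc_succ_left_eq_Ioc _ _,
    show 1 = Nat.card {I : Ideal (𝓞 F) // Ideal.absNorm I = 0} by simp [Ideal.absNorm_eq_zero_iff],
    Finset.sum_Ioc_add_eq_sum_Icc (n.zero_le),
    ← Finset.card_preimage_eq_sum_card_image_eq
      (fun k _ ↦ Ideal.finite_setOfPred_absNorm_eq k)]
  simp [Set.coe_eq_subtype]

theorem lSeriesSummable {s : ℝ} (hs : 1 < s) :
    LSeriesSummable (fun n ↦ (Nat.card {I : Ideal (𝓞 F) // Ideal.absNorm I = n} : ℂ)) s := by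
  have := LSeriesSummable_of_sum_norm_bigO_and_nonneg
    (f := fun n ↦ (Nat.card {I : Ideal (𝓞 F) // Ideal.absNorm I = n} : ℝ)) (r := 1) (s := s)
    (Asymptotics.isBigO_atTop_natCast_rpow_of_tendsto_div_rpow (𝕜 := ℝ) (a := dedekindZeta_residue F)
      (by simpa using tendsto_sum_card_div F)) (fun _ => Nat.cast_nonneg _) zero_le_one
      (by simpa using hs)
  simpa using this

variable {F}

theorem hasSum_fiber {s : ℝ} (hs : 1 < s) (n : ℕ) :
    HasSum (fun I : {I : Ideal (𝓞 F) // Ideal.absNorm I = n} =>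
      (Ideal.absNorm (I : Ideal (𝓞 F)) : ℝ) ^ (-s))
      ((Nat.card {I : Ideal (𝓞 F) // Ideal.absNorm I = n} : ℝ) * (n : ℝ) ^ (-s)) := by
  have : Finite {I : Ideal (𝓞 F) // Ideal.absNorm I = n} :=
    (Ideal.finite_setOfPred_absNorm_eq n).to_subtype
  have := Fintype.ofFinite {I : Ideal (𝓞 F) // Ideal.absNorm I = n}
  convert hasSum_fintype _ using 1
  rw [Finset.sum_congr rfl (fun I _ => by rw [I.2]), Finset.sum_const, nsmul_eq_mul,
    Finset.card_univ, Nat.card_eq_fintype_card]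

theorem term_eq {s : ℝ} (hs : 1 < s) (n : ℕ) :
    LSeries.term (fun n ↦ (Nat.card {I : Ideal (𝓞 F) // Ideal.absNorm I = n} : ℂ)) s n =
      (((Nat.card {I : Ideal (𝓞 F) // Ideal.absNorm I = n} : ℝ) * (n : ℝ) ^ (-s) : ℝ) : ℂ) := by
  rw [LSeries.term_def]
  split_ifs with hn
  · rw [hn, Nat.cast_zero, Real.zero_rpow (by linarith), mul_zero, Complex.ofReal_zero]
  · rw [Real.rpow_neg (Nat.cast_nonneg _), div_eq_mul_inv]
    push_cast [Complex.ofReal_cpow (Nat.cast_nonneg n)]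
    rfl

theorem summable_absNorm_rpow {s : ℝ} (hs : 1 < s) :
    Summable (fun I : Ideal (𝓞 F) => (Ideal.absNorm I : ℝ) ^ (-s)) := by
  rw [← (Equiv.sigmaFiberEquiv (fun I : Ideal (𝓞 F) => Ideal.absNorm I)).summable_iff]
  refine (summable_sigma_of_nonneg (fun _ => Real.rpow_nonneg (Nat.cast_nonneg _) _)).2 ?_
  refine ⟨fun n => (hasSum_fiber hs n).summable, ?_⟩
  have h1 := lSeriesSummable F hs
  have h2 : Summable fun n : ℕ =>
      ((Nat.card {I : Ideal (𝓞 F) // Ideal.absNorm I = n} : ℝ) * (n : ℝ) ^ (-s)) := by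
    rw [← Complex.summable_ofReal]
    exact h1.congr fun n => term_eq hs n
  exact h2.congr fun n => (hasSum_fiber hs n).tsum_eq.symm

theorem tsum_absNorm_rpow {s : ℝ} (hs : 1 < s) :
    ((∑' I : Ideal (𝓞 F), (Ideal.absNorm I : ℝ) ^ (-s) : ℝ) : ℂ) = dedekindZeta F s := by
  have h1 := ((Equiv.sigmaFiberEquiv (fun I : Ideal (𝓞 F) => Ideal.absNorm I)).hasSum_iff.2
    (summable_absNorm_rpow hs).hasSum).sigma (fun n => hasSum_fiber hs n)
  rw [dedekindZeta, LSeries, ← h1.tsum_eq, Complex.ofReal_tsum]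
  exact tsum_congr fun n => (term_eq hs n).symm

variable (F) in
theorem tendsto_sub_one_mul_tsum :
    Tendsto (fun s : ℝ => (s - 1) * ∑' I : Ideal (𝓞 F), (Ideal.absNorm I : ℝ) ^ (-s))
      (𝓝[>] 1) (𝓝 (dedekindZeta_residue F)) := by
  have h1 := (Complex.continuous_re.tendsto _).comp (tendsto_sub_one_mul_dedekindZeta_nhdsGT F)
  rw [Complex.ofReal_re] at h1
  refine h1.congr' ?_
  filter_upwards [self_mem_nhdsWithin] with s hs
  rw [Function.comp_apply, ← tsum_absNorm_rpow hs, ← Complex.ofReal_one, ← Complex.ofReal_sub,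
    ← Complex.ofReal_mul, Complex.ofReal_re]

end IdealZeta

end

section

open NumberField FractionalIdeal FracAct IsDedekindDomain Filter Topology
open scoped nonZeroDivisors

namespace IsUnramifiedQuadratic

section LSeries

variable {F : Type*} [Field F] [NumberField F]

/-- A nonzero ideal as an invertible fractional ideal. -/
noncomputable def idealUnit (I : Ideal (𝓞 F)) (hI : I ≠ 0) : FI F :=
  FractionalIdeal.mk0 F ⟨I, mem_nonZeroDivisors_of_ne_zero hI⟩

@[simp] theorem coe_idealUnit (I : Ideal (𝓞 F)) (hI : I ≠ 0) :
    (idealUnit I hI : FractionalIdeal (𝓞 F)⁰ F) = I := rfl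

theorem idealUnit_mul (I J : Ideal (𝓞 F)) (hI : I ≠ 0) (hJ : J ≠ 0) :
    idealUnit (I * J) (mul_ne_zero hI hJ) = idealUnit I hI * idealUnit J hJ :=
  Units.ext (coeIdeal_mul I J)

open Classical in
/-- The completely multiplicative function `I ↦ χ(I) N(I)⁻ˢ` on ideals. -/
noncomputable def lTerm (χ : FI F →* ℤˣ) (s : ℝ) : Ideal (𝓞 F) →*₀ ℝ where
  toFun I := if hI : I = 0 then 0 else
    ((χ (idealUnit I hI) : ℤ) : ℝ) * (Ideal.absNorm I : ℝ) ^ (-s)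
  map_zero' := dif_pos rfl
  map_one' := by
    rw [dif_neg one_ne_zero]
    have : idealUnit (1 : Ideal (𝓞 F)) one_ne_zero = 1 := Units.ext
      ((congrArg _ Ideal.one_eq_top).trans (coeIdeal_top (𝓞 F)⁰))
    rw [this, map_one, map_one]
    simp
  map_mul' I J := by
    by_cases hI : I = 0
    · subst hI; simp
    by_cases hJ : J = 0
    · subst hJ; simp
    rw [dif_neg hI, dif_neg hJ, dif_neg (mul_ne_zero hI hJ), idealUnit_mul I J hI hJ, map_mul,
      map_mul, Nat.cast_mul, Real.mul_rpow (Nat.cast_nonneg _) (Nat.cast_nonneg _)]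
    push_cast
    ring

theorem lTerm_of_ne_zero (χ : FI F →* ℤˣ) (s : ℝ) {I : Ideal (𝓞 F)} (hI : I ≠ 0) :
    lTerm χ s I = ((χ (idealUnit I hI) : ℤ) : ℝ) * (Ideal.absNorm I : ℝ) ^ (-s) := dif_neg hI

theorem abs_units_cast (u : ℤˣ) : |((u : ℤ) : ℝ)| = 1 := by
  rcases Int.units_eq_one_or u with h | h <;> simp [h]

theorem abs_lTerm (χ : FI F →* ℤˣ) {s : ℝ} (hs : 1 < s) (I : Ideal (𝓞 F)) :
    |lTerm χ s I| = (Ideal.absNorm I : ℝ) ^ (-s) := by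
  by_cases hI : I = 0
  · subst hI
    rw [map_zero, abs_zero, map_zero, Nat.cast_zero, Real.zero_rpow (by linarith)]
  · rw [lTerm_of_ne_zero χ s hI, abs_mul, abs_units_cast, one_mul,
      abs_of_nonneg (Real.rpow_nonneg (Nat.cast_nonneg _) _)]

theorem summable_lTerm (χ : FI F →* ℤˣ) {s : ℝ} (hs : 1 < s) : Summable (lTerm χ s) :=
  Summable.of_abs ((IdealZeta.summable_absNorm_rpow hs).congr fun I => (abs_lTerm χ hs I).symm)

theorem lTerm_one {s : ℝ} (hs : 1 < s) (I : Ideal (𝓞 F)) :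
    lTerm (1 : FI F →* ℤˣ) s I = (Ideal.absNorm I : ℝ) ^ (-s) := by
  by_cases hI : I = 0
  · subst hI
    rw [map_zero, map_zero, Nat.cast_zero, Real.zero_rpow (by linarith)]
  · rw [lTerm_of_ne_zero _ s hI]
    simp

end LSeries

variable {K M : Type*} [Field K] [NumberField K] [Field M] [NumberField M] [Algebra K M]
variable {σ : M ≃ₐ[K] M} (h : IsUnramifiedQuadratic σ)

theorem absNorm_rpow_mem {F : Type*} [Field F] [NumberField F] (p : HeightOneSpectrum (𝓞 F))
    {s : ℝ} (hs : 1 < s) : 0 < (Ideal.absNorm p.asIdeal : ℝ) ^ (-s) ∧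
      (Ideal.absNorm p.asIdeal : ℝ) ^ (-s) < 1 := by
  have h1 : (1 : ℝ) < Ideal.absNorm p.asIdeal := by exact_mod_cast one_lt_absNorm p
  exact ⟨Real.rpow_pos_of_pos (by linarith) _, Real.rpow_lt_one_of_one_lt_of_neg h1 (by linarith)⟩

theorem lTerm_prime_lt_one {F : Type*} [Field F] [NumberField F] (χ : FI F →* ℤˣ)
    (p : HeightOneSpectrum (𝓞 F)) {s : ℝ} (hs : 1 < s) : lTerm χ s p.asIdeal < 1 :=
  (le_abs_self _).trans_lt (abs_lTerm χ hs _ ▸ (absNorm_rpow_mem p hs).2)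

include h

open Classical in
theorem local_factor_le {χ₁ χ₂ : FI K →* ℤˣ} (h₁ : IsNormCharacter σ χ₁)
    (h₂ : IsNormCharacter σ χ₂) {s : ℝ} (hs : 1 < s) (p : HeightOneSpectrum (𝓞 K)) :
    ∃ fib : Finset (HeightOneSpectrum (𝓞 M)),
      (∀ Q, Q ∈ fib ↔ Q.asIdeal.comap (algebraMap (𝓞 K) (𝓞 M)) = p.asIdeal) ∧
      (1 - lTerm 1 s p.asIdeal) * (1 - lTerm χ₁ s p.asIdeal) * (1 - lTerm χ₂ s p.asIdeal) *
        (1 - lTerm (χ₁ * χ₂) s p.asIdeal) ≤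
        (∏ Q ∈ fib, (1 - lTerm 1 s Q.asIdeal)) ^ 2 := by
  obtain ⟨hx0, hx1⟩ := absNorm_rpow_mem p hs
  have e1 := lTerm_one hs p.asIdeal
  have ec : ∀ χ : FI K →* ℤˣ, lTerm χ s p.asIdeal = ((χ (idealUnit p.asIdeal p.ne_bot) : ℤ) : ℝ) *
    (Ideal.absNorm p.asIdeal : ℝ) ^ (-s) := fun χ => lTerm_of_ne_zero χ s p.ne_bot
  rcases h.inert_or_split p with ⟨P, hP, hN⟩ | ⟨P, P', hne, hP, hN, hN', hmul, hP'⟩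
  · refine ⟨{P}, fun Q => by rw [hP Q, Finset.mem_singleton], ?_⟩
    rw [Finset.prod_singleton, lTerm_one hs P.asIdeal, hN, Nat.cast_pow,
      ← Real.rpow_pow_comm (Nat.cast_nonneg _), e1, ec χ₁, ec χ₂, ec (χ₁ * χ₂), MonoidHom.mul_apply]
    set x := (Ideal.absNorm p.asIdeal : ℝ) ^ (-s)
    rcases Int.units_eq_one_or (χ₁ (idealUnit p.asIdeal p.ne_bot)) with e | e <;>
    rcases Int.units_eq_one_or (χ₂ (idealUnit p.asIdeal p.ne_bot)) with e' | e' <;>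
    rw [e, e'] <;> push_cast <;> nlinarith [mul_pos hx0 (pow_pos (sub_pos.2 hx1) 2),
      mul_pos hx0 hx0]
  · refine ⟨{P, P'}, fun Q => by rw [hP Q]; simp, ?_⟩
    rw [Finset.prod_pair hne, lTerm_one hs P.asIdeal, lTerm_one hs P'.asIdeal, hN, hN']
    have hχ : ∀ χ : FI K →* ℤˣ, IsNormCharacter σ χ →
        χ (idealUnit p.asIdeal p.ne_bot) = 1 := by
      intro χ hχ
      refine hχ.norm _ (idealUnit P.asIdeal P.ne_bot) (Units.ext ?_)
      rw [idealExt_apply, coe_idealUnit, Units.val_mul, idealAct_apply, coe_idealUnit]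
      have e : act σ.toRingEquiv (P.asIdeal : FractionalIdeal (𝓞 M)⁰ M) = P'.asIdeal := by
        ext z
        rw [mem_act_iff, hP', mem_coeIdeal, mem_coeIdeal]
        have hs : ∀ z, σ.toRingEquiv.symm z = σ z := fun z => by
          conv_lhs => rw [← h.invol z]
          exact σ.symm_apply_apply _
        constructor
        · rintro ⟨w, hw, hwz⟩
          refine ⟨RingOfIntegers.mapRingEquiv σ.toRingEquiv w, ?_, ?_⟩
          · have : RingOfIntegers.mapRingEquiv σ.toRingEquiv
                (RingOfIntegers.mapRingEquiv σ.toRingEquiv w) = w := RingOfIntegers.ext (h.invol w)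
            rw [Ideal.mem_comap, this]
            exact hw
          · have : σ (algebraMap (𝓞 M) M w) = z := by rw [hwz, hs, h.invol]
            exact this
        · rintro ⟨w, hw, rfl⟩
          exact ⟨RingOfIntegers.mapRingEquiv σ.toRingEquiv w, hw, (hs _).symm⟩
      rw [e, ← coeIdeal_mul, ← hmul]
      exact extendedHom_coeIdeal_eq_map M (𝓞 M) p.asIdeal
    rw [e1, ec χ₁, ec χ₂, ec (χ₁ * χ₂), MonoidHom.mul_apply, hχ _ h₁, hχ _ h₂]
    push_cast
    nlinarith

/-- The product of the four `L`-functions dominates the square of the zeta function upstairs. -/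
theorem zeta_sq_le {χ₁ χ₂ : FI K →* ℤˣ} (h₁ : IsNormCharacter σ χ₁)
    (h₂ : IsNormCharacter σ χ₂) {s : ℝ} (hs : 1 < s) :
    (∑' I : Ideal (𝓞 M), (Ideal.absNorm I : ℝ) ^ (-s)) ^ 2 ≤
      (∑' I : Ideal (𝓞 K), (Ideal.absNorm I : ℝ) ^ (-s)) * (∑' I, lTerm χ₁ s I) *
        (∑' I, lTerm χ₂ s I) * (∑' I, lTerm (χ₁ * χ₂) s I) := by
  classical
  choose fib hfib hle using h.local_factor_le h₁ h₂ hs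
  have hE : ∀ χ : FI K →* ℤˣ, _ := fun χ => hasProd_one_sub_ideal _ (summable_lTerm χ hs)
  have hM := hasProd_one_sub_ideal _ (summable_lTerm (1 : FI M →* ℤˣ) hs)
  have hT : Tendsto (fun T : Finset (HeightOneSpectrum (𝓞 K)) => T.biUnion fib) atTop atTop := by
    refine tendsto_atTop_finset_of_monotone (fun S T hST => Finset.biUnion_subset_biUnion_of_subset_left _ hST)
      fun Q => ?_
    have hne : Q.asIdeal.comap (algebraMap (𝓞 K) (𝓞 M)) ≠ ⊥ := by
      have := Q.isPrime
      have h0 := Q.ne_bot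
      exact fun e => h0 (Ideal.eq_bot_of_comap_eq_bot e)
    refine ⟨{⟨_, Q.isPrime.comap _, hne⟩}, ?_⟩
    rw [Finset.singleton_biUnion, hfib]
  have hM2 := (hM.comp hT).pow 2
  have hX := (((hE 1).mul (hE χ₁)).mul (hE χ₂)).mul (hE (χ₁ * χ₂))
  rw [tsum_congr (fun I => lTerm_one hs I)] at hX hM2
  set X := (∑' I : Ideal (𝓞 K), (Ideal.absNorm I : ℝ) ^ (-s)) * (∑' I, lTerm χ₁ s I) *
        (∑' I, lTerm χ₂ s I) * (∑' I, lTerm (χ₁ * χ₂) s I) with hXdef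
  set Z := ∑' I : Ideal (𝓞 M), (Ideal.absNorm I : ℝ) ^ (-s) with hZdef
  set a : Finset (HeightOneSpectrum (𝓞 K)) → ℝ := fun T =>
    ∏ p ∈ T, ((1 - lTerm 1 s p.asIdeal) * (1 - lTerm χ₁ s p.asIdeal) * (1 - lTerm χ₂ s p.asIdeal) *
        (1 - lTerm (χ₁ * χ₂) s p.asIdeal))
  set b : Finset (HeightOneSpectrum (𝓞 K)) → ℝ := fun T =>
    (∏ Q ∈ T.biUnion fib, (1 - lTerm 1 s Q.asIdeal)) ^ 2
  have hb : Tendsto (fun T => b T * Z ^ 2) atTop (𝓝 1) := by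
    rw [one_pow] at hM2
    refine hM2.congr fun T => ?_
    rw [Function.comp_apply, mul_pow]
  have ha : Tendsto (fun T => a T * X) atTop (𝓝 1) := by
    norm_num at hX
    refine hX.congr fun T => ?_
    simp only [a, Finset.prod_mul_distrib, hXdef]
    ring
  have hapos : ∀ T, 0 < a T := fun T => Finset.prod_pos fun p _ => by
    have := fun χ : FI K →* ℤˣ => sub_pos.2 (lTerm_prime_lt_one χ p hs)
    exact mul_pos (mul_pos (mul_pos (this _) (this _)) (this _)) (this _)
  have hab : ∀ T, a T ≤ b T := by
    intro T
    simp only [a, b]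
    rw [Finset.prod_biUnion, ← Finset.prod_pow]
    · refine Finset.prod_le_prod (fun p _ => ?_) (fun p _ => hle p)
      have := fun χ : FI K →* ℤˣ => (sub_pos.2 (lTerm_prime_lt_one χ p hs)).le
      exact mul_nonneg (mul_nonneg (mul_nonneg (this _) (this _)) (this _)) (this _)
    · intro p _ q _ hpq
      rw [Function.onFun, Finset.disjoint_left]
      intro Q hQ hQ'
      rw [hfib] at hQ hQ'
      exact hpq (HeightOneSpectrum.ext (hQ.symm.trans hQ'))
  have hXpos : 0 < X := by
    obtain ⟨T, hT⟩ := (ha.eventually (lt_mem_nhds (zero_lt_one (α := ℝ)))).exists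
    exact (pos_iff_pos_of_mul_pos hT).1 (hapos T)
  have h3 : Tendsto (fun T => (a T * X) * Z ^ 2) atTop (𝓝 (1 * Z ^ 2)) := ha.mul_const _
  have h4 : Tendsto (fun T => (b T * Z ^ 2) * X) atTop (𝓝 (1 * X)) := hb.mul_const _
  rw [one_mul] at h3 h4
  refine le_of_tendsto_of_tendsto' h3 h4 fun T => ?_
  have := mul_le_mul_of_nonneg_right (hab T) (mul_nonneg hXpos.le (sq_nonneg Z))
  linarith

end IsUnramifiedQuadratic

end

section

open NumberField NumberField.InfinitePlace NumberField.mixedEmbedding NumberField.Units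
open NumberField.mixedEmbedding.fundamentalCone NumberField.Units.dirichletUnitTheorem

namespace ConeWeight

/-- The tent function. -/
noncomputable def tent (t : ℝ) : ℝ := max 0 (1 - |t|)

theorem tent_nonneg (t : ℝ) : 0 ≤ tent t := le_max_left _ _

theorem tent_le_one (t : ℝ) : tent t ≤ 1 := max_le zero_le_one (by linarith [abs_nonneg t])

theorem abs_le_one_of_tent_ne_zero {t : ℝ} (h : tent t ≠ 0) : |t| < 1 := by
  by_contra h1
  exact h (max_eq_left (by linarith))

theorem abs_tent_sub_le (s t : ℝ) : |tent s - tent t| ≤ |s - t| := by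
  have := abs_max_sub_max_le_abs (1 - |s|) (1 - |t|) 0
  rw [tent, tent, max_comm 0, max_comm 0]
  refine this.trans ?_
  rw [show 1 - |s| - (1 - |t|) = |t| - |s| by ring, abs_sub_comm s t]
  exact abs_abs_sub_abs_le t s

theorem hasSum_tent (y : ℝ) : HasSum (fun k : ℤ => tent (k + y)) 1 := by
  have h1 : tent (((⌊-y⌋ : ℤ) : ℝ) + y) + tent (((⌊-y⌋ + 1 : ℤ) : ℝ) + y) = 1 := by
    have h2 := Int.floor_le (-y)
    have h3 := Int.lt_floor_add_one (-y)
    rw [tent, tent, abs_of_nonpos (by linarith), abs_of_nonneg (by push_cast; linarith),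
      max_eq_right (by linarith), max_eq_right (by push_cast; linarith)]
    push_cast
    ring
  rw [← h1, ← Finset.sum_pair (f := fun k : ℤ => tent (k + y)) (by omega : ⌊-y⌋ ≠ ⌊-y⌋ + 1)]
  refine hasSum_sum_of_ne_finset_zero fun k hk => ?_
  by_contra h0
  have h2 := abs_lt.1 (abs_le_one_of_tent_ne_zero h0)
  apply hk
  have h3 : k ≤ ⌊-y⌋ + 1 := by
    have : (k : ℝ) - 1 ≤ -y := by linarith
    have := Int.le_floor.2 (by push_cast; exact this : ((k - 1 : ℤ) : ℝ) ≤ -y)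
    omega
  have h4 : ⌊-y⌋ ≤ k := by
    have : ⌊-y⌋ < k + 1 := Int.floor_lt.2 (by push_cast; linarith)
    omega
  simp only [Finset.mem_insert, Finset.mem_singleton]
  omega

theorem hasSum_prod_tent {ι : Type*} [Fintype ι] (y : ι → ℝ) :
    HasSum (fun k : ι → ℤ => ∏ i, tent (k i + y i)) 1 := by
  classical
  have hfin : ∀ i, ∃ S : Finset ℤ, (∀ k ∉ S, tent (k + y i) = 0) ∧ ∑ k ∈ S, tent (k + y i) = 1 := by
    intro i
    have hf : (Function.support fun k : ℤ => tent (k + y i)).Finite := by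
      refine (Set.finite_Icc (⌊-y i⌋ - 5) (⌊-y i⌋ + 5)).subset fun k hk => ?_
      have h2 := abs_lt.1 (abs_le_one_of_tent_ne_zero hk)
      have h5 := Int.floor_le (-y i)
      have h6 := Int.lt_floor_add_one (-y i)
      constructor
      · have : ((⌊-y i⌋ - 5 : ℤ) : ℝ) ≤ k := by push_cast; linarith
        exact_mod_cast this
      · have : (k : ℝ) ≤ ((⌊-y i⌋ + 5 : ℤ) : ℝ) := by push_cast; linarith
        exact_mod_cast this
    refine ⟨hf.toFinset, fun k hk => by simpa using hk, ?_⟩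
    exact (hasSum_sum_of_ne_finset_zero fun k hk => by simpa using hk).unique (hasSum_tent (y i))
  choose S hS hS1 using hfin
  have h1 : ∑ k ∈ Fintype.piFinset S, ∏ i, tent (k i + y i) = 1 := by
    rw [← Finset.prod_univ_sum S (fun i (k : ℤ) => tent (k + y i)), Finset.prod_congr rfl
      (fun i _ => hS1 i), Finset.prod_const_one]
  rw [← h1]
  refine hasSum_sum_of_ne_finset_zero fun k hk => ?_
  rw [Fintype.mem_piFinset, not_forall] at hk
  obtain ⟨i, hi⟩ := hk
  exact Finset.prod_eq_zero (Finset.mem_univ i) (hS i _ hi)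

theorem abs_prod_sub_prod_le {ι : Type*} (s : Finset ι) (a b : ι → ℝ)
    (ha : ∀ i, 0 ≤ a i ∧ a i ≤ 1) (hb : ∀ i, 0 ≤ b i ∧ b i ≤ 1) :
    |∏ i ∈ s, a i - ∏ i ∈ s, b i| ≤ ∑ i ∈ s, |a i - b i| := by
  classical
  induction s using Finset.induction_on with
  | empty => simp
  | insert i s hi ih =>
    rw [Finset.prod_insert hi, Finset.prod_insert hi, Finset.sum_insert hi]
    have h1 : |∏ i ∈ s, a i| ≤ 1 := by
      rw [abs_of_nonneg (Finset.prod_nonneg fun i _ => (ha i).1)]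
      exact Finset.prod_le_one (fun i _ => (ha i).1) (fun i _ => (ha i).2)
    have h2 : |b i| ≤ 1 := by rw [abs_of_nonneg (hb i).1]; exact (hb i).2
    calc |a i * ∏ i ∈ s, a i - b i * ∏ i ∈ s, b i|
        = |(a i - b i) * ∏ i ∈ s, a i + b i * (∏ i ∈ s, a i - ∏ i ∈ s, b i)| := by ring_nf
      _ ≤ |(a i - b i) * ∏ i ∈ s, a i| + |b i * (∏ i ∈ s, a i - ∏ i ∈ s, b i)| := abs_add_le _ _
      _ ≤ |a i - b i| * 1 + 1 * ∑ i ∈ s, |a i - b i| := by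
        rw [abs_mul, abs_mul]
        gcongr
      _ = _ := by ring

variable (F : Type*) [Field F] [NumberField F]

open scoped Classical in
/-- The basis of the logarithmic space given by the fundamental units. -/
noncomputable def unitBasis : Module.Basis (Fin (rank F)) ℝ (logSpace F) :=
  (basisUnitLattice F).ofZLatticeBasis ℝ (unitLattice F)

variable {F}

open scoped Classical in
/-- A compactly supported partition of unity for the action of the units. -/
noncomputable def weight (x : mixedSpace F) : ℝ := ∏ j, tent ((unitBasis F).repr (logMap x) j)

theorem weight_nonneg (x : mixedSpace F) : 0 ≤ weight x := Finset.prod_nonneg fun _ _ => tent_nonneg _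

theorem weight_le_one (x : mixedSpace F) : weight x ≤ 1 :=
  Finset.prod_le_one (fun _ _ => tent_nonneg _) (fun _ _ => tent_le_one _)

theorem log_norm_eq {x : mixedSpace F} (hx : mixedEmbedding.norm x ≠ 0) :
    Real.log (mixedEmbedding.norm x) =
      ∑ v : InfinitePlace F, (mult v : ℝ) * Real.log (normAtPlace v x) := by
  rw [mixedEmbedding.norm_apply, Real.log_prod]
  · exact Finset.sum_congr rfl fun v _ => Real.log_pow _ _
  · exact fun v _ => pow_ne_zero _ (mixedEmbedding.norm_ne_zero_iff.1 hx v)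

variable (F) in
theorem exists_log_le_of_weight_ne_zero : ∃ B : ℝ, 0 ≤ B ∧ ∀ x : mixedSpace F,
    mixedEmbedding.norm x ≠ 0 → weight x ≠ 0 → ∀ v w,
      Real.log (normAtPlace v x) ≤ Real.log (normAtPlace w x) + B := by
  classical
  set B₀ := ∑ j, ‖unitBasis F j‖ with hB₀
  have hB₀0 : 0 ≤ B₀ := Finset.sum_nonneg fun _ _ => norm_nonneg _
  refine ⟨2 * (Fintype.card (InfinitePlace F) * B₀), by positivity, fun x hx hw => ?_⟩
  have h1 : ‖logMap x‖ ≤ B₀ := by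
    rw [← (unitBasis F).sum_repr (logMap x)]
    refine (norm_sum_le _ _).trans (Finset.sum_le_sum fun j _ => ?_)
    rw [_root_.norm_smul]
    have := abs_le_one_of_tent_ne_zero (fun h => hw (Finset.prod_eq_zero (Finset.mem_univ j) h))
    exact mul_le_of_le_one_left (norm_nonneg _) this.le
  set d : InfinitePlace F → ℝ := fun v => Real.log (normAtPlace v x) -
    Real.log (mixedEmbedding.norm x) * (Module.finrank ℚ F : ℝ)⁻¹ with hd
  have h2 : ∀ v, v ≠ w₀ → |(mult v : ℝ) * d v| ≤ B₀ := fun v hv =>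
    (norm_le_pi_norm (logMap x) ⟨v, hv⟩).trans h1
  have h3 : ∑ v, (mult v : ℝ) * d v = 0 := by
    simp only [hd, mul_sub, Finset.sum_sub_distrib]
    rw [← log_norm_eq hx, ← Finset.sum_mul, ← Nat.cast_sum, sum_mult_eq]
    have : (Module.finrank ℚ F : ℝ) ≠ 0 := Nat.cast_ne_zero.2 Module.finrank_pos.ne'
    field_simp
    ring
  have hcard : (1 : ℝ) ≤ Fintype.card (InfinitePlace F) := by
    exact_mod_cast Fintype.card_pos
  have h4 : ∀ v, |(mult v : ℝ) * d v| ≤ Fintype.card (InfinitePlace F) * B₀ := by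
    intro v
    by_cases hv : v = w₀
    · rw [← Finset.add_sum_erase _ _ (Finset.mem_univ v), add_eq_zero_iff_eq_neg] at h3
      rw [h3, abs_neg]
      refine (Finset.abs_sum_le_sum_abs _ _).trans ?_
      refine (Finset.sum_le_card_nsmul _ _ B₀ fun w hw => h2 w ?_).trans ?_
      · rw [← hv]; exact Finset.ne_of_mem_erase hw
      · rw [nsmul_eq_mul]
        gcongr
        exact Finset.card_le_univ _
    · refine (h2 v hv).trans (le_mul_of_one_le_left hB₀0 hcard)
  have h5 : ∀ v, |d v| ≤ Fintype.card (InfinitePlace F) * B₀ := by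
    intro v
    refine le_trans ?_ (h4 v)
    rw [abs_mul]
    refine le_mul_of_one_le_left (abs_nonneg _) ?_
    rw [Nat.abs_cast]
    exact_mod_cast mult_pos
  intro v w
  have hv := abs_le.1 (h5 v)
  have hw := abs_le.1 (h5 w)
  simp only [hd] at hv hw
  linarith

variable (F) in
theorem exists_abs_weight_sub_le : ∃ C : ℝ, 0 ≤ C ∧ ∀ (x y : mixedSpace F) (δ : ℝ),
    mixedEmbedding.norm x ≠ 0 → mixedEmbedding.norm y ≠ 0 →
    (∀ v, |Real.log (normAtPlace v x) - Real.log (normAtPlace v y)| ≤ δ) →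
    |weight x - weight y| ≤ C * δ ∧
      |Real.log (mixedEmbedding.norm x) - Real.log (mixedEmbedding.norm y)| ≤ C * δ := by
  classical
  set n : ℝ := ((Module.finrank ℚ F : ℕ) : ℝ) with hn
  have hn0 : 0 < n := by rw [hn]; exact_mod_cast Module.finrank_pos
  set A : Fin (rank F) → ℝ := fun j => ‖LinearMap.toContinuousLinearMap ((unitBasis F).coord j)‖
    with hA
  have hlog : ∀ (x y : mixedSpace F) (δ : ℝ), mixedEmbedding.norm x ≠ 0 →
      mixedEmbedding.norm y ≠ 0 →
      (∀ v, |Real.log (normAtPlace v x) - Real.log (normAtPlace v y)| ≤ δ) →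
      |Real.log (mixedEmbedding.norm x) - Real.log (mixedEmbedding.norm y)| ≤ n * δ := by
    intro x y δ hx hy h
    rw [log_norm_eq hx, log_norm_eq hy, ← Finset.sum_sub_distrib]
    refine (Finset.abs_sum_le_sum_abs _ _).trans ?_
    rw [hn, ← sum_mult_eq, Nat.cast_sum, Finset.sum_mul]
    refine Finset.sum_le_sum fun v _ => ?_
    rw [← mul_sub, abs_mul, Nat.abs_cast]
    exact mul_le_mul_of_nonneg_left (h v) (Nat.cast_nonneg _)
  have hA0 : 0 ≤ ∑ j, A j := Finset.sum_nonneg fun _ _ => norm_nonneg _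
  refine ⟨(∑ j, A j) * 4 + n, by positivity, fun x y δ hx hy h => ?_⟩
  have hδ : 0 ≤ δ := (abs_nonneg _).trans (h w₀)
  have h1 := hlog x y δ hx hy h
  have h2 : ‖logMap x - logMap y‖ ≤ 4 * δ := by
    rw [pi_norm_le_iff_of_nonneg (by positivity)]
    intro v
    rw [Pi.sub_apply, logMap_apply, logMap_apply, ← mul_sub, norm_mul, Real.norm_eq_abs,
      Real.norm_eq_abs, Nat.abs_cast]
    have hm : (mult v.1 : ℝ) ≤ 2 := by
      have : mult v.1 ≤ 2 := by rw [mult]; split_ifs <;> norm_num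
      exact_mod_cast this
    have h3 : |Real.log (normAtPlace v.1 x) - Real.log (mixedEmbedding.norm x) * n⁻¹ -
        (Real.log (normAtPlace v.1 y) - Real.log (mixedEmbedding.norm y) * n⁻¹)| ≤ 2 * δ := by
      have e : Real.log (normAtPlace v.1 x) - Real.log (mixedEmbedding.norm x) * n⁻¹ -
        (Real.log (normAtPlace v.1 y) - Real.log (mixedEmbedding.norm y) * n⁻¹) =
        (Real.log (normAtPlace v.1 x) - Real.log (normAtPlace v.1 y)) -
          (Real.log (mixedEmbedding.norm x) - Real.log (mixedEmbedding.norm y)) * n⁻¹ := by ring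
      rw [e]
      refine (abs_sub _ _).trans ?_
      rw [abs_mul, abs_of_pos (inv_pos.2 hn0)]
      have : |Real.log (mixedEmbedding.norm x) - Real.log (mixedEmbedding.norm y)| * n⁻¹ ≤ δ := by
        rw [← div_eq_mul_inv, div_le_iff₀ hn0]
        linarith
      linarith [h v.1]
    calc (mult v.1 : ℝ) * _ ≤ 2 * (2 * δ) := mul_le_mul hm h3 (abs_nonneg _) (by norm_num)
      _ = 4 * δ := by ring
  constructor
  · refine (abs_prod_sub_prod_le _ _ _ (fun j => ⟨tent_nonneg _, tent_le_one _⟩)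
      (fun j => ⟨tent_nonneg _, tent_le_one _⟩)).trans ?_
    calc _ ≤ ∑ j, A j * (4 * δ) := Finset.sum_le_sum fun j _ => by
          refine (abs_tent_sub_le _ _).trans ?_
          rw [← Finsupp.sub_apply, ← map_sub]
          refine ((LinearMap.toContinuousLinearMap ((unitBasis F).coord j)).le_opNorm
            (logMap x - logMap y)).trans ?_
          exact mul_le_mul_of_nonneg_left h2 (norm_nonneg _)
      _ ≤ _ := by
        rw [← Finset.sum_mul]
        nlinarith
  · nlinarith

end ConeWeight

end

section

open NumberField NumberField.InfinitePlace NumberField.mixedEmbedding NumberField.Units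
open NumberField.mixedEmbedding.fundamentalCone NumberField.Units.dirichletUnitTheorem

namespace ConeWeight

variable {F : Type*} [Field F] [NumberField F]

/-- The unit with given torsion part and exponents. -/
noncomputable def unitOf (p : torsion F × (Fin (rank F) → ℤ)) : (𝓞 F)ˣ :=
  p.1 * ∏ i, (fundSystem F i) ^ (p.2 i)

theorem unitOf_bijective : Function.Bijective (unitOf (F := F)) := by
  rw [Function.bijective_iff_existsUnique]
  intro u
  obtain ⟨p, hp, hp'⟩ := exist_unique_eq_mul_prod F u
  exact ⟨p, hp.symm, fun q hq => hp' q hq.symm⟩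

theorem logEmbedding_unitOf (p : torsion F × (Fin (rank F) → ℤ)) :
    logEmbedding F (Additive.ofMul (unitOf p)) = ∑ i, (p.2 i : ℝ) • unitBasis F i := by
  rw [unitOf, ofMul_mul, map_add, logEmbedding_eq_zero_iff.2 p.1.2, zero_add, ofMul_prod, map_sum]
  refine Finset.sum_congr rfl fun i _ => ?_
  rw [ofMul_zpow, map_zsmul, logEmbedding_fundSystem, unitBasis,
    Module.Basis.ofZLatticeBasis_apply, Int.cast_smul_eq_zsmul]

theorem weight_unitOf_smul {x : mixedSpace F} (hx : mixedEmbedding.norm x ≠ 0)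
    (p : torsion F × (Fin (rank F) → ℤ)) :
    weight (unitOf p • x) = ∏ j, tent (p.2 j + (unitBasis F).repr (logMap x) j) := by
  rw [weight]
  refine Finset.prod_congr rfl fun j _ => ?_
  congr 1
  rw [logMap_unit_smul _ hx, map_add, Finsupp.add_apply, logEmbedding_unitOf,
    Module.Basis.repr_sum_self]

variable (F) in
theorem hasSum_one_torsion : HasSum (fun _ : torsion F => (1 : ℝ)) (torsionOrder F) := by
  have : Fintype (torsion F) := Fintype.ofFinite _
  have h2 := hasSum_fintype (fun _ : torsion F => (1 : ℝ))
  rwa [Finset.sum_const, Finset.card_univ, ← Nat.card_eq_fintype_card, nsmul_eq_mul,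
    mul_one] at h2

theorem hasSum_prod_snd {α β : Type*} {g : β → ℝ} {t : ℝ} (hα : HasSum (fun _ : α => (1 : ℝ)) t)
    (hg : HasSum g 1) (hg0 : ∀ b, 0 ≤ g b) : HasSum (fun p : α × β => g p.2) t := by
  have := hα.mul hg (hα.summable.mul_of_nonneg hg.summable (fun _ => zero_le_one) hg0)
  rw [mul_one] at this
  exact this.congr_fun fun p => (one_mul _).symm

theorem hasSum_weight_unitOf_smul {x : mixedSpace F} (hx : mixedEmbedding.norm x ≠ 0) :
    HasSum (fun p : torsion F × (Fin (rank F) → ℤ) => weight (unitOf p • x)) (torsionOrder F) := by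
  simp only [weight_unitOf_smul hx]
  exact hasSum_prod_snd
    (g := fun k : Fin (rank F) → ℤ => ∏ j, tent (k j + (unitBasis F).repr (logMap x) j))
    (hasSum_one_torsion F) (hasSum_prod_tent fun j => (unitBasis F).repr (logMap x) j)
    (fun _ => Finset.prod_nonneg fun _ _ => tent_nonneg _)

theorem hasSum_weight_unit_smul {x : mixedSpace F} (hx : mixedEmbedding.norm x ≠ 0) :
    HasSum (fun u : (𝓞 F)ˣ => weight (u • x)) (torsionOrder F) :=
  (Equiv.ofBijective unitOf unitOf_bijective).hasSum_iff.1 (hasSum_weight_unitOf_smul hx)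

/-- The weighted power of the norm on the ring of integers. -/
noncomputable def wPow (s : ℝ) (x : mixedSpace F) : ℝ := weight x * (mixedEmbedding.norm x) ^ (-s)

theorem wPow_nonneg (s : ℝ) (x : mixedSpace F) : 0 ≤ wPow s x :=
  mul_nonneg (weight_nonneg x) (Real.rpow_nonneg (mixedEmbedding.norm_nonneg x) _)

theorem wPow_of_norm_eq_zero {s : ℝ} (hs : s ≠ 0) {x : mixedSpace F}
    (hx : mixedEmbedding.norm x = 0) : wPow s x = 0 := by
  rw [wPow, hx, Real.zero_rpow (neg_ne_zero.2 hs), mul_zero]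

theorem hasSum_wPow_unit_smul (s : ℝ) {x : mixedSpace F} (hx : mixedEmbedding.norm x ≠ 0) :
    HasSum (fun u : (𝓞 F)ˣ => wPow s (u • x))
      (torsionOrder F * (mixedEmbedding.norm x) ^ (-s)) := by
  simp only [wPow, norm_unit_smul]
  exact (hasSum_weight_unit_smul hx).mul_right _

variable (F) in
open scoped Classical in
/-- On the support of the weight all absolute values are comparable to the norm. -/
theorem exists_le_normAtPlace : ∃ c : ℝ, 0 < c ∧ c ≤ 1 ∧ ∀ x : mixedSpace F,
    mixedEmbedding.norm x ≠ 0 → weight x ≠ 0 → ∀ v, c * ‖x‖ ≤ normAtPlace v x := by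
  obtain ⟨B, hB0, hB⟩ := exists_log_le_of_weight_ne_zero F
  refine ⟨Real.exp (-B), Real.exp_pos _, Real.exp_le_one_iff.2 (by linarith),
    fun x hx hw v => ?_⟩
  have hpos : ∀ w, 0 < normAtPlace w x := fun w =>
    lt_of_le_of_ne (normAtPlace_nonneg w x) (mixedEmbedding.norm_ne_zero_iff.1 hx w).symm
  rw [norm_eq_sup'_normAtPlace]
  obtain ⟨w, -, hw'⟩ := Finset.exists_mem_eq_sup' Finset.univ_nonempty (fun w => normAtPlace w x)
  rw [hw', ← Real.exp_log (hpos v), ← Real.exp_log (hpos w), ← Real.exp_add]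
  exact Real.exp_le_exp.2 (by linarith [hB x hx hw w v])

end ConeWeight

end

section

open NumberField NumberField.InfinitePlace NumberField.mixedEmbedding NumberField.Units
open NumberField.mixedEmbedding.fundamentalCone NumberField.Units.dirichletUnitTheorem

namespace ConeWeight

theorem abs_exp_neg_sub_le {a b M : ℝ} (ha : Real.exp (-a) ≤ M) (hb : Real.exp (-b) ≤ M) :
    |Real.exp (-a) - Real.exp (-b)| ≤ |a - b| * M := by
  wlog h : a ≤ b generalizing a b
  · rw [abs_sub_comm, abs_sub_comm a]
    exact this hb ha (le_of_not_ge h)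
  have h1 : Real.exp (-b) = Real.exp (-a) * Real.exp (a - b) := by rw [← Real.exp_add]; ring_nf
  have h2 := Real.add_one_le_exp (a - b)
  rw [abs_of_nonneg (sub_nonneg.2 (Real.exp_le_exp.2 (by linarith))), abs_of_nonpos (by linarith),
    h1]
  nlinarith [Real.exp_pos (-a)]

theorem abs_log_sub_log_le {a b m : ℝ} (hm : 0 < m) (ha : m ≤ a) (hb : m ≤ b) :
    |Real.log a - Real.log b| ≤ |a - b| / m := by
  wlog h : b ≤ a generalizing a b
  · rw [abs_sub_comm, abs_sub_comm a]
    exact this hb ha (le_of_not_ge h)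
  have hb0 : 0 < b := hm.trans_le hb
  have ha0 : 0 < a := hm.trans_le ha
  rw [abs_of_nonneg (sub_nonneg.2 (Real.log_le_log hb0 h)), abs_of_nonneg (by linarith),
    ← Real.log_div ha0.ne' hb0.ne']
  refine (Real.log_le_sub_one_of_pos (by positivity)).trans ?_
  rw [div_sub_one hb0.ne']
  exact div_le_div_of_nonneg_left (by linarith) hm hb

variable {F : Type*} [Field F] [NumberField F]

open scoped Classical in
theorem normAtPlace_le_norm (x : mixedSpace F) (v : InfinitePlace F) : normAtPlace v x ≤ ‖x‖ := by
  rw [norm_eq_sup'_normAtPlace]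
  exact Finset.le_sup' (fun w => normAtPlace w x) (Finset.mem_univ v)

open scoped Classical in
theorem abs_normAtPlace_add_sub_le (x r : mixedSpace F) (v : InfinitePlace F) :
    |normAtPlace v (x + r) - normAtPlace v x| ≤ ‖r‖ := by
  have h1 := normAtPlace_add_le v x r
  have h2 := normAtPlace_add_le v (x + r) (-r)
  rw [add_neg_cancel_right, normAtPlace_neg] at h2
  have h3 := normAtPlace_le_norm r v
  exact abs_le.2 ⟨by linarith, by linarith⟩

theorem pow_le_norm {x : mixedSpace F} {m : ℝ} (hm : 0 ≤ m) (h : ∀ v, m ≤ normAtPlace v x) :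
    m ^ Module.finrank ℚ F ≤ mixedEmbedding.norm x := by
  rw [mixedEmbedding.norm_apply, ← sum_mult_eq, ← Finset.prod_pow_eq_pow_sum]
  exact Finset.prod_le_prod (fun _ _ => pow_nonneg hm _) fun v _ => pow_le_pow_left₀ hm (h v) _

theorem rpow_neg_le {N m s : ℝ} {n : ℕ} (hm : 1 ≤ m) (hN : m ^ n ≤ N) (hs : 1 ≤ s) :
    N ^ (-s) ≤ m⁻¹ ^ n := by
  have h1 : 1 ≤ m ^ n := one_le_pow₀ hm
  calc N ^ (-s) ≤ N ^ (-1 : ℝ) := Real.rpow_le_rpow_of_exponent_le (h1.trans hN) (by linarith)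
    _ = N⁻¹ := Real.rpow_neg_one N
    _ ≤ (m ^ n)⁻¹ := inv_anti₀ (by positivity) hN
    _ = _ := (inv_pow m n).symm

open scoped Classical in
theorem exists_abs_wPow_sub_le_of_norm_le (r : mixedSpace F) : ∃ R C : ℝ, 0 ≤ R ∧ 0 ≤ C ∧
    ∀ (x : mixedSpace F) (s : ℝ), 1 ≤ s → s ≤ 2 → R ≤ ‖x‖ →
      |wPow s (x + r) - wPow s x| ≤ C * ‖x‖⁻¹ ^ (Module.finrank ℚ F + 1) := by
  obtain ⟨c, hc, hc1, hcx⟩ := exists_le_normAtPlace F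
  obtain ⟨C, hC, hCx⟩ := exists_abs_weight_sub_le F
  refine ⟨max (2 / c) (4 / c * ‖r‖), 3 * C * ‖r‖ * (c / 2)⁻¹ ^ (Module.finrank ℚ F + 1), by positivity,
    by positivity, fun x s hs hs2 hx => ?_⟩
  have hx1 : 1 ≤ c / 2 * ‖x‖ := by
    have := (le_max_left _ _).trans hx
    rw [div_le_iff₀ hc] at this
    linarith
  have hx2 : ‖r‖ ≤ c / 4 * ‖x‖ := by
    have := (le_max_right _ _).trans hx
    rw [div_mul_eq_mul_div, div_le_iff₀ hc] at this
    linarith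
  have hx0 : 0 < ‖x‖ := by nlinarith [norm_nonneg x]
  have hs0 : s ≠ 0 := by linarith
  by_cases h0 : wPow s x = 0 ∧ wPow s (x + r) = 0
  · rw [h0.1, h0.2, sub_zero, abs_zero]
    positivity
  have key : ∀ y : mixedSpace F, wPow s y ≠ 0 → mixedEmbedding.norm y ≠ 0 ∧ weight y ≠ 0 := fun y hy =>
    ⟨fun h => hy (wPow_of_norm_eq_zero hs0 h), fun h => hy (by rw [wPow, h, zero_mul])⟩
  have hm : (∀ v, c / 2 * ‖x‖ ≤ normAtPlace v x) ∧ ∀ v, c / 2 * ‖x‖ ≤ normAtPlace v (x + r) := by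
    rw [not_and_or] at h0
    rcases h0 with h0 | h0
    · have h1 := hcx x (key _ h0).1 (key _ h0).2
      refine ⟨fun v => by nlinarith [h1 v], fun v => ?_⟩
      have := (abs_le.1 (abs_normAtPlace_add_sub_le x r v)).1
      nlinarith [h1 v]
    · have h1 := hcx (x + r) (key _ h0).1 (key _ h0).2
      have h2 : ‖x‖ - ‖r‖ ≤ ‖x + r‖ := by
        have := norm_sub_norm_le x (-r)
        rwa [norm_neg, sub_neg_eq_add] at this
      have h3 : c * (3 / 4 * ‖x‖) ≤ c * ‖x + r‖ :=
        mul_le_mul_of_nonneg_left (by nlinarith) hc.le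
      refine ⟨fun v => ?_, fun v => ?_⟩
      · have := (abs_le.1 (abs_normAtPlace_add_sub_le x r v)).2
        linarith [h1 v]
      · nlinarith [h1 v]
  have hm0 : 0 < c / 2 * ‖x‖ := by linarith
  have hN := pow_le_norm hm0.le hm.1
  have hN' := pow_le_norm hm0.le hm.2
  have hp : 0 < (c / 2 * ‖x‖) ^ Module.finrank ℚ F := by positivity
  have hNp : 0 < mixedEmbedding.norm x := hp.trans_le hN
  have hNp' : 0 < mixedEmbedding.norm (x + r) := hp.trans_le hN'
  obtain ⟨hw, hl⟩ := hCx (x + r) x (‖r‖ / (c / 2 * ‖x‖)) hNp'.ne' hNp.ne' fun v =>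
    (abs_log_sub_log_le hm0 (hm.2 v) (hm.1 v)).trans
      (div_le_div_of_nonneg_right (abs_normAtPlace_add_sub_le x r v) hm0.le)
  have hP := rpow_neg_le hx1 hN hs
  have hP' := rpow_neg_le hx1 hN' hs
  set P := (c / 2 * ‖x‖)⁻¹ ^ Module.finrank ℚ F with hPdef
  have hP0 : 0 ≤ P := by positivity
  have hd : |(mixedEmbedding.norm (x + r)) ^ (-s) - (mixedEmbedding.norm x) ^ (-s)| ≤
      2 * (C * (‖r‖ / (c / 2 * ‖x‖))) * P := by
    have e : ∀ N : ℝ, 0 < N → N ^ (-s) = Real.exp (-(s * Real.log N)) := fun N hN => by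
      rw [Real.rpow_def_of_pos hN]; ring_nf
    rw [e _ hNp] at hP ⊢
    rw [e _ hNp'] at hP' ⊢
    refine (abs_exp_neg_sub_le hP' hP).trans (mul_le_mul_of_nonneg_right ?_ hP0)
    rw [← mul_sub, abs_mul, abs_of_nonneg (by linarith)]
    exact mul_le_mul hs2 hl (abs_nonneg _) (by norm_num)
  have hfin : |wPow s (x + r) - wPow s x| ≤ 3 * (C * (‖r‖ / (c / 2 * ‖x‖))) * P := by
    have e : wPow s (x + r) - wPow s x =
        (weight (x + r) - weight x) * (mixedEmbedding.norm (x + r)) ^ (-s) + weight x *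
        ((mixedEmbedding.norm (x + r)) ^ (-s) - (mixedEmbedding.norm x) ^ (-s)) := by
      simp only [wPow]; ring
    rw [e]
    refine (abs_add_le _ _).trans ?_
    rw [abs_mul, abs_mul, abs_of_nonneg (weight_nonneg x),
      abs_of_nonneg (Real.rpow_nonneg hNp'.le _)]
    have h1 := mul_le_mul hw hP' (Real.rpow_nonneg hNp'.le _) ((abs_nonneg _).trans hw)
    have h2 := mul_le_mul (weight_le_one x) hd (abs_nonneg _) zero_le_one
    linarith
  refine hfin.trans (le_of_eq ?_)
  rw [hPdef, pow_succ, pow_succ, mul_inv, mul_pow]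
  field_simp

end ConeWeight

end

section

open NumberField NumberField.InfinitePlace NumberField.mixedEmbedding NumberField.Units
open NumberField.mixedEmbedding.fundamentalCone NumberField.Units.dirichletUnitTheorem

namespace ConeWeight

variable {F : Type*} [Field F] [NumberField F]

theorem norm_mixedEmbedding (x : 𝓞 F) :
    mixedEmbedding.norm (mixedEmbedding F x) = Ideal.absNorm (Ideal.span {x}) := by
  rw [norm_eq_norm, Ideal.absNorm_span_singleton, ← Algebra.coe_norm_int,
    Nat.cast_natAbs]
  simp

theorem norm_mixedEmbedding_ne_zero {x : 𝓞 F} (hx : x ≠ 0) :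
    mixedEmbedding.norm (mixedEmbedding F x) ≠ 0 := by
  rw [norm_mixedEmbedding, Nat.cast_ne_zero]
  exact Ideal.absNorm_ne_zero_iff_mem_nonZeroDivisors.2 (mem_nonZeroDivisors_of_ne_zero (by simpa))

/-- The weighted power of the norm as a function on the ring of integers. -/
noncomputable def intPow (s : ℝ) (x : 𝓞 F) : ℝ := wPow s (mixedEmbedding F (x : F))

theorem intPow_nonneg (s : ℝ) (x : 𝓞 F) : 0 ≤ intPow s x := wPow_nonneg _ _

theorem intPow_zero {s : ℝ} (hs : s ≠ 0) : intPow s (0 : 𝓞 F) = 0 :=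
  wPow_of_norm_eq_zero hs (by simp)

theorem intPow_le_one {s : ℝ} (hs : 1 ≤ s) (x : 𝓞 F) : intPow s x ≤ 1 := by
  by_cases hx : x = 0
  · rw [hx, intPow_zero (by linarith)]; exact zero_le_one
  · have h0 := norm_mixedEmbedding_ne_zero hx
    rw [intPow, wPow]
    refine mul_le_one₀ (weight_le_one _) (Real.rpow_nonneg (mixedEmbedding.norm_nonneg _) _) ?_
    refine Real.rpow_le_one_of_one_le_of_nonpos ?_ (by linarith)
    rw [norm_mixedEmbedding] at h0 ⊢
    exact_mod_cast Nat.one_le_iff_ne_zero.2 (by exact_mod_cast h0)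

open scoped Classical in
variable (F) in
theorem summable_inv_norm_pow : Summable fun x : 𝓞 F =>
    ‖mixedEmbedding F (x : F)‖⁻¹ ^ (Module.finrank ℚ F + 1) := by
  have h := ZLattice.summable_norm_pow_inv (mixedEmbedding.integerLattice F)
    (Module.finrank ℚ F + 1) (by
      rw [ZLattice.rank ℝ, mixedEmbedding.finrank]; exact Nat.lt_succ_self _)
  let e : 𝓞 F → mixedEmbedding.integerLattice F := fun x => ⟨mixedEmbedding F (x : F), x, rfl⟩
  have he : Function.Injective e := fun x y hxy => by
    have := congrArg Subtype.val hxy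
    exact RingOfIntegers.ext (mixedEmbedding_injective F this)
  refine (h.comp_injective he).congr fun x => ?_
  rw [Function.comp_apply, ← Submodule.norm_coe]

open scoped Classical in
theorem exists_abs_intPow_sub_le (r : 𝓞 F) : ∃ g : 𝓞 F → ℝ, Summable g ∧
    ∀ s : ℝ, 1 ≤ s → s ≤ 2 → ∀ x, |intPow s (x + r) - intPow s x| ≤ g x := by
  obtain ⟨R, C, hR, hC, h⟩ := exists_abs_wPow_sub_le_of_norm_le (mixedEmbedding F (r : F))
  refine ⟨fun x => (C + R ^ (Module.finrank ℚ F + 1)) *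
    ‖mixedEmbedding F (x : F)‖⁻¹ ^ (Module.finrank ℚ F + 1) + if x = 0 then 1 else 0, ?_, ?_⟩
  · refine ((summable_inv_norm_pow F).mul_left _).add ?_
    exact summable_of_ne_finset_zero (s := {0}) fun x hx => if_neg (by simpa using hx)
  · intro s hs hs2 x
    beta_reduce
    have h1 : |intPow s (x + r) - intPow s x| ≤ 1 := by
      have := intPow_nonneg s x
      have := intPow_nonneg s (x + r)
      have := intPow_le_one hs x
      have := intPow_le_one hs (x + r)
      exact abs_le.2 ⟨by linarith, by linarith⟩
    have h0 : (0 : ℝ) ≤ ‖mixedEmbedding F (x : F)‖⁻¹ ^ (Module.finrank ℚ F + 1) := by positivity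
    by_cases hx : x = 0
    · rw [if_pos hx]
      have : 0 ≤ (C + R ^ (Module.finrank ℚ F + 1)) *
        ‖mixedEmbedding F (x : F)‖⁻¹ ^ (Module.finrank ℚ F + 1) := by positivity
      linarith
    · rw [if_neg hx, add_zero, add_mul]
      by_cases hxR : R ≤ ‖mixedEmbedding F (x : F)‖
      · have h2 := h _ s hs hs2 hxR
        rw [← map_add] at h2
        have h3 : 0 ≤ R ^ (Module.finrank ℚ F + 1) *
          ‖mixedEmbedding F (x : F)‖⁻¹ ^ (Module.finrank ℚ F + 1) := by positivity
        refine le_trans ?_ (le_add_of_nonneg_right h3)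
        exact h2
      · have hn : 0 < ‖mixedEmbedding F (x : F)‖ := by
          rw [norm_pos_iff]
          intro hx0
          refine norm_mixedEmbedding_ne_zero hx ?_
          rw [hx0, map_zero]
        have h2 : 1 ≤ R ^ (Module.finrank ℚ F + 1) *
            ‖mixedEmbedding F (x : F)‖⁻¹ ^ (Module.finrank ℚ F + 1) := by
          rw [← mul_pow]
          refine one_le_pow₀ ?_
          rw [← div_eq_mul_inv, one_le_div hn]
          linarith
        have := mul_nonneg hC h0
        linarith

/-- Sums over cosets of an ideal. -/
theorem bijective_section_add (J : Ideal (𝓞 F)) : Function.Bijective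
    fun p : (𝓞 F ⧸ J) × J =>
      (p.2 : 𝓞 F) + Function.surjInv (Ideal.Quotient.mk_surjective (I := J)) p.1 := by
  have hs := Function.surjInv_eq (Ideal.Quotient.mk_surjective (I := J))
  have hmk : ∀ p : (𝓞 F ⧸ J) × J, Ideal.Quotient.mk J ((p.2 : 𝓞 F) +
      Function.surjInv (Ideal.Quotient.mk_surjective (I := J)) p.1) = p.1 := fun p => by
    rw [map_add, hs, Ideal.Quotient.eq_zero_iff_mem.2 p.2.2, zero_add]
  constructor
  · intro p q hpq
    have h1 : p.1 = q.1 := by rw [← hmk p, ← hmk q]; exact congrArg _ hpq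
    refine Prod.ext h1 (Subtype.ext ?_)
    simpa [h1] using hpq
  · intro x
    refine ⟨(Ideal.Quotient.mk J x, ⟨x - Function.surjInv (Ideal.Quotient.mk_surjective (I := J))
      (Ideal.Quotient.mk J x), Ideal.Quotient.eq.1 (hs _).symm⟩), ?_⟩
    simp

theorem exists_abs_tsum_ideal_sub_le (J : Ideal (𝓞 F)) (hJ : J ≠ 0) : ∃ C : ℝ, ∀ s : ℝ, 1 ≤ s →
    s ≤ 2 → Summable (intPow s : 𝓞 F → ℝ) →
    |∑' x : 𝓞 F, intPow s x - Ideal.absNorm J * ∑' x : J, intPow s (x : 𝓞 F)| ≤ C := by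
  choose g hg hgs using exists_abs_intPow_sub_le (F := F)
  have : Finite (𝓞 F ⧸ J) := Ideal.finiteQuotientOfFreeOfNeBot J hJ
  have : Fintype (𝓞 F ⧸ J) := Fintype.ofFinite _
  set out := Function.surjInv (Ideal.Quotient.mk_surjective (I := J)) with hout
  refine ⟨∑ q : 𝓞 F ⧸ J, ∑' x : J, g (out q) x, fun s hs hs2 hsum => ?_⟩
  have hinj : ∀ r : 𝓞 F, Function.Injective fun x : J => (x : 𝓞 F) + r := fun r x y hxy =>
    Subtype.ext (add_right_cancel hxy)
  have h1 : ∑' x : 𝓞 F, intPow s x = ∑ q : 𝓞 F ⧸ J, ∑' x : J, intPow s ((x : 𝓞 F) + out q) := by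
    rw [← (Equiv.ofBijective _ (bijective_section_add J)).tsum_eq, ← tsum_fintype (L := .unconditional _)]
    refine Summable.tsum_prod' ?_ fun q => hsum.comp_injective (hinj (out q))
    exact hsum.comp_injective (bijective_section_add J).injective
  have h2 : (Ideal.absNorm J : ℝ) * ∑' x : J, intPow s (x : 𝓞 F) =
      ∑ q : 𝓞 F ⧸ J, ∑' x : J, intPow s (x : 𝓞 F) := by
    rw [Finset.sum_const, nsmul_eq_mul, Finset.card_univ, Ideal.absNorm_apply,
      Submodule.cardQuot_apply, Nat.card_eq_fintype_card]
  rw [h1, h2, ← Finset.sum_sub_distrib]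
  refine (Finset.abs_sum_le_sum_abs _ _).trans (Finset.sum_le_sum fun q _ => ?_)
  have hs1 : Summable fun x : J => intPow s ((x : 𝓞 F) + out q) := hsum.comp_injective (hinj _)
  have hs2' : Summable fun x : J => intPow s (x : 𝓞 F) := hsum.comp_injective Subtype.val_injective
  rw [← hs1.tsum_sub hs2']
  have hg' : Summable fun x : J => g (out q) x := (hg (out q)).comp_injective Subtype.val_injective
  have hle : ∀ x : J, |intPow s ((x : 𝓞 F) + out q) - intPow s (x : 𝓞 F)| ≤ g (out q) x :=
    fun x => hgs (out q) s hs hs2 x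
  have habs := Summable.of_nonneg_of_le (fun x : J => abs_nonneg _) hle hg'
  have h3 := norm_tsum_le_tsum_norm (f := fun x : J =>
    intPow s ((x : 𝓞 F) + out q) - intPow s (x : 𝓞 F)) habs
  exact h3.trans (habs.tsum_le_tsum hle hg')

end ConeWeight

end

section

open NumberField NumberField.InfinitePlace NumberField.mixedEmbedding NumberField.Units
open NumberField.mixedEmbedding.fundamentalCone NumberField.Units.dirichletUnitTheorem
open Filter Topology

namespace ConeWeight

variable {F : Type*} [Field F] [NumberField F]

open scoped Classical in
/-- The term of the partial zeta function of the class inverse to that of `J`. -/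
noncomputable def clTerm (s : ℝ) (J I : Ideal (𝓞 F)) : ℝ :=
  if I ≠ 0 ∧ (I * J).IsPrincipal then (Ideal.absNorm I : ℝ) ^ (-s) else 0

theorem clTerm_nonneg (s : ℝ) (J I : Ideal (𝓞 F)) : 0 ≤ clTerm s J I := by
  rw [clTerm]
  split_ifs
  · positivity
  · exact le_rfl

theorem clTerm_le (s : ℝ) (J I : Ideal (𝓞 F)) : clTerm s J I ≤ (Ideal.absNorm I : ℝ) ^ (-s) := by
  rw [clTerm]
  split_ifs
  · exact le_rfl
  · positivity

theorem summable_clTerm {s : ℝ} (hs : 1 < s) (J : Ideal (𝓞 F)) : Summable (clTerm s J) :=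
  (IdealZeta.summable_absNorm_rpow hs).of_nonneg_of_le (clTerm_nonneg s J) (clTerm_le s J)

theorem hasSum_fiber {s : ℝ} (hs : s ≠ 0) (P : Ideal (𝓞 F)) :
    HasSum (fun x : {x : 𝓞 F // Ideal.span {x} = P} => intPow s x.1)
      (torsionOrder F * clTerm s ⊤ P) := by
  by_cases hP : P ≠ 0 ∧ (P * ⊤).IsPrincipal
  · rw [clTerm, if_pos hP]
    obtain ⟨hP0, hP1⟩ := hP
    rw [Ideal.mul_top] at hP1
    obtain ⟨x₀, hx₀⟩ := hP1.principal
    rw [Ideal.submodule_span_eq] at hx₀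
    subst hx₀
    have hx0 : x₀ ≠ 0 := by rintro rfl; exact hP0 (by simp)
    let e : (𝓞 F)ˣ → {x : 𝓞 F // Ideal.span {x} = Ideal.span {x₀}} := fun u => ⟨u * x₀, by
      rw [Ideal.span_singleton_eq_span_singleton]
      exact (associated_isUnit_mul_left_iff u.isUnit).2 (Associated.refl _)⟩
    have he : Function.Bijective e := by
      constructor
      · intro u v huv
        exact Units.ext (mul_right_cancel₀ hx0 (congrArg Subtype.val huv))
      · rintro ⟨x, hx⟩
        rw [Ideal.span_singleton_eq_span_singleton] at hx
        obtain ⟨u, hu⟩ := hx.symm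
        exact ⟨u, Subtype.ext ((mul_comm _ _).trans hu)⟩
    rw [← (Equiv.ofBijective e he).hasSum_iff, ← norm_mixedEmbedding]
    refine (hasSum_wPow_unit_smul s (norm_mixedEmbedding_ne_zero hx0)).congr_fun fun u => ?_
    rw [Function.comp_apply, Equiv.ofBijective_apply, intPow, unitSMul_smul, ← map_mul]
    rfl
  · rw [clTerm, if_neg hP, mul_zero]
    refine hasSum_zero.congr_fun fun x => ?_
    obtain ⟨x, hx⟩ := x
    have : x = 0 := by
      by_contra h0
      refine hP ⟨?_, ?_⟩
      · rw [← hx]; simpa using h0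
      · rw [Ideal.mul_top, ← hx]; exact ⟨x, rfl⟩
    subst this
    exact intPow_zero hs

open scoped Classical in
theorem hasSum_indicator {s : ℝ} (hs : 1 < s) (J : Ideal (𝓞 F)) :
    HasSum (fun x : 𝓞 F => if x ∈ J then intPow s x else 0)
      (torsionOrder F * ∑' P : Ideal (𝓞 F), if P ≤ J then clTerm s ⊤ P else 0) := by
  have hs0 : s ≠ 0 := by linarith
  set f : 𝓞 F → ℝ := fun x => if x ∈ J then intPow s x else 0 with hf
  have hf0 : ∀ x, 0 ≤ f x := fun x => by
    simp only [hf]; split_ifs; exacts [intPow_nonneg _ _, le_rfl]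
  have hfib : ∀ P : Ideal (𝓞 F), HasSum (fun x : {x : 𝓞 F // Ideal.span {x} = P} => f x.1)
      (torsionOrder F * if P ≤ J then clTerm s ⊤ P else 0) := by
    intro P
    by_cases hP : P ≤ J
    · rw [if_pos hP]
      refine (hasSum_fiber hs0 P).congr_fun fun x => ?_
      simp only [hf]
      rw [if_pos]
      exact hP (x.2.le (Ideal.mem_span_singleton_self x.1))
    · rw [if_neg hP, mul_zero]
      refine hasSum_zero.congr_fun fun x => ?_
      simp only [hf]
      rw [if_neg]
      intro hx
      exact hP (x.2.symm.le.trans ((Ideal.span_singleton_le_iff_mem J).2 hx))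
  have hsumP : Summable fun P : Ideal (𝓞 F) => if P ≤ J then clTerm s ⊤ P else 0 := by
    refine (summable_clTerm hs ⊤).of_nonneg_of_le (fun P => ?_) (fun P => ?_)
    · split_ifs; exacts [clTerm_nonneg _ _ _, le_rfl]
    · split_ifs; exacts [le_rfl, clTerm_nonneg _ _ _]
  rw [← (Equiv.sigmaFiberEquiv fun x : 𝓞 F => Ideal.span {x}).hasSum_iff]
  have hsum : Summable (f ∘ (Equiv.sigmaFiberEquiv fun x : 𝓞 F => Ideal.span {x})) := by
    refine (summable_sigma_of_nonneg fun _ => hf0 _).2 ⟨fun P => (hfib P).summable, ?_⟩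
    refine (hsumP.mul_left (torsionOrder F : ℝ)).congr fun P => ?_
    exact (hfib P).tsum_eq.symm
  have h1 := hsum.hasSum.sigma hfib
  rw [← tsum_mul_left, h1.tsum_eq]
  exact hsum.hasSum

theorem summable_intPow {s : ℝ} (hs : 1 < s) : Summable (intPow s : 𝓞 F → ℝ) := by
  classical
  simpa using (hasSum_indicator hs (⊤ : Ideal (𝓞 F))).summable

theorem tsum_intPow_ideal {s : ℝ} (hs : 1 < s) (J : Ideal (𝓞 F)) (hJ : J ≠ 0) :
    ∑' x : J, intPow s (x : 𝓞 F) =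
      torsionOrder F * ((Ideal.absNorm J : ℝ) ^ (-s) * ∑' I, clTerm s J I) := by
  classical
  have h1 : ∑' x : J, intPow s (x : 𝓞 F) = ∑' x : 𝓞 F, if x ∈ J then intPow s x else 0 := by
    refine (tsum_subtype (J : Set (𝓞 F)) (intPow s)).trans ?_
    refine tsum_congr fun x => ?_
    rw [Set.indicator_apply]
    rfl
  rw [h1, (hasSum_indicator hs J).tsum_eq, ← tsum_mul_left (a := (Ideal.absNorm J : ℝ) ^ (-s))]
  congr 1
  have hinj : Function.Injective fun I : Ideal (𝓞 F) => I * J := fun I I' h =>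
    mul_right_cancel₀ hJ h
  rw [← hinj.tsum_eq]
  · refine tsum_congr fun I => ?_
    rw [if_pos (Ideal.mul_le_right : I * J ≤ J), clTerm, clTerm, Ideal.mul_top]
    by_cases h : I ≠ 0 ∧ (I * J).IsPrincipal
    · rw [if_pos h, if_pos ⟨mul_ne_zero h.1 hJ, h.2⟩, map_mul, Nat.cast_mul,
        Real.mul_rpow (Nat.cast_nonneg _) (Nat.cast_nonneg _), mul_comm]
    · rw [if_neg h, if_neg (fun h' => h ⟨left_ne_zero_of_mul h'.1, h'.2⟩), mul_zero]
  · intro P hP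
    have hPJ : P ≤ J := by
      by_contra h
      exact hP (if_neg h)
    obtain ⟨I, rfl⟩ := Ideal.dvd_iff_le.2 hPJ
    exact ⟨I, mul_comm _ _⟩

theorem rpow_sub_one_le {N s : ℝ} (hN : 1 ≤ N) (hs : 1 ≤ s) (hs2 : s ≤ 2) :
    |N ^ (s - 1) - 1| ≤ (s - 1) * (N * Real.log N) := by
  have h0 : 0 ≤ Real.log N := Real.log_nonneg hN
  have h1 : N ^ (s - 1) = Real.exp (-(-((s - 1) * Real.log N))) := by
    rw [Real.rpow_def_of_pos (by linarith)]; ring_nf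
  have h2 : Real.exp (-(-((s - 1) * Real.log N))) ≤ N := by
    rw [← h1]
    calc N ^ (s - 1) ≤ N ^ (1 : ℝ) := Real.rpow_le_rpow_of_exponent_le hN (by linarith)
      _ = N := Real.rpow_one N
  have h3 : Real.exp (-0) ≤ N := by simpa using hN
  have := abs_exp_neg_sub_le h2 h3
  rw [h1]
  simp only [neg_zero, Real.exp_zero, sub_zero, abs_neg] at this ⊢
  rw [abs_of_nonneg (mul_nonneg (by linarith) h0)] at this
  linarith

theorem exists_tsum_clTerm_sub_le (J : Ideal (𝓞 F)) (hJ : J ≠ 0) : ∃ C : ℝ,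
    ∀ᶠ s in 𝓝[>] (1 : ℝ), |∑' I, clTerm s J I - ∑' I : Ideal (𝓞 F), clTerm s ⊤ I| ≤ C := by
  obtain ⟨C, hC⟩ := exists_abs_tsum_ideal_sub_le J hJ
  set N : ℝ := ((Ideal.absNorm J : ℕ) : ℝ) with hN
  have hN1 : 1 ≤ N := by
    rw [hN]
    exact_mod_cast Nat.one_le_iff_ne_zero.2 (Ideal.absNorm_ne_zero_iff_mem_nonZeroDivisors.2
      (mem_nonZeroDivisors_of_ne_zero hJ))
  have hT : (1 : ℝ) ≤ torsionOrder F := by exact_mod_cast torsionOrder_pos F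
  set B := dedekindZeta_residue F + 1
  have hB : ∀ᶠ s in 𝓝[>] (1 : ℝ), (s - 1) * ∑' I : Ideal (𝓞 F), (Ideal.absNorm I : ℝ) ^ (-s) ≤ B :=
    ((IdealZeta.tendsto_sub_one_mul_tsum F).eventually_lt_const (lt_add_one _)).mono
      fun _ h => h.le
  refine ⟨N * C + B * (N * Real.log N), ?_⟩
  filter_upwards [hB, Ioc_mem_nhdsGT (show (1 : ℝ) < 2 by norm_num)] with s hs hs12
  have h1 := hC s hs12.1.le hs12.2 (summable_intPow hs12.1)
  have h2 : ∑' x : 𝓞 F, intPow s x = torsionOrder F * ∑' I : Ideal (𝓞 F), clTerm s ⊤ I := by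
    classical
    have := (hasSum_indicator hs12.1 (⊤ : Ideal (𝓞 F))).tsum_eq
    simpa using this
  rw [h2, tsum_intPow_ideal hs12.1 J hJ] at h1
  set Z := ∑' I, clTerm s J I
  set Z₁ := ∑' I : Ideal (𝓞 F), clTerm s ⊤ I
  have hZ₁0 : 0 ≤ Z₁ := tsum_nonneg fun _ => clTerm_nonneg _ _ _
  have hZ₁ : Z₁ ≤ ∑' I : Ideal (𝓞 F), (Ideal.absNorm I : ℝ) ^ (-s) :=
    (summable_clTerm hs12.1 ⊤).tsum_le_tsum (clTerm_le s ⊤)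
      (IdealZeta.summable_absNorm_rpow hs12.1)
  have hsB : (s - 1) * Z₁ ≤ B :=
    (mul_le_mul_of_nonneg_left hZ₁ (by linarith [hs12.1])).trans hs
  have h3 : |Z₁ - N * N ^ (-s) * Z| ≤ C := by
    rw [show (torsionOrder F : ℝ) * Z₁ - N * (torsionOrder F * (N ^ (-s) * Z)) =
      torsionOrder F * (Z₁ - N * N ^ (-s) * Z) by ring, abs_mul, Nat.abs_cast] at h1
    exact (le_mul_of_one_le_left (abs_nonneg _) hT).trans h1
  have hN0 : 0 < N := by linarith
  have h4 : N ^ (s - 1) * (N * N ^ (-s)) = 1 := by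
    nth_rw 2 [← Real.rpow_one N]
    rw [← Real.rpow_add hN0, ← Real.rpow_add hN0]
    ring_nf
    exact Real.rpow_zero N
  have h5 : N ^ (s - 1) ≤ N := by
    calc N ^ (s - 1) ≤ N ^ (1 : ℝ) :=
          Real.rpow_le_rpow_of_exponent_le hN1 (by linarith [hs12.2])
      _ = N := Real.rpow_one N
  have e : Z - Z₁ = -(N ^ (s - 1) * (Z₁ - N * N ^ (-s) * Z)) + (N ^ (s - 1) - 1) * Z₁ := by
    linear_combination (-Z) * h4
  rw [e]
  refine (abs_add_le _ _).trans ?_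
  rw [abs_neg, abs_mul, abs_mul, abs_of_nonneg hZ₁0, abs_of_nonneg (by positivity : 0 ≤ N ^ (s - 1))]
  refine add_le_add (mul_le_mul h5 h3 (abs_nonneg _) hN0.le) ?_
  have h6 := mul_le_mul_of_nonneg_right (rpow_sub_one_le hN1 hs12.1.le hs12.2) hZ₁0
  have h7 := mul_le_mul_of_nonneg_right hsB (mul_nonneg hN0.le (Real.log_nonneg hN1))
  linarith

end ConeWeight

end

section

open NumberField FractionalIdeal IsUnramifiedQuadratic ConeWeight Filter Topology
open scoped nonZeroDivisors

namespace ClassLSeries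

variable {F : Type*} [Field F] [NumberField F]

/-- The character of the class group induced by a character of ideals trivial on principal
ideals. -/
noncomputable def classChar (χ : FI F →* ℤˣ)
    (hχ : ∀ x : Fˣ, χ (toPrincipalIdeal (𝓞 F) F x) = 1) : ClassGroup (𝓞 F) →* ℝ :=
  ((Int.castRingHom ℝ : ℤ →* ℝ).comp (Units.coeHom ℤ)).comp
    ((QuotientGroup.lift _ χ (by rintro _ ⟨x, rfl⟩; exact hχ x)).comp
      (ClassGroup.equiv F).toMonoidHom)

theorem classChar_mk0 (χ : FI F →* ℤˣ) (hχ) (I : Ideal (𝓞 F)) (hI : I ≠ 0) :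
    classChar χ hχ (ClassGroup.mk0 ⟨I, mem_nonZeroDivisors_of_ne_zero hI⟩) =
      ((χ (idealUnit I hI) : ℤ) : ℝ) := by
  simp only [classChar, MonoidHom.comp_apply, MulEquiv.toMonoidHom_eq_coe, MonoidHom.coe_coe]
  rw [ClassGroup.equiv_mk0]
  rfl

theorem classChar_ne_one {χ : FI F →* ℤˣ} (hχ) (h1 : χ ≠ 1) : classChar χ hχ ≠ 1 := by
  intro h
  apply h1
  ext I
  have h2 := DFunLike.congr_fun h ((ClassGroup.equiv F).symm (QuotientGroup.mk I))
  simp only [classChar, MonoidHom.comp_apply, MulEquiv.toMonoidHom_eq_coe, MonoidHom.coe_coe,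
    MulEquiv.apply_symm_apply, MonoidHom.one_apply] at h2
  have h3 : (((χ I : ℤˣ) : ℤ) : ℝ) = 1 := h2
  have h4 : ((χ I : ℤˣ) : ℤ) = 1 := Int.cast_injective (α := ℝ) (h3.trans Int.cast_one.symm)
  exact h4

theorem lTerm_eq_sum (χ : FI F →* ℤˣ) (hχ) (J : ClassGroup (𝓞 F) → (Ideal (𝓞 F))⁰)
    (hJ : ∀ c, ClassGroup.mk0 (J c) = c) (s : ℝ) (I : Ideal (𝓞 F)) :
    lTerm χ s I = ∑ c, classChar χ hχ c * clTerm s (J c : Ideal (𝓞 F)) I := by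
  classical
  by_cases hI : I = 0
  · subst hI
    rw [map_zero, Finset.sum_eq_zero]
    intro c _
    rw [clTerm, if_neg (by simp), mul_zero]
  set I' : (Ideal (𝓞 F))⁰ := ⟨I, mem_nonZeroDivisors_of_ne_zero hI⟩ with hI'
  have hpr : ∀ c, (I * (J c : Ideal (𝓞 F))).IsPrincipal ↔ c = (ClassGroup.mk0 I')⁻¹ := by
    intro c
    have h1 : (I * (J c : Ideal (𝓞 F))).IsPrincipal ↔ ClassGroup.mk0 (I' * J c) = 1 := by
      rw [ClassGroup.mk0_eq_one_iff]; rfl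
    rw [h1, map_mul, hJ, mul_eq_one_iff_eq_inv']
  rw [Finset.sum_eq_single (ClassGroup.mk0 I')⁻¹]
  · rw [clTerm, if_pos ⟨hI, (hpr _).2 rfl⟩, lTerm_of_ne_zero χ s hI]
    have h1 : classChar χ hχ (ClassGroup.mk0 I')⁻¹ * classChar χ hχ (ClassGroup.mk0 I') = 1 := by
      rw [← map_mul, inv_mul_cancel, map_one]
    rw [classChar_mk0 χ hχ I hI] at h1
    congr 1
    have h2 : (((χ (idealUnit I hI) : ℤ) : ℝ)) * ((χ (idealUnit I hI) : ℤ) : ℝ) = 1 := by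
      rw [← Int.cast_mul, ← Units.val_mul, Int.units_mul_self]; simp
    exact mul_right_cancel₀ (right_ne_zero_of_mul_eq_one h1) (h2.trans h1.symm)
  · intro c _ hc
    rw [clTerm, if_neg (fun h => hc ((hpr c).1 h.2)), mul_zero]
  · intro h
    exact absurd (Finset.mem_univ _) h

/-- The `L`-function of a nontrivial class group character stays bounded at `1`. -/
theorem exists_tsum_lTerm_le (χ : FI F →* ℤˣ)
    (hχ : ∀ x : Fˣ, χ (toPrincipalIdeal (𝓞 F) F x) = 1) (h1 : χ ≠ 1) :
    ∃ C : ℝ, ∀ᶠ s in 𝓝[>] (1 : ℝ), |∑' I, lTerm χ s I| ≤ C := by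
  choose J hJ using ClassGroup.mk0_surjective (R := 𝓞 F)
  choose C hC using fun c => exists_tsum_clTerm_sub_le (J c : Ideal (𝓞 F))
    (nonZeroDivisors.coe_ne_zero (J c))
  refine ⟨∑ c, |classChar χ hχ c| * C c, ?_⟩
  filter_upwards [eventually_all.2 hC, self_mem_nhdsWithin] with s hs hs1
  have hs1' : 1 < s := hs1
  simp only [lTerm_eq_sum χ hχ J hJ s]
  rw [Summable.tsum_finsetSum fun c _ => (summable_clTerm hs1' _).mul_left _]
  have h0 : ∑ c, classChar χ hχ c * ∑' I : Ideal (𝓞 F), clTerm s ⊤ I = 0 := by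
    rw [← Finset.sum_mul, sum_hom_units_eq_zero _ (classChar_ne_one hχ h1), zero_mul]
  rw [← sub_zero (∑ c, _), ← h0, ← Finset.sum_sub_distrib]
  refine (Finset.abs_sum_le_sum_abs _ _).trans (Finset.sum_le_sum fun c _ => ?_)
  rw [tsum_mul_left, ← mul_sub, abs_mul]
  exact mul_le_mul_of_nonneg_left (hs c) (abs_nonneg _)

end ClassLSeries

namespace IsUnramifiedQuadratic

open ClassLSeries

variable {K M : Type*} [Field K] [NumberField K] [Field M] [NumberField M] [Algebra K M]
  {σ : M ≃ₐ[K] M}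

theorem eq_one_or_eq_one_or_eq (h : IsUnramifiedQuadratic σ) (χ₁ χ₂ : FI K →* ℤˣ)
    (h₁ : IsNormCharacter σ χ₁) (h₂ : IsNormCharacter σ χ₂) : χ₁ = 1 ∨ χ₂ = 1 ∨ χ₁ = χ₂ := by
  by_contra! hne
  obtain ⟨n1, n2, n12⟩ := hne
  have n3 : χ₁ * χ₂ ≠ 1 := by
    intro h3
    apply n12
    ext I
    have := DFunLike.congr_fun h3 I
    rw [MonoidHom.mul_apply, MonoidHom.one_apply] at this
    rw [eq_inv_of_mul_eq_one_left this, Int.units_inv_eq_self]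
  have p3 : ∀ x : Kˣ, (χ₁ * χ₂) (toPrincipalIdeal (𝓞 K) K x) = 1 := fun x => by
    rw [MonoidHom.mul_apply, h₁.principal, h₂.principal, one_mul]
  obtain ⟨C₁, hC₁⟩ := exists_tsum_lTerm_le χ₁ h₁.principal n1
  obtain ⟨C₂, hC₂⟩ := exists_tsum_lTerm_le χ₂ h₂.principal n2
  obtain ⟨C₃, hC₃⟩ := exists_tsum_lTerm_le (χ₁ * χ₂) p3 n3
  set A := dedekindZeta_residue M
  have hA : 0 < A := dedekindZeta_residue_pos M
  set B := dedekindZeta_residue K + 1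
  have hM : ∀ᶠ s in 𝓝[>] (1 : ℝ),
      A / 2 < (s - 1) * ∑' I : Ideal (𝓞 M), (Ideal.absNorm I : ℝ) ^ (-s) :=
    (IdealZeta.tendsto_sub_one_mul_tsum M).eventually_const_lt (half_lt_self hA)
  have hK : ∀ᶠ s in 𝓝[>] (1 : ℝ),
      (s - 1) * ∑' I : Ideal (𝓞 K), (Ideal.absNorm I : ℝ) ^ (-s) < B :=
    (IdealZeta.tendsto_sub_one_mul_tsum K).eventually_lt_const (lt_add_one _)
  have hB : 0 < B := by have := dedekindZeta_residue_pos K; positivity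
  set D := B * (|C₁| * |C₂| * |C₃|) + 1
  have hD : 0 < D := by positivity
  have hsmall : ∀ᶠ s in 𝓝[>] (1 : ℝ), s < 1 + (A / 2) ^ 2 / D :=
    (eventually_lt_nhds (by have : 0 < (A / 2) ^ 2 / D := by positivity
                            linarith)).filter_mono nhdsWithin_le_nhds
  obtain ⟨s, hs, c1, c2, c3, hM, hK, hsm⟩ := ((eventually_mem_nhdsWithin).and (hC₁.and (hC₂.and
    (hC₃.and (hM.and (hK.and hsmall)))))).exists
  have hs1 : 0 < s - 1 := sub_pos.2 hs
  have key := zeta_sq_le h h₁ h₂ hs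
  set ZM := ∑' I : Ideal (𝓞 M), (Ideal.absNorm I : ℝ) ^ (-s)
  set ZK := ∑' I : Ideal (𝓞 K), (Ideal.absNorm I : ℝ) ^ (-s)
  have hZK : 0 ≤ ZK := tsum_nonneg fun _ => by positivity
  have hprod : ZM ^ 2 ≤ ZK * (|C₁| * |C₂| * |C₃|) := by
    refine key.trans ((le_abs_self _).trans ?_)
    rw [abs_mul, abs_mul, abs_mul, abs_of_nonneg hZK, mul_assoc, mul_assoc, mul_assoc]
    have := c1.trans (le_abs_self _)
    have := c2.trans (le_abs_self _)
    have := c3.trans (le_abs_self _)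
    gcongr
  have h5 : (A / 2) ^ 2 < ((s - 1) * ZM) ^ 2 := by gcongr
  have h6 : ((s - 1) * ZM) ^ 2 ≤ (s - 1) * (B * (|C₁| * |C₂| * |C₃|)) := by
    have e : 0 ≤ |C₁| * |C₂| * |C₃| := by positivity
    calc ((s - 1) * ZM) ^ 2 = (s - 1) ^ 2 * ZM ^ 2 := by ring
      _ ≤ (s - 1) ^ 2 * (ZK * (|C₁| * |C₂| * |C₃|)) := by gcongr
      _ = (s - 1) * ((s - 1) * ZK * (|C₁| * |C₂| * |C₃|)) := by ring
      _ ≤ _ := by gcongr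
  have h7 : (s - 1) * D < (A / 2) ^ 2 := by
    rw [← lt_div_iff₀ hD]
    linarith
  have h8 : (s - 1) * (B * (|C₁| * |C₂| * |C₃|)) ≤ (s - 1) * D := by
    simp only [D]
    gcongr
    linarith
  linarith

/-- In an unramified quadratic extension with totally real top field, an element fixed by the
involution which is the norm of an ideal is the norm of an element. -/
theorem exists_norm_eq_of_ideal_norm_eq [IsTotallyReal M] (h : IsUnramifiedQuadratic σ) {a : Mˣ}
    (ha : unitAct σ a = a) {I : FI M} (hI : I * idealAct σ I = toPrincipalIdeal (𝓞 M) M a) :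
    ∃ b : Mˣ, b * unitAct σ b = a :=
  h.exists_mul_apply_eq h.eq_one_or_eq_one_or_eq ha hI

end IsUnramifiedQuadratic

end

section

namespace CocycleExtension

variable {Γ U : Type*} [Group Γ] [CommGroup U]

/-- `β` satisfies the crossed homomorphism identity on `Λ`. -/
def IsCrossed (φ : Γ →* MulAut U) (Λ : Subgroup Γ) (β : Γ → U) : Prop :=
  ∀ x ∈ Λ, ∀ y ∈ Λ, β (x * y) = β x * φ x (β y)

theorem IsCrossed.map_one {φ : Γ →* MulAut U} {Λ : Subgroup Γ} {β : Γ → U}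
    (h : IsCrossed φ Λ β) : β 1 = 1 := by
  simpa using h 1 Λ.one_mem 1 Λ.one_mem

theorem exists_extension_of_value {φ : Γ →* MulAut U} {N : Subgroup Γ} {β : Γ → U}
    (hβ : IsCrossed φ N β) {t : Γ} (ht : t ∉ N) (hconj : ∀ m ∈ N, t * m * t⁻¹ ∈ N)
    (hsq : t * t ∈ N) {c : U} (hc : c * φ t c = β (t * t))
    (hrel : ∀ m ∈ N, β (t * m * t⁻¹) * φ (t * m * t⁻¹) c = c * φ t (β m))
    {Λ : Subgroup Γ} (hΛ : ∀ x ∈ Λ, x ∈ N ∨ x * t⁻¹ ∈ N) :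
    ∃ β' : Γ → U, IsCrossed φ Λ β' ∧ ∀ m ∈ N, β' m = β m := by
  classical
  set β' : Γ → U := fun x => if x ∈ N then β x else β (x * t⁻¹) * φ (x * t⁻¹) c with hβ'
  have h1 : ∀ m ∈ N, β' m = β m := fun m hm => if_pos hm
  have h2 : ∀ m ∈ N, β' (m * t) = β m * φ m c := by
    intro m hm
    have : m * t ∉ N := fun h => ht ((N.mul_mem_cancel_left hm).1 h)
    rw [hβ']
    simp only [this, if_false, mul_inv_cancel_right]
  refine ⟨β', fun x hx y hy => ?_, h1⟩
  rcases hΛ x hx with hx | hx <;> rcases hΛ y hy with hy | hy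
  · rw [h1 _ (N.mul_mem hx hy), h1 _ hx, h1 _ hy, hβ x hx y hy]
  · obtain ⟨m, rfl⟩ : ∃ m, y = m * t := ⟨y * t⁻¹, by simp⟩
    rw [mul_inv_cancel_right] at hy
    rw [← mul_assoc, h2 _ (N.mul_mem hx hy), h1 _ hx, h2 _ hy, hβ x hx m hy]
    simp only [map_mul, MulAut.mul_apply, mul_assoc]
  · obtain ⟨m, rfl⟩ : ∃ m, x = m * t := ⟨x * t⁻¹, by simp⟩
    rw [mul_inv_cancel_right] at hx
    have e : m * t * y = m * (t * y * t⁻¹) * t := by group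
    have hu := hconj y hy
    rw [h1 _ hy, h2 _ hx, e, h2 _ (N.mul_mem hx hu), hβ m hx _ hu, map_mul φ m, MulAut.mul_apply,
      mul_assoc, ← map_mul (φ m), hrel y hy, map_mul (φ m), map_mul φ m, MulAut.mul_apply, mul_assoc]
  · obtain ⟨m, rfl⟩ : ∃ m, x = m * t := ⟨x * t⁻¹, by simp⟩
    obtain ⟨n, rfl⟩ : ∃ n, y = n * t := ⟨y * t⁻¹, by simp⟩
    rw [mul_inv_cancel_right] at hx hy
    have hu := hconj n hy
    have e : m * t * (n * t) = m * ((t * n * t⁻¹) * (t * t)) := by group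
    have e2 : φ t (φ n c) = φ (t * n * t⁻¹) (φ t c) := by
      rw [← MulAut.mul_apply, ← MulAut.mul_apply, ← map_mul, ← map_mul]
      congr 2
      group
    rw [e, h1 _ (N.mul_mem hx (N.mul_mem hu hsq)), hβ m hx _ (N.mul_mem hu hsq),
      hβ _ hu _ hsq, ← hc, h2 _ hx, h2 _ hy, map_mul (φ (t * n * t⁻¹)),
      ← mul_assoc (β (t * n * t⁻¹)), hrel n hy, map_mul φ m, MulAut.mul_apply, mul_assoc (β m),
      ← map_mul (φ m), map_mul (φ t), e2, mul_assoc c]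

theorem exists_extension {I : Type*} [CommGroup I] {φ : Γ →* MulAut U} {ψ : Γ →* MulAut I}
    (P : U →* I) (hP : ∀ g u, P (φ g u) = ψ g (P u)) {N : Subgroup Γ} {β : Γ → U}
    (hβ : IsCrossed φ N β) {t : Γ} (ht : t ∉ N) (hconj : ∀ m ∈ N, t * m * t⁻¹ ∈ N)
    (hsq : t * t ∈ N) {b : U}
    (hb : ∀ m ∈ N, β (t * m * t⁻¹) * φ (t * m * t⁻¹) b = b * φ t (β m))
    {B : I} (hB : ∀ m ∈ N, P (β m) * ψ m B = B)
    (hOb : ∀ (a : U) (C : I), (∀ m ∈ N, φ m a = a) → φ t a = a → (∀ m ∈ N, ψ m C = C) →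
      C * ψ t C = P a → ∃ μ : U, (∀ m ∈ N, φ m μ = μ) ∧ μ * φ t μ = a)
    {Λ : Subgroup Γ} (hΛ : ∀ x ∈ Λ, x ∈ N ∨ x * t⁻¹ ∈ N) :
    ∃ β' : Γ → U, IsCrossed φ Λ β' ∧ ∀ m ∈ N, β' m = β m := by
  have htt : φ t (β (t * t)) = β (t * t) * φ (t * t) b * b⁻¹ := by
    have := hb _ hsq
    rw [show t * (t * t) * t⁻¹ = t * t by group] at this
    rw [this, mul_comm b, mul_inv_cancel_right]
  -- elements of `N` are conjugates by `t`
  have hconj' : ∀ m ∈ N, ∃ m' ∈ N, m = t * m' * t⁻¹ := by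
    intro m hm
    refine ⟨(t * t)⁻¹ * (t * m * t⁻¹) * (t * t), N.mul_mem (N.mul_mem (N.inv_mem hsq)
      (hconj m hm)) hsq, by group⟩
  suffices hs : ∃ μ : U, (∀ m ∈ N, φ m μ = μ) ∧ μ * φ t μ = β (t * t) * (b * φ t b)⁻¹ by
    obtain ⟨μ, hμ, hμa⟩ := hs
    refine exists_extension_of_value (c := b * μ) hβ ht hconj hsq ?_ ?_ hΛ
    · rw [map_mul (φ t), mul_mul_mul_comm, hμa, mul_comm, inv_mul_cancel_right]
    · intro m hm
      rw [map_mul (φ _), hμ _ (hconj m hm), ← mul_assoc, hb m hm, mul_right_comm]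
  refine hOb _ (B * (P b * ψ t B)⁻¹) ?_ ?_ ?_ ?_
  · intro m hm
    obtain ⟨u, hu, rfl⟩ := hconj' m hm
    obtain ⟨v, hv, rfl⟩ := hconj' u hu
    have e : (t * (t * v * t⁻¹) * t⁻¹) * (t * t) = (t * t) * v := by group
    have h1 : β (t * (t * v * t⁻¹) * t⁻¹) * φ (t * (t * v * t⁻¹) * t⁻¹) (β (t * t)) =
        β (t * t) * φ (t * t) (β v) := by
      rw [← hβ _ hm _ hsq, e, hβ _ hsq _ hv]
    have h2 := hb _ hu
    have h3 := congrArg (φ t) (hb _ hv)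
    rw [map_mul (φ t), map_mul (φ t)] at h3
    have e3 : φ t (φ (t * v * t⁻¹) b) = φ (t * (t * v * t⁻¹) * t⁻¹) (φ t b) := by
      rw [← MulAut.mul_apply, ← MulAut.mul_apply, ← map_mul, ← map_mul]
      congr 2
      group
    rw [e3, show φ t (φ t (β v)) = φ (t * t) (β v) by rw [map_mul, MulAut.mul_apply]] at h3
    rw [map_mul (φ _), map_inv, map_mul (φ _)]
    generalize φ (t * (t * v * t⁻¹) * t⁻¹) (β (t * t)) = A₁ at *
    generalize φ (t * (t * v * t⁻¹) * t⁻¹) b = A₂ at *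
    generalize φ (t * (t * v * t⁻¹) * t⁻¹) (φ t b) = A₃ at *
    generalize β (t * (t * v * t⁻¹) * t⁻¹) = A₄ at *
    generalize φ t (β (t * v * t⁻¹)) = A₅ at *
    generalize φ (t * t) (β v) = A₆ at *
    have e4 : A₄ * A₅ * (A₁ * (b * φ t b)) = A₄ * A₅ * (β (t * t) * (A₂ * A₃)) := by
      calc A₄ * A₅ * (A₁ * (b * φ t b)) = (A₄ * A₁) * (b * A₅) * φ t b := by
            simp only [mul_comm, mul_left_comm, mul_assoc]
        _ = (β (t * t) * A₆) * (A₄ * A₂) * φ t b := by rw [h1, h2]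
        _ = β (t * t) * (A₄ * A₂) * (φ t b * A₆) := by
            simp only [mul_comm, mul_left_comm, mul_assoc]
        _ = β (t * t) * (A₄ * A₂) * (A₅ * A₃) := by rw [h3]
        _ = _ := by simp only [mul_comm, mul_left_comm]
    rw [mul_inv_eq_iff_eq_mul, mul_right_comm, eq_mul_inv_iff_mul_eq]
    exact mul_left_cancel e4
  · rw [map_mul (φ t), htt, map_inv, map_mul (φ t), map_mul φ t t, MulAut.mul_apply]
    simp only [mul_inv, mul_assoc]
    rw [mul_comm (φ t b)⁻¹, ← mul_assoc b⁻¹, mul_comm b⁻¹, mul_assoc, mul_inv_cancel_left]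
  · intro m hm
    obtain ⟨u, hu, rfl⟩ := hconj' m hm
    have h1 := congrArg (ψ t) (hB u hu)
    have h2 := hB _ hm
    have h3 := congrArg P (hb u hu)
    rw [map_mul P, map_mul P, hP, hP] at h3
    rw [map_mul (ψ t)] at h1
    have e3 : ψ t (ψ u B) = ψ (t * u * t⁻¹) (ψ t B) := by
      rw [← MulAut.mul_apply, ← MulAut.mul_apply, ← map_mul, ← map_mul]
      congr 2
      group
    rw [e3] at h1
    rw [map_mul (ψ _), map_inv, map_mul (ψ _)]
    generalize ψ (t * u * t⁻¹) (ψ t B) = A₁ at *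
    generalize ψ (t * u * t⁻¹) B = A₂ at *
    generalize ψ (t * u * t⁻¹) (P b) = A₃ at *
    generalize P (β (t * u * t⁻¹)) = A₄ at *
    generalize ψ t (P (β u)) = A₅ at *
    rw [mul_inv_eq_iff_eq_mul, mul_right_comm, eq_mul_inv_iff_mul_eq, ← h1]
    conv_rhs => rw [← h2]
    calc A₂ * (P b * (A₅ * A₁)) = A₂ * A₁ * (P b * A₅) := by
          simp only [mul_comm, mul_left_comm, mul_assoc]
      _ = A₂ * A₁ * (A₄ * A₃) := by rw [h3]
      _ = _ := by simp only [mul_comm, mul_left_comm]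
  · have h1 := hB _ hsq
    rw [map_mul ψ t t, MulAut.mul_apply] at h1
    rw [map_mul (ψ t), map_inv, map_mul (ψ t), map_mul P, map_inv, map_mul P, hP]
    generalize ψ t (ψ t B) = A₁ at *
    rw [← h1]
    simp only [mul_inv, mul_assoc]
    rw [inv_mul_cancel_left, mul_comm _ A₁⁻¹, mul_left_comm (P b)⁻¹, mul_inv_cancel_left]

end CocycleExtension

end

section

open NumberField FractionalIdeal FracAct
open scoped nonZeroDivisors

/-- A finite group of automorphisms of a number field which is unramified at all finite places,
in the sense that the ring of integers is Galois over the fixed ring. -/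
def IsEtaleGroup {L : Type*} [Field L] [NumberField L] (G : Subgroup (L ≃ₐ[ℚ] L)) : Prop :=
  ∃ (m : ℕ) (x y : Fin m → 𝓞 L), ∑ i, (x i : L) * (y i : L) = 1 ∧
    ∀ g ∈ G, g ≠ 1 → ∑ i, (x i : L) * g (y i : L) = 0

namespace FracAct

theorem exists_eq_sum_spanSingleton {F : Type*} [Field F] [NumberField F]
    (I : FractionalIdeal (𝓞 F)⁰ F) : ∃ s : Finset F, I = ∑ x ∈ s, spanSingleton (𝓞 F)⁰ x := by
  classical
  obtain ⟨s, hs⟩ := fg_of_isNoetherianRing le_rfl I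
  refine ⟨s, ?_⟩
  have : ∀ s : Finset F, ((∑ x ∈ s, spanSingleton (𝓞 F)⁰ x : FractionalIdeal (𝓞 F)⁰ F) :
      Submodule (𝓞 F) F) = Submodule.span (𝓞 F) (s : Set F) := by
    intro s
    induction s using Finset.induction_on with
    | empty => simp
    | insert a s ha ih =>
      rw [Finset.sum_insert ha, coe_add, ih, coe_spanSingleton, Finset.coe_insert,
        Submodule.span_insert]
      rfl
  apply coeToSubmodule_injective
  exact ((this s).trans hs).symm

theorem spanSingleton_le_sum {F ι : Type*} [Field F] [NumberField F] (s : Finset ι) (x : ι → 𝓞 F)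
    (w : ι → F) {z : F} (hz : z = ∑ i ∈ s, (x i : F) * w i) :
    spanSingleton (𝓞 F)⁰ z ≤ ∑ i ∈ s, spanSingleton (𝓞 F)⁰ (w i) := by
  rw [spanSingleton_le_iff_mem, hz]
  refine Submodule.sum_mem _ fun i hi => ?_
  have h1 : spanSingleton (𝓞 F)⁰ (w i) ≤ ∑ i ∈ s, spanSingleton (𝓞 F)⁰ (w i) :=
    Finset.single_le_sum (f := fun i => spanSingleton (𝓞 F)⁰ (w i))
      (fun i _ => FractionalIdeal.zero_le _) hi
  have h2 : (x i : F) * w i = x i • w i := (Algebra.smul_def _ _).symm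
  rw [h2]
  exact Submodule.smul_mem _ _ (h1 (mem_spanSingleton_self _ _))

theorem extendedHom_act {M L : Type*} [Field M] [NumberField M] [Field L] [NumberField L]
    [Algebra M L] (τ : M ≃+* M) (t : L ≃+* L)
    (h : ∀ x, algebraMap M L (τ x) = t (algebraMap M L x)) (I : FractionalIdeal (𝓞 M)⁰ M) :
    extendedHom L (𝓞 L) (act τ I) = act t (extendedHom L (𝓞 L) I) := by
  obtain ⟨s, rfl⟩ := exists_eq_sum_spanSingleton I
  simp_rw [map_sum, IsUnramifiedQuadratic.extendedHom_spanSingleton, act_spanSingleton,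
    IsUnramifiedQuadratic.extendedHom_spanSingleton, h]

end FracAct

namespace IsEtaleGroup

variable {L : Type*} [Field L] [NumberField L] {G : Subgroup (L ≃ₐ[ℚ] L)}

theorem mono {H : Subgroup (L ≃ₐ[ℚ] L)} (h : IsEtaleGroup G) (hH : H ≤ G) : IsEtaleGroup H := by
  obtain ⟨m, x, y, h1, h2⟩ := h
  exact ⟨m, x, y, h1, fun g hg => h2 g (hH hg)⟩

variable (G) in
/-- The sum of the conjugates under a finite group of automorphisms. -/
noncomputable def tr [Fintype G] (z : L) : L := ∑ g : G, (g : L ≃ₐ[ℚ] L) z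

theorem apply_tr [Fintype G] {g : L ≃ₐ[ℚ] L} (hg : g ∈ G) (z : L) : g (tr G z) = tr G z := by
  rw [tr, map_sum]
  exact Fintype.sum_equiv (Equiv.mulLeft (⟨g, hg⟩ : G)) _ _ fun _ => rfl

theorem tr_mem [Fintype G] (z : L) : tr G z ∈ IntermediateField.fixedField G :=
  (IntermediateField.mem_fixedField_iff _ _).2 fun _ hg => apply_tr hg z

theorem isIntegral_apply (g : L ≃ₐ[ℚ] L) {x : L} (hx : IsIntegral ℤ x) : IsIntegral ℤ (g x) :=
  hx.map (g.toRingEquiv.toRingHom.toIntAlgHom)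

theorem isIntegral_tr [Fintype G] {z : L} (hz : IsIntegral ℤ z) : IsIntegral ℤ (tr G z) :=
  IsIntegral.sum _ fun g _ => isIntegral_apply g.1 hz

theorem tr_add [Fintype G] (z w : L) : tr G (z + w) = tr G z + tr G w := by
  simp only [tr, map_add, Finset.sum_add_distrib]

theorem tr_fixed_mul [Fintype G] {a : L} (ha : ∀ g ∈ G, g a = a) (z : L) :
    tr G (a * z) = a * tr G z := by
  simp only [tr, map_mul, Finset.mul_sum]
  exact Finset.sum_congr rfl fun g _ => by rw [ha g g.2]

theorem sum_mul_tr [Fintype G] {m : ℕ} {x y : Fin m → 𝓞 L} (h1 : ∑ i, (x i : L) * (y i : L) = 1)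
    (h2 : ∀ g ∈ G, g ≠ 1 → ∑ i, (x i : L) * g (y i : L) = 0) (z : L) :
    ∑ i, (x i : L) * tr G ((y i : L) * z) = z := by
  simp only [tr, map_mul, Finset.mul_sum]
  rw [Finset.sum_comm]
  simp only [← mul_assoc, ← Finset.sum_mul]
  rw [Finset.sum_eq_single (1 : G)]
  · simp [h1]
  · intro g _ hg
    rw [h2 g g.2 fun h => hg (Subtype.ext h), zero_mul]
  · simp

variable (h : IsEtaleGroup G)
include h

theorem exists_extendedHom_eq {I : FractionalIdeal (𝓞 L)⁰ L}
    (hI : ∀ g ∈ G, act g.toRingEquiv I = I) :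
    ∃ I' : FractionalIdeal (𝓞 (IntermediateField.fixedField G)) ⁰ (IntermediateField.fixedField G),
      extendedHom L (𝓞 L) I' = I := by
  classical
  have : Fintype G := Fintype.ofFinite G
  obtain ⟨m, x, y, h1, h2⟩ := h
  obtain ⟨s, hs⟩ := exists_eq_sum_spanSingleton I
  refine ⟨∑ z ∈ s, ∑ i, spanSingleton _ ⟨tr G ((y i : L) * z), tr_mem _⟩, ?_⟩
  simp_rw [map_sum, IsUnramifiedQuadratic.extendedHom_spanSingleton]
  refine le_antisymm ?_ ?_
  · refine Finset.sum_induction _ (· ≤ I) (fun a b => sup_le) (FractionalIdeal.zero_le _)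
      fun z hz => Finset.sum_induction _ (· ≤ I) (fun a b => sup_le) (FractionalIdeal.zero_le _)
      fun i _ => ?_
    rw [spanSingleton_le_iff_mem]
    have hzI : z ∈ I := by
      have h3 : spanSingleton (𝓞 L)⁰ z ≤ ∑ i ∈ s, spanSingleton (𝓞 L)⁰ i :=
        Finset.single_le_sum (f := fun i => spanSingleton (𝓞 L)⁰ i)
          (fun i _ => FractionalIdeal.zero_le _) hz
      rw [hs]
      exact h3 (mem_spanSingleton_self _ _)
    have hyz : (y i : L) * z ∈ I := by
      rw [show (y i : L) * z = y i • z from (Algebra.smul_def _ _).symm]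
      exact Submodule.smul_mem _ _ hzI
    change tr G ((y i : L) * z) ∈ I
    refine Submodule.sum_mem _ fun g _ => ?_
    have := mem_act_of_mem (g : L ≃ₐ[ℚ] L).toRingEquiv hyz
    rwa [hI g g.2] at this
  · conv_lhs => rw [hs]
    refine Finset.sum_le_sum fun z _ => ?_
    exact spanSingleton_le_sum _ x _ (sum_mul_tr h1 h2 z).symm

theorem exists_tr_eq_one [Fintype G] : ∃ e : 𝓞 L, tr G (e : L) = 1 := by
  obtain ⟨m, x, y, h1, h2⟩ := h
  set M := IntermediateField.fixedField G
  let T : Ideal (𝓞 M) :=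
    { carrier := {a | ∃ e : 𝓞 L, tr G (e : L) = ((a : M) : L)}
      add_mem' := by
        rintro a b ⟨e, he⟩ ⟨f, hf⟩
        exact ⟨e + f, (tr_add _ _).trans (congrArg₂ (· + ·) he hf)⟩
      zero_mem' := ⟨0, by simp [tr]⟩
      smul_mem' := by
        rintro c a ⟨e, he⟩
        refine ⟨algebraMap (𝓞 M) (𝓞 L) c * e, ?_⟩
        have := tr_fixed_mul (G := G) (a := ((c : M) : L))
          (fun g hg => (IntermediateField.mem_fixedField_iff _ _).1 (c : M).2 g hg) (e : L)
        rw [he] at this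
        exact this }
  have hT : T = ⊤ := by
    by_contra hne
    obtain ⟨P, hP, hle⟩ := Ideal.exists_le_maximal T hne
    obtain ⟨Q, hQ, hover⟩ := Ideal.exists_maximal_ideal_liesOver_of_isIntegral P (S := 𝓞 L)
    apply hQ.ne_top
    rw [Ideal.eq_top_iff_one]
    have hc : ∀ i, ∃ c : 𝓞 M, ((c : M) : L) = tr G (y i : L) := fun i =>
      ⟨⟨⟨tr G (y i : L), tr_mem _⟩, (isIntegral_algebraMap_iff (algebraMap M L).injective).1
        (isIntegral_tr (y i).2)⟩, rfl⟩
    choose c hc using hc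
    have : (1 : 𝓞 L) = ∑ i, x i * algebraMap (𝓞 M) (𝓞 L) (c i) := by
      apply RingOfIntegers.ext
      have e : ((∑ i, x i * algebraMap (𝓞 M) (𝓞 L) (c i) : 𝓞 L) : L) =
          ∑ i, (x i : L) * ((c i : M) : L) := by
        rw [RingOfIntegers.coe_eq_algebraMap, map_sum]
        rfl
      rw [e]
      simp_rw [hc]
      have := sum_mul_tr h1 h2 1
      simp only [mul_one] at this
      rw [this]
      rfl
    rw [this]
    refine Ideal.sum_mem _ fun i _ => Ideal.mul_mem_left _ _ ?_
    have : c i ∈ P := hle ⟨y i, (hc i).symm⟩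
    rw [hover.over] at this
    exact this
  obtain ⟨e, he⟩ : (1 : 𝓞 M) ∈ T := hT ▸ Submodule.mem_top
  exact ⟨e, he⟩

end IsEtaleGroup

end

section

open NumberField FractionalIdeal FracAct IsUnramifiedQuadratic
open scoped nonZeroDivisors

namespace IsEtaleGroup

variable {L : Type*} [Field L] [NumberField L]

theorem isUnramifiedQuadratic_fixedField {M : Type*} [Field M] [NumberField M] (τ : M ≃ₐ[ℚ] M)
    (hτ : ∀ x, τ (τ x) = x) (hne : ∃ x, τ x ≠ x)
    (het : ∃ (m : ℕ) (x y : Fin m → 𝓞 M), ∑ i, (x i : M) * (y i : M) = 1 ∧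
      ∑ i, (x i : M) * τ (y i : M) = 0) :
    ∃ σ : M ≃ₐ[IntermediateField.fixedField (Subgroup.zpowers τ)] M,
      IsUnramifiedQuadratic σ ∧ ∀ x, σ x = τ x := by
  refine ⟨AlgEquiv.ofRingEquiv (f := τ.toRingEquiv) fun r => ?_, ⟨hτ, fun x hx => ?_, hne, het⟩,
    fun x => rfl⟩
  · exact (IntermediateField.mem_fixedField_iff _ _).1 r.2 τ (Subgroup.mem_zpowers τ)
  · refine ⟨⟨x, (IntermediateField.mem_fixedField_iff _ _).2 fun g hg => ?_⟩, rfl⟩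
    have hx : τ x = x := hx
    have : Subgroup.zpowers τ ≤ MulAction.stabilizer (M ≃ₐ[ℚ] M) x := by
      rw [Subgroup.zpowers_le]
      exact hx
    exact this hg

variable {N H : Subgroup (L ≃ₐ[ℚ] L)}

theorem quotient_etale (hH : IsEtaleGroup H) (hN : N ≤ H) {t : L ≃ₐ[ℚ] L} (ht : t ∈ H)
    (htN : t ∉ N) (τ : IntermediateField.fixedField N ≃ₐ[ℚ] IntermediateField.fixedField N)
    (hτ : ∀ x, ((τ x : IntermediateField.fixedField N) : L) = t x) :
    ∃ (m : ℕ) (x y : Fin m → 𝓞 (IntermediateField.fixedField N)),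
      ∑ i, (x i : IntermediateField.fixedField N) * (y i : IntermediateField.fixedField N) = 1 ∧
      ∑ i, (x i : IntermediateField.fixedField N) * τ (y i : IntermediateField.fixedField N) =
        0 := by
  classical
  have : Fintype N := Fintype.ofFinite N
  obtain ⟨e, he⟩ := (hH.mono hN).exists_tr_eq_one
  obtain ⟨m, x, y, h1, h2⟩ := hH
  have hc : ∀ z : 𝓞 L, ∃ c : 𝓞 (IntermediateField.fixedField N),
      ((c : IntermediateField.fixedField N) : L) = tr N (z : L) := fun z =>
    ⟨⟨⟨tr N (z : L), tr_mem _⟩, (isIntegral_algebraMap_iff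
      (algebraMap (IntermediateField.fixedField N) L).injective).1 (isIntegral_tr z.2)⟩, rfl⟩
  choose X hX using fun i => hc (e * x i)
  choose Y hY using fun i => hc (y i)
  have key : ∀ s ∈ H, ∑ i, tr N ((e : L) * (x i : L)) * s (tr N (y i : L)) =
      ∑ n : N, (n : L ≃ₐ[ℚ] L) (e : L) *
        ∑ n' : N, if ((n : L ≃ₐ[ℚ] L)⁻¹ * (s * n')) = 1 then 1 else 0 := by
    intro s hs
    have h3 : ∀ n n' : N, ∑ i, (n : L ≃ₐ[ℚ] L) (x i : L) * s ((n' : L ≃ₐ[ℚ] L) (y i : L)) =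
        if ((n : L ≃ₐ[ℚ] L)⁻¹ * (s * n')) = 1 then 1 else 0 := by
      intro n n'
      set g := (n : L ≃ₐ[ℚ] L)⁻¹ * (s * n') with hg
      have h4 : ∑ i, (x i : L) * g (y i : L) = if g = 1 then 1 else 0 := by
        split_ifs with hg1
        · rw [hg1]
          exact h1
        · exact h2 g (H.mul_mem (H.inv_mem (hN n.2)) (H.mul_mem hs (hN n'.2))) hg1
      have h5 := congrArg (n : L ≃ₐ[ℚ] L) h4
      rw [map_sum] at h5
      have h6 : ∀ i, (n : L ≃ₐ[ℚ] L) ((x i : L) * g (y i : L)) =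
          (n : L ≃ₐ[ℚ] L) (x i : L) * s ((n' : L ≃ₐ[ℚ] L) (y i : L)) := by
        intro i
        rw [map_mul, ← AlgEquiv.mul_apply, hg, mul_inv_cancel_left]
        rfl
      simp_rw [h6] at h5
      rw [h5]
      split_ifs <;> simp
    simp_rw [← h3, tr, map_sum, Finset.sum_mul_sum, map_mul]
    rw [Finset.sum_comm]
    refine Finset.sum_congr rfl fun n _ => ?_
    rw [Finset.sum_comm, Finset.mul_sum]
    refine Finset.sum_congr rfl fun n' _ => ?_
    rw [Finset.mul_sum]
    exact Finset.sum_congr rfl fun i _ => mul_assoc _ _ _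
  refine ⟨m, X, Y, ?_, ?_⟩
  · apply Subtype.ext
    have e1 : ((∑ i, (X i : IntermediateField.fixedField N) *
        (Y i : IntermediateField.fixedField N) : IntermediateField.fixedField N) : L) =
        ∑ i, tr N ((e : L) * (x i : L)) * (1 : L ≃ₐ[ℚ] L) (tr N (y i : L)) := by
      rw [← IntermediateField.algebraMap_apply, map_sum]
      refine Finset.sum_congr rfl fun i _ => ?_
      rw [map_mul]
      exact congrArg₂ (· * ·) (hX i) (hY i)
    rw [e1, key 1 H.one_mem]
    have e2 : ∀ n : N, (∑ n' : N, if ((n : L ≃ₐ[ℚ] L)⁻¹ * (1 * n')) = 1 then (1 : L) else 0) = 1 := by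
      intro n
      simp_rw [one_mul, inv_mul_eq_one, SetLike.coe_eq_coe]
      simp
    simp_rw [e2, mul_one]
    exact he
  · apply Subtype.ext
    have e1 : ((∑ i, (X i : IntermediateField.fixedField N) *
        τ (Y i : IntermediateField.fixedField N) : IntermediateField.fixedField N) : L) =
        ∑ i, tr N ((e : L) * (x i : L)) * t (tr N (y i : L)) := by
      rw [← IntermediateField.algebraMap_apply, map_sum]
      refine Finset.sum_congr rfl fun i _ => ?_
      rw [map_mul]
      refine congrArg₂ (· * ·) (hX i) ((hτ _).trans ?_)
      rw [hY i]
    rw [e1, key t ht]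
    refine Finset.sum_eq_zero fun n _ => ?_
    rw [Finset.sum_eq_zero, mul_zero]
    intro n' _
    refine if_neg fun h3 => htN ?_
    have : t = n * (n' : L ≃ₐ[ℚ] L)⁻¹ := by
      rw [inv_mul_eq_one] at h3
      rw [h3, mul_inv_cancel_right]
    rw [this]
    exact N.mul_mem n.2 (N.inv_mem n'.2)

theorem exists_restrict {t : L ≃ₐ[ℚ] L} (hconj : ∀ n ∈ N, t * n * t⁻¹ ∈ N) (hsq : t * t ∈ N) :
    ∃ τ : IntermediateField.fixedField N ≃ₐ[ℚ] IntermediateField.fixedField N,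
      ∀ x, ((τ x : IntermediateField.fixedField N) : L) = t x := by
  have hmem : ∀ x : IntermediateField.fixedField N, t x ∈ IntermediateField.fixedField N := by
    intro x
    rw [IntermediateField.mem_fixedField_iff]
    intro n hn
    have h1 : (t * t)⁻¹ * (t * n * t⁻¹) * (t * t) ∈ N :=
      N.mul_mem (N.mul_mem (N.inv_mem hsq) (hconj n hn)) hsq
    have h2 := (IntermediateField.mem_fixedField_iff _ _).1 x.2 _ h1
    have h3 := congrArg t h2
    have h4 : t * ((t * t)⁻¹ * (t * n * t⁻¹) * (t * t)) = n * t := by group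
    rw [← AlgEquiv.mul_apply, h4] at h3
    exact h3
  exact ⟨AlgEquiv.ofBijective ((t.toAlgHom.comp (IntermediateField.val _)).codRestrict
    (IntermediateField.fixedField N).toSubalgebra hmem) (AlgHom.bijective _), fun x => rfl⟩

theorem exists_norm_eq [IsTotallyReal L] (hH : IsEtaleGroup H) (hN : N ≤ H) {t : L ≃ₐ[ℚ] L}
    (ht : t ∈ H) (htN : t ∉ N) (hconj : ∀ n ∈ N, t * n * t⁻¹ ∈ N) (hsq : t * t ∈ N) {a : Lˣ}
    {C : FI L} (haN : ∀ n ∈ N, unitAct n a = a) (hat : unitAct t a = a)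
    (hCN : ∀ n ∈ N, idealAct n C = C) (hC : C * idealAct t C = toPrincipalIdeal (𝓞 L) L a) :
    ∃ μ : Lˣ, (∀ n ∈ N, unitAct n μ = μ) ∧ μ * unitAct t μ = a := by
  obtain ⟨τ, hτ⟩ := exists_restrict hconj hsq
  have hτ2 : ∀ x, τ (τ x) = x := by
    intro x
    apply Subtype.ext
    rw [hτ, hτ]
    exact (IntermediateField.mem_fixedField_iff _ _).1 x.2 _ hsq
  have hτne : ∃ x, τ x ≠ x := by
    by_contra! hfix
    apply htN
    rw [← IntermediateField.fixingSubgroup_fixedField N, IntermediateField.mem_fixingSubgroup_iff]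
    intro x hx
    rw [← hτ ⟨x, hx⟩, hfix]
  obtain ⟨σ, hσ, hστ⟩ := isUnramifiedQuadratic_fixedField τ hτ2 hτne
    (quotient_etale hH hN ht htN τ hτ)
  have haM : (a : L) ∈ IntermediateField.fixedField N :=
    (IntermediateField.mem_fixedField_iff _ _).2 fun n hn => congrArg Units.val (haN n hn)
  have ha0 : (⟨a, haM⟩ : IntermediateField.fixedField N) ≠ 0 := fun h0 =>
    a.ne_zero (congrArg Subtype.val h0)
  obtain ⟨I', hI'⟩ := (hH.mono hN).exists_extendedHom_eq (I := (C : FractionalIdeal (𝓞 L)⁰ L))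
    fun n hn => congrArg Units.val (hCN n hn)
  have hI0 : I' ≠ 0 := by
    rintro rfl
    rw [map_zero] at hI'
    exact C.ne_zero hI'.symm
  suffices hs : ∃ b : (IntermediateField.fixedField N)ˣ, b * unitAct σ b = Units.mk0 _ ha0 by
    obtain ⟨b, hb⟩ := hs
    refine ⟨Units.map (algebraMap (IntermediateField.fixedField N) L) b, fun n hn => ?_, ?_⟩
    · apply Units.ext
      exact (IntermediateField.mem_fixedField_iff _ _).1 (b : IntermediateField.fixedField N).2 n hn
    · have h1 := congrArg (fun u : (IntermediateField.fixedField N)ˣ =>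
        ((u : IntermediateField.fixedField N) : L)) hb
      apply Units.ext
      refine Eq.trans ?_ h1
      change ((b : IntermediateField.fixedField N) : L) * t ((b : IntermediateField.fixedField N) : L) =
        ((b : IntermediateField.fixedField N) : L) * ((σ b : IntermediateField.fixedField N) : L)
      rw [hστ, hτ]
  refine hσ.exists_norm_eq_of_ideal_norm_eq (I := Units.mk0 I' hI0) ?_ ?_
  · apply Units.ext
    apply Subtype.ext
    refine Eq.trans ?_ (congrArg Units.val hat)
    change ((σ ⟨a, haM⟩ : IntermediateField.fixedField N) : L) = t a
    rw [hστ, hτ]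
  · apply Units.ext
    apply FractionalIdeal.extendedHom_injective (𝓞 (IntermediateField.fixedField N))
      (IntermediateField.fixedField N) L (𝓞 L)
    have h1 := congrArg Units.val hC
    rw [Units.val_mul, idealAct_apply, coe_toPrincipalIdeal] at h1
    rw [Units.val_mul, idealAct_apply, coe_toPrincipalIdeal]
    simp only [map_mul, Units.val_mk0]
    rw [extendedHom_act σ.toRingEquiv t.toRingEquiv, hI', h1,
      IsUnramifiedQuadratic.extendedHom_spanSingleton]
    · rfl
    · intro x
      change ((σ x : IntermediateField.fixedField N) : L) = t x
      rw [hστ, hτ]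

end IsEtaleGroup

end

section

open NumberField FractionalIdeal FracAct IsUnramifiedQuadratic CocycleExtension
open scoped nonZeroDivisors

namespace IsEtaleGroup

variable {L : Type*} [Field L] [NumberField L]

variable (L) in
/-- The action of automorphisms on nonzero elements. -/
noncomputable def unitAut : (L ≃ₐ[ℚ] L) →* MulAut Lˣ where
  toFun g := Units.mapEquiv (g : L ≃* L)
  map_one' := rfl
  map_mul' _ _ := rfl

variable (L) in
/-- The action of automorphisms on nonzero fractional ideals. -/
noncomputable def idealAut : (L ≃ₐ[ℚ] L) →* MulAut (FI L) where
  toFun g := Units.mapEquiv (act g.toRingEquiv : FractionalIdeal (𝓞 L)⁰ L ≃* FractionalIdeal (𝓞 L)⁰ L)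
  map_one' := by
    ext1 I
    exact Units.ext (act_one _)
  map_mul' g h := by
    ext1 I
    exact Units.ext (act_mul g.toRingEquiv h.toRingEquiv _)

theorem exists_coboundary (N : Subgroup (L ≃ₐ[ℚ] L)) (c : (L ≃ₐ[ℚ] L) → Lˣ)
    (hc : ∀ m ∈ N, ∀ n ∈ N, c (m * n) = c m * unitAut L m (c n)) :
    ∃ b : Lˣ, ∀ m ∈ N, c m * unitAut L m b = b := by
  classical
  have : Fintype N := Fintype.ofFinite N
  have hli := (linearIndependent_monoidHom L L).comp
    (fun n : N => ((n : L ≃ₐ[ℚ] L) : L →* L)) (fun a b h => by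
      apply Subtype.ext
      exact AlgEquiv.ext fun x => DFunLike.congr_fun h x)
  obtain ⟨z, hz⟩ : ∃ z : L, ∑ n : N, (c n : L) * (n : L ≃ₐ[ℚ] L) z ≠ 0 := by
    by_contra! hall
    have := Fintype.linearIndependent_iff.1 hli (fun n => (c n : L)) (by
      ext z
      simpa using hall z) 1
    exact (c 1).ne_zero this
  refine ⟨Units.mk0 _ hz, fun m hm => Units.ext ?_⟩
  change (c m : L) * m (∑ n : N, (c n : L) * (n : L ≃ₐ[ℚ] L) z) = _
  rw [map_sum, Finset.mul_sum]
  refine Fintype.sum_equiv (Equiv.mulLeft (⟨m, hm⟩ : N)) _ _ fun n => ?_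
  rw [map_mul, ← mul_assoc]
  have := congrArg Units.val (hc m hm n n.2)
  change ((c (m * n) : Lˣ) : L) = (c m : L) * m (c n) at this
  rw [← this]
  rfl

theorem unitAut_intCast (g : L ≃ₐ[ℚ] L) (e : ℤˣ) :
    unitAut L g (Units.map (Int.castRingHom L : ℤ →* L) e) =
      Units.map (Int.castRingHom L : ℤ →* L) e := by
  apply Units.ext
  change g ((e : ℤ) : L) = ((e : ℤ) : L)
  exact map_intCast g _

theorem toPrincipalIdeal_intCast (e : ℤˣ) :
    toPrincipalIdeal (𝓞 L) L (Units.map (Int.castRingHom L : ℤ →* L) e) = 1 := by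
  rcases Int.units_eq_one_or e with rfl | rfl
  · simp
  · rw [← MonoidHom.mem_ker, ker_toPrincipalIdeal]
    exact ⟨-1, Units.ext (by simp)⟩

variable {G : Subgroup (L ≃ₐ[ℚ] L)} {Γ : Type*} [Group Γ] {π : Γ →* G}

/-- A crossed homomorphism extending a sign character of the kernel. -/
def IsExtending (π : Γ →* G) (lam : π.ker →* ℤˣ) (Λ : Subgroup Γ) (β : Γ → Lˣ) : Prop :=
  IsCrossed ((unitAut L).comp (G.subtype.comp π)) Λ β ∧
    ∀ r : π.ker, β r = Units.map (Int.castRingHom L : ℤ →* L) (lam r)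

theorem exists_isExtending_step [IsTotallyReal L] (hG : IsEtaleGroup G)
    (hsurj : Function.Surjective π) (lam : π.ker →* ℤˣ)
    (hlam : ∀ f (y : π.ker), lam ⟨f * y * f⁻¹, π.normal_ker.conj_mem y y.2 f⟩ = lam y)
    {N : Subgroup G} {t : Γ} (ht : π t ∉ N) (hconj : ∀ n ∈ N, π t * n * (π t)⁻¹ ∈ N)
    (hsq : π t * π t ∈ N) {Λ : Subgroup Γ} (hΛ : ∀ x ∈ Λ, π x ∈ N ∨ π x * (π t)⁻¹ ∈ N)
    {β : Γ → Lˣ} (hβ : IsExtending π lam (N.comap π) β) :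
    ∃ β', IsExtending π lam Λ β' := by
  classical
  obtain ⟨hc, hr⟩ := hβ
  set φ := (unitAut L).comp (G.subtype.comp π) with hφ
  set ψ := (idealAut L).comp (G.subtype.comp π) with hψ
  set P := toPrincipalIdeal (𝓞 L) L with hP
  have hPφ : ∀ g u, P (φ g u) = ψ g (P u) := fun g u =>
    toPrincipalIdeal_unitAct ((π g : G) : L ≃ₐ[ℚ] L) u
  have hkerN : ∀ r ∈ π.ker, r ∈ N.comap π := fun r hr => by
    rw [Subgroup.mem_comap, MonoidHom.mem_ker.1 hr]
    exact N.one_mem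
  -- changing the argument by an element of the kernel
  have hβr : ∀ u ∈ N.comap π, ∀ r : π.ker,
      β (u * r) = β u * Units.map (Int.castRingHom L : ℤ →* L) (lam r) := by
    intro u hu r
    rw [hc u hu r (hkerN _ r.2), hr]
    exact congrArg _ (unitAut_intCast _ _)
  have hconjΓ : ∀ m ∈ N.comap π, t * m * t⁻¹ ∈ N.comap π := by
    intro m hm
    rw [Subgroup.mem_comap, map_mul, map_mul, map_inv]
    exact hconj _ hm
  have hsqΓ : t * t ∈ N.comap π := by
    rw [Subgroup.mem_comap, map_mul]
    exact hsq
  have hconj' : ∀ m ∈ N.comap π, t⁻¹ * m * t ∈ N.comap π := by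
    intro m hm
    have : t⁻¹ * m * t = (t * t)⁻¹ * (t * m * t⁻¹) * (t * t) := by group
    rw [this]
    exact (N.comap π).mul_mem ((N.comap π).mul_mem ((N.comap π).inv_mem hsqΓ)
      (hconjΓ m hm)) hsqΓ
  obtain ⟨s, hs⟩ := hsurj.hasRightInverse
  have hdecomp : ∀ u v : Γ, π u = π v → ∃ r : π.ker, u = v * r := fun u v h =>
    ⟨⟨v⁻¹ * u, by rw [MonoidHom.mem_ker, map_mul, map_inv, h, inv_mul_cancel]⟩, by simp⟩
  set δ : Γ → Lˣ := fun u => β u * (φ t (β (t⁻¹ * u * t)))⁻¹ with hδ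
  have hδr : ∀ u ∈ N.comap π, ∀ r : π.ker, δ (u * r) = δ u := by
    intro u hu r
    have e : t⁻¹ * (u * r) * t = (t⁻¹ * u * t) *
        ((⟨t⁻¹ * r * t⁻¹⁻¹, π.normal_ker.conj_mem r r.2 t⁻¹⟩ : π.ker) : Γ) := by
      simp only [inv_inv]
      group
    have e2 : φ t (Units.map (Int.castRingHom L : ℤ →* L) (lam r)) =
      Units.map (Int.castRingHom L : ℤ →* L) (lam r) := unitAut_intCast _ _
    simp only [hδ]
    rw [hβr u hu, e, hβr _ (hconj' u hu), hlam, map_mul (φ t), e2, mul_inv, mul_mul_mul_comm,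
      mul_inv_cancel, mul_one]
  have hδs : ∀ u v, u ∈ N.comap π → π u = π v → δ u = δ v := by
    intro u v hu huv
    obtain ⟨r, rfl⟩ := hdecomp v u huv.symm
    exact (hδr u hu r).symm
  have hδc : ∀ u ∈ N.comap π, ∀ v ∈ N.comap π, δ (u * v) = δ u * φ u (δ v) := by
    intro u hu v hv
    have e : t⁻¹ * (u * v) * t = (t⁻¹ * u * t) * (t⁻¹ * v * t) := by group
    have e2 : φ t (φ (t⁻¹ * u * t) (β (t⁻¹ * v * t))) = φ u (φ t (β (t⁻¹ * v * t))) := by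
      rw [← MulAut.mul_apply, ← MulAut.mul_apply, ← map_mul, ← map_mul]
      congr 2
      group
    simp only [hδ]
    rw [hc u hu v hv, e, hc _ (hconj' u hu) _ (hconj' v hv), map_mul (φ t), e2, map_mul (φ u),
      map_inv, mul_inv, mul_mul_mul_comm]
  obtain ⟨b, hb⟩ := exists_coboundary (N.map G.subtype)
    (fun n => if h : n ∈ G then δ (s ⟨n, h⟩) else 1) (by
      rintro _ ⟨m, hm, rfl⟩ _ ⟨n, hn, rfl⟩
      have h1 : ((G.subtype m : L ≃ₐ[ℚ] L)) ∈ G := m.2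
      have h2 : ((G.subtype n : L ≃ₐ[ℚ] L)) ∈ G := n.2
      rw [dif_pos h1, dif_pos h2, dif_pos (G.mul_mem h1 h2)]
      have hm' : s m ∈ N.comap π := by
        rw [Subgroup.mem_comap, hs m]
        exact hm
      have hn' : s n ∈ N.comap π := by
        rw [Subgroup.mem_comap, hs n]
        exact hn
      have h3 := hδc _ hm' _ hn'
      have h4 : δ (s m * s n) = δ (s (m * n)) :=
        hδs _ _ ((N.comap π).mul_mem hm' hn') (by rw [map_mul, hs, hs, hs])
      rw [h4] at h3
      refine Eq.trans h3 ?_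
      rw [hφ, MonoidHom.comp_apply, MonoidHom.comp_apply, hs m]
      rfl)
  have hb' : ∀ u ∈ N.comap π, δ u * φ u b = b := by
    intro u hu
    have h1 := hb _ ⟨π u, hu, rfl⟩
    have h2 : ((G.subtype (π u) : L ≃ₐ[ℚ] L)) ∈ G := (π u).2
    rw [dif_pos h2] at h1
    rw [hδs u (s (π u)) hu (hs _).symm]
    exact h1
  have hbγ : ∀ m ∈ N.comap π, β (t * m * t⁻¹) * φ (t * m * t⁻¹) b = b * φ t (β m) := by
    intro m hm
    have h1 := hb' _ (hconjΓ m hm)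
    have e : t⁻¹ * (t * m * t⁻¹) * t = m := by group
    simp only [hδ, e] at h1
    rw [mul_right_comm, mul_inv_eq_iff_eq_mul] at h1
    exact h1
  -- the ideal
  have : Fintype N := Fintype.ofFinite N
  have hPβ : ∀ u v, u ∈ N.comap π → π u = π v → P (β u) = P (β v) := by
    intro u v hu huv
    obtain ⟨r, rfl⟩ := hdecomp v u huv.symm
    rw [hβr u hu, map_mul P, hP, toPrincipalIdeal_intCast, mul_one]
  set B0 : FractionalIdeal (𝓞 L)⁰ L :=
    ∑ n : N, ((P (β (s (n : G))) : FI L) : FractionalIdeal (𝓞 L)⁰ L) with hB0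
  have hB0ne : B0 ≠ 0 := by
    intro h0
    have h1 : ((P (β (s ((1 : N) : G))) : FI L) : FractionalIdeal (𝓞 L)⁰ L) ≤ B0 :=
      Finset.single_le_sum (f := fun n : N =>
        ((P (β (s (n : G))) : FI L) : FractionalIdeal (𝓞 L)⁰ L))
        (fun i _ => FractionalIdeal.zero_le _) (Finset.mem_univ _)
    rw [h0, FractionalIdeal.le_zero_iff] at h1
    exact Units.ne_zero _ h1
  have hB : ∀ m ∈ N.comap π, P (β m) * ψ m (Units.mk0 B0 hB0ne) = Units.mk0 B0 hB0ne := by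
    intro m hm
    apply Units.ext
    change (P (β m) : FractionalIdeal (𝓞 L)⁰ L) * act ((π m : G) : L ≃ₐ[ℚ] L).toRingEquiv B0 = B0
    rw [hB0, map_sum, Finset.mul_sum]
    refine Fintype.sum_equiv (Equiv.mulLeft (⟨π m, hm⟩ : N)) _ _ fun n => ?_
    have hn : s (n : G) ∈ N.comap π := by
      rw [Subgroup.mem_comap, hs]
      exact n.2
    have h1 := congrArg P (hc m hm _ hn)
    rw [map_mul P, hPφ, hPβ (m * s n) (s (π m * n)) ((N.comap π).mul_mem hm hn)
      (by rw [map_mul, hs, hs])] at h1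
    exact (congrArg Units.val h1).symm
  obtain ⟨β', hβ', hββ'⟩ := exists_extension (φ := φ) (ψ := ψ) P hPφ hc (t := t) ht hconjΓ hsqΓ hbγ
    hB (by
      intro a C ha hat hC hCa
      have hlift : ∀ n ∈ N.map G.subtype, ∃ m ∈ N.comap π, n = ((π m : G) : L ≃ₐ[ℚ] L) := by
        rintro _ ⟨n, hn, rfl⟩
        refine ⟨s n, ?_, ?_⟩
        · rw [Subgroup.mem_comap, hs]
          exact hn
        · rw [hs]
          rfl
      obtain ⟨μ, hμ, hμa⟩ := exists_norm_eq hG (N := N.map G.subtype) (Subgroup.map_subtype_le N)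
        (t := ((π t : G) : L ≃ₐ[ℚ] L)) (π t).2
        (by
          rintro ⟨n, hn, hnt⟩
          exact ht (by rwa [← Subtype.ext hnt]))
        (by
          rintro _ ⟨n, hn, rfl⟩
          exact ⟨_, hconj n hn, rfl⟩)
        ⟨_, hsq, rfl⟩ (a := a) (C := C)
        (by
          intro n hn
          obtain ⟨m, hm, rfl⟩ := hlift n hn
          exact ha m hm)
        hat
        (by
          intro n hn
          obtain ⟨m, hm, rfl⟩ := hlift n hn
          exact hC m hm)
        hCa
      exact ⟨μ, fun m hm => hμ _ ⟨π m, hm, rfl⟩, hμa⟩)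
    (Λ := Λ) (by
      intro x hx
      rw [Subgroup.mem_comap, Subgroup.mem_comap, map_mul, map_inv]
      exact hΛ x hx)
  exact ⟨β', hβ', fun r => (hββ' r (hkerN _ r.2)).trans (hr r)⟩

end IsEtaleGroup

end

section

open NumberField FractionalIdeal FracAct IsUnramifiedQuadratic CocycleExtension
open scoped nonZeroDivisors

namespace IsEtaleGroup

variable {L : Type*} [Field L] [NumberField L] {G : Subgroup (L ≃ₐ[ℚ] L)} {Γ : Type*} [Group Γ]
  {π : Γ →* G}

theorem exists_isExtending [IsTotallyReal L] (hG : IsEtaleGroup G)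
    (hsurj : Function.Surjective π) (lam : π.ker →* ℤˣ)
    (hlam : ∀ f (y : π.ker), lam ⟨f * y * f⁻¹, π.normal_ker.conj_mem y y.2 f⟩ = lam y) (n : ℕ) :
    ∀ H : Subgroup G, Nat.card H = 2 ^ n → ∃ β, IsExtending π lam (H.comap π) β := by
  classical
  induction n with
  | zero =>
    intro H hH
    rw [pow_zero, Subgroup.card_eq_one] at hH
    subst hH
    have hker : ∀ x, x ∈ (⊥ : Subgroup G).comap π → x ∈ π.ker := fun x hx => by
      simpa [MonoidHom.mem_ker] using hx
    refine ⟨fun x => if h : x ∈ π.ker then Units.map (Int.castRingHom L : ℤ →* L) (lam ⟨x, h⟩)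
      else 1, fun x hx y hy => ?_, fun r => dif_pos r.2⟩
    have hx := hker x hx
    have hy := hker y hy
    beta_reduce
    rw [dif_pos hx, dif_pos hy, dif_pos (π.ker.mul_mem hx hy)]
    have : lam ⟨x * y, π.ker.mul_mem hx hy⟩ = lam ⟨x, hx⟩ * lam ⟨y, hy⟩ := by
      rw [← map_mul]
      rfl
    rw [this, map_mul]
    exact congrArg _ (unitAut_intCast _ _).symm
  | succ n ih =>
    intro H hH
    have : Fact (Nat.Prime 2) := ⟨Nat.prime_two⟩
    obtain ⟨K, hK⟩ := Sylow.exists_subgroup_card_pow_prime (G := H) 2 (n := n)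
      (by rw [hH]; exact pow_dvd_pow 2 n.le_succ)
    have hidx : K.index = 2 := by
      have := K.card_mul_index
      rw [hK, hH, pow_succ] at this
      exact Nat.eq_of_mul_eq_mul_left (by positivity) this
    have hnorm : K.Normal := Subgroup.normal_of_index_eq_two hidx
    obtain ⟨β, hβ⟩ := ih (K.map H.subtype) (by
      rw [Nat.card_congr (K.equivMapOfInjective _ H.subtype_injective).toEquiv.symm, hK])
    obtain ⟨h, hh⟩ : ∃ h : H, h ∉ K := by
      by_contra! hall
      rw [(Subgroup.eq_top_iff' K).2 hall, Subgroup.index_top] at hidx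
      omega
    obtain ⟨t, ht⟩ := hsurj h
    refine exists_isExtending_step hG hsurj lam hlam (N := K.map H.subtype) (t := t) ?_ ?_ ?_ ?_ hβ
    · rintro ⟨k, hk, hkt⟩
      rw [ht] at hkt
      rw [← Subtype.ext hkt] at hh
      exact hh hk
    · rintro _ ⟨k, hk, rfl⟩
      rw [ht]
      exact ⟨h * k * h⁻¹, hnorm.conj_mem k hk h, rfl⟩
    · rw [ht]
      exact ⟨h * h, Subgroup.mul_self_mem_of_index_two hidx h, rfl⟩
    · intro x hx
      by_cases hxK : (⟨π x, hx⟩ : H) ∈ K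
      · exact Or.inl ⟨_, hxK, rfl⟩
      · refine Or.inr ⟨⟨π x, hx⟩ * h⁻¹, ?_, ?_⟩
        · rw [SetLike.mem_coe, Subgroup.mul_mem_iff_of_index_two hidx]
          simp only [hxK, false_iff, inv_mem_iff]
          exact hh
        · rw [ht]
          rfl

/-- Invariant sign characters of the kernel of a presentation of an unramified `2`-group of
automorphisms of a totally real field extend to crossed homomorphisms. -/
theorem exists_crossed [IsTotallyReal L] (hG : IsEtaleGroup G) (h2 : IsPGroup 2 G)
    (hsurj : Function.Surjective π) (lam : π.ker →* ℤˣ)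
    (hlam : ∀ f (y : π.ker), lam ⟨f * y * f⁻¹, π.normal_ker.conj_mem y y.2 f⟩ = lam y) :
    ∃ β : Γ → Lˣ, (∀ x y, β (x * y) = β x * unitAut L (π x) (β y)) ∧
      ∀ r : π.ker, β r = Units.map (Int.castRingHom L : ℤ →* L) (lam r) := by
  obtain ⟨n, hn⟩ := IsPGroup.iff_card.1 h2
  obtain ⟨β, hβ, hr⟩ := exists_isExtending hG hsurj lam hlam n ⊤ (by
    rw [Subgroup.card_top, hn])
  exact ⟨β, fun x y => hβ x (Subgroup.mem_comap.2 trivial) y (Subgroup.mem_comap.2 trivial), hr⟩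

end IsEtaleGroup

end

section

open NumberField FractionalIdeal FracAct
open scoped nonZeroDivisors

namespace IsEtaleGroup

variable {L : Type*} [Field L] [NumberField L] {G : Subgroup (L ≃ₐ[ℚ] L)}

theorem isGalois_fixedField (G : Subgroup (L ≃ₐ[ℚ] L)) :
    IsGalois (IntermediateField.fixedField G) L :=
  haveI : Finite G := inferInstance
  IsGalois.of_fixed_field L G

theorem algebraMap_trace [Fintype G] (z : L) :
    algebraMap (IntermediateField.fixedField G) L
      (Algebra.trace (IntermediateField.fixedField G) L z) = tr G z := by
  have := isGalois_fixedField G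
  rw [trace_eq_sum_automorphisms, tr]
  refine Fintype.sum_equiv ((IntermediateField.fixingSubgroupEquiv _).symm.toEquiv.trans
    (Equiv.subtypeEquivRight fun g => by rw [IntermediateField.fixingSubgroup_fixedField])) _ _
    fun σ => ?_
  rfl

theorem natAbs_discr (h : IsEtaleGroup G) :
    (discr L).natAbs = (discr (IntermediateField.fixedField G)).natAbs ^ Nat.card G := by
  classical
  have : Fintype G := Fintype.ofFinite G
  have key : differentIdeal (𝓞 (IntermediateField.fixedField G)) (𝓞 L) = ⊤ := by
    rw [eq_top_iff, ← coeIdeal_le_coeIdeal (K := L),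
      coeIdeal_differentIdeal (𝓞 (IntermediateField.fixedField G)) (IntermediateField.fixedField G),
      coeIdeal_top]
    have h0 := dual_ne_zero (𝓞 (IntermediateField.fixedField G)) (IntermediateField.fixedField G)
      (one_ne_zero : (1 : FractionalIdeal (𝓞 L)⁰ L) ≠ 0)
    rw [FractionalIdeal.le_inv_comm (one_ne_zero : (1 : FractionalIdeal (𝓞 L)⁰ L) ≠ 0) h0, inv_one]
    intro z hz
    rw [FractionalIdeal.mem_dual (one_ne_zero : (1 : FractionalIdeal (𝓞 L)⁰ L) ≠ 0)] at hz
    obtain ⟨m, x, y, h1, h2⟩ := h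
    rw [← sum_mul_tr h1 h2 z]
    have : ∀ i, ∃ t : 𝓞 L, (t : L) = tr G ((y i : L) * z) := fun i => by
      obtain ⟨t, ht⟩ := hz (y i : L) (mem_one_iff _ |>.2 ⟨y i, rfl⟩)
      refine ⟨algebraMap _ _ t, ?_⟩
      rw [← algebraMap_trace, mul_comm, ← Algebra.traceForm_apply, ← ht]
      rfl
    choose t ht using this
    refine (mem_one_iff _).2 ⟨∑ i, x i * t i, ?_⟩
    rw [map_sum]
    exact Finset.sum_congr rfl fun i _ => by rw [map_mul, ← ht]
  rw [natAbs_discr_eq_absNorm_differentIdeal_mul_natAbs_discr_pow (IntermediateField.fixedField G)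
    (𝓞 (IntermediateField.fixedField G)) L (𝓞 L), key, Ideal.absNorm_top, one_mul,
    IntermediateField.finrank_fixedField_eq_card]

end IsEtaleGroup

end

section

open NumberField

namespace QuadraticField

variable {K : Type*} [Field K] [NumberField K] (hK : Module.finrank ℚ K = 2) {D : ℕ}
  (hsq : ¬ IsSquare D) {s : K} (hs : s ^ 2 = D)

include hsq hs in
theorem linearIndependent_one_sqrt : LinearIndependent ℚ ![1, s] := by
  rw [LinearIndependent.pair_iff]
  intro a b hab
  have hb : b = 0 := by
    by_contra hb
    have h1 : s = ((-a / b : ℚ) : K) := by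
      have hb' : (b : K) ≠ 0 := by exact_mod_cast hb
      rw [Algebra.smul_def, Algebra.smul_def, mul_one] at hab
      push_cast
      rw [eq_div_iff hb']
      change (a : K) + (b : K) * s = 0 at hab
      linear_combination hab
    have h2 : ((-a / b : ℚ)) ^ 2 = D := by
      rw [h1] at hs
      exact_mod_cast hs
    apply hsq
    have := (Rat.isSquare_natCast_iff (n := D)).1 ⟨-a / b, by rw [← h2, sq]⟩
    exact this
  subst hb
  simpa using hab

include hsq hs in
theorem coords_eq_zero {a b : ℚ} (h : (a : K) + b * s = 0) : a = 0 ∧ b = 0 := by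
  have := linearIndependent_one_sqrt hsq hs
  rw [LinearIndependent.pair_iff] at this
  refine this a b ?_
  rw [Algebra.smul_def, Algebra.smul_def, mul_one]
  exact h

/-- The basis `1, √D` of a quadratic field. -/
noncomputable def sqrtBasis : Module.Basis (Fin 2) ℚ K :=
  basisOfLinearIndependentOfCardEqFinrank (linearIndependent_one_sqrt hsq hs) (by simp [hK])

theorem sqrtBasis_zero : sqrtBasis hK hsq hs 0 = 1 := by simp [sqrtBasis]

theorem sqrtBasis_one : sqrtBasis hK hsq hs 1 = s := by simp [sqrtBasis]

include hK hsq hs in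
theorem exists_coords (z : K) : ∃ a b : ℚ, z = a + b * s := by
  refine ⟨(sqrtBasis hK hsq hs).repr z 0, (sqrtBasis hK hsq hs).repr z 1, ?_⟩
  conv_lhs => rw [← (sqrtBasis hK hsq hs).sum_repr z]
  rw [Fin.sum_univ_two, sqrtBasis_zero, sqrtBasis_one, Algebra.smul_def, Algebra.smul_def, mul_one]
  rfl

theorem leftMulMatrix_eq (a b : ℚ) :
    Algebra.leftMulMatrix (sqrtBasis hK hsq hs) (a + b * s) = !![a, b * D; b, a] := by
  have e (a b : ℚ) : (a : K) + b * s =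
      a • sqrtBasis hK hsq hs 0 + b • sqrtBasis hK hsq hs 1 := by
    rw [sqrtBasis_zero, sqrtBasis_one, Algebra.smul_def, Algebra.smul_def, mul_one]
    rfl
  have e2 : ((a : K) + b * s) * s = ((b * D : ℚ) : K) + a * s := by
    push_cast
    linear_combination (b : K) * hs
  ext i j
  rw [Algebra.leftMulMatrix_eq_repr_mul]
  fin_cases j
  · simp only [Fin.zero_eta]
    rw [sqrtBasis_zero, mul_one, e, map_add, map_smul, map_smul, Module.Basis.repr_self, Module.Basis.repr_self]
    fin_cases i <;> simp
  · simp only [Fin.mk_one, sqrtBasis_one]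
    rw [e2, e, map_add, map_smul, map_smul, Module.Basis.repr_self, Module.Basis.repr_self]
    fin_cases i <;> simp

include hK hsq hs in
theorem norm_eq (a b : ℚ) : Algebra.norm ℚ ((a : K) + b * s) = a ^ 2 - D * b ^ 2 := by
  rw [Algebra.norm_eq_matrix_det (sqrtBasis hK hsq hs), leftMulMatrix_eq, Matrix.det_fin_two_of]
  ring

include hK hsq hs in
theorem trace_eq (a b : ℚ) : Algebra.trace ℚ K ((a : K) + b * s) = 2 * a := by
  rw [Algebra.trace_eq_matrix_trace (sqrtBasis hK hsq hs), leftMulMatrix_eq,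
    Matrix.trace_fin_two_of]
  ring

include hK hsq hs in
theorem exists_mul_eq (hD : D % 4 = 1) (z : 𝓞 K) :
    ∃ u v : ℤ, 2 * (D : K) * z = 2 * u + v + v * s := by
  obtain ⟨a, b, hab⟩ := exists_coords hK hsq hs (z : K)
  have hsint : IsIntegral ℤ s := by
    refine IsIntegral.of_pow two_pos ?_
    rw [hs]
    exact map_natCast (algebraMap ℤ K) D ▸ isIntegral_algebraMap
  have hz : IsIntegral ℤ (z : K) := RingOfIntegers.isIntegral_coe z
  have hzs : (z : K) * s = ((b * D : ℚ) : K) + a * s := by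
    rw [hab]
    push_cast
    linear_combination (b : K) * hs
  obtain ⟨p, hp⟩ := IsIntegrallyClosed.isIntegral_iff.1 (Algebra.isIntegral_trace (L := ℚ) hz)
  obtain ⟨q, hq⟩ := IsIntegrallyClosed.isIntegral_iff.1
    (Algebra.isIntegral_trace (L := ℚ) (hz.mul hsint))
  obtain ⟨r, hr⟩ := IsIntegrallyClosed.isIntegral_iff.1 (Algebra.isIntegral_norm ℚ hz)
  rw [hab, trace_eq hK hsq hs] at hp
  rw [hzs, trace_eq hK hsq hs] at hq
  rw [hab, norm_eq hK hsq hs] at hr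
  have hp' : (p : ℚ) = 2 * a := hp
  have hq' : (q : ℚ) = 2 * (b * D) := hq
  have hr' : (r : ℚ) = a ^ 2 - D * b ^ 2 := hr
  have h4 : 4 * D * r = D * p ^ 2 - q ^ 2 := by
    have : (4 : ℚ) * D * r = D * p ^ 2 - q ^ 2 := by
      rw [hp', hq', hr']
      ring
    exact_mod_cast this
  obtain ⟨e, he⟩ : ∃ e : ℕ, D = 4 * e + 1 := ⟨D / 4, by omega⟩
  have hpar : Even (p * D - q) := by
    by_contra hodd
    rw [Int.not_even_iff_odd] at hodd
    rw [he] at h4 hodd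
    push_cast at h4 hodd
    have h5 : Odd (p - q) := by
      have : p - q = (p * (4 * e + 1) - q) - 2 * (2 * e * p) := by ring
      rw [this]
      exact hodd.sub_even (even_two_mul _)
    have h6 : Odd (p + q) := by
      have : p + q = (p - q) + 2 * q := by ring
      rw [this]
      exact h5.add_even (even_two_mul _)
    have h7 := h5.mul h6
    have : (p - q) * (p + q) = 2 * (2 * (4 * e + 1) * r - 2 * e * p ^ 2) := by
      linear_combination -h4
    rw [this] at h7
    exact (Int.not_even_iff_odd.2 h7) (even_two_mul _)
  obtain ⟨u, hu⟩ := hpar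
  refine ⟨u, q, ?_⟩
  have h1 : (2 * u + q : ℤ) = p * D := by linear_combination -hu
  have h2 : (2 : K) * u + q = p * D := by exact_mod_cast congrArg (Int.cast : ℤ → K) h1
  have h3 : (p : K) = 2 * a := by exact_mod_cast congrArg (Rat.cast : ℚ → K) hp'
  have h4 : (q : K) = 2 * (b * D) := by exact_mod_cast congrArg (Rat.cast : ℚ → K) hq'
  rw [h2, h3, h4, hab]
  ring

include hs in
theorem exists_half (hD : D % 4 = 1) : ∃ t : 𝓞 K, 2 * (t : K) = 1 + s := by
  refine ⟨⟨(1 + s) / 2, ?_⟩, ?_⟩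
  · refine ⟨.X ^ 2 - .X - .C (((D - 1 : ℕ) / 4 : ℕ) : ℤ), ?_, ?_⟩
    · monicity!
    · simp only [Polynomial.eval₂_sub, Polynomial.eval₂_pow, Polynomial.eval₂_X,
        Polynomial.eval₂_C]
      obtain ⟨e, he⟩ : ∃ e : ℕ, D = 4 * e + 1 := ⟨D / 4, by omega⟩
      rw [he, show (4 * e + 1 - 1) / 4 = e by omega]
      rw [he] at hs
      push_cast at hs
      simp only [eq_intCast, Int.cast_natCast]
      linear_combination hs / 4
  · change 2 * ((1 + s) / 2) = 1 + s
    ring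

include hK hsq hs in
/-- Integers of a quadratic field modulo `2`. -/
theorem exists_eq_add_two_mul (hD : D % 4 = 1) :
    ∃ t : 𝓞 K, 2 * (t : K) = 1 + s ∧ ∀ z : 𝓞 K, ∃ (u v : ℤ) (y : 𝓞 K),
      (D : 𝓞 K) * z = u + v * t ∧ z = u + v * t + 2 * y := by
  obtain ⟨t, ht⟩ := exists_half hs hD
  refine ⟨t, ht, fun z => ?_⟩
  obtain ⟨u, v, h⟩ := exists_mul_eq hK hsq hs hD z
  have h1 : (D : 𝓞 K) * z = u + v * t := by
    apply RingOfIntegers.ext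
    have : ((D : K)) * z = u + v * t := by linear_combination h / 2 - (v : K) / 2 * ht
    simpa using this
  obtain ⟨e, he⟩ : ∃ e : ℕ, D = 2 * e + 1 := ⟨D / 2, by omega⟩
  refine ⟨u, v, -(e * z), h1, ?_⟩
  rw [← h1, he]
  push_cast
  ring

include hK hsq hs in
/-- The prime `2` is unramified. -/
theorem two_dvd_of_two_dvd_sq (hD : D % 4 = 1) {z : 𝓞 K} (hz : 2 ∣ z ^ 2) : 2 ∣ z := by
  obtain ⟨t, ht, H⟩ := exists_eq_add_two_mul hK hsq hs hD
  obtain ⟨u, v, y, h1, h2⟩ := H z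
  obtain ⟨w, hw⟩ := hz
  obtain ⟨e, he⟩ : ∃ e : ℕ, D = 4 * e + 1 := ⟨D / 4, by omega⟩
  have htt : t ^ 2 = t + e := by
    apply RingOfIntegers.ext
    have : (t : K) ^ 2 = t + e := by
      rw [he] at hs
      push_cast at hs
      linear_combination hs / 4 + (2 * (t : K) + s - 1) / 4 * ht
    simpa using this
  have h3 : ((u ^ 2 + v ^ 2 * e : ℤ) : 𝓞 K) + ((v ^ 2 : ℤ) : 𝓞 K) * t =
      2 * (D ^ 2 * w - u * v * t) := by
    push_cast
    linear_combination -(D * z + u + v * t) * h1 + (D : 𝓞 K) ^ 2 * hw - (v : 𝓞 K) ^ 2 * htt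
  have huniq : ∀ a b c d : ℤ, (a : 𝓞 K) + b * t = c + d * t → a = c ∧ b = d := by
    intro a b c d h
    have h' : (a : K) + b * t = c + d * t := by
      have := congrArg (algebraMap (𝓞 K) K) h
      simpa using this
    have hli := coords_eq_zero hsq hs (a := (2 * (a - c) + (b - d) : ℤ)) (b := (b - d : ℤ)) (by
      simp only [Rat.cast_intCast]
      push_cast
      linear_combination 2 * h' - ((b : K) - d) * ht)
    obtain ⟨e1, e2⟩ := hli
    have e1' : 2 * (a - c) + (b - d) = 0 := by exact_mod_cast e1
    have e2' : b - d = 0 := by exact_mod_cast e2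
    omega
  obtain ⟨a, b, _, h4, -⟩ := H (D ^ 2 * w - u * v * t)
  have h5 := huniq (D * (u ^ 2 + v ^ 2 * e)) (D * v ^ 2) (2 * a) (2 * b) (by
    push_cast at h3 ⊢
    linear_combination D * h3 + 2 * h4)
  have hDodd : ¬ (2 : ℤ) ∣ D := by omega
  have hv2 : (2 : ℤ) ∣ D * v ^ 2 := ⟨b, h5.2⟩
  have hu2 : (2 : ℤ) ∣ D * (u ^ 2 + v ^ 2 * e) := ⟨a, h5.1⟩
  have hv : (2 : ℤ) ∣ v := Int.prime_two.dvd_of_dvd_pow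
    ((Int.prime_two.dvd_or_dvd hv2).resolve_left hDodd)
  have hu : (2 : ℤ) ∣ u := by
    refine Int.prime_two.dvd_of_dvd_pow (n := 2) ?_
    have := (Int.prime_two.dvd_or_dvd hu2).resolve_left hDodd
    exact (dvd_add_left ((dvd_pow hv two_ne_zero).mul_right _)).1 this
  obtain ⟨u', rfl⟩ := hu
  obtain ⟨v', rfl⟩ := hv
  refine ⟨u' + v' * t + y, ?_⟩
  rw [h2]
  push_cast
  ring

end QuadraticField

end

section

open NumberField
open scoped nonZeroDivisors

namespace QuadraticField

variable {K : Type*} [Field K] [NumberField K] (hK : Module.finrank ℚ K = 2) {D : ℕ}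
  (hsq : ¬ IsSquare D) {s : K} (hs : s ^ 2 = D)

theorem absNorm_span_natCast (F : Type*) [Field F] [NumberField F] (m : ℕ) :
    Ideal.absNorm (Ideal.span {(m : 𝓞 F)}) = m ^ Module.finrank ℚ F := by
  rw [Ideal.absNorm_span_singleton, ← RingOfIntegers.rank, ← map_natCast (algebraMap ℤ (𝓞 F)),
    Algebra.norm_algebraMap, Int.natAbs_pow, Int.natAbs_natCast]

include hK hsq hs in
theorem exists_mem_absNorm_le {I : Ideal (𝓞 K)} (hI : I ≠ ⊥) :
    ∃ x ∈ I, x ≠ 0 ∧ Ideal.absNorm (Ideal.span {x}) ≤ D * Ideal.absNorm I := by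
  classical
  have hN : Ideal.absNorm I ≠ 0 := fun h => hI (Ideal.absNorm_eq_zero_iff.1 h)
  have hD0 : D ≠ 0 := by
    rintro rfl
    exact hsq ⟨0, rfl⟩
  have hsint : IsIntegral ℤ s := by
    refine IsIntegral.of_pow two_pos ?_
    rw [hs]
    exact map_natCast (algebraMap ℤ K) D ▸ isIntegral_algebraMap
  let t : 𝓞 K := ⟨s, hsint⟩
  have ht : (t : K) = s := rfl
  set q := Nat.sqrt (Ideal.absNorm I) with hq
  have : Finite (𝓞 K ⧸ I) := Ideal.finiteQuotientOfFreeOfNeBot I hI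
  let f : Fin (q + 1) × Fin (q + 1) → 𝓞 K ⧸ I := fun p =>
    Ideal.Quotient.mk I ((p.1 : ℕ) + (p.2 : ℕ) * t)
  have hninj : ¬ Function.Injective f := by
    intro hinj
    have := Nat.card_le_card_of_injective f hinj
    rw [Nat.card_prod, Nat.card_fin] at this
    have h2 : Nat.card (𝓞 K ⧸ I) = Ideal.absNorm I := rfl
    rw [h2] at this
    exact absurd (Nat.lt_succ_sqrt (Ideal.absNorm I)) (not_lt.2 this)
  rw [Function.Injective] at hninj
  push Not at hninj
  obtain ⟨⟨a, b⟩, ⟨a', b'⟩, hf, hne⟩ := hninj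
  have hmem := Ideal.Quotient.eq.1 hf
  refine ⟨_, hmem, fun h0 => hne ?_, ?_⟩
  · have h1 : (((a : ℤ) - a' : ℤ) : ℚ) = 0 ∧ (((b : ℤ) - b' : ℤ) : ℚ) = 0 := by
      refine coords_eq_zero hsq hs ?_
      have := congrArg (algebraMap (𝓞 K) K) h0
      simp only [map_sub, map_add, map_mul, map_natCast, map_zero] at this
      change (a : K) + b * s - (a' + b' * s) = 0 at this
      push_cast
      linear_combination this
    have h2 : ((a : ℤ) - a' : ℤ) = 0 := by exact_mod_cast h1.1
    have h3 : ((b : ℤ) - b' : ℤ) = 0 := by exact_mod_cast h1.2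
    ext
    · change (a : ℕ) = a'
      omega
    · change (b : ℕ) = b'
      omega
  · rw [Ideal.absNorm_span_singleton]
    have hn : (Algebra.norm ℤ (((a : ℕ) : 𝓞 K) + (b : ℕ) * t - ((a' : ℕ) + (b' : ℕ) * t))) =
        ((a : ℤ) - a') ^ 2 - D * ((b : ℤ) - b') ^ 2 := by
      have h1 := norm_eq hK hsq hs (((a : ℤ) - a' : ℤ) : ℚ) (((b : ℤ) - b' : ℤ) : ℚ)
      have h2 : ((((a : ℕ) : 𝓞 K) + (b : ℕ) * t - ((a' : ℕ) + (b' : ℕ) * t) : 𝓞 K) : K) =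
          ((((a : ℤ) - a' : ℤ) : ℚ) : K) + ((((b : ℤ) - b' : ℤ) : ℚ) : K) * s := by
        simp only [map_sub, map_add, map_mul, map_natCast]
        rw [show algebraMap (𝓞 K) K t = s from ht]
        push_cast
        ring
      rw [← h2, ← Algebra.coe_norm_int] at h1
      exact_mod_cast h1
    rw [hn]
    have hqq : (q : ℤ) * q ≤ Ideal.absNorm I := by exact_mod_cast Nat.sqrt_le _
    have ha := a.2
    have hb := b.2
    have ha' := a'.2
    have hb' := b'.2
    have e1 : ((a : ℤ) - a') ^ 2 ≤ Ideal.absNorm I := by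
      refine le_trans ?_ hqq
      rw [← sq]
      refine sq_le_sq' ?_ ?_ <;> omega
    have e2 : ((b : ℤ) - b') ^ 2 ≤ Ideal.absNorm I := by
      refine le_trans ?_ hqq
      rw [← sq]
      refine sq_le_sq' ?_ ?_ <;> omega
    have e3 : (Ideal.absNorm I : ℤ) ≤ D * Ideal.absNorm I :=
      le_mul_of_one_le_left (by positivity) (by exact_mod_cast Nat.one_le_iff_ne_zero.2 hD0)
    have e4 : (D : ℤ) * ((b : ℤ) - b') ^ 2 ≤ D * Ideal.absNorm I :=
      mul_le_mul_of_nonneg_left e2 (by positivity)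
    have e5 : |((a : ℤ) - a') ^ 2 - D * ((b : ℤ) - b') ^ 2| ≤ D * Ideal.absNorm I := by
      have p1 := sq_nonneg ((a : ℤ) - a')
      have p2 : (0 : ℤ) ≤ D * ((b : ℤ) - b') ^ 2 := by positivity
      rw [abs_le]
      constructor <;> linarith
    rw [Int.abs_eq_natAbs] at e5
    exact_mod_cast e5

include hK hsq hs in
theorem exists_mk0_eq (C : ClassGroup (𝓞 K)) :
    ∃ (J : Ideal (𝓞 K)) (hJ : J ∈ (Ideal (𝓞 K))⁰), Ideal.absNorm J ≤ D ∧
      ClassGroup.mk0 ⟨J, hJ⟩ = C := by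
  obtain ⟨⟨I, hI⟩, hIC⟩ := ClassGroup.mk0_surjective C⁻¹
  have hI0 : I ≠ ⊥ := nonZeroDivisors.ne_zero hI
  obtain ⟨x, hxI, hx0, hx⟩ := exists_mem_absNorm_le hK hsq hs hI0
  obtain ⟨J, hJ⟩ := Ideal.dvd_iff_le.2 ((Ideal.span_singleton_le_iff_mem I).2 hxI)
  have hJ0 : J ≠ ⊥ := by
    rintro rfl
    exact hx0 (Ideal.span_singleton_eq_bot.1 (hJ.trans (Ideal.mul_bot I)))
  refine ⟨J, mem_nonZeroDivisors_of_ne_zero hJ0, ?_, ?_⟩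
  · rw [hJ, map_mul, mul_comm] at hx
    exact le_of_mul_le_mul_right hx
      (Nat.pos_of_ne_zero fun h => hI0 (Ideal.absNorm_eq_zero_iff.1 h))
  · have h1 : ClassGroup.mk0 ⟨I, hI⟩ * ClassGroup.mk0 ⟨J, mem_nonZeroDivisors_of_ne_zero hJ0⟩ = 1 := by
      rw [← map_mul]
      refine (ClassGroup.mk0_eq_one_iff (mul_mem hI (mem_nonZeroDivisors_of_ne_zero hJ0))).2 ?_
      rw [← hJ]
      exact ⟨x, rfl⟩
    rw [hIC] at h1
    exact (inv_mul_eq_one.1 h1).symm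

include hK hsq hs in
theorem card_classGroup_le : Nat.card (ClassGroup (𝓞 K)) ≤ D ^ 3 := by
  classical
  have hm0 : ∀ m : ℕ, Ideal.span {((m + 1 : ℕ) : 𝓞 K)} ≠ ⊥ := fun m => by
    rw [Ne, Ideal.span_singleton_eq_bot]
    exact_mod_cast m.succ_ne_zero
  have : ∀ m : ℕ, Finite (𝓞 K ⧸ Ideal.span {((m + 1 : ℕ) : 𝓞 K)}) := fun m =>
    Ideal.finiteQuotientOfFreeOfNeBot _ (hm0 m)
  have hmem : ∀ (m : ℕ) (y : 𝓞 K),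
      Ideal.span {((m + 1 : ℕ) : 𝓞 K)} ⊔ Ideal.span {y} ∈ (Ideal (𝓞 K))⁰ := fun m y =>
    mem_nonZeroDivisors_of_ne_zero fun h => hm0 m (le_bot_iff.1 (le_sup_left.trans h.le))
  let f : (Σ m : Fin D, 𝓞 K ⧸ Ideal.span {(((m : ℕ) + 1 : ℕ) : 𝓞 K)}) → ClassGroup (𝓞 K) :=
    fun p => ClassGroup.mk0 ⟨_, hmem p.1 (Quotient.out p.2)⟩
  have hf : Function.Surjective f := by
    intro C
    obtain ⟨J, hJ, hJD, rfl⟩ := exists_mk0_eq hK hsq hs C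
    have hJ0 : J ≠ ⊥ := nonZeroDivisors.ne_zero hJ
    have hN : Ideal.absNorm J ≠ 0 := fun h => hJ0 (Ideal.absNorm_eq_zero_iff.1 h)
    obtain ⟨m, hm⟩ : ∃ m, Ideal.absNorm J = m + 1 := Nat.exists_eq_succ_of_ne_zero hN
    have hle : Ideal.span {((m + 1 : ℕ) : 𝓞 K)} ≤ J := by
      rw [Ideal.span_singleton_le_iff_mem, ← hm]
      exact Ideal.absNorm_mem J
    obtain ⟨y, hy⟩ := IsDedekindDomain.exists_sup_span_eq hle (hm0 m)
    refine ⟨⟨⟨m, by omega⟩, Ideal.Quotient.mk _ y⟩, ?_⟩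
    refine congrArg ClassGroup.mk0 (Subtype.ext ?_)
    change Ideal.span {((m + 1 : ℕ) : 𝓞 K)} ⊔
      Ideal.span {Quotient.out (Ideal.Quotient.mk (Ideal.span {((m + 1 : ℕ) : 𝓞 K)}) y)} = J
    set y' := Quotient.out (Ideal.Quotient.mk (Ideal.span {((m + 1 : ℕ) : 𝓞 K)}) y)
    have hyy : y' - y ∈ Ideal.span {((m + 1 : ℕ) : 𝓞 K)} :=
      Ideal.Quotient.eq.1 (Ideal.Quotient.mk_out _)
    rw [← hy]
    refine le_antisymm (sup_le le_sup_left ?_) (sup_le le_sup_left ?_)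
    · rw [Ideal.span_singleton_le_iff_mem, show y' = (y' - y) + y by ring]
      exact add_mem (Ideal.mem_sup_left hyy) (Ideal.mem_sup_right (Ideal.mem_span_singleton_self _))
    · rw [Ideal.span_singleton_le_iff_mem, show y = -(y' - y) + y' by ring]
      exact add_mem (Ideal.mem_sup_left (neg_mem hyy))
        (Ideal.mem_sup_right (Ideal.mem_span_singleton_self _))
  refine (Nat.card_le_card_of_surjective f hf).trans ?_
  rw [Nat.card_sigma]
  calc ∑ m : Fin D, Nat.card (𝓞 K ⧸ Ideal.span {(((m : ℕ) + 1 : ℕ) : 𝓞 K)})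
      ≤ ∑ _m : Fin D, D ^ 2 := Finset.sum_le_sum fun m _ => by
        have h : Nat.card (𝓞 K ⧸ Ideal.span {(((m : ℕ) + 1 : ℕ) : 𝓞 K)}) =
          Ideal.absNorm (Ideal.span {(((m : ℕ) + 1 : ℕ) : 𝓞 K)}) := rfl
        rw [h, absNorm_span_natCast, hK]
        exact Nat.pow_le_pow_left m.2 2
    _ = D ^ 3 := by
        rw [Finset.sum_const, Finset.card_univ, Fintype.card_fin, smul_eq_mul]
        ring

end QuadraticField

end

section

open NumberField

namespace IsEtaleGroup

variable {L : Type*} [Field L] [NumberField L] {G : Subgroup (L ≃ₐ[ℚ] L)}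

theorem two_dvd_sum_sq_sub {R ι : Type*} [CommRing R] (t : Finset ι) (f : ι → R) :
    (2 : R) ∣ (∑ i ∈ t, f i) ^ 2 - ∑ i ∈ t, f i ^ 2 := by
  classical
  induction t using Finset.induction_on with
  | empty => simp
  | insert a t ha ih =>
    rw [Finset.sum_insert ha, Finset.sum_insert ha]
    obtain ⟨c, hc⟩ := ih
    exact ⟨c + f a * ∑ i ∈ t, f i, by linear_combination hc⟩

theorem two_dvd_of_coe_eq {F : Type*} [Field F] [NumberField F] {a : 𝓞 F} {c : F}
    (hc : IsIntegral ℤ c) (h : (a : F) = 2 * c) : 2 ∣ a := by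
  obtain ⟨c', rfl⟩ : ∃ c' : 𝓞 F, (c' : F) = c := ⟨⟨c, hc⟩, rfl⟩
  refine ⟨c', RingOfIntegers.ext ?_⟩
  rw [h, RingOfIntegers.coe_eq_algebraMap (2 * c'), map_mul, map_ofNat]

theorem two_dvd_of_two_dvd_map {M : IntermediateField ℚ L} {t : 𝓞 M}
    (h : (2 : 𝓞 L) ∣ algebraMap (𝓞 M) (𝓞 L) t) : 2 ∣ t := by
  obtain ⟨c, hc⟩ := h
  have hc' : algebraMap M L (t : M) = 2 * (c : L) := by
    have := congrArg (algebraMap (𝓞 L) L) hc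
    rw [map_mul, map_ofNat] at this
    exact this
  have h2 : algebraMap M L ((t : M) / 2) = c := by
    rw [map_div₀, hc', map_ofNat]
    ring
  have h3 : IsIntegral ℤ (algebraMap M L ((t : M) / 2)) := by
    rw [h2]
    exact RingOfIntegers.isIntegral_coe c
  exact two_dvd_of_coe_eq ((isIntegral_algebraMap_iff (algebraMap M L).injective).1 h3) (by ring)

theorem two_dvd_of_two_dvd_sq (h : IsEtaleGroup G)
    (hred : ∀ z : 𝓞 (IntermediateField.fixedField G), 2 ∣ z ^ 2 → 2 ∣ z) {z : 𝓞 L}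
    (hz : 2 ∣ z ^ 2) : 2 ∣ z := by
  classical
  have : Fintype G := Fintype.ofFinite G
  obtain ⟨m, x, y, h1, h2⟩ := h
  have key : ∀ w : 𝓞 L, 2 ∣ w ^ 2 → ∃ c : 𝓞 L, tr G (w : L) = 2 * c := by
    intro w hw
    have hW : ∀ g : G, ∃ v : 𝓞 L, (v : L) = (g : L ≃ₐ[ℚ] L) w := fun g =>
      ⟨⟨_, isIntegral_apply _ (RingOfIntegers.isIntegral_coe w)⟩, rfl⟩
    choose W hW using hW
    obtain ⟨t, ht⟩ : ∃ t : 𝓞 (IntermediateField.fixedField G),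
        algebraMap (𝓞 (IntermediateField.fixedField G)) (𝓞 L) t = ∑ g, W g := by
      have h_int : IsIntegral ℤ (tr G (w : L)) := isIntegral_tr (RingOfIntegers.isIntegral_coe w)
      refine ⟨⟨⟨tr G (w : L), tr_mem _⟩, (isIntegral_algebraMap_iff
        (algebraMap (IntermediateField.fixedField G) L).injective).1 h_int⟩, ?_⟩
      apply RingOfIntegers.ext
      rw [RingOfIntegers.coe_eq_algebraMap (∑ g, W g), map_sum]
      exact Finset.sum_congr rfl fun g _ => (hW g).symm
    have h3 : (2 : 𝓞 L) ∣ ∑ g, W g ^ 2 := Finset.dvd_sum fun g _ => by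
      obtain ⟨c, hc⟩ := hw
      refine two_dvd_of_coe_eq (isIntegral_apply (g : L ≃ₐ[ℚ] L)
        (RingOfIntegers.isIntegral_coe c)) ?_
      rw [RingOfIntegers.coe_eq_algebraMap, map_pow]
      change (W g : L) ^ 2 = 2 * (g : L ≃ₐ[ℚ] L) c
      have hc' : (w : L) ^ 2 = 2 * c := by
        have := congrArg (algebraMap (𝓞 L) L) hc
        rwa [map_mul, map_ofNat, map_pow] at this
      rw [hW, ← map_pow, hc', map_mul, map_ofNat]
    have h4 : (2 : 𝓞 L) ∣ (∑ g, W g) ^ 2 :=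
      (dvd_sub_right h3).1 ((dvd_neg.2 (two_dvd_sum_sq_sub Finset.univ W)).trans (by simp))
    rw [← ht, ← map_pow] at h4
    obtain ⟨c, hc⟩ := hred t (two_dvd_of_two_dvd_map h4)
    refine ⟨algebraMap _ (𝓞 L) c, ?_⟩
    have : tr G (w : L) = ((∑ g, W g : 𝓞 L) : L) := by
      rw [RingOfIntegers.coe_eq_algebraMap (∑ g, W g), map_sum]
      exact Finset.sum_congr rfl fun g _ => (hW g).symm
    rw [this, ← ht, hc, map_mul, map_ofNat, RingOfIntegers.coe_eq_algebraMap (2 * _), map_mul, map_ofNat]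
  have hc : ∀ i, ∃ c : 𝓞 L, tr G ((y i : L) * z) = 2 * c := fun i => by
    have := key (y i * z) (by rw [mul_pow]; exact hz.mul_left _)
    rwa [RingOfIntegers.coe_eq_algebraMap, map_mul] at this
  choose c hc using hc
  refine ⟨∑ i, x i * c i, ?_⟩
  apply RingOfIntegers.ext
  rw [RingOfIntegers.coe_eq_algebraMap (2 * _), map_mul, map_ofNat, map_sum, Finset.mul_sum]
  conv_lhs => rw [← sum_mul_tr h1 h2 (z : L)]
  refine Finset.sum_congr rfl fun i _ => ?_
  rw [hc, map_mul]
  ring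

end IsEtaleGroup

end

section

open NumberField

/-- `L'` is obtained from `L` by adjoining a square root `s` of the nonsquare `α`. -/
structure IsSqrtExtension {L L' : Type*} [Field L] [Field L'] [Algebra L L'] (α : L) (s : L') :
    Prop where
  sq_eq : s ^ 2 = algebraMap L L' α
  exists_coords : ∀ z : L', ∃ a b : L, z = algebraMap L L' a + algebraMap L L' b * s
  coords_eq_zero : ∀ a b : L, algebraMap L L' a + algebraMap L L' b * s = 0 → a = 0 ∧ b = 0
  exists_lift : ∀ (φ : L →+* L') (x : L'), x ^ 2 = φ α →
    ∃ ψ : L' →+* L', (∀ y, ψ (algebraMap L L' y) = φ y) ∧ ψ s = x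

theorem exists_isSqrtExtension {L : Type} [Field L] [NumberField L] {α : L}
    (hα : ¬ IsSquare α) : ∃ (L' : Type) (_ : Field L') (_ : NumberField L') (_ : Algebra L L')
      (s : L'), IsSqrtExtension α s := by
  have hirr : Irreducible (Polynomial.X ^ 2 - Polynomial.C α : Polynomial L) := by
    refine X_pow_sub_C_irreducible_of_prime Nat.prime_two fun b hb => hα ⟨b, ?_⟩
    rw [← hb, sq]
  have : Fact (Irreducible (Polynomial.X ^ 2 - Polynomial.C α : Polynomial L)) := ⟨hirr⟩
  set f : Polynomial L := Polynomial.X ^ 2 - Polynomial.C α with hf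
  have hdeg : f.natDegree = 2 := Polynomial.natDegree_X_pow_sub_C
  have hmonic : f.Monic := Polynomial.monic_X_pow_sub_C α two_ne_zero
  have : CharZero (AdjoinRoot f) := charZero_of_injective_algebraMap
    (algebraMap L (AdjoinRoot f)).injective
  have : FiniteDimensional L (AdjoinRoot f) := hmonic.finite_adjoinRoot
  have : FiniteDimensional ℚ (AdjoinRoot f) := FiniteDimensional.trans ℚ L (AdjoinRoot f)
  have hcoords : ∀ a b : L, algebraMap L (AdjoinRoot f) a + algebraMap L (AdjoinRoot f) b *
      AdjoinRoot.root f = AdjoinRoot.mk f (Polynomial.C b * Polynomial.X + Polynomial.C a) :=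
    fun a b => by
      rw [map_add, map_mul, AdjoinRoot.mk_X, AdjoinRoot.mk_C, AdjoinRoot.mk_C, add_comm]
      rfl
  refine ⟨AdjoinRoot f, inferInstance, ⟨⟩, inferInstance, AdjoinRoot.root f, ?_, ?_, ?_, ?_⟩
  · have := AdjoinRoot.eval₂_root f
    rw [hf, Polynomial.eval₂_sub, Polynomial.eval₂_pow, Polynomial.eval₂_X, Polynomial.eval₂_C,
      sub_eq_zero] at this
    exact this
  · intro z
    obtain ⟨p, rfl⟩ := AdjoinRoot.mk_surjective z
    have h1 : AdjoinRoot.mk f p = AdjoinRoot.mk f (p %ₘ f) := by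
      rw [AdjoinRoot.mk_eq_mk]
      exact ⟨p /ₘ f, by linear_combination -Polynomial.modByMonic_add_div p f⟩
    have h2 : (p %ₘ f).natDegree ≤ 1 := by
      have := Polynomial.natDegree_modByMonic_lt p hmonic (by
        intro h
        rw [h] at hdeg
        simp at hdeg)
      omega
    refine ⟨(p %ₘ f).coeff 0, (p %ₘ f).coeff 1, ?_⟩
    rw [hcoords, h1]
    exact congrArg _ (Polynomial.eq_X_add_C_of_natDegree_le_one h2)
  · intro a b h
    rw [hcoords, AdjoinRoot.mk_eq_zero] at h
    have h0 := Polynomial.eq_zero_of_dvd_of_natDegree_lt h (by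
      rw [hdeg]
      exact lt_of_le_of_lt Polynomial.natDegree_linear_le one_lt_two)
    constructor
    · simpa using congrArg (fun q => q.coeff 0) h0
    · simpa using congrArg (fun q => q.coeff 1) h0
  · intro φ x hx
    refine ⟨AdjoinRoot.lift φ x ?_, fun y => ?_, ?_⟩
    · change Polynomial.eval₂ φ x (Polynomial.X ^ 2 - Polynomial.C α) = 0
      simp only [Polynomial.eval₂_sub, Polynomial.eval₂_pow, Polynomial.eval₂_X, Polynomial.eval₂_C,
        hx, sub_self]
    · exact AdjoinRoot.lift_of _
    · exact AdjoinRoot.lift_root _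

namespace IsSqrtExtension

variable {L L' : Type*} [Field L] [NumberField L] [Field L'] [NumberField L'] [Algebra L L']
  {α : L} {s : L'} (h : IsSqrtExtension α s)

include h

theorem exists_lift_aut (g : L ≃ₐ[ℚ] L) {w : L} (hw : g α = w ^ 2 * α) :
    ∃ g' : L' ≃ₐ[ℚ] L', (∀ x, g' (algebraMap L L' x) = algebraMap L L' (g x)) ∧
      g' s = algebraMap L L' w * s := by
  obtain ⟨ψ, h1, h2⟩ := h.exists_lift ((algebraMap L L').comp g.toRingEquiv.toRingHom)
    (algebraMap L L' w * s) (by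
      rw [mul_pow, h.sq_eq, ← map_pow, ← map_mul, ← hw]
      rfl)
  exact ⟨AlgEquiv.ofBijective ψ.toRatAlgHom (AlgHom.bijective _), h1, h2⟩

theorem aut_ext {g₁ g₂ : L' ≃ₐ[ℚ] L'}
    (h1 : ∀ x, g₁ (algebraMap L L' x) = g₂ (algebraMap L L' x)) (h2 : g₁ s = g₂ s) : g₁ = g₂ := by
  ext z
  obtain ⟨a, b, rfl⟩ := h.exists_coords z
  rw [map_add, map_mul, map_add, map_mul, h1, h1, h2]

theorem ne_zero : s ≠ 0 := fun hs => by
  have := (h.coords_eq_zero 0 1 (by rw [hs]; simp)).2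
  exact one_ne_zero this

theorem finrank_eq : Module.finrank ℚ L' = 2 * Module.finrank ℚ L := by
  have hli : LinearIndependent L ![1, s] := by
    rw [LinearIndependent.pair_iff]
    intro a b hab
    rw [Algebra.smul_def, Algebra.smul_def, mul_one] at hab
    exact h.coords_eq_zero a b hab
  have hsp : ⊤ ≤ Submodule.span L (Set.range ![(1 : L'), s]) := by
    intro z _
    obtain ⟨a, b, rfl⟩ := h.exists_coords z
    rw [Matrix.range_cons, Matrix.range_cons, Matrix.range_empty, Set.union_empty,
      Set.singleton_union, Submodule.mem_span_pair]
    exact ⟨a, b, by rw [Algebra.smul_def, Algebra.smul_def, mul_one]⟩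
  have h2 : Module.finrank L L' = 2 := by
    rw [Module.finrank_eq_card_basis (Module.Basis.mk hli hsp), Fintype.card_fin]
  rw [← Module.finrank_mul_finrank ℚ L L', h2, mul_comm]

theorem isTotallyReal [IsTotallyReal L] (hpos : ∀ φ : L →+* ℝ, 0 < φ α) : IsTotallyReal L' := by
  refine ⟨fun v => ?_⟩
  rw [← InfinitePlace.mk_embedding v, InfinitePlace.isReal_mk_iff]
  set φ := v.embedding
  have hreal := IsTotallyReal.complexEmbedding_isReal (φ.comp (algebraMap L L'))
  have h1 : ∀ x : L, (starRingEnd ℂ) (φ (algebraMap L L' x)) = φ (algebraMap L L' x) := fun x =>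
    RingHom.congr_fun hreal x
  have h2 : (φ s) ^ 2 = ((hreal.embedding α : ℝ) : ℂ) := by
    rw [ComplexEmbedding.IsReal.coe_embedding_apply, ← map_pow, h.sq_eq]
    rfl
  have h3 : (starRingEnd ℂ) (φ s) = φ s := by
    have h4 : (φ s) ^ 2 = ((Real.sqrt (hreal.embedding α) : ℝ) : ℂ) ^ 2 := by
      rw [h2, ← Complex.ofReal_pow, Real.sq_sqrt (hpos _).le]
    rcases sq_eq_sq_iff_eq_or_eq_neg.1 h4 with h5 | h5
    · rw [h5, Complex.conj_ofReal]
    · rw [h5, map_neg, Complex.conj_ofReal]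
  ext z
  obtain ⟨a, b, rfl⟩ := h.exists_coords z
  rw [ComplexEmbedding.conjugate_coe_eq, map_add, map_mul, map_add, map_mul, h1, h1, h3]

end IsSqrtExtension

end

section

open NumberField FractionalIdeal
open scoped nonZeroDivisors

namespace IsSqrtExtension

variable {L L' : Type*} [Field L] [NumberField L] [Field L'] [NumberField L'] [Algebra L L']
  {α : L} {s : L'} (h : IsSqrtExtension α s)

theorem exists_etale_of_mem_span {σ : L' ≃ₐ[ℚ] L'}
    (hspan : (1 : 𝓞 L') ∈ Ideal.span {c : 𝓞 L' | ∃ b : 𝓞 L', (c : L') = b - σ b}) :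
    ∃ (m : ℕ) (u v : Fin m → 𝓞 L'), ∑ i, (u i : L') * (v i : L') = 1 ∧
      ∑ i, (u i : L') * σ (v i : L') = 0 := by
  obtain ⟨n, f, c, hfc⟩ := Submodule.mem_span_set'.1 hspan
  have hb : ∀ i, ∃ b : 𝓞 L', ((c i : 𝓞 L') : L') = b - σ b := fun i => (c i).2
  choose b hb using hb
  have hsum : ∑ i, (f i : L') * (b i - σ (b i)) = 1 := by
    have := congrArg (algebraMap (𝓞 L') L') hfc
    rw [map_sum, map_one] at this
    rw [← this]
    refine Finset.sum_congr rfl fun i _ => ?_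
    rw [smul_eq_mul, map_mul, ← RingOfIntegers.coe_eq_algebraMap (c i : 𝓞 L'), hb]
  have h_int : ∀ z : 𝓞 L', IsIntegral ℤ (σ (z : L')) := fun z =>
    (RingOfIntegers.isIntegral_coe z).map (σ.toRingEquiv.toRingHom.toIntAlgHom)
  have hσb : ∀ i, ∃ e : 𝓞 L', (e : L') = σ (b i) := fun i => ⟨⟨_, h_int (b i)⟩, rfl⟩
  choose e he using hσb
  have hu0 : ((-∑ i, f i * e i : 𝓞 L') : L') = -∑ i, (f i : L') * σ (b i) := by
    rw [RingOfIntegers.coe_eq_algebraMap, map_neg, map_sum]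
    simp only [map_mul, he]
  have hone : ((1 : 𝓞 L') : L') = 1 := by rw [RingOfIntegers.coe_eq_algebraMap, map_one]
  refine ⟨n + 1, Fin.cons (-∑ i, f i * e i) f, Fin.cons 1 b, ?_, ?_⟩
  · rw [Fin.sum_univ_succ]
    simp only [Fin.cons_zero, Fin.cons_succ]
    rw [hu0, ← hsum, hone]
    simp only [mul_sub, Finset.sum_sub_distrib]
    ring
  · rw [Fin.sum_univ_succ]
    simp only [Fin.cons_zero, Fin.cons_succ]
    rw [hu0, hone, map_one]
    ring

include h

theorem exists_etale {x : 𝓞 L} (hx : α = 1 + 4 * (x : L)) {J : FractionalIdeal (𝓞 L)⁰ L}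
    (hJ0 : J ≠ 0) (hJ : J * J = spanSingleton (𝓞 L)⁰ α) {σ : L' ≃ₐ[ℚ] L'}
    (hσ : ∀ y, σ (algebraMap L L' y) = algebraMap L L' y) (hσs : σ s = -s) :
    ∃ (m : ℕ) (u v : Fin m → 𝓞 L'), ∑ i, (u i : L') * (v i : L') = 1 ∧
      ∑ i, (u i : L') * σ (v i : L') = 0 := by
  have hαint : IsIntegral ℤ α := by
    rw [hx]
    have : IsIntegral ℤ ((1 + 4 * x : 𝓞 L) : L) := RingOfIntegers.isIntegral_coe _
    rwa [RingOfIntegers.coe_eq_algebraMap, map_add, map_mul, map_one, map_ofNat] at this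
  have hα0 : α ≠ 0 := by
    rintro rfl
    rw [spanSingleton_zero] at hJ
    exact hJ0 (mul_self_eq_zero.1 hJ)
  have hsq : ∀ r : L, IsIntegral ℤ (r ^ 2 * α) → IsIntegral ℤ (algebraMap L L' r * s) := by
    intro r hr
    refine IsIntegral.of_pow two_pos ?_
    rw [mul_pow, h.sq_eq, ← map_pow, ← map_mul]
    exact hr.map (algebraMap L L').toIntAlgHom
  have hsint : IsIntegral ℤ s := by simpa using hsq 1 (by simpa using hαint)
  obtain ⟨S, hS⟩ : ∃ S : 𝓞 L', (S : L') = s := ⟨⟨s, hsint⟩, rfl⟩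
  apply exists_etale_of_mem_span
  set I := Ideal.span {c : 𝓞 L' | ∃ b : 𝓞 L', (c : L') = b - σ b}
  have hSI : S ∈ I := by
    refine Ideal.subset_span ?_
    have h_int : IsIntegral ℤ ((1 + s) / 2) := by
      have hmon : (Polynomial.X ^ 2 - Polynomial.X : Polynomial ℤ).Monic := by monicity!
      have hdeg : (Polynomial.X ^ 2 - Polynomial.X : Polynomial ℤ).natDegree = 2 := by
        compute_degree!
      refine IsIntegral.of_aeval_monic hmon (by rw [hdeg]; exact two_ne_zero) ?_
      have : Polynomial.aeval ((1 + s) / 2) (Polynomial.X ^ 2 - Polynomial.X : Polynomial ℤ) =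
          algebraMap L L' x := by
        rw [map_sub, map_pow, Polynomial.aeval_X]
        have hs2 := h.sq_eq
        rw [hx, map_add, map_mul, map_one, map_ofNat] at hs2
        linear_combination hs2 / 4
      rw [this]
      exact (RingOfIntegers.isIntegral_coe x).map (algebraMap L L').toIntAlgHom
    refine ⟨⟨_, h_int⟩, ?_⟩
    change (S : L') = (1 + s) / 2 - σ ((1 + s) / 2)
    rw [hS, map_div₀, map_add, map_one, map_ofNat, hσs]
    ring
  have hαSS : ∀ t : 𝓞 L, (t : L) = α → algebraMap (𝓞 L) (𝓞 L') t = S * S := fun t ht => by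
    apply RingOfIntegers.ext
    rw [RingOfIntegers.coe_eq_algebraMap (S * S), map_mul, ← RingOfIntegers.coe_eq_algebraMap S, hS, ← sq, h.sq_eq, ← ht]
    rfl
  have hinv : J⁻¹ * J⁻¹ = spanSingleton (𝓞 L)⁰ α⁻¹ := by
    rw [← mul_inv, hJ, spanSingleton_inv]
  have hJint : ∀ r ∈ J⁻¹, ∀ r' ∈ J⁻¹, IsIntegral ℤ (r * r' * α) := by
    intro r hr r' hr'
    have := mul_mem_mul hr hr'
    rw [hinv, mem_spanSingleton] at this
    obtain ⟨z, hz⟩ := this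
    rw [← hz, Algebra.smul_def, inv_mul_cancel_right₀ hα0]
    exact RingOfIntegers.isIntegral_coe z
  have key : ∀ r ∈ J⁻¹ * J⁻¹, ∃ c ∈ I, (c : L') = 2 * algebraMap L L' (r * α) := by
    intro r hr
    refine FractionalIdeal.mul_induction_on hr (fun i hi j hj => ?_) fun a b ha hb => ?_
    · have h1 : IsIntegral ℤ (algebraMap L L' i * s) := hsq i (by rw [sq]; exact hJint i hi i hi)
      have h2 : IsIntegral ℤ (algebraMap L L' j * s) := hsq j (by rw [sq]; exact hJint j hj j hj)
      obtain ⟨A, hA⟩ : ∃ A : 𝓞 L', (A : L') = algebraMap L L' i * s := ⟨⟨_, h1⟩, rfl⟩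
      obtain ⟨B, hB⟩ : ∃ B : 𝓞 L', (B : L') = algebraMap L L' j * s := ⟨⟨_, h2⟩, rfl⟩
      refine ⟨A * (2 * B), Ideal.mul_mem_left _ _ (Ideal.subset_span ⟨B, ?_⟩), ?_⟩
      · rw [RingOfIntegers.coe_eq_algebraMap (2 * B), map_mul, map_ofNat, ← RingOfIntegers.coe_eq_algebraMap B, hB, map_mul, hσ, hσs]
        ring
      · rw [RingOfIntegers.coe_eq_algebraMap (A * _), map_mul, map_mul, map_ofNat, ← RingOfIntegers.coe_eq_algebraMap A,
          ← RingOfIntegers.coe_eq_algebraMap B, hA, hB, map_mul,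
          map_mul, ← h.sq_eq]
        ring
    · obtain ⟨c, hc, hc'⟩ := ha
      obtain ⟨d, hd, hd'⟩ := hb
      refine ⟨c + d, add_mem hc hd, ?_⟩
      rw [RingOfIntegers.coe_eq_algebraMap (c + d), map_add, ← RingOfIntegers.coe_eq_algebraMap c,
        ← RingOfIntegers.coe_eq_algebraMap d, hc', hd', add_mul, map_add]
      ring
  have h2I : (2 : 𝓞 L') ∈ I := by
    obtain ⟨c, hc, hc'⟩ := key α⁻¹ (by rw [hinv]; exact mem_spanSingleton_self _ _)
    rw [inv_mul_cancel₀ hα0, map_one, mul_one] at hc'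
    have : c = 2 := RingOfIntegers.ext (by rw [hc', RingOfIntegers.coe_eq_algebraMap, map_ofNat])
    rwa [← this]
  have h1 : (1 : 𝓞 L') = S * S - 2 * (2 * algebraMap (𝓞 L) (𝓞 L') x) := by
    rw [← hαSS (1 + 4 * x) (by
      rw [RingOfIntegers.coe_eq_algebraMap, map_add, map_mul, map_one, map_ofNat, hx]),
      map_add, map_mul, map_ofNat, map_one]
    ring
  rw [h1]
  exact sub_mem (Ideal.mul_mem_left _ _ hSI) (Ideal.mul_mem_right _ _ h2I)

end IsSqrtExtension

end

section

open NumberField FractionalIdeal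
open scoped nonZeroDivisors

/-- `L` is a totally real field with a `2`-group `G` of automorphisms over which it is étale (at
the level of rings of integers) and whose fixed field is a quadratic field containing `√D`. -/
structure IsQuadraticTower (D : ℕ) {L : Type*} [Field L] [NumberField L]
    (G : Subgroup (L ≃ₐ[ℚ] L)) : Prop where
  isTotallyReal : IsTotallyReal L
  isPGroup : IsPGroup 2 G
  finrank_eq : Module.finrank ℚ L = 2 * Nat.card G
  isEtale : IsEtaleGroup G
  exists_sqrt : ∃ s : L, (∀ g ∈ G, g s = s) ∧ s ^ 2 = D

namespace IsSqrtExtension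

variable {L L' : Type*} [Field L] [NumberField L] [Field L'] [NumberField L'] [Algebra L L']
  {α : L} {s : L'} {G : Subgroup (L ≃ₐ[ℚ] L)}

variable (L') in
/-- The automorphisms of `L'` that restrict to elements of `G`. -/
def liftGroup (G : Subgroup (L ≃ₐ[ℚ] L)) : Subgroup (L' ≃ₐ[ℚ] L') where
  carrier := {g' | ∃ g ∈ G, ∀ x, g' (algebraMap L L' x) = algebraMap L L' (g x)}
  one_mem' := ⟨1, one_mem _, fun _ => rfl⟩
  mul_mem' := by
    rintro a b ⟨g, hg, h1⟩ ⟨g', hg', h2⟩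
    exact ⟨g * g', mul_mem hg hg', fun x => by rw [AlgEquiv.mul_apply, h2, h1, AlgEquiv.mul_apply]⟩
  inv_mem' := by
    rintro a ⟨g, hg, h1⟩
    refine ⟨g⁻¹, inv_mem hg, fun x => a.injective ?_⟩
    rw [h1, ← AlgEquiv.mul_apply, ← AlgEquiv.mul_apply, mul_inv_cancel, mul_inv_cancel]
    rfl

theorem exists_restrictHom : ∃ ρ : liftGroup L' G →* G,
    ∀ (g' : liftGroup L' G) x,
      (g' : L' ≃ₐ[ℚ] L') (algebraMap L L' x) = algebraMap L L' ((ρ g' : L ≃ₐ[ℚ] L) x) := by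
  have h : ∀ g' : liftGroup L' G, ∃ g : G, ∀ x,
      (g' : L' ≃ₐ[ℚ] L') (algebraMap L L' x) = algebraMap L L' ((g : L ≃ₐ[ℚ] L) x) := fun g' => by
    obtain ⟨g, hg, h⟩ := g'.2
    exact ⟨⟨g, hg⟩, h⟩
  choose f hf using h
  refine ⟨MonoidHom.mk' f fun a b => Subtype.ext (AlgEquiv.ext fun x =>
    (algebraMap L L').injective ?_), hf⟩
  rw [← hf, Subgroup.coe_mul, AlgEquiv.mul_apply, hf, hf, Subgroup.coe_mul, AlgEquiv.mul_apply]

theorem restrictHom_surjective (h : IsSqrtExtension α s) (hG : ∀ g ∈ G, ∃ w : L, g α = w ^ 2 * α)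
    {ρ : liftGroup L' G →* G} (hρ : ∀ (g' : liftGroup L' G) x,
      (g' : L' ≃ₐ[ℚ] L') (algebraMap L L' x) = algebraMap L L' ((ρ g' : L ≃ₐ[ℚ] L) x)) :
    Function.Surjective ρ := fun g => by
  obtain ⟨w, hw⟩ := hG g g.2
  obtain ⟨g', h1, -⟩ := h.exists_lift_aut g.1 hw
  refine ⟨⟨g', g.1, g.2, h1⟩, Subtype.ext (AlgEquiv.ext fun x => (algebraMap L L').injective ?_)⟩
  rw [← hρ, h1]

theorem apply_eq_or (h : IsSqrtExtension α s) {g' : L' ≃ₐ[ℚ] L'}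
    (hg : ∀ x : L, g' (algebraMap L L' x) = algebraMap L L' x) : g' s = s ∨ g' s = -s := by
  rw [← sq_eq_sq_iff_eq_or_eq_neg, ← map_pow, h.sq_eq, hg]

theorem exists_conj (h : IsSqrtExtension α s) : ∃ σ : L' ≃ₐ[ℚ] L',
    (∀ x : L, σ (algebraMap L L' x) = algebraMap L L' x) ∧ σ s = -s := by
  obtain ⟨σ, h1, h2⟩ := h.exists_lift_aut 1 (w := -1) (by simp)
  exact ⟨σ, h1, by rw [h2]; simp⟩

theorem card_liftGroup (h : IsSqrtExtension α s) (hG : ∀ g ∈ G, ∃ w : L, g α = w ^ 2 * α) :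
    Nat.card (liftGroup L' G) = 2 * Nat.card G := by
  obtain ⟨ρ, hρ⟩ := exists_restrictHom (L' := L') (G := G)
  have hs := h.restrictHom_surjective hG hρ
  rw [Subgroup.card_eq_card_quotient_mul_card_subgroup ρ.ker,
    Nat.card_congr (QuotientGroup.quotientKerEquivOfSurjective ρ hs).toEquiv, mul_comm]
  congr 1
  obtain ⟨σ, h1, h2⟩ := h.exists_conj
  rw [Nat.card_eq_two_iff]
  have hσ : ρ ⟨σ, 1, one_mem _, h1⟩ = 1 :=
    Subtype.ext (AlgEquiv.ext fun x => (algebraMap L L').injective (by rw [← hρ, h1]; rfl))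
  refine ⟨1, ⟨⟨σ, 1, one_mem _, h1⟩, hσ⟩, fun h0 => ?_, Set.eq_univ_of_forall fun g => ?_⟩
  · have : (1 : L' ≃ₐ[ℚ] L') = σ := congrArg (fun y : ρ.ker => ((y : liftGroup L' G) : L' ≃ₐ[ℚ] L')) h0
    rw [← this, AlgEquiv.one_apply, eq_neg_iff_add_eq_zero, ← two_mul] at h2
    exact h.ne_zero ((mul_eq_zero.1 h2).resolve_left two_ne_zero)
  · have hg : ∀ x : L, (g : L' ≃ₐ[ℚ] L') (algebraMap L L' x) = algebraMap L L' x := fun x => by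
      rw [hρ, (MonoidHom.mem_ker).1 g.2]
      rfl
    rcases h.apply_eq_or hg with hs | hs
    · exact Or.inl (Subtype.ext (Subtype.ext (h.aut_ext hg hs)))
    · exact Or.inr (Subtype.ext (Subtype.ext (h.aut_ext (fun x => (hg x).trans (h1 x).symm)
        (hs.trans h2.symm))))

theorem isEtaleGroup_liftGroup (h : IsSqrtExtension α s) (hG : IsEtaleGroup G) {x : 𝓞 L}
    (hx : α = 1 + 4 * (x : L)) {J : FractionalIdeal (𝓞 L)⁰ L} (hJ0 : J ≠ 0)
    (hJ : J * J = spanSingleton _ α) : IsEtaleGroup (liftGroup L' G) := by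
  obtain ⟨σ, h1, h2⟩ := h.exists_conj
  obtain ⟨m, u, v, hu, hv⟩ := h.exists_etale hx hJ0 hJ h1 h2
  obtain ⟨n, x, y, hx, hy⟩ := hG
  have hc : ∀ z : 𝓞 L, ((algebraMap (𝓞 L) (𝓞 L') z : 𝓞 L') : L') = algebraMap L L' z :=
    fun z => rfl
  have hm : ∀ a b : 𝓞 L', ((a * b : 𝓞 L') : L') = a * b := fun a b => map_mul _ _ _
  refine ⟨n * m, fun k => algebraMap _ _ (x (finProdFinEquiv.symm k).1) *
      u (finProdFinEquiv.symm k).2, fun k => algebraMap _ _ (y (finProdFinEquiv.symm k).1) *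
      v (finProdFinEquiv.symm k).2, ?_, ?_⟩
  · rw [← finProdFinEquiv.sum_comp, Fintype.sum_prod_type]
    simp only [Equiv.symm_apply_apply, hm, hc]
    calc _ = ∑ i, ∑ j, (algebraMap L L' (x i) * algebraMap L L' (y i)) * ((u j : L') * v j) :=
          Finset.sum_congr rfl fun i _ => Finset.sum_congr rfl fun j _ => by ring
      _ = (∑ i, algebraMap L L' (x i) * algebraMap L L' (y i)) * ∑ j, (u j : L') * v j :=
          (Finset.sum_mul_sum _ _ _ _).symm
      _ = 1 := by
          rw [hu, mul_one, ← map_one (algebraMap L L'), ← hx, map_sum]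
          exact Finset.sum_congr rfl fun i _ => (map_mul _ _ _).symm
  · rintro g' ⟨g, hg, hgg⟩ hne
    rw [← finProdFinEquiv.sum_comp, Fintype.sum_prod_type]
    simp only [Equiv.symm_apply_apply, hm, hc]
    calc _ = ∑ i, ∑ j, (algebraMap L L' (x i) * algebraMap L L' (g (y i))) *
            ((u j : L') * g' (v j : L')) :=
          Finset.sum_congr rfl fun i _ => Finset.sum_congr rfl fun j _ => by
            rw [map_mul, hgg]; ring
      _ = (∑ i, algebraMap L L' (x i) * algebraMap L L' (g (y i))) *
            ∑ j, (u j : L') * g' (v j : L') := (Finset.sum_mul_sum _ _ _ _).symm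
      _ = 0 := by
          by_cases h0 : g = 1
          · subst h0
            rcases h.apply_eq_or hgg with hs | hs
            · exact absurd (h.aut_ext (g₂ := 1) hgg hs) hne
            · rw [h.aut_ext (g₂ := σ) (fun x => (hgg x).trans (h1 x).symm) (hs.trans h2.symm), hv,
                mul_zero]
          · simp only [← map_mul, ← map_sum]
            rw [hy g hg h0, map_zero, zero_mul]

theorem isQuadraticTower_liftGroup {D : ℕ} (h : IsSqrtExtension α s) (hT : IsQuadraticTower D G)
    (hG : ∀ g ∈ G, ∃ w : L, g α = w ^ 2 * α) {x : 𝓞 L} (hx : α = 1 + 4 * (x : L))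
    {J : FractionalIdeal (𝓞 L)⁰ L} (hJ0 : J ≠ 0) (hJ : J * J = spanSingleton _ α)
    (hpos : ∀ φ : L →+* ℝ, 0 < φ α) : IsQuadraticTower D (liftGroup L' G) := by
  have := hT.isTotallyReal
  refine ⟨h.isTotallyReal hpos, ?_, ?_, h.isEtaleGroup_liftGroup hT.isEtale hx hJ0 hJ, ?_⟩
  · obtain ⟨n, hn⟩ := IsPGroup.iff_card.1 hT.isPGroup
    exact IsPGroup.of_card (n := n + 1) (by rw [h.card_liftGroup hG, hn, pow_succ, mul_comm])
  · rw [h.card_liftGroup hG, h.finrank_eq, hT.finrank_eq]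
  · obtain ⟨t, ht, ht'⟩ := hT.exists_sqrt
    refine ⟨algebraMap L L' t, ?_, by rw [← map_pow, ht', map_natCast]⟩
    rintro g' ⟨g, hg, hgg⟩
    rw [hgg, ht g hg]

end IsSqrtExtension

end

section

open NumberField FractionalIdeal IsSqrtExtension
open scoped nonZeroDivisors

namespace IsQuadraticTower

theorem exists_base {D : ℕ} (hD : ¬ IsSquare D) : ∃ (L : Type) (_ : Field L) (_ : NumberField L)
    (G : Subgroup (L ≃ₐ[ℚ] L)), IsQuadraticTower D G := by
  obtain ⟨L, _, _, _, s, h⟩ := exists_isSqrtExtension (L := ℚ) (α := (D : ℚ))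
    fun h => hD (Rat.isSquare_natCast_iff.1 h)
  refine ⟨L, inferInstance, inferInstance, ⊥, ?_, ?_, ?_, ⟨1, fun _ => 1, fun _ => 1, by simp, ?_⟩,
    s, ?_, ?_⟩
  · refine h.isTotallyReal fun φ => ?_
    rw [map_natCast]
    exact Nat.cast_pos.2 (Nat.pos_of_ne_zero fun h0 => hD (h0 ▸ IsSquare.zero))
  · exact IsPGroup.of_card (n := 0) (by simp)
  · rw [h.finrank_eq]
    simp
  · intro g hg hne
    exact absurd (Subgroup.mem_bot.1 hg) hne
  · intro g hg
    rw [Subgroup.mem_bot.1 hg]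
    rfl
  · rw [h.sq_eq, map_natCast]

theorem span_mul_self {L : Type*} [Field L] [NumberField L] {s : L} {d e : ℕ}
    (hs : s ^ 2 = ((d * e : ℕ) : L)) (hde : d.Coprime e) :
    (spanSingleton (𝓞 L)⁰ (d : L) + spanSingleton _ s) *
      (spanSingleton (𝓞 L)⁰ (d : L) + spanSingleton _ s) = spanSingleton _ (d : L) := by
  have h_int : IsIntegral ℤ s := by
    refine IsIntegral.of_pow two_pos ?_
    rw [hs]
    exact map_natCast (algebraMap ℤ L) (d * e) ▸ isIntegral_algebraMap
  obtain ⟨S, rfl⟩ : ∃ S : 𝓞 L, (S : L) = s := ⟨⟨s, h_int⟩, rfl⟩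
  have hmem : ∀ z : 𝓞 L, (d : L) * z ∈ spanSingleton (𝓞 L)⁰ (d : L) := fun z =>
    (mem_spanSingleton _).2 ⟨z, by rw [Algebra.smul_def, mul_comm]⟩
  rw [add_mul, mul_add, mul_add, spanSingleton_mul_spanSingleton, spanSingleton_mul_spanSingleton,
    spanSingleton_mul_spanSingleton, spanSingleton_mul_spanSingleton]
  refine le_antisymm ?_ ?_
  · simp only [← sup_eq_add, sup_le_iff, spanSingleton_le_iff_mem]
    refine ⟨⟨?_, ?_⟩, ?_, ?_⟩
    · simpa using hmem d
    · exact hmem S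
    · rw [mul_comm]
      exact hmem S
    · rw [← sq, hs, Nat.cast_mul]
      simpa using hmem e
  · obtain ⟨a, b, hab⟩ := Int.isCoprime_iff_gcd_eq_one.2
      (by simpa using hde : Int.gcd (d : ℤ) (e : ℤ) = 1)
    have hab' : (a : L) * d + b * e = 1 := by exact_mod_cast congrArg (Int.cast : ℤ → L) hab
    rw [spanSingleton_le_iff_mem]
    simp only [← sup_eq_add]
    have h1 : (a : L) * (d * d) ∈ spanSingleton (𝓞 L)⁰ ((d : L) * d) :=
      (mem_spanSingleton _).2 ⟨(a : 𝓞 L), by rw [Algebra.smul_def, map_intCast]⟩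
    have h2 : (b : L) * (S * S) ∈ spanSingleton (𝓞 L)⁰ ((S : L) * S) :=
      (mem_spanSingleton _).2 ⟨(b : 𝓞 L), by rw [Algebra.smul_def, map_intCast]⟩
    have h3 : (d : L) = a * (d * d) + b * (S * S) := by
      rw [← sq (S : L), hs, Nat.cast_mul]
      linear_combination -(d : L) * hab'
    have h4 := Submodule.add_mem_sup (Submodule.mem_sup_left
      (T := ((spanSingleton (𝓞 L)⁰ ((d : L) * S) : FractionalIdeal (𝓞 L)⁰ L) :
        Submodule (𝓞 L) L)) h1) (Submodule.mem_sup_right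
      (S := ((spanSingleton (𝓞 L)⁰ ((S : L) * d) : FractionalIdeal (𝓞 L)⁰ L) :
        Submodule (𝓞 L) L)) h2)
    rw [← h3] at h4
    exact h4

theorem exists_adjoin_sqrt {L : Type} [Field L] [NumberField L] {G : Subgroup (L ≃ₐ[ℚ] L)}
    {d e : ℕ} (h : IsQuadraticTower (d * e) G) (hd : d % 4 = 1) (hde : d.Coprime e) :
    ∃ (L' : Type) (_ : Field L') (_ : NumberField L') (_ : Algebra L L')
      (G' : Subgroup (L' ≃ₐ[ℚ] L')), IsQuadraticTower (d * e) G' ∧ ∃ s : L', s ^ 2 = d := by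
  have hd0 : 0 < d := by omega
  by_cases hsq : IsSquare (d : L)
  · obtain ⟨s, hs⟩ := hsq
    exact ⟨L, inferInstance, inferInstance, inferInstance, G, h, s, by rw [hs, sq]⟩
  obtain ⟨L', _, _, _, s', h'⟩ := exists_isSqrtExtension hsq
  obtain ⟨s, -, hs⟩ := h.exists_sqrt
  refine ⟨L', inferInstance, inferInstance, inferInstance, liftGroup L' G,
    h'.isQuadraticTower_liftGroup h (fun g _ => ⟨1, by simp⟩) (x := ((d / 4 : ℕ) : 𝓞 L)) ?_
      (fun h0 => ?_) (span_mul_self hs hde) ?_, s', by rw [h'.sq_eq, map_natCast]⟩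
  · rw [RingOfIntegers.coe_eq_algebraMap, map_natCast]
    have : d = 1 + 4 * (d / 4) := by omega
    exact_mod_cast congrArg (Nat.cast : ℕ → L) this
  · have h1 := span_mul_self hs hde
    rw [h0, zero_mul, eq_comm, spanSingleton_eq_zero_iff] at h1
    exact hd0.ne' (Nat.cast_eq_zero.1 h1)
  · intro φ
    rw [map_natCast]
    exact_mod_cast hd0

theorem exists_adjoin_sqrts {ι : Type*} [Fintype ι] {d : ι → ℕ} (hd : ∀ i, d i % 4 = 1)
    (hco : Pairwise fun i j => (d i).Coprime (d j)) (hD : ¬ IsSquare (∏ i, d i)) :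
    ∃ (L : Type) (_ : Field L) (_ : NumberField L) (G : Subgroup (L ≃ₐ[ℚ] L)),
      IsQuadraticTower (∏ i, d i) G ∧ ∀ i, ∃ s : L, s ^ 2 = d i := by
  classical
  suffices H : ∀ S : Finset ι, ∃ (L : Type) (_ : Field L) (_ : NumberField L)
      (G : Subgroup (L ≃ₐ[ℚ] L)), IsQuadraticTower (∏ i, d i) G ∧ ∀ i ∈ S, ∃ s : L, s ^ 2 = d i by
    obtain ⟨L, _, _, G, h1, h2⟩ := H Finset.univ
    exact ⟨L, inferInstance, inferInstance, G, h1, fun i => h2 i (Finset.mem_univ i)⟩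
  intro S
  induction S using Finset.induction_on with
  | empty =>
    obtain ⟨L, _, _, G, h⟩ := exists_base hD
    exact ⟨L, inferInstance, inferInstance, G, h, fun i hi => absurd hi (Finset.notMem_empty i)⟩
  | insert a S _ ih =>
    obtain ⟨L, _, _, G, h, hS⟩ := ih
    rw [← Finset.mul_prod_erase Finset.univ d (Finset.mem_univ a)] at h ⊢
    obtain ⟨L', _, _, _, G', h', s, hs⟩ := h.exists_adjoin_sqrt (hd a)
      (Nat.Coprime.prod_right fun j hj => hco (Finset.ne_of_mem_erase hj).symm)
    refine ⟨L', inferInstance, inferInstance, G', h', fun i hi => ?_⟩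
    rcases Finset.mem_insert.1 hi with rfl | hi
    · exact ⟨s, hs⟩
    · obtain ⟨t, ht⟩ := hS i hi
      exact ⟨algebraMap L L' t, by rw [← map_pow, ht, map_natCast]⟩

end IsQuadraticTower

end

section

namespace IsPGroup

variable {G : Type*} [Group G]

variable (G) in
/-- The `𝔽₂`-vector space of homomorphisms from a group to `ℤ/2`. -/
def homSubmodule : Submodule (ZMod 2) (G → ZMod 2) where
  carrier := {f | ∀ a b, f (a * b) = f a + f b}
  zero_mem' := fun _ _ => (add_zero _).symm
  add_mem' := fun {f g} hf hg a b => by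
    simp only [Pi.add_apply]
    rw [hf, hg]
    ring
  smul_mem' := fun c f hf a b => by
    simp only [Pi.smul_apply, hf a b, smul_add]

theorem exists_hom_ne_zero [Finite G] (hG : IsPGroup 2 G) {H : Subgroup G} (hH : H ≠ ⊤) :
    ∃ f ∈ homSubmodule G, (∀ h ∈ H, f h = 0) ∧ f ≠ 0 := by
  classical
  obtain ⟨n, hn⟩ := IsPGroup.iff_card.1 hG
  obtain ⟨m, hm⟩ := IsPGroup.iff_card.1 (hG.to_subgroup H)
  have hlt : m < n := by
    by_contra h
    refine hH (Subgroup.eq_top_of_le_card _ ?_)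
    rw [hn, hm]
    exact Nat.pow_le_pow_right two_pos (not_lt.1 h)
  obtain ⟨k, rfl⟩ : ∃ k, n = k + 1 := ⟨n - 1, by omega⟩
  obtain ⟨M, hM, hHM⟩ := Sylow.exists_subgroup_card_pow_prime_le (p := 2) (m := k)
    (by rw [hn]; exact pow_dvd_pow _ (Nat.le_succ k)) H hm (Nat.le_of_lt_succ hlt)
  have hidx : M.index = 2 := by
    have := M.index_mul_card
    rw [hn, hM, pow_succ, mul_comm] at this
    exact Nat.eq_of_mul_eq_mul_left (pow_pos two_pos k) this
  refine ⟨fun g => if g ∈ M then 0 else 1, fun a b => ?_, fun h hh => if_pos (hHM hh), fun h0 => ?_⟩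
  · have := Subgroup.mul_mem_iff_of_index_two hidx (a := a) (b := b)
    by_cases ha : a ∈ M <;> by_cases hb : b ∈ M <;> simp [this, ha, hb]
    decide
  · have htop : M = ⊤ := (Subgroup.eq_top_iff' M).2 fun g => by
      by_contra hg
      exact one_ne_zero ((if_neg hg).symm.trans (congrFun h0 g))
    rw [htop, Subgroup.index_top] at hidx
    exact absurd hidx (by decide)

theorem exists_dual_generators [Finite G] (hG : IsPGroup 2 G) {ι : Type*} [Fintype ι]
    {f : ι → homSubmodule G} (hf : LinearIndependent (ZMod 2) f) :
    ∃ (d : ℕ) (x : Fin d → G) (chi : Fin d → G →* Multiplicative (ZMod 2)),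
      Fintype.card ι ≤ d ∧ Function.Surjective (FreeGroup.lift x) ∧
      ∀ i j, (chi j (x i)).toAdd = if i = j then 1 else 0 := by
  classical
  let W := homSubmodule G
  let ev : G → Module.Dual (ZMod 2) W := fun g => (LinearMap.proj g).comp W.subtype
  have hspan : Submodule.span (ZMod 2) (Set.range ev) = ⊤ := by
    by_contra hne
    obtain ⟨φ, hφ0, hφ⟩ := Submodule.exists_dual_map_eq_bot_of_lt_top (lt_top_iff_ne_top.2 hne)
      inferInstance
    obtain ⟨w, rfl⟩ := (Module.evalEquiv (ZMod 2) W).surjective φ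
    refine hφ0 ?_
    have : w = 0 := by
      ext g
      have h1 : (Module.evalEquiv (ZMod 2) W w) (ev g) ∈
          (Submodule.span (ZMod 2) (Set.range ev)).map (Module.evalEquiv (ZMod 2) W w) :=
        Submodule.mem_map_of_mem (Submodule.subset_span ⟨g, rfl⟩)
      rw [hφ, Submodule.mem_bot] at h1
      exact h1
    rw [this, map_zero]
  obtain ⟨s, hs, hsp, hli⟩ := exists_linearIndependent (ZMod 2) (Set.range ev)
  have hfin : s.Finite := (Set.finite_range ev).subset hs
  have : Fintype s := hfin.fintype
  let b0 : Module.Basis s (ZMod 2) (Module.Dual (ZMod 2) W) := Module.Basis.mk hli (by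
    rw [Subtype.range_coe, hsp, hspan])
  let b := b0.reindex (Fintype.equivFin s)
  have hb : ∀ i, ∃ g, ev g = b i := fun i => by
    have : b i = ((Fintype.equivFin s).symm i : s) := by
      simp [b, b0]
    rw [this]
    exact hs (Subtype.mem _)
  choose x hx using hb
  let w : Fin (Fintype.card s) → W := fun j => (Module.evalEquiv (ZMod 2) W).symm (b.coord j)
  have hw : ∀ i j, (w j : G → ZMod 2) (x i) = if i = j then 1 else 0 := fun i j => by
    have h1 : (w j : G → ZMod 2) (x i) = Module.evalEquiv (ZMod 2) W (w j) (ev (x i)) := rfl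
    rw [h1, hx]
    simp only [w, LinearEquiv.apply_symm_apply]
    rw [Module.Basis.coord_apply, Module.Basis.repr_self, Finsupp.single_apply]
  refine ⟨Fintype.card s, x, fun j => MonoidHom.mk' (fun g => Multiplicative.ofAdd
    ((w j : G → ZMod 2) g)) fun a b => ?_, ?_, ?_, fun i j => hw i j⟩
  · rw [(w j).2 a b, ofAdd_add]
  · refine hf.fintype_card_le_finrank.trans ?_
    rw [← Subspace.dual_finrank_eq, Module.finrank_eq_card_basis b, Fintype.card_fin]
  · rw [FreeGroup.lift_surjective_iff_closure_range_eq_top]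
    by_contra hne
    obtain ⟨f, hf, hf0, hfne⟩ := hG.exists_hom_ne_zero hne
    refine hfne (congrArg Subtype.val (?_ : (⟨f, hf⟩ : W) = 0))
    refine (Module.evalEquiv (ZMod 2) W).map_eq_zero_iff.1 (b.ext fun i => ?_)
    rw [← hx]
    exact hf0 _ (Subgroup.subset_closure ⟨i, rfl⟩)

end IsPGroup

end

section

open NumberField IsPGroup

theorem Nat.Prime.not_isSquare_mul {q m : ℕ} (hq : q.Prime) (hm : ¬ q ∣ m) : ¬ IsSquare (q * m) := by
  rintro ⟨r, hr⟩
  have h1 : q ∣ r := (hq.dvd_mul.1 ⟨m, hr.symm⟩).elim id id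
  obtain ⟨k, rfl⟩ := h1
  refine hm ⟨k * k, Nat.eq_of_mul_eq_mul_left hq.pos ?_⟩
  rw [hr]
  ring

theorem Nat.Prime.not_dvd_prod_of_notMem {q : ℕ} (hq : q.Prime) {T : Finset ℕ}
    (hT : ∀ p ∈ T, p.Prime) (h : q ∉ T) : ¬ q ∣ ∏ p ∈ T, p := fun hd => by
  obtain ⟨p, hp, hqp⟩ := (Prime.dvd_finsetProd_iff hq.prime _).1 hd
  exact h ((Nat.prime_dvd_prime_iff_eq hq (hT p hp)).1 hqp ▸ hp)

namespace IsQuadraticTower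

variable {L : Type*} [Field L] [NumberField L] {G : Subgroup (L ≃ₐ[ℚ] L)} {D : ℕ}

theorem finrank_fixedField (h : IsQuadraticTower D G) :
    Module.finrank ℚ (IntermediateField.fixedField G) = 2 := by
  have h1 := Module.finrank_mul_finrank ℚ (IntermediateField.fixedField G) L
  rw [IntermediateField.finrank_fixedField_eq_card, h.finrank_eq] at h1
  exact Nat.eq_of_mul_eq_mul_right Nat.card_pos h1

theorem exists_sqrt_fixedField (h : IsQuadraticTower D G) :
    ∃ s : IntermediateField.fixedField G, s ^ 2 = (D : IntermediateField.fixedField G) := by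
  obtain ⟨s, hs, hs'⟩ := h.exists_sqrt
  exact ⟨⟨s, (IntermediateField.mem_fixedField_iff _ _).2 hs⟩, Subtype.ext hs'⟩

theorem isSquare_or_of_sq_eq (h : IsQuadraticTower D G) (hD : ¬ IsSquare D) {z : L}
    (hz : ∀ g ∈ G, g z = z) {n : ℕ} (hn : z ^ 2 = n) : IsSquare n ∨ IsSquare (n * D) := by
  obtain ⟨s, hs⟩ := h.exists_sqrt_fixedField
  obtain ⟨a, b, hab⟩ := QuadraticField.exists_coords h.finrank_fixedField hD hs
    ⟨z, (IntermediateField.mem_fixedField_iff _ _).2 hz⟩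
  have hn' : (⟨z, (IntermediateField.mem_fixedField_iff _ _).2 hz⟩ :
      IntermediateField.fixedField G) ^ 2 = n := Subtype.ext hn
  rw [hab] at hn'
  have h0 := QuadraticField.coords_eq_zero hD hs (a := a ^ 2 + b ^ 2 * D - n) (b := 2 * a * b) (by
    push_cast
    linear_combination hn' - (b : IntermediateField.fixedField G) ^ 2 * hs)
  rcases mul_eq_zero.1 h0.2 with ha | hb
  · have ha0 : a = 0 := by simpa using ha
    refine Or.inr (Rat.isSquare_natCast_iff.1 ⟨b * D, ?_⟩)
    push_cast
    rw [ha0] at h0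
    linear_combination -(D : ℚ) * h0.1
  · refine Or.inl (Rat.isSquare_natCast_iff.1 ⟨a, ?_⟩)
    rw [hb] at h0
    linear_combination -h0.1

theorem exists_linearIndependent (h : IsQuadraticTower D G) {P : Finset ℕ} {q : ℕ}
    (hP : ∀ p ∈ P, p.Prime) (hq : q.Prime) (hqP : q ∉ P) (hD : D = q * ∏ p ∈ P, p)
    (hs : ∀ p ∈ P, ∃ s : L, s ^ 2 = p) :
    ∃ f : P → homSubmodule G, LinearIndependent (ZMod 2) f := by
  classical
  have hs' : ∀ p : P, ∃ s : L, s ^ 2 = ((p : ℕ) : L) := fun p => hs p p.2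
  choose s hs using hs'
  have hsq : ¬ IsSquare D := hD ▸ hq.not_isSquare_mul (hq.not_dvd_prod_of_notMem hP hqP)
  have hs0 : ∀ p, s p ≠ 0 := fun p h0 => by
    have := hs p
    rw [h0, zero_pow two_ne_zero] at this
    exact (hP p p.2).ne_zero (Nat.cast_eq_zero.1 this.symm)
  have hneg : ∀ p, -s p ≠ s p := fun p h0 => hs0 p (self_eq_neg.1 h0.symm)
  have hg : ∀ (g : G) p, (g : L ≃ₐ[ℚ] L) (s p) = s p ∨ (g : L ≃ₐ[ℚ] L) (s p) = -s p :=
    fun g p => by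
      rw [← sq_eq_sq_iff_eq_or_eq_neg, ← map_pow, hs, map_natCast]
  let f : P → G → ZMod 2 := fun p g => if (g : L ≃ₐ[ℚ] L) (s p) = s p then 0 else 1
  have hf : ∀ p, f p ∈ homSubmodule G := fun p a b => by
    have hab : ((a * b : G) : L ≃ₐ[ℚ] L) (s p) = (a : L ≃ₐ[ℚ] L) ((b : L ≃ₐ[ℚ] L) (s p)) := rfl
    rcases hg a p with ha | ha <;> rcases hg b p with hb | hb <;>
      simp [f, hab, ha, hb, hneg p] <;> decide
  refine ⟨fun p => ⟨f p, hf p⟩, ?_⟩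
  rw [Fintype.linearIndependent_iff]
  intro c hc
  let e : ZMod 2 → L := fun a => if a = 0 then 1 else -1
  have he : ∀ a b, e (a + b) = e a * e b := by
    have h2 : ∀ a : ZMod 2, a = 0 ∨ a = 1 := by decide
    have h11 : (1 : ZMod 2) + 1 = 0 := by decide
    intro a b
    rcases h2 a with rfl | rfl <;> rcases h2 b with rfl | rfl <;> simp [e, h11]
  have hes : ∀ (g : G) p, (g : L ≃ₐ[ℚ] L) (s p) = e (f p g) * s p := fun g p => by
    rcases hg g p with ha | ha <;> simp [e, f, ha, hneg p]
  have hprod : ∀ (T : Finset P) (g : G), (g : L ≃ₐ[ℚ] L) (∏ p ∈ T, s p) =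
      e (∑ p ∈ T, f p g) * ∏ p ∈ T, s p := fun T g => by
    induction T using Finset.induction_on with
    | empty => simp [e]
    | insert a T ha ih =>
      rw [Finset.prod_insert ha, Finset.sum_insert ha, map_mul, ih, hes, he]
      ring
  set T : Finset P := Finset.univ.filter fun p => c p ≠ 0 with hT
  have hfix : ∀ g ∈ G, g (∏ p ∈ T, s p) = ∏ p ∈ T, s p := fun g hgG => by
    have h1 := hprod T ⟨g, hgG⟩
    have h2 : ∑ p ∈ T, f p ⟨g, hgG⟩ = 0 := by
      have := congrFun (congrArg Subtype.val hc) ⟨g, hgG⟩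
      rw [hT, Finset.sum_filter]
      have h3 : ∑ p, c p * f p ⟨g, hgG⟩ = 0 := by
        refine Eq.trans ?_ this
        simp [Finset.sum_apply]
      refine Eq.trans ?_ h3
      refine Finset.sum_congr rfl fun p _ => ?_
      have h4 : ∀ a : ZMod 2, a = 0 ∨ a = 1 := by decide
      rcases h4 (c p) with h0 | h0 <;> simp [h0]
    rw [h2] at h1
    simpa [e] using h1
  have hTimg : ∀ p ∈ T.image Subtype.val, p.Prime := fun p hp => by
    obtain ⟨p', -, rfl⟩ := Finset.mem_image.1 hp
    exact hP _ p'.2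
  have hsqT : (∏ p ∈ T, s p) ^ 2 = ((∏ p ∈ T.image Subtype.val, p : ℕ) : L) := by
    rw [Finset.prod_image Subtype.val_injective.injOn, Nat.cast_prod, ← Finset.prod_pow]
    exact Finset.prod_congr rfl fun p _ => hs p
  intro p0
  by_contra hp0
  rcases h.isSquare_or_of_sq_eq hsq hfix hsqT with h1 | h1
  · have hmem : (p0 : ℕ) ∈ T.image Subtype.val :=
      Finset.mem_image.2 ⟨p0, Finset.mem_filter.2 ⟨Finset.mem_univ _, hp0⟩, rfl⟩
    rw [← Finset.mul_prod_erase _ _ hmem] at h1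
    exact (hP p0 p0.2).not_isSquare_mul ((hP p0 p0.2).not_dvd_prod_of_notMem
      (fun p hp => hTimg p (Finset.mem_of_mem_erase hp)) (Finset.notMem_erase _ _)) h1
  · rw [hD, mul_left_comm] at h1
    refine hq.not_isSquare_mul (fun hd => ?_) h1
    rcases hq.dvd_mul.1 hd with hd | hd
    · refine hq.not_dvd_prod_of_notMem hTimg (fun hm => ?_) hd
      obtain ⟨p', -, hp'⟩ := Finset.mem_image.1 hm
      exact hqP (hp' ▸ p'.2)
    · exact hq.not_dvd_prod_of_notMem hP hqP hd

end IsQuadraticTower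

end

section

open NumberField FractionalIdeal
open scoped nonZeroDivisors

namespace NumberField

variable {F : Type*} [Field F] [NumberField F]

theorem not_isUnit_two : ¬ IsUnit (2 : 𝓞 F) := fun h => by
  obtain ⟨c, hc⟩ := isUnit_iff_exists_inv.1 h
  have h1 : (2 : F) * (c : F) = 1 := by
    have := congrArg (algebraMap (𝓞 F) F) hc
    rwa [map_mul, map_ofNat, map_one] at this
  have h2 : (c : F) = algebraMap ℚ F (1 / 2) := by
    rw [map_div₀, map_one, map_ofNat]
    field_simp
    linear_combination h1
  have h3 : IsIntegral ℤ (1 / 2 : ℚ) := by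
    have : IsIntegral ℤ (c : F) := RingOfIntegers.isIntegral_coe c
    rw [h2] at this
    exact (isIntegral_algebraMap_iff (algebraMap ℚ F).injective).1 this
  obtain ⟨n, hn⟩ := IsIntegrallyClosed.isIntegral_iff.1 h3
  have h4 : (2 * n : ℤ) = 1 := by
    have : (2 : ℚ) * n = 1 := by
      rw [show (n : ℚ) = 1 / 2 from hn]
      norm_num
    exact_mod_cast this
  omega

theorem exists_mul_sq_isCoprime_two {α : F} {J : FractionalIdeal (𝓞 F)⁰ F} (hJ0 : J ≠ 0)
    (hJ : J * J = spanSingleton _ α) :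
    ∃ (z : F) (a c e : 𝓞 F), α * z ^ 2 = a ∧ a * c + 2 * e = 1 := by
  obtain ⟨m, I, hm, hI⟩ := exists_eq_spanSingleton_mul J⁻¹
  have hI0 : I ≠ ⊥ := by
    rintro rfl
    rw [coeIdeal_bot, mul_zero] at hI
    exact inv_ne_zero hJ0 hI
  obtain ⟨b, hb⟩ := IsDedekindDomain.exists_sup_span_eq
    (I := Ideal.span {(2 : 𝓞 F)} * I) (J := I) Ideal.mul_le_right
    (mul_ne_zero (by simp) hI0)
  set z : F := (algebraMap (𝓞 F) F m)⁻¹ * b with hz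
  have h1 : spanSingleton (𝓞 F)⁰ z * J + spanSingleton (𝓞 F)⁰ (2 : F) = 1 := by
    have h2 : J⁻¹ = spanSingleton (𝓞 F)⁰ (2 : F) * J⁻¹ + spanSingleton (𝓞 F)⁰ z := by
      conv_lhs => rw [hI, ← hb, coeIdeal_sup, mul_add, coeIdeal_mul,
        coeIdeal_span_singleton, coeIdeal_span_singleton, mul_left_comm, ← hI, map_ofNat,
        spanSingleton_mul_spanSingleton]
    have h3 : J⁻¹ * J = 1 := inv_mul_cancel₀ hJ0
    calc _ = (spanSingleton (𝓞 F)⁰ (2 : F) * J⁻¹ + spanSingleton (𝓞 F)⁰ z) * J := by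
          rw [add_mul, mul_assoc, h3, mul_one, add_comm]
      _ = 1 := by rw [← h2, h3]
  have h2 : spanSingleton (𝓞 F)⁰ (α * z ^ 2) ≤ 1 := by
    have h4 : spanSingleton (𝓞 F)⁰ z * J ≤ 1 := by
      rw [← h1, ← sup_eq_add]
      exact le_sup_left
    calc spanSingleton (𝓞 F)⁰ (α * z ^ 2) = (spanSingleton (𝓞 F)⁰ z * J) *
          (spanSingleton (𝓞 F)⁰ z * J) := by
            rw [mul_mul_mul_comm, hJ, spanSingleton_mul_spanSingleton,
              spanSingleton_mul_spanSingleton]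
            congr 1
            ring
      _ ≤ 1 * 1 := mul_le_mul' h4 h4
      _ = 1 := one_mul 1
  obtain ⟨a, ha⟩ := (mem_one_iff _).1 ((spanSingleton_le_iff_mem).1 h2)
  have h5 : (1 : FractionalIdeal (𝓞 F)⁰ F) ≤
      spanSingleton (𝓞 F)⁰ (a : F) + spanSingleton (𝓞 F)⁰ (2 : F) := by
    have h4 : (1 : FractionalIdeal (𝓞 F)⁰ F) = spanSingleton (𝓞 F)⁰ (a : F) +
        spanSingleton (𝓞 F)⁰ (2 : F) * (spanSingleton (𝓞 F)⁰ z * J + 1) := by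
      have h6 : spanSingleton (𝓞 F)⁰ (a : F) = (spanSingleton (𝓞 F)⁰ z * J) *
          (spanSingleton (𝓞 F)⁰ z * J) := by
        rw [mul_mul_mul_comm, hJ, spanSingleton_mul_spanSingleton,
              spanSingleton_mul_spanSingleton, RingOfIntegers.coe_eq_algebraMap, ha]
        congr 1
        ring
      rw [h6]
      calc (1 : FractionalIdeal (𝓞 F)⁰ F) = spanSingleton (𝓞 F)⁰ z * J * 1 + spanSingleton (𝓞 F)⁰ (2 : F) := by
            rw [mul_one, h1]
        _ = _ := by
            nth_rewrite 1 [← h1]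
            ring
    nth_rewrite 1 [h4]
    have h7 : spanSingleton (𝓞 F)⁰ z * J + 1 ≤ 1 := by
      rw [← sup_eq_add]
      refine sup_le ?_ le_rfl
      rw [← h1, ← sup_eq_add]
      exact le_sup_left
    rw [← sup_eq_add, ← sup_eq_add]
    refine sup_le_sup le_rfl ?_
    calc _ ≤ spanSingleton (𝓞 F)⁰ (2 : F) * 1 := mul_le_mul_right h7 _
      _ = _ := mul_one _
  have h6 : (1 : F) ∈ ((spanSingleton (𝓞 F)⁰ (a : F) + spanSingleton (𝓞 F)⁰ (2 : F) :
      FractionalIdeal (𝓞 F)⁰ F) : Submodule (𝓞 F) F) := h5 (one_mem_one _)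
  rw [coe_add, Submodule.add_eq_sup] at h6
  obtain ⟨p, hp, q, hq, hpq⟩ := Submodule.mem_sup.1 h6
  obtain ⟨c, rfl⟩ := (mem_spanSingleton _).1 hp
  obtain ⟨e, rfl⟩ := (mem_spanSingleton _).1 hq
  refine ⟨z, a, c, e, ha.symm, RingOfIntegers.ext ?_⟩
  rw [RingOfIntegers.coe_eq_algebraMap, map_add, map_mul, map_mul, map_ofNat,
    RingOfIntegers.coe_eq_algebraMap (1 : 𝓞 F), map_one, ← hpq,
    Algebra.smul_def, Algebra.smul_def, mul_comm, mul_comm (2 : F)]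

theorem exists_mul_sq_eq_one_add (hred : ∀ z : 𝓞 F, 2 ∣ z ^ 2 → 2 ∣ z) {α : F}
    {J : FractionalIdeal (𝓞 F)⁰ F} (hJ0 : J ≠ 0) (hJ : J * J = spanSingleton _ α) :
    ∃ z : F, z ≠ 0 ∧ ∃ x : 𝓞 F, α * z ^ 2 = 1 + 2 * (x : F) := by
  obtain ⟨z, a, c, e, hz, hac⟩ := exists_mul_sq_isCoprime_two hJ0 hJ
  have h2 : Ideal.span {(2 : 𝓞 F)} ≠ ⊥ := by simp
  have : Finite (𝓞 F ⧸ Ideal.span {(2 : 𝓞 F)}) := Ring.HasFiniteQuotients.finiteQuotient h2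
  have hinj : Function.Injective fun q : 𝓞 F ⧸ Ideal.span {(2 : 𝓞 F)} => q ^ 2 := by
    intro p q hpq
    obtain ⟨p, rfl⟩ := Ideal.Quotient.mk_surjective p
    obtain ⟨q, rfl⟩ := Ideal.Quotient.mk_surjective q
    simp only [← map_pow] at hpq
    rw [Ideal.Quotient.eq, Ideal.mem_span_singleton] at hpq ⊢
    refine hred _ ?_
    have : (p - q) ^ 2 = (p ^ 2 - q ^ 2) + 2 * (q ^ 2 - p * q) := by ring
    rw [this]
    exact dvd_add hpq (dvd_mul_right _ _)
  obtain ⟨q, hq⟩ := Finite.injective_iff_surjective.1 hinj (Ideal.Quotient.mk _ c)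
  obtain ⟨y, rfl⟩ := Ideal.Quotient.mk_surjective q
  simp only [← map_pow] at hq
  rw [Ideal.Quotient.eq, Ideal.mem_span_singleton] at hq
  obtain ⟨w, hw⟩ := hq
  have hx : a * y ^ 2 = 1 + 2 * (a * w - e) := by linear_combination a * hw + hac
  have hx' : α * (z * y) ^ 2 = 1 + 2 * ((a * w - e : 𝓞 F) : F) := by
    have := congrArg (algebraMap (𝓞 F) F) hx
    rw [map_mul, map_pow, map_add, map_one, map_mul, map_ofNat] at this
    rw [mul_pow, ← mul_assoc, hz]
    exact this
  refine ⟨z * y, fun h0 => not_isUnit_two (F := F) ?_, _, hx'⟩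
  rw [h0, zero_pow two_ne_zero, mul_zero] at hx'
  refine isUnit_iff_exists_inv.2 ⟨-(a * w - e), RingOfIntegers.ext ?_⟩
  rw [RingOfIntegers.coe_eq_algebraMap, map_mul, map_ofNat, map_neg,
    RingOfIntegers.coe_eq_algebraMap (1 : 𝓞 F), map_one]
  linear_combination hx'

end NumberField

namespace IsEtaleGroup

variable {L : Type*} [Field L] [NumberField L] {G : Subgroup (L ≃ₐ[ℚ] L)}

theorem exists_apply_eq_add (hred : ∀ z : 𝓞 L, 2 ∣ z ^ 2 → 2 ∣ z) {x : 𝓞 L} {g : L ≃ₐ[ℚ] L} {w : L}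
    (hw : g (1 + 2 * (x : L)) = w ^ 2 * (1 + 2 * x)) : ∃ y : 𝓞 L, g x = x + 2 * y := by
  have h_int : IsIntegral ℤ (g x) := isIntegral_apply g (RingOfIntegers.isIntegral_coe x)
  obtain ⟨x', hx'⟩ : ∃ x' : 𝓞 L, (x' : L) = g x := ⟨⟨_, h_int⟩, rfl⟩
  have h1 : (w * (1 + 2 * (x : L))) ^ 2 = ((1 + 2 * x' : 𝓞 L) * (1 + 2 * x) : 𝓞 L) := by
    rw [map_add, map_mul, map_one, map_ofNat, ← hx'] at hw
    rw [RingOfIntegers.coe_eq_algebraMap ((1 + 2 * x') * (1 + 2 * x))]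
    simp only [map_mul, map_add, map_one, map_ofNat]
    rw [← RingOfIntegers.coe_eq_algebraMap x, ← RingOfIntegers.coe_eq_algebraMap x']
    linear_combination -(1 + 2 * (x : L)) * hw
  obtain ⟨v, hv⟩ : ∃ v : 𝓞 L, (v : L) = w * (1 + 2 * (x : L)) :=
    ⟨⟨_, IsIntegral.of_pow two_pos (h1 ▸ RingOfIntegers.isIntegral_coe _)⟩, rfl⟩
  have h2 : v ^ 2 = (1 + 2 * x') * (1 + 2 * x) := RingOfIntegers.ext (by
    rw [← h1, ← hv]
    exact map_pow _ _ _)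
  obtain ⟨u, hu⟩ := hred (v - 1) ⟨x + x' + 2 * x * x' - v + 1, by linear_combination h2⟩
  have h3 : x + x' = 2 * (u + u ^ 2 - x * x') := by
    have h4 : (2 : 𝓞 L) * (x + x') = 2 * (2 * (u + u ^ 2 - x * x')) := by
      rw [sub_eq_iff_eq_add.1 hu] at h2
      linear_combination -h2
    exact mul_left_cancel₀ two_ne_zero h4
  refine ⟨u + u ^ 2 - x * x' - x, ?_⟩
  have h5 : x' = x + 2 * (u + u ^ 2 - x * x' - x) := by linear_combination h3
  rw [← hx']
  nth_rewrite 1 [h5]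
  rw [RingOfIntegers.coe_eq_algebraMap, map_add, map_mul, map_ofNat]

theorem exists_eq_add_two_mul (hG : IsEtaleGroup G) {x : 𝓞 L}
    (hx : ∀ g ∈ G, ∃ y : 𝓞 L, g x = x + 2 * y) :
    ∃ (κ : 𝓞 (IntermediateField.fixedField G)) (y : 𝓞 L),
      (x : L) = ((κ : IntermediateField.fixedField G) : L) + 2 * y := by
  classical
  have : Fintype G := Fintype.ofFinite G
  obtain ⟨e, he⟩ := hG.exists_tr_eq_one
  have hκ : IsIntegral ℤ (tr G ((x : L) * e)) :=
    isIntegral_tr ((RingOfIntegers.isIntegral_coe x).mul (RingOfIntegers.isIntegral_coe e))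
  have hx' : ∀ g : G, ∃ y : 𝓞 L, (g : L ≃ₐ[ℚ] L) x = x + 2 * y := fun g => hx g g.2
  choose y hy using hx'
  have hY : IsIntegral ℤ (∑ g : G, (y g : L) * (g : L ≃ₐ[ℚ] L) e) :=
    IsIntegral.sum _ fun g _ => (RingOfIntegers.isIntegral_coe _).mul (isIntegral_apply _ (RingOfIntegers.isIntegral_coe e))
  obtain ⟨Y, hY'⟩ : ∃ Y : 𝓞 L, (Y : L) = ∑ g : G, (y g : L) * (g : L ≃ₐ[ℚ] L) e := ⟨⟨_, hY⟩, rfl⟩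
  refine ⟨⟨⟨_, tr_mem ((x : L) * e)⟩, (isIntegral_algebraMap_iff
    (algebraMap (IntermediateField.fixedField G) L).injective).1 hκ⟩, -Y, ?_⟩
  have h1 : tr G ((x : L) * e) = x + 2 * ∑ g : G, (y g : L) * (g : L ≃ₐ[ℚ] L) e := by
    nth_rewrite 2 [← mul_one (x : L)]
    rw [← he, tr, tr, Finset.mul_sum, Finset.mul_sum, ← Finset.sum_add_distrib]
    refine Finset.sum_congr rfl fun g _ => ?_
    rw [map_mul, hy]
    ring
  rw [RingOfIntegers.coe_eq_algebraMap (-Y), map_neg, ← RingOfIntegers.coe_eq_algebraMap Y, hY']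
  change (x : L) = tr G ((x : L) * e) + 2 * -(∑ g : G, (y g : L) * (g : L ≃ₐ[ℚ] L) e)
  rw [h1]
  ring

end IsEtaleGroup

end

section

open NumberField FractionalIdeal
open scoped nonZeroDivisors

namespace IsQuadraticTower

variable {L : Type*} [Field L] [NumberField L] {G : Subgroup (L ≃ₐ[ℚ] L)} {D : ℕ}

theorem exists_eq_comp (h : IsQuadraticTower D G) (hD : ¬ IsSquare D)
    {s : IntermediateField.fixedField G} (hs : s ^ 2 = (D : IntermediateField.fixedField G))
    {φ φ' : L →+* ℝ} (hφ : φ s = φ' s) : ∃ g ∈ G, ∀ z, φ' z = φ (g z) := by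
  have := IsEtaleGroup.isGalois_fixedField G
  have hK : ∀ z : IntermediateField.fixedField G, φ z = φ' z := fun z => by
    obtain ⟨a, b, rfl⟩ := QuadraticField.exists_coords h.finrank_fixedField hD hs z
    push_cast
    simp only [map_add, map_mul, map_ratCast, hφ]
  letI := φ.toAlgebra
  let ψ : L →ₐ[IntermediateField.fixedField G] ℝ := ⟨φ', fun z => (hK z).symm⟩
  let τ := Normal.algHomEquivAut (IntermediateField.fixedField G) ℝ L ψ
  have hτ : ∀ z, φ' z = φ (τ z) := fun z => by
    have h1 : (Normal.algHomEquivAut (IntermediateField.fixedField G) ℝ L).symm τ = ψ :=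
      Equiv.symm_apply_apply _ _
    have := DFunLike.congr_fun h1 z
    exact this.symm
  refine ⟨τ.restrictScalars ℚ, ?_, hτ⟩
  have h2 := IntermediateField.fixingSubgroup_fixedField G
  refine h2.le ((IntermediateField.mem_fixingSubgroup_iff _ _).2 fun z hz => ?_)
  exact τ.commutes ⟨z, hz⟩

theorem pos_iff_pos (h : IsQuadraticTower D G) (hD : ¬ IsSquare D)
    {s : IntermediateField.fixedField G} (hs : s ^ 2 = (D : IntermediateField.fixedField G))
    {φ φ' : L →+* ℝ} (hφ : 0 < φ s ↔ 0 < φ' s) {α : L} (hα : α ≠ 0)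
    (hG : ∀ g ∈ G, ∃ w : L, g α = w ^ 2 * α) : 0 < φ α ↔ 0 < φ' α := by
  have h1 : ∀ ψ : L →+* ℝ, ψ s ^ 2 = D := fun ψ => by
    have := congrArg (fun z : IntermediateField.fixedField G => ψ z) hs
    push_cast at this
    rwa [map_pow, map_natCast] at this
  have h2 : φ s = φ' s := by
    rcases sq_eq_sq_iff_eq_or_eq_neg.1 ((h1 φ).trans (h1 φ').symm) with h2 | h2
    · exact h2
    · rcases lt_trichotomy (φ' s) 0 with h3 | h3 | h3
      · exact absurd (hφ.1 (by linarith)) (not_lt.2 h3.le)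
      · rw [h2, h3, neg_zero]
      · exact absurd (hφ.2 h3) (by linarith)
  obtain ⟨g, hg, hg'⟩ := h.exists_eq_comp hD hs h2
  obtain ⟨w, hw⟩ := hG g hg
  rw [hg', hw, map_mul, map_pow]
  have hw0 : w ≠ 0 := by
    rintro rfl
    rw [zero_pow two_ne_zero, zero_mul] at hw
    exact hα (g.injective (hw.trans (map_zero g).symm))
  have : 0 < φ w ^ 2 := sq_pos_of_ne_zero ((map_ne_zero φ).2 hw0)
  exact (mul_pos_iff_of_pos_left this).symm

end IsQuadraticTower

end

section

open NumberField FractionalIdeal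
open scoped nonZeroDivisors

namespace IsQuadraticTower

variable {L : Type*} [Field L] [NumberField L] {G : Subgroup (L ≃ₐ[ℚ] L)} {D : ℕ}

theorem exists_mod_two (h : IsQuadraticTower D G) (hD : ¬ IsSquare D) (hD4 : D % 4 = 1) :
    ∃ t : 𝓞 L, ∀ {α : L} {J : FractionalIdeal (𝓞 L)⁰ L}, J ≠ 0 → J * J = spanSingleton _ α →
      (∀ g ∈ G, ∃ w : L, g α = w ^ 2 * α) →
      ∃ z : L, z ≠ 0 ∧ ∃ (u v : ℤ) (y : 𝓞 L),
        α * z ^ 2 = ((1 + 2 * (u + v * t + 2 * y) : 𝓞 L) : L) := by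
  obtain ⟨s, hs⟩ := h.exists_sqrt_fixedField
  have hK := h.finrank_fixedField
  obtain ⟨t, -, ht⟩ := QuadraticField.exists_eq_add_two_mul hK hD hs hD4
  have hred : ∀ z : 𝓞 L, 2 ∣ z ^ 2 → 2 ∣ z := fun z => h.isEtale.two_dvd_of_two_dvd_sq
    fun z => QuadraticField.two_dvd_of_two_dvd_sq hK hD hs hD4
  refine ⟨algebraMap _ _ t, fun {α J} hJ0 hJ hG => ?_⟩
  obtain ⟨z, hz, x, hx⟩ := exists_mul_sq_eq_one_add hred hJ0 hJ
  obtain ⟨κ, y, hκ⟩ := h.isEtale.exists_eq_add_two_mul (x := x) fun g hg => by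
    obtain ⟨w, hw⟩ := hG g hg
    refine IsEtaleGroup.exists_apply_eq_add hred (w := w * g z / z) ?_
    rw [← hx, map_mul, map_pow, hw]
    field_simp
  obtain ⟨u, v, y', -, hκ'⟩ := ht κ
  refine ⟨z, hz, u, v, y + algebraMap _ _ y', ?_⟩
  have h1 : x = u + v * algebraMap _ _ t + 2 * (y + algebraMap _ _ y') := by
    have h2 : x = algebraMap _ _ κ + 2 * y := RingOfIntegers.ext (by
      rw [hκ, RingOfIntegers.coe_eq_algebraMap (_ + _), map_add, map_mul, map_ofNat]
      rfl)
    rw [h2, hκ']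
    simp only [map_add, map_mul, map_intCast, map_ofNat]
    ring
  rw [← h1, hx, RingOfIntegers.coe_eq_algebraMap (_ + _), map_add, map_mul, map_ofNat, map_one]

theorem exists_pair (h : IsQuadraticTower D G) (hD : ¬ IsSquare D) (hD4 : D % 4 = 1)
    {M : Type*} [Fintype M] (hM : 16 < Fintype.card M) {α : M → L}
    {J : M → FractionalIdeal (𝓞 L)⁰ L} (hJ0 : ∀ μ, J μ ≠ 0)
    (hJ : ∀ μ, J μ * J μ = spanSingleton _ (α μ))
    (hG : ∀ μ, ∀ g ∈ G, ∃ w : L, g (α μ) = w ^ 2 * α μ)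
    (hinj : ∀ μ ν, IsSquare (α μ * α ν) → μ = ν) :
    ∃ (β : L) (x : 𝓞 L) (I : FractionalIdeal (𝓞 L)⁰ L), ¬ IsSquare β ∧ β = 1 + 4 * (x : L) ∧
      I ≠ 0 ∧ I * I = spanSingleton _ β ∧ (∀ g ∈ G, ∃ w : L, g β = w ^ 2 * β) ∧
      ∀ φ : L →+* ℝ, 0 < φ β := by
  classical
  obtain ⟨s, hs⟩ := h.exists_sqrt_fixedField
  obtain ⟨t, ht⟩ := h.exists_mod_two hD hD4
  choose z hz u v y hy using fun μ => ht (hJ0 μ) (hJ μ) (hG μ)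
  let σ : M → Bool → Prop := fun μ b => ∃ φ : L →+* ℝ, decide (0 < φ s) = b ∧ 0 < φ (α μ)
  obtain ⟨μ, ν, hne, hμν⟩ := Fintype.exists_ne_map_eq_of_card_lt
    (fun μ => ((u μ : ZMod 2), (v μ : ZMod 2), decide (σ μ true), decide (σ μ false)))
    (by simpa [ZMod.card] using hM)
  simp only [Prod.mk.injEq, decide_eq_decide] at hμν
  obtain ⟨hu, hv, h1, h2⟩ := hμν
  have hσ : ∀ b, σ μ b ↔ σ ν b := fun b => by cases b; exacts [h2, h1]
  have hα0 : ∀ μ, α μ ≠ 0 := fun μ h0 => by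
    have h3 := hJ μ
    rw [h0, spanSingleton_zero] at h3
    exact hJ0 μ (mul_self_eq_zero.1 h3)
  have hpos : ∀ (φ : L →+* ℝ) μ, 0 < φ (α μ) ↔ σ μ (decide (0 < φ s)) := fun φ μ => by
    refine ⟨fun h3 => ⟨φ, rfl, h3⟩, ?_⟩
    rintro ⟨φ', h3, h4⟩
    exact (h.pos_iff_pos hD hs (decide_eq_decide.1 h3) (hα0 μ) (hG μ)).1 h4
  have hev : ∀ {a b : ℤ}, (a : ZMod 2) = b → ∃ c, a + b = 2 * c := fun {a b} hab => by
    rw [ZMod.intCast_eq_intCast_iff_dvd_sub] at hab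
    obtain ⟨c, hc⟩ := hab
    exact ⟨c + a, by push_cast at hc; linarith⟩
  obtain ⟨a, ha⟩ := hev hu
  obtain ⟨b, hb⟩ := hev hv
  refine ⟨α μ * z μ ^ 2 * (α ν * z ν ^ 2), a + b * t + y μ + y ν +
    (u μ + v μ * t + 2 * y μ) * (u ν + v ν * t + 2 * y ν),
    spanSingleton _ (z μ * z ν) * (J μ * J ν), fun hsq => hne (hinj _ _ ?_), ?_, ?_, ?_, ?_, ?_⟩
  · obtain ⟨γ, hγ⟩ := hsq
    refine ⟨γ / (z μ * z ν), ?_⟩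
    have := hz μ
    have := hz ν
    field_simp
    linear_combination hγ
  · rw [hy, hy]
    have h3 : (1 + 2 * (u μ + v μ * t + 2 * y μ)) * (1 + 2 * (u ν + v ν * t + 2 * y ν)) =
        1 + 4 * (a + b * t + y μ + y ν +
          (u μ + v μ * t + 2 * y μ) * (u ν + v ν * t + 2 * y ν) : 𝓞 L) := by
      have ha' : (u μ : 𝓞 L) + u ν = 2 * a := by exact_mod_cast congrArg (Int.cast : ℤ → 𝓞 L) ha
      have hb' : (v μ : 𝓞 L) + v ν = 2 * b := by exact_mod_cast congrArg (Int.cast : ℤ → 𝓞 L) hb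
      linear_combination 2 * ha' + 2 * t * hb'
    have := congrArg (algebraMap (𝓞 L) L) h3
    rwa [map_mul, map_add _ 1 (4 * _), map_mul _ 4, map_one, map_ofNat] at this
  · refine mul_ne_zero ?_ (mul_ne_zero (hJ0 μ) (hJ0 ν))
    rw [Ne, spanSingleton_eq_zero_iff]
    exact mul_ne_zero (hz μ) (hz ν)
  · rw [mul_mul_mul_comm, mul_mul_mul_comm (J μ), hJ, hJ]
    simp only [spanSingleton_mul_spanSingleton]
    congr 1
    ring
  · intro g hg
    obtain ⟨w, hw⟩ := hG μ g hg
    obtain ⟨w', hw'⟩ := hG ν g hg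
    refine ⟨w * w' * (g (z μ) / z μ) * (g (z ν) / z ν), ?_⟩
    have := hz μ
    have := hz ν
    simp only [map_mul, map_pow, hw, hw']
    field_simp
  · intro φ
    have h3 : φ (α μ) ≠ 0 := (map_ne_zero φ).2 (hα0 μ)
    have h4 : φ (α ν) ≠ 0 := (map_ne_zero φ).2 (hα0 ν)
    have h5 : 0 < φ (α μ) * φ (α ν) := by
      have h6 : 0 < φ (α μ) ↔ 0 < φ (α ν) := by rw [hpos, hpos, hσ]
      rcases h3.lt_or_gt with h7 | h7
      · exact mul_pos_of_neg_of_neg h7 (h4.lt_or_gt.resolve_right fun h8 => h7.not_gt (h6.2 h8))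
      · exact mul_pos h7 (h6.1 h7)
    have h8 : φ (z μ * z ν) ≠ 0 := (map_ne_zero φ).2 (mul_ne_zero (hz μ) (hz ν))
    have h9 : φ (α μ * z μ ^ 2 * (α ν * z ν ^ 2)) = φ (α μ) * φ (α ν) * φ (z μ * z ν) ^ 2 := by
      simp only [map_mul, map_pow]
      ring
    rw [h9]
    exact mul_pos h5 (sq_pos_of_ne_zero h8)

end IsQuadraticTower

end

section

open NumberField FractionalIdeal FracAct
open scoped nonZeroDivisors

theorem FreeGroup.apply_eq_one_of_dual {d : ℕ} {G A : Type*} [Group G] [CommGroup A]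
    {x : Fin d → G} {chi : Fin d → G →* Multiplicative (ZMod 2)}
    (hchi : ∀ i j, (chi j (x i)).toAdd = if i = j then 1 else 0)
    (ε : FreeGroup (Fin d) →* A) (hε : ∀ f, ε f ^ 2 = 1) {r : FreeGroup (Fin d)}
    (hr : FreeGroup.lift x r = 1) : ε r = 1 := by
  let φ : Fin d → Multiplicative (ZMod 2) →* A := fun i => AddMonoidHom.toMultiplicativeLeft
    (ZMod.lift 2 ⟨zmultiplesHom (Additive A) (Additive.ofMul (ε (FreeGroup.of i))), by
      rw [zmultiplesHom_apply]
      exact congrArg Additive.ofMul ((zpow_natCast _ 2).trans (hε (FreeGroup.of i)))⟩)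
  have hφ : ∀ i, φ i (Multiplicative.ofAdd 1) = ε (FreeGroup.of i) := fun i => by
    have h1 := ZMod.lift_coe 2 ⟨zmultiplesHom (Additive A) (Additive.ofMul (ε (FreeGroup.of i))),
      by
        rw [zmultiplesHom_apply]
        exact congrArg Additive.ofMul ((zpow_natCast _ 2).trans (hε (FreeGroup.of i)))⟩ 1
    rw [Int.cast_one] at h1
    exact congrArg Additive.toMul (h1.trans (one_zsmul _))
  have h : (∏ j, (φ j).comp (chi j)).comp (FreeGroup.lift x) = ε := by
    refine FreeGroup.ext_hom _ _ fun i => ?_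
    rw [MonoidHom.comp_apply, FreeGroup.lift_apply_of, MonoidHom.finsetProd_apply,
      Finset.prod_eq_single i]
    · rw [MonoidHom.comp_apply, ← hφ]
      congr 1
      exact (congrArg Multiplicative.ofAdd (hchi i i)).trans (by rw [if_pos rfl])
    · intro j _ hj
      have : chi j (x i) = 1 :=
        (congrArg Multiplicative.ofAdd (hchi i j)).trans (by rw [if_neg (Ne.symm hj)]; rfl)
      rw [MonoidHom.comp_apply, this, _root_.map_one]
    · simp
  rw [← h, MonoidHom.comp_apply, hr, _root_.map_one]

namespace IsEtaleGroup

variable {L : Type*} [Field L] [NumberField L] {G : Subgroup (L ≃ₐ[ℚ] L)}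

theorem exists_of_crossed (hG : IsEtaleGroup G) {Γ : Type*} [Group Γ] {π : Γ →* G}
    (hsurj : Function.Surjective π) {β : Γ → Lˣ}
    (hβ : ∀ x y, β (x * y) = β x * unitAut L (π x) (β y))
    (hker : ∀ r : π.ker, ∃ e : ℤˣ, β r = Units.map (Int.castRingHom L : ℤ →* L) e) :
    ∃ (α : Lˣ) (B : FractionalIdeal (𝓞 L)⁰ L)
      (C : FractionalIdeal (𝓞 (IntermediateField.fixedField G))⁰ (IntermediateField.fixedField G)),
      B ≠ 0 ∧ (∀ f, unitAut L (π f) α = β f ^ 2 * α) ∧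
      extendedHom L (𝓞 L) C = spanSingleton _ (α : L) * (B * B) := by
  classical
  have : Fintype G := Fintype.ofFinite G
  obtain ⟨s, hs⟩ := hsurj.hasRightInverse
  have hsign : ∀ u v, π u = π v → ∃ e : ℤˣ,
      β u = β v * Units.map (Int.castRingHom L : ℤ →* L) e := fun u v huv => by
    obtain ⟨e, he⟩ := hker ⟨v⁻¹ * u, by
      rw [MonoidHom.mem_ker, map_mul, map_inv, huv, inv_mul_cancel]⟩
    refine ⟨e, ?_⟩
    rw [← unitAut_intCast (π v : L ≃ₐ[ℚ] L) e, ← he, ← hβ, mul_inv_cancel_left]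
  have hsq : ∀ u v, π u = π v → β u ^ 2 = β v ^ 2 := fun u v huv => by
    obtain ⟨e, he⟩ := hsign u v huv
    rw [he, mul_pow, ← map_pow, Int.units_sq, map_one, mul_one]
  have hspan : ∀ u v, π u = π v →
      spanSingleton (𝓞 L)⁰ (β u : L) = spanSingleton _ (β v : L) := fun u v huv => by
    obtain ⟨e, he⟩ := hsign u v huv
    rcases Int.units_eq_one_or e with rfl | rfl
    · rw [he, map_one, mul_one]
    · have h1 : ((β u : Lˣ) : L) = -(β v : L) := by rw [he]; simp
      rw [h1]
      refine le_antisymm ?_ ?_ <;> rw [spanSingleton_le_iff_mem]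
      · exact Submodule.neg_mem _ (mem_spanSingleton_self _ _)
      · have := Submodule.neg_mem _ (mem_spanSingleton_self (𝓞 L)⁰ (-(β v : L)))
        rwa [neg_neg] at this
  obtain ⟨b, hb⟩ := exists_coboundary G (fun g => if h : g ∈ G then β (s ⟨g, h⟩) ^ 2 else 1) (by
    intro m hm n hn
    rw [dif_pos hm, dif_pos hn, dif_pos (G.mul_mem hm hn),
      hsq _ (s ⟨m, hm⟩ * s ⟨n, hn⟩) (by rw [map_mul, hs, hs, hs]; rfl), hβ, mul_pow, hs, map_pow])
  have hα : ∀ f, unitAut L (π f) b⁻¹ = β f ^ 2 * b⁻¹ := fun f => by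
    have h := hb (π f) (π f).2
    simp only [SetLike.coe_mem, dif_pos] at h
    rw [hsq (s _) f (hs _)] at h
    rw [map_inv, ← h, mul_inv, mul_inv_cancel_left, h]
  set B : FractionalIdeal (𝓞 L)⁰ L := ∑ h : G, spanSingleton _ (β (s h) : L) with hB
  have hact : ∀ f, spanSingleton _ (β f : L) * act ((π f : G) : L ≃ₐ[ℚ] L).toRingEquiv B = B := by
    intro f
    rw [hB, map_sum, Finset.mul_sum]
    refine Fintype.sum_equiv (Equiv.mulLeft (π f)) _ _ fun h => ?_
    rw [act_spanSingleton, spanSingleton_mul_spanSingleton,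
      Equiv.coe_mulLeft, hspan (s (π f * h)) (f * s h) (by rw [map_mul, hs, hs]), hβ]
    rfl
  have hB0 : B ≠ 0 := fun h0 => by
    have h1 : spanSingleton (𝓞 L)⁰ (β (s 1) : L) ≤ B :=
      Finset.single_le_sum (f := fun h : G => spanSingleton (𝓞 L)⁰ (β (s h) : L))
        (fun i _ => FractionalIdeal.zero_le _) (Finset.mem_univ 1)
    rw [h0, FractionalIdeal.le_zero_iff, spanSingleton_eq_zero_iff] at h1
    exact (β (s 1)).ne_zero h1
  obtain ⟨C, hC⟩ := hG.exists_extendedHom_eq (I := spanSingleton _ ((b⁻¹ : Lˣ) : L) * (B * B)) (by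
    intro g hg
    obtain ⟨f, hf⟩ := hsurj ⟨g, hg⟩
    have e1 : g = ((π f : G) : L ≃ₐ[ℚ] L) := by rw [hf]
    rw [e1, map_mul, map_mul, act_spanSingleton]
    have e2 : ((π f : G) : L ≃ₐ[ℚ] L).toRingEquiv ((b⁻¹ : Lˣ) : L) =
        ((β f : Lˣ) : L) ^ 2 * ((b⁻¹ : Lˣ) : L) := congrArg Units.val (hα f)
    rw [e2, sq, ← spanSingleton_mul_spanSingleton, ← spanSingleton_mul_spanSingleton]
    conv_rhs => rw [← hact f]
    ring)
  exact ⟨b⁻¹, B, C, hB0, hα, hC⟩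

theorem mul_apply_eq_one_of_dual {d : ℕ} {x : Fin d → G}
    {chi : Fin d → G →* Multiplicative (ZMod 2)}
    (hchi : ∀ i j, (chi j (x i)).toAdd = if i = j then 1 else 0)
    {β β' : FreeGroup (Fin d) → Lˣ}
    (hβ : ∀ u v, β (u * v) = β u * unitAut L (FreeGroup.lift x u) (β v))
    (hβ' : ∀ u v, β' (u * v) = β' u * unitAut L (FreeGroup.lift x u) (β' v))
    {α α' c γ : Lˣ} (hα : ∀ f, unitAut L (FreeGroup.lift x f) α = β f ^ 2 * α)
    (hα' : ∀ f, unitAut L (FreeGroup.lift x f) α' = β' f ^ 2 * α')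
    (hc : ∀ f, unitAut L (FreeGroup.lift x f) c = c) (h : α * α' = c * γ ^ 2)
    {r : FreeGroup (Fin d)} (hr : FreeGroup.lift x r = 1) : β r * β' r = 1 := by
  set π := FreeGroup.lift x
  have hsq : ∀ f, (β f * β' f * γ * (unitAut L (π f) γ)⁻¹) ^ 2 = 1 := by
    intro f
    have h1 := congrArg (unitAut L (π f)) h
    rw [map_mul, hα, hα', map_mul, hc, map_pow, mul_mul_mul_comm, h] at h1
    have h2 : β f ^ 2 * β' f ^ 2 * γ ^ 2 = unitAut L (π f) γ ^ 2 := by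
      apply mul_left_cancel (a := c)
      rw [← h1]
      ac_rfl
    rw [mul_pow, mul_pow, mul_pow, h2, inv_pow, mul_inv_cancel]
  have hsign : ∀ f g, unitAut L (π g) (β f * β' f * γ * (unitAut L (π f) γ)⁻¹) =
      β f * β' f * γ * (unitAut L (π f) γ)⁻¹ := by
    intro f g
    have h1 := hsq f
    rw [Units.ext_iff, Units.val_pow_eq_pow_val, Units.val_one, sq_eq_one_iff] at h1
    apply Units.ext
    change ((π g : G) : L ≃ₐ[ℚ] L) _ = _
    rcases h1 with h1 | h1
    · rw [h1, map_one]
    · rw [h1, map_neg, map_one]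
  let ε : FreeGroup (Fin d) →* Lˣ :=
    { toFun := fun f => β f * β' f * γ * (unitAut L (π f) γ)⁻¹
      map_one' := by
        have h1 : β 1 = 1 := by simpa using hβ 1 1
        have h2 : β' 1 = 1 := by simpa using hβ' 1 1
        simp [h1, h2]
      map_mul' := fun u v => by
        have h1 := hsign v u
        rw [← h1, hβ, hβ']
        simp only [map_mul, map_inv, Subgroup.coe_mul, MulAut.mul_apply]
        have := mul_inv_cancel (unitAut L (π u) γ)
        set t := unitAut L (π u) γ
        calc _ = β u * β' u * γ * (t * t⁻¹) * (unitAut L (π u) (β v) * unitAut L (π u) (β' v)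
              * (unitAut L (π u) (unitAut L (π v) γ))⁻¹) := by
              rw [this, mul_one]
              ac_rfl
          _ = _ := by
              generalize (unitAut L (π u) (unitAut L (π v) γ))⁻¹ = y
              generalize t⁻¹ = z
              ac_rfl }
  have h1 := FreeGroup.apply_eq_one_of_dual hchi ε hsq hr
  change β r * β' r * γ * (unitAut L (π r) γ)⁻¹ = 1 at h1
  rw [hr] at h1
  simpa using h1

end IsEtaleGroup

end

section

open NumberField FractionalIdeal IsEtaleGroup
open scoped nonZeroDivisors

theorem ClassGroup.exists_fiber {F ι : Type*} [Field F] [NumberField F] [Fintype ι]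
    {C : ι → FractionalIdeal (𝓞 F)⁰ F} (hC : ∀ i, C i ≠ 0) {n : ℕ}
    (hn : Nat.card (ClassGroup (𝓞 F)) * n < Fintype.card ι) :
    ∃ s : Finset ι, n < s.card ∧
      ∀ i ∈ s, ∀ j ∈ s, ∃ c : Fˣ, C i = spanSingleton _ (c : F) * C j := by
  classical
  rw [Nat.card_eq_fintype_card] at hn
  obtain ⟨y, hy⟩ := Fintype.exists_lt_card_fiber_of_mul_lt_card (fun i =>
    (ClassGroup.equiv F).symm (QuotientGroup.mk' _ (Units.mk0 (C i) (hC i)))) hn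
  refine ⟨_, hy, fun i hi j hj => ?_⟩
  have h := (Finset.mem_filter.1 hj).2.trans (Finset.mem_filter.1 hi).2.symm
  obtain ⟨_, ⟨c, rfl⟩, hc⟩ := (QuotientGroup.mk'_eq_mk' _).1 ((ClassGroup.equiv F).symm.injective h)
  refine ⟨c, ?_⟩
  rw [mul_comm]
  have h1 := (congrArg Units.val hc).symm
  rwa [Units.val_mul, coe_toPrincipalIdeal] at h1

namespace IsQuadraticTower

variable {D : ℕ}

theorem exists_step {L : Type} [Field L] [NumberField L] {G : Subgroup (L ≃ₐ[ℚ] L)}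
    (h : IsQuadraticTower D G) (hD : ¬ IsSquare D) (hD4 : D % 4 = 1)
    {d : ℕ} (hd : 2 ≤ d) (hdD : ∀ r, d ^ 2 < 4 * r → D ^ 3 * 16 < 2 ^ r) {x : Fin d → G}
    {chi : Fin d → G →* Multiplicative (ZMod 2)} (hx : Function.Surjective (FreeGroup.lift x))
    (hchi : ∀ i j, (chi j (x i)).toAdd = if i = j then 1 else 0) :
    ∃ (L' : Type) (_ : Field L') (_ : NumberField L') (_ : Algebra L L')
      (G' : Subgroup (L' ≃ₐ[ℚ] L')), IsQuadraticTower D G' ∧ Nat.card G' = 2 * Nat.card G := by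
  classical
  have := h.isTotallyReal
  obtain ⟨s, hs⟩ := h.exists_sqrt_fixedField
  obtain ⟨r, hr, lam, hlam, hconj⟩ :=
    GolodShafarevich.exists_invariant_characters h.isPGroup hd hx chi hchi
  choose β hβ hβker using fun n => h.isEtale.exists_crossed h.isPGroup hx (lam n) (hconj n)
  choose α B C hB hα hC using fun n =>
    h.isEtale.exists_of_crossed hx (hβ n) fun r => ⟨_, hβker n r⟩
  have hC0 : ∀ n, C n ≠ 0 := fun n h0 => by
    have h1 := hC n
    rw [h0, map_zero, eq_comm, mul_eq_zero, mul_self_eq_zero, spanSingleton_eq_zero_iff] at h1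
    exact h1.elim (α n).ne_zero (hB n)
  obtain ⟨S, hS, hSC⟩ := ClassGroup.exists_fiber hC0 (n := 16) (by
    rw [Fintype.card_fin]
    exact (Nat.mul_le_mul_right _ (QuadraticField.card_classGroup_le h.finrank_fixedField hD
      hs)).trans_lt (hdD r hr))
  obtain ⟨n₀, hn₀⟩ := Finset.card_pos.1 ((Nat.zero_le _).trans_lt hS)
  choose c hc using fun n : S => hSC n n.2 n₀ hn₀
  let c' : S → Lˣ := fun n => Units.map (algebraMap (IntermediateField.fixedField G) L).toMonoidHom (c n)
  have hc' : ∀ n, ∀ g ∈ G, unitAut L g (c' n) = c' n := fun n g hg =>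
    Units.ext ((IntermediateField.mem_fixedField_iff _ _).1 (c n : IntermediateField.fixedField G).2
      g hg)
  obtain ⟨A, y, I, hA, hAy, hI0, hI, hAG, hpos⟩ := h.exists_pair hD hD4 (M := S)
    (by rwa [Fintype.card_coe]) (α := fun n => ((α n * (c' n)⁻¹ * (α n₀)⁻¹ : Lˣ) : L))
    (J := fun n => B n₀ * (B n)⁻¹) (fun n => mul_ne_zero (hB _) (inv_ne_zero (hB _)))
    (fun n => by
      have h1 := congrArg (extendedHom L (𝓞 L)) (hc n)
      rw [map_mul, hC, hC, IsUnramifiedQuadratic.extendedHom_spanSingleton] at h1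
      have h2 : spanSingleton (𝓞 L)⁰ (c' n : L) * (spanSingleton _ (α n₀ : L) * (B n₀ * B n₀)) =
        spanSingleton _ (α n : L) * (B n * B n) := h1.symm
      have h3 : spanSingleton (𝓞 L)⁰ ((α n * (c' n)⁻¹ * (α n₀)⁻¹ : Lˣ) : L) =
          spanSingleton _ (α n : L) * (spanSingleton _ (c' n : L))⁻¹ *
            (spanSingleton _ (α n₀ : L))⁻¹ := by
        rw [spanSingleton_inv, spanSingleton_inv, spanSingleton_mul_spanSingleton,
          spanSingleton_mul_spanSingleton]
        push_cast
        rfl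
      have e1 : spanSingleton (𝓞 L)⁰ (c' n : L) ≠ 0 :=
        spanSingleton_eq_zero_iff.not.2 (c' n).ne_zero
      have e2 : spanSingleton (𝓞 L)⁰ (α n₀ : L) ≠ 0 :=
        spanSingleton_eq_zero_iff.not.2 (α n₀).ne_zero
      have e3 := hB n
      rw [h3]
      field_simp
      refine Eq.trans ?_ (h2.trans ?_) <;> ring)
    (fun n g hg => by
      obtain ⟨f, hf⟩ := hx ⟨g, hg⟩
      have e : g = ((FreeGroup.lift x f : G) : L ≃ₐ[ℚ] L) := by rw [hf]
      refine ⟨((β n f * (β n₀ f)⁻¹ : Lˣ) : L), ?_⟩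
      have h1 : unitAut L g (α n * (c' n)⁻¹ * (α n₀)⁻¹) =
          (β n f * (β n₀ f)⁻¹) ^ 2 * (α n * (c' n)⁻¹ * (α n₀)⁻¹) := by
        rw [map_mul, map_mul, map_inv, map_inv, hc' n g hg, e, hα, hα, mul_inv, mul_pow, inv_pow]
        generalize (c' n)⁻¹ = u
        generalize (α n₀)⁻¹ = v
        generalize (β n₀ f ^ 2)⁻¹ = w
        ac_rfl
      exact congrArg Units.val h1)
    (fun m n hmn => by
      obtain ⟨γ, hγ⟩ := hmn
      have hγ0 : γ ≠ 0 := by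
        rintro rfl
        rw [mul_zero, ← Units.val_mul] at hγ
        exact Units.ne_zero _ hγ
      have h1 : α m * α n = (c' m * c' n) * (Units.mk0 γ hγ0 * α n₀) ^ 2 := by
        have h2 : (α m * (c' m)⁻¹ * (α n₀)⁻¹) * (α n * (c' n)⁻¹ * (α n₀)⁻¹) =
            Units.mk0 γ hγ0 * Units.mk0 γ hγ0 := Units.ext hγ
        rw [mul_pow, sq, ← h2]
        calc _ = α m * α n * (c' m * (c' m)⁻¹) * (c' n * (c' n)⁻¹) *
              (α n₀ * (α n₀)⁻¹) ^ 2 := by simp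
          _ = _ := by
              rw [sq, sq]
              generalize (c' m)⁻¹ = u
              generalize (c' n)⁻¹ = v
              generalize (α n₀)⁻¹ = w
              ac_rfl
      refine Subtype.ext (hlam (MonoidHom.ext fun r => ?_))
      have h3 := mul_apply_eq_one_of_dual hchi (hβ m) (hβ n) (hα m) (hα n)
        (fun f => by rw [map_mul, hc' m _ (SetLike.coe_mem _), hc' n _ (SetLike.coe_mem _)]) h1 r.2
      rw [hβker, hβker, ← map_mul] at h3
      have h4 : ((lam m r * lam n r : ℤˣ) : ℤ) = 1 := by
        have := congrArg Units.val h3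
        exact_mod_cast (show (((lam m r * lam n r : ℤˣ) : ℤ) : L) = 1 from this)
      have h5 : lam m r * lam n r = 1 := Units.ext h4
      rw [mul_eq_one_iff_eq_inv.1 h5, Int.units_inv_eq_self])
  obtain ⟨L', _, _, _, s', hs'⟩ := exists_isSqrtExtension hA
  exact ⟨L', inferInstance, inferInstance, inferInstance, IsSqrtExtension.liftGroup L' G,
    hs'.isQuadraticTower_liftGroup h hAG hAy hI0 hI hpos, hs'.card_liftGroup hAG⟩

end IsQuadraticTower

end

section

namespace IsQuadraticTower

theorem exists_primes : ∃ (P : Finset ℕ) (q : ℕ), (∀ p ∈ insert q P, p.Prime ∧ p % 4 = 1) ∧ q ∉ P ∧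
    P.card = 134 ∧ (∏ p ∈ insert q P, p) ^ 3 * 16 < 2 ^ 4489 := by
  have h : 135 ≤ ((Finset.range 2000).filter fun p =>
      1 < p ∧ p % 4 = 1 ∧ ∀ m ∈ Finset.range 45, 1 < m → m < p → p % m ≠ 0).card := by
    decide +kernel
  obtain ⟨S, hS, hS'⟩ := Finset.exists_subset_card_eq h
  obtain ⟨q, hq⟩ : S.Nonempty := Finset.card_pos.1 (by omega)
  refine ⟨S.erase q, q, ?_, Finset.notMem_erase _ _, by rw [Finset.card_erase_of_mem hq, hS'], ?_⟩
  · intro p hp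
    rw [Finset.insert_erase hq] at hp
    obtain ⟨h1, h2, h3, h4⟩ := Finset.mem_filter.1 (hS hp)
    refine ⟨Nat.prime_def_le_sqrt.2 ⟨h2, fun m hm hmp hdvd => ?_⟩, h3⟩
    have h5 : m * m ≤ p := Nat.le_sqrt.1 hmp
    have h6 := Finset.mem_range.1 h1
    exact h4 m (Finset.mem_range.2 (by nlinarith)) hm (by nlinarith) (Nat.mod_eq_zero_of_dvd hdvd)
  · rw [Finset.insert_erase hq]
    have h1 : ∏ p ∈ S, p ≤ (2 ^ 11) ^ 135 := by
      rw [← hS']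
      exact Finset.prod_le_pow_card _ _ _ fun p hp =>
        (Finset.mem_range.1 (Finset.mem_filter.1 (hS hp)).1).le.trans (by norm_num)
    exact (Nat.mul_le_mul_right _ (Nat.pow_le_pow_left h1 3)).trans_lt (by
      rw [show 16 = 2 ^ 4 from rfl, ← pow_mul, ← pow_mul, ← pow_add]
      exact Nat.pow_lt_pow_right one_lt_two (by norm_num))

theorem exists_large : ∃ D : ℕ, ¬ IsSquare D ∧ ∀ n, ∃ (L : Type) (_ : Field L) (_ : NumberField L)
    (G : Subgroup (L ≃ₐ[ℚ] L)), IsQuadraticTower D G ∧ n ≤ Nat.card G := by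
  obtain ⟨P, q, hP, hqP, hcard, hlt⟩ := exists_primes
  set D := ∏ p ∈ insert q P, p with hDdef
  have hq := (hP q (Finset.mem_insert_self _ _)).1
  have hPp : ∀ p ∈ P, p.Prime := fun p hp => (hP p (Finset.mem_insert_of_mem hp)).1
  have hDq : D = q * ∏ p ∈ P, p := Finset.prod_insert hqP
  have hD : ¬ IsSquare D := by
    rw [hDq]
    exact hq.not_isSquare_mul (hq.not_dvd_prod_of_notMem hPp hqP)
  have hD4 : D % 4 = 1 := by
    rw [hDdef, Finset.prod_nat_mod, Finset.prod_congr rfl fun p hp => (hP p hp).2]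
    simp
  refine ⟨D, hD, fun n => ?_⟩
  suffices h : ∃ (L : Type) (_ : Field L) (_ : NumberField L) (G : Subgroup (L ≃ₐ[ℚ] L)),
      IsQuadraticTower D G ∧ 2 ^ n ≤ Nat.card G ∧ ∀ p ∈ P, ∃ s : L, s ^ 2 = p by
    obtain ⟨L, _, _, G, h1, h2, -⟩ := h
    exact ⟨L, inferInstance, inferInstance, G, h1, n.lt_two_pow_self.le.trans h2⟩
  induction n with
  | zero =>
    have hprod : ∏ i : ↥(insert q P), (i : ℕ) = D := Finset.prod_coe_sort (insert q P) fun p => p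
    obtain ⟨L, _, _, G, h1, h2⟩ := exists_adjoin_sqrts (d := fun i : ↥(insert q P) => (i : ℕ))
      (fun i => (hP i i.2).2)
      (fun i j hij => (Nat.coprime_primes (hP i i.2).1 (hP j j.2).1).2
        fun h => hij (Subtype.ext h)) (by rwa [hprod])
    rw [hprod] at h1
    exact ⟨L, inferInstance, inferInstance, G, h1, Nat.card_pos, fun p hp =>
      h2 ⟨p, Finset.mem_insert_of_mem hp⟩⟩
  | succ n ih =>
    obtain ⟨L, _, _, G, h1, h2, h3⟩ := ih
    obtain ⟨f, hf⟩ := h1.exists_linearIndependent hPp hq hqP hDq h3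
    obtain ⟨d, x, chi, hd, hx, hchi⟩ := h1.isPGroup.exists_dual_generators hf
    rw [Fintype.card_coe, hcard] at hd
    obtain ⟨L', _, _, _, G', h4, h5⟩ := h1.exists_step hD hD4 (by omega) (fun r hr =>
      hlt.trans_le (Nat.pow_le_pow_right two_pos (by nlinarith))) hx hchi
    refine ⟨L', inferInstance, inferInstance, G', h4, ?_, fun p hp => ?_⟩
    · rw [h5, pow_succ, mul_comm]
      exact Nat.mul_le_mul_left 2 h2
    · obtain ⟨s, hs⟩ := h3 p hp
      exact ⟨algebraMap L L' s, by rw [← map_pow, hs, map_natCast]⟩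

end IsQuadraticTower

end

section

open scoped Pointwise

theorem Finset.sq_sum_card_le {α β : Type*} [Fintype α] [DecidableEq β] (B : α → Finset β) :
    (∑ a, (B a).card) ^ 2 ≤ (univ.biUnion B).card * ∑ a, ∑ b, (B a ∩ B b).card := by
  set A := univ.biUnion B with hA
  have hsub : ∀ a, B a ⊆ A := fun a => subset_biUnion_of_mem B (mem_univ a)
  have h1 : ∑ a, (B a).card = ∑ x ∈ A, ∑ a, if x ∈ B a then 1 else 0 := by
    rw [sum_comm]
    refine sum_congr rfl fun a _ => ?_
    rw [sum_boole, filter_mem_eq_inter, inter_eq_right.2 (hsub a), Nat.cast_id]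
  have h2 : ∑ a, ∑ b, (B a ∩ B b).card = ∑ x ∈ A, (∑ a, if x ∈ B a then 1 else 0) ^ 2 := by
    simp_rw [sq, sum_mul_sum]
    rw [sum_comm (s := A)]
    refine sum_congr rfl fun a _ => ?_
    rw [sum_comm (s := A)]
    refine sum_congr rfl fun b _ => ?_
    simp_rw [ite_zero_mul_ite_zero, mul_one]
    rw [sum_boole, Nat.cast_id]
    congr 1
    ext x
    rw [mem_inter, mem_filter]
    exact ⟨fun h => ⟨hsub a h.1, h⟩, fun h => h.2⟩
  rw [h1, h2]
  exact_mod_cast sq_sum_le_card_mul_sum_sq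

theorem sum_half_pow_dist_le (u T : ℕ) :
    ∑ v ∈ Finset.range T, (2⁻¹ : ℝ) ^ (max u v - min u v) ≤ 4 := by
  have h1 : ∀ T, T ≤ u + 1 → ∑ v ∈ Finset.range T, (2⁻¹ : ℝ) ^ (max u v - min u v) ≤
      2 * 2⁻¹ ^ (u + 1 - T) := by
    intro T
    induction T with
    | zero => intro _; simp
    | succ T ih =>
      intro hT
      have e : max u T - min u T = u - T := by omega
      have e2 : u + 1 - T = (u - T) + 1 := by omega
      have := ih (by omega)
      rw [Finset.sum_range_succ, e, show u + 1 - (T + 1) = u - T by omega]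
      rw [e2, pow_succ] at this
      linarith
  have h2 : ∀ k, ∑ v ∈ Finset.range (u + 1 + k), (2⁻¹ : ℝ) ^ (max u v - min u v) ≤
      4 - 2 * 2⁻¹ ^ k := by
    intro k
    induction k with
    | zero => have := h1 (u + 1) le_rfl; norm_num at this ⊢; linarith
    | succ k ih =>
      rw [← add_assoc, Finset.sum_range_succ,
        show max u (u + 1 + k) - min u (u + 1 + k) = k + 1 by omega, pow_succ]
      have : (0 : ℝ) < 2⁻¹ ^ k := by positivity
      linarith
  rcases le_total T (u + 1) with h | h
  · refine (h1 T h).trans ?_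
    have : (2⁻¹ : ℝ) ^ (u + 1 - T) ≤ 1 := pow_le_one₀ (by norm_num) (by norm_num)
    linarith
  · obtain ⟨k, rfl⟩ := Nat.exists_eq_add_of_le h
    refine (h2 k).trans ?_
    have : (0 : ℝ) < 2⁻¹ ^ k := by positivity
    linarith

namespace BoxCount

variable {X W : Type*} [CommRing X] [Fintype W]

/-- The elements all of whose conjugates are bounded by prescribed quantities. -/
def box (σ : W → X →+* ℝ) (r : W → ℝ) : Set X := {x | ∀ w, |σ w x| ≤ r w}

section

variable [Nonempty W] {σ : W → X →+* ℝ} (hσ : ∀ x, x ≠ 0 → 1 ≤ ∏ w, |σ w x|)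
include hσ

theorem box_finite_and_ncard_le {r t : W → ℝ} (hr : ∀ w, 0 ≤ r w) (ht : ∀ w, 0 < t w)
    (hprod : ∏ w, t w ≤ 1) :
    (box σ r).Finite ∧ ((box σ r).ncard : ℝ) ≤ ∏ w, (2 * (r w / t w) + 2) := by
  classical
  set F : X → W → ℤ := fun x w => ⌊σ w x / t w⌋
  set S : Finset (W → ℤ) := Fintype.piFinset fun w => Finset.Icc ⌊-(r w / t w)⌋ ⌊r w / t w⌋
  have hmaps : Set.MapsTo F (box σ r) S := fun x hx => by
    rw [Finset.mem_coe, Fintype.mem_piFinset]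
    intro w
    have h1 := abs_le.1 (hx w)
    refine Finset.mem_Icc.2 ⟨Int.floor_le_floor ?_, Int.floor_le_floor ?_⟩
    · rw [← neg_div]
      exact div_le_div_of_nonneg_right h1.1 (ht w).le
    · exact div_le_div_of_nonneg_right h1.2 (ht w).le
  have hinj : Set.InjOn F (box σ r) := fun x _ y _ hxy => by
    by_contra hne
    have h1 : ∀ w, |σ w (x - y)| < t w := fun w => by
      have := Int.abs_sub_lt_one_of_floor_eq_floor (congrFun hxy w)
      rwa [← sub_div, ← map_sub, abs_div, abs_of_pos (ht w), div_lt_one (ht w)] at this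
    have h2 := hσ _ (sub_ne_zero.2 hne)
    have h3 : ∏ w, |σ w (x - y)| < ∏ w, t w :=
      Finset.prod_lt_prod_of_nonempty (fun w hw => (abs_nonneg _).lt_of_ne fun h0 => by
        rw [Finset.prod_eq_zero hw h0.symm] at h2
        linarith) (fun w _ => h1 w) Finset.univ_nonempty
    linarith
  refine ⟨Set.Finite.of_injOn hmaps hinj S.finite_toSet, ?_⟩
  have h1 := Set.ncard_le_ncard_of_injOn F hmaps hinj S.finite_toSet
  rw [Set.ncard_coe_finset, Fintype.card_piFinset] at h1
  refine (Nat.cast_le.2 h1).trans ?_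
  rw [Nat.cast_prod]
  refine Finset.prod_le_prod (fun w _ => Nat.cast_nonneg _) fun w _ => ?_
  have h2 : 0 ≤ r w / t w := div_nonneg (hr w) (ht w).le
  rw [Int.card_Icc]
  have h3 := Int.floor_le (r w / t w)
  have h4 := Int.lt_floor_add_one (-(r w / t w))
  have h5 : 0 ≤ ⌊r w / t w⌋ + 1 - ⌊-(r w / t w)⌋ := by
    have := Int.floor_le_floor (show -(r w / t w) ≤ r w / t w by linarith)
    linarith
  have h6 : (((⌊r w / t w⌋ + 1 - ⌊-(r w / t w)⌋).toNat : ℤ) : ℝ) =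
      ((⌊r w / t w⌋ + 1 - ⌊-(r w / t w)⌋ : ℤ) : ℝ) := by rw [Int.toNat_of_nonneg h5]
  rw [Int.cast_natCast] at h6
  rw [h6]
  push_cast
  linarith

end

end BoxCount

end

section

open scoped Pointwise

namespace BoxCount

variable {X : Type*} [CommRing X] {m : ℕ}

/-- Opposite dilations by powers of two on pairs of coordinates. -/
noncomputable def dil (a : Fin m → ℕ) (p : Fin m × Bool) : ℝ :=
  if p.2 then 2 ^ a p.1 else (2 ^ a p.1)⁻¹

theorem dil_pos (a : Fin m → ℕ) (p) : 0 < dil a p := by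
  unfold dil
  split_ifs <;> positivity

theorem prod_pair (f : Fin m × Bool → ℝ) : ∏ p, f p = ∏ i, f (i, true) * f (i, false) := by
  rw [Fintype.prod_prod_type]
  simp_rw [Fintype.prod_bool]

theorem prod_dil (a : Fin m → ℕ) : ∏ p, dil a p = 1 := by
  rw [prod_pair]
  refine Finset.prod_eq_one fun i _ => ?_
  simp [dil]

theorem dil_add (a b : Fin m → ℕ) (p) : dil (a + b) p = dil a p * dil b p := by
  unfold dil
  split_ifs
  · exact pow_add _ _ _
  · rw [Pi.add_apply, pow_add, mul_inv]

theorem dil_le (a : Fin m → ℕ) {T : ℕ} (ha : ∀ i, a i < T) (p) : dil a p ≤ 2 ^ T := by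
  unfold dil
  split_ifs
  · exact pow_le_pow_right₀ one_le_two (ha _).le
  · exact (inv_le_one_of_one_le₀ (one_le_pow₀ one_le_two)).trans (one_le_pow₀ one_le_two)

variable [NeZero m] {σ : Fin m × Bool → X →+* ℝ} (hσ : ∀ x, x ≠ 0 → 1 ≤ ∏ w, |σ w x|)
include hσ

theorem ncard_box_dil_le (a : Fin m → ℕ) {R : ℝ} (hR : 1 ≤ R) :
    (box σ fun p => R * dil a p).Finite ∧
      ((box σ fun p => R * dil a p).ncard : ℝ) ≤ (16 * R ^ 2) ^ m := by
  obtain ⟨h1, h2⟩ := box_finite_and_ncard_le hσ (r := fun p => R * dil a p)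
    (fun p => mul_nonneg (by linarith) (dil_pos a p).le) (dil_pos a) (prod_dil a).le
  refine ⟨h1, h2.trans ?_⟩
  simp_rw [mul_div_cancel_right₀ R (dil_pos a _).ne']
  rw [prod_pair, Finset.prod_const, Finset.card_univ, Fintype.card_fin]
  exact pow_le_pow_left₀ (by positivity) (by nlinarith) _

theorem ncard_inter_le {a b : Fin m → ℕ} {T : ℕ} (ha : ∀ i, a i < T) (hb : ∀ i, b i < T) {R : ℝ}
    (hR : 2 ^ T ≤ R) : (((box σ fun p => R * dil a p) ∩ box σ fun p => R * dil b p).ncard : ℝ) ≤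
      ∏ i, 16 * R ^ 2 * 2⁻¹ ^ (max (a i) (b i) - min (a i) (b i)) := by
  have hR0 : 0 < R := lt_of_lt_of_le (by positivity) hR
  let r : Fin m × Bool → ℝ := fun p =>
    if p.2 then R * 2 ^ min (a p.1) (b p.1) else R * (2 ^ max (a p.1) (b p.1))⁻¹
  have hr : ∀ p, 0 ≤ r p := fun p => by
    simp only [r]
    split_ifs <;> positivity
  obtain ⟨h1, h2⟩ := box_finite_and_ncard_le hσ hr (dil_pos fun i => min (a i) (b i))
    (prod_dil _).le
  have hsub : ((box σ fun p => R * dil a p) ∩ box σ fun p => R * dil b p) ⊆ box σ r := by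
    rintro x ⟨hx, hy⟩ ⟨i, c⟩
    have h3 := hx (i, c)
    have h4 := hy (i, c)
    cases c
    · simp only [dil, r, Bool.false_eq_true, if_false] at h3 h4 ⊢
      rcases max_choice (a i) (b i) with h | h <;> rwa [h]
    · simp only [dil, r, if_true] at h3 h4 ⊢
      rcases min_choice (a i) (b i) with h | h <;> rwa [h]
  refine (Nat.cast_le.2 (Set.ncard_le_ncard hsub h1)).trans (h2.trans ?_)
  rw [prod_pair]
  refine Finset.prod_le_prod (fun i _ => mul_nonneg ?_ ?_) fun i _ => ?_
  · have := div_nonneg (hr (i, true)) (dil_pos (fun i => min (a i) (b i)) (i, true)).le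
    linarith
  · have := div_nonneg (hr (i, false)) (dil_pos (fun i => min (a i) (b i)) (i, false)).le
    linarith
  obtain ⟨k, hk⟩ : ∃ k, max (a i) (b i) = min (a i) (b i) + k :=
    Nat.exists_eq_add_of_le min_le_max
  have hkT : k ≤ T := by
    have := ha i
    have := hb i
    omega
  simp only [r, dil, Bool.false_eq_true, if_false, if_true]
  rw [hk, Nat.add_sub_cancel_left, mul_div_cancel_right₀ _ (by positivity), pow_add]
  have e : R * (2 ^ min (a i) (b i) * 2 ^ k)⁻¹ / (2 ^ min (a i) (b i))⁻¹ = R * 2⁻¹ ^ k := by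
    rw [inv_pow]
    field_simp
  rw [e]
  have h3 : 1 ≤ R * 2⁻¹ ^ k := by
    rw [inv_pow, ← div_eq_mul_inv, one_le_div (by positivity)]
    exact (pow_le_pow_right₀ one_le_two hkT).trans hR
  have h4 : 1 ≤ R := le_trans (one_le_pow₀ one_le_two) hR
  calc (2 * R + 2) * (2 * (R * 2⁻¹ ^ k) + 2) ≤ (4 * R) * (4 * (R * 2⁻¹ ^ k)) := by
        gcongr <;> linarith
    _ = _ := by ring

variable (σ) in
omit hσ [NeZero m] in
/-- The union of the dilated boxes. -/
def unionBox (T : ℕ) (R : ℝ) : Set X :=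
  ⋃ a : Fin m → Fin T, box σ fun p => R * dil (fun i => (a i : ℕ)) p

theorem unionBox_finite (T : ℕ) {R : ℝ} (hR : 1 ≤ R) : (unionBox σ T R).Finite :=
  Set.finite_iUnion fun _ => (ncard_box_dil_le hσ _ hR).1

theorem ncard_unionBox_le (T : ℕ) {R : ℝ} (hR : 1 ≤ R) :
    ((unionBox σ T R).ncard : ℝ) ≤ (T * (16 * R ^ 2)) ^ m := by
  classical
  have h1 : unionBox σ T R = ((Finset.univ.biUnion fun a : Fin m → Fin T =>
      (ncard_box_dil_le hσ (fun i => (a i : ℕ)) hR).1.toFinset : Finset X) : Set X) := by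
    rw [unionBox, Finset.coe_biUnion]
    simp
  rw [h1, Set.ncard_coe_finset]
  refine (Nat.cast_le.2 Finset.card_biUnion_le).trans ?_
  rw [Nat.cast_sum]
  refine (Finset.sum_le_card_nsmul _ _ ((16 * R ^ 2) ^ m) fun a _ => ?_).trans ?_
  · rw [← Set.ncard_eq_toFinset_card _ (ncard_box_dil_le hσ _ hR).1]
    exact (ncard_box_dil_le hσ _ hR).2
  · rw [Finset.card_univ, Fintype.card_fun, Fintype.card_fin, Fintype.card_fin, nsmul_eq_mul,
      Nat.cast_pow, ← mul_pow]

theorem mul_subset (T : ℕ) {R : ℝ} (hR : 1 ≤ R) :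
    unionBox σ T R * unionBox σ T R ⊆ unionBox σ (2 * T) (R ^ 2) := by
  rintro _ ⟨x, hx, y, hy, rfl⟩
  obtain ⟨a, ha⟩ := Set.mem_iUnion.1 hx
  obtain ⟨b, hb⟩ := Set.mem_iUnion.1 hy
  refine Set.mem_iUnion.2 ⟨fun i => ⟨a i + b i, by omega⟩, fun p => ?_⟩
  change |σ p (x * y)| ≤ R ^ 2 * dil ((fun i => (a i : ℕ)) + fun i => (b i : ℕ)) p
  rw [map_mul, abs_mul, dil_add, sq, mul_mul_mul_comm]
  exact mul_le_mul (ha p) (hb p) (abs_nonneg _) (mul_nonneg (by linarith) (dil_pos _ _).le)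

theorem ncard_mul_le (T : ℕ) {R : ℝ} (hR : 1 ≤ R) :
    ((unionBox σ T R * unionBox σ T R).ncard : ℝ) ≤ (32 * T * R ^ 4) ^ m := by
  have h1 : 1 ≤ R ^ 2 := one_le_pow₀ hR
  refine (Nat.cast_le.2 (Set.ncard_le_ncard (mul_subset hσ T hR)
    (unionBox_finite hσ _ h1))).trans ((ncard_unionBox_le hσ _ h1).trans_eq ?_)
  push_cast
  ring

theorem ncard_add_le (T : ℕ) {R : ℝ} (hR : 1 ≤ R) :
    ((unionBox σ T R + unionBox σ T R).ncard : ℝ) ≤ (36 * R ^ 2 * 4 ^ T) ^ m := by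
  have h1 : 1 ≤ R * 2 ^ T := one_le_mul_of_one_le_of_one_le hR (one_le_pow₀ one_le_two)
  obtain ⟨h2, h3⟩ := box_finite_and_ncard_le hσ (r := fun _ => 2 * (R * 2 ^ T)) (t := fun _ => 1)
    (fun _ => by positivity) (fun _ => one_pos) (by simp)
  have hbd : ∀ x ∈ unionBox σ T R, ∀ p, |σ p x| ≤ R * 2 ^ T := fun x hx p => by
    obtain ⟨a, ha⟩ := Set.mem_iUnion.1 hx
    exact (ha p).trans (mul_le_mul_of_nonneg_left (dil_le _ (fun i => (a i).2) p) (by linarith))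
  refine (Nat.cast_le.2 (Set.ncard_le_ncard ?_ h2)).trans (h3.trans ?_)
  · rintro _ ⟨x, hx, y, hy, rfl⟩ p
    rw [map_add]
    exact (abs_add_le _ _).trans (by linarith [hbd x hx p, hbd y hy p])
  · rw [prod_pair, Finset.prod_const, Finset.card_univ, Fintype.card_fin]
    refine pow_le_pow_left₀ (by positivity) ?_ _
    rw [div_one]
    have h4 : (4 : ℝ) ^ T = 2 ^ T * 2 ^ T := by rw [← mul_pow]; norm_num
    calc _ ≤ (6 * (R * 2 ^ T)) * (6 * (R * 2 ^ T)) := by gcongr <;> linarith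
      _ = _ := by rw [h4]; ring

theorem le_ncard_unionBox {T : ℕ} (hT : 1 ≤ T) {R κ : ℝ} (hR : 2 ^ T ≤ R) (hκ : 0 < κ)
    (hlow : ∀ r : Fin m × Bool → ℝ, (∀ w, 0 < r w) → ∏ w, r w ≤ κ ^ m * (box σ r).ncard) :
    (T * R ^ 2 / (64 * κ ^ 2)) ^ m ≤ ((unionBox σ T R).ncard : ℝ) := by
  classical
  have hR1 : 1 ≤ R := le_trans (one_le_pow₀ one_le_two) hR
  have hT0 : (0 : ℝ) < T := by exact_mod_cast hT
  set B : (Fin m → Fin T) → Finset X := fun a =>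
    (ncard_box_dil_le hσ (fun i => (a i : ℕ)) hR1).1.toFinset with hB
  have hBc : ∀ a, (B a : Set X) = box σ fun p => R * dil (fun i => (a i : ℕ)) p := fun a => by
    simp [hB]
  have hU : unionBox σ T R = ((Finset.univ.biUnion B : Finset X) : Set X) := by
    rw [unionBox, Finset.coe_biUnion]
    simp [hBc]
  have h1 : ∀ a, (R ^ 2 / κ) ^ m ≤ ((B a).card : ℝ) := fun a => by
    have := hlow _ fun p => mul_pos (by linarith : 0 < R) (dil_pos (fun i => (a i : ℕ)) p)
    rw [← hBc, Set.ncard_coe_finset, Finset.prod_mul_distrib, prod_dil, mul_one, Finset.prod_const,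
      Finset.card_univ, Fintype.card_prod, Fintype.card_fin, Fintype.card_bool, mul_comm m,
      pow_mul] at this
    rw [div_pow, div_le_iff₀ (by positivity), mul_comm]
    exact this
  have h2 : ((∑ a, (B a).card : ℕ) : ℝ) ≥ (T * (R ^ 2 / κ)) ^ m := by
    rw [Nat.cast_sum]
    have := Finset.card_nsmul_le_sum Finset.univ (fun a => ((B a).card : ℝ)) _ fun a _ => h1 a
    rwa [Finset.card_univ, Fintype.card_fun, Fintype.card_fin, Fintype.card_fin, nsmul_eq_mul,
      Nat.cast_pow, ← mul_pow] at this
  have h3 : ((∑ a, ∑ b, (B a ∩ B b).card : ℕ) : ℝ) ≤ (T * (64 * R ^ 2)) ^ m := by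
    rw [Nat.cast_sum]
    have h4 : ∀ a, ((∑ b, (B a ∩ B b).card : ℕ) : ℝ) ≤ (64 * R ^ 2) ^ m := fun a => by
      rw [Nat.cast_sum]
      have h5 : ∀ b, ((B a ∩ B b).card : ℝ) ≤ ∏ i, 16 * R ^ 2 *
          2⁻¹ ^ (max (a i : ℕ) (b i) - min (a i : ℕ) (b i)) := fun b => by
        have := ncard_inter_le hσ (fun i => (a i).2) (fun i => (b i).2) hR
        rwa [← hBc, ← hBc, ← Finset.coe_inter, Set.ncard_coe_finset] at this
      refine (Finset.sum_le_sum fun b _ => h5 b).trans ?_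
      rw [← Fintype.prod_sum (fun i (v : Fin T) => 16 * R ^ 2 *
        (2⁻¹ : ℝ) ^ (max (a i : ℕ) v - min (a i : ℕ) v))]
      refine (Finset.prod_le_prod (fun i _ => Finset.sum_nonneg fun v _ => by positivity)
        fun i _ => ?_).trans_eq (by rw [Finset.prod_const, Finset.card_univ, Fintype.card_fin])
      rw [← Finset.mul_sum, Fin.sum_univ_eq_sum_range
        (fun v => (2⁻¹ : ℝ) ^ (max (a i : ℕ) v - min (a i : ℕ) v))]
      nlinarith [sum_half_pow_dist_le (a i) T, sq_nonneg R]
    have := Finset.sum_le_card_nsmul Finset.univ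
      (fun a => ((∑ b, (B a ∩ B b).card : ℕ) : ℝ)) _ fun a _ => h4 a
    rwa [Finset.card_univ, Fintype.card_fun, Fintype.card_fin, Fintype.card_fin, nsmul_eq_mul,
      Nat.cast_pow, ← mul_pow] at this
  have h4 : (((∑ a, (B a).card) ^ 2 : ℕ) : ℝ) ≤ _ := Nat.cast_le.2 (Finset.sq_sum_card_le B)
  rw [Nat.cast_pow, Nat.cast_mul] at h4
  rw [hU, Set.ncard_coe_finset]
  have h5 : ((T * (R ^ 2 / κ)) ^ m) ^ 2 ≤
      ((Finset.univ.biUnion B).card : ℝ) * (T * (64 * R ^ 2)) ^ m :=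
    (pow_le_pow_left₀ (by positivity) h2 2).trans (h4.trans
      (mul_le_mul_of_nonneg_left h3 (Nat.cast_nonneg _)))
  have h6 : (0 : ℝ) < (T * (64 * R ^ 2)) ^ m := by positivity
  refine le_of_mul_le_mul_right (le_trans (le_of_eq ?_) h5) h6
  rw [← pow_mul, mul_comm m 2, pow_mul, ← mul_pow]
  congr 1
  field_simp

end BoxCount

end

section

open NumberField MeasureTheory Pointwise

theorem QuadraticField.natAbs_discr_le {K : Type*} [Field K] [NumberField K]
    (hK : Module.finrank ℚ K = 2) {D : ℕ} (hsq : ¬ IsSquare D) {s : K} (hs : s ^ 2 = D) :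
    (discr K).natAbs ≤ 4 * D := by
  have h_int : IsIntegral ℤ s := by
    refine IsIntegral.of_pow two_pos ?_
    rw [hs]
    exact map_natCast (algebraMap ℤ K) D ▸ isIntegral_algebraMap
  have hD : D ≠ 0 := by
    rintro rfl
    exact hsq (IsSquare.zero)
  let s' : 𝓞 K := ⟨s, h_int⟩
  have hs' : s' * s' = (D : 𝓞 K) := RingOfIntegers.ext (by
    have h : s * s = D := by rw [← hs, sq]
    rw [RingOfIntegers.coe_eq_algebraMap, RingOfIntegers.coe_eq_algebraMap, map_mul, map_natCast]
    exact h)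
  have htr (a b : ℤ) : Algebra.trace ℤ (𝓞 K) (a + b * s') = 2 * a := by
    have h1 := Algebra.coe_trace_int (K := K) (a + b * s')
    have h2 := QuadraticField.trace_eq hK hsq hs a b
    have h3 : (((a + b * s' : 𝓞 K)) : K) = ((a : ℚ) : K) + ((b : ℚ) : K) * s := by
      simp only [map_add, map_mul, map_intCast, Rat.cast_intCast]
      rfl
    rw [h3, h2] at h1
    exact_mod_cast h1
  have hcard : Fintype.card (Module.Free.ChooseBasisIndex ℤ (𝓞 K)) = Fintype.card (Fin 2) := by
    rw [← Module.finrank_eq_card_chooseBasisIndex, RingOfIntegers.rank, hK, Fintype.card_fin]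
  let b := (RingOfIntegers.basis K).reindex (Fintype.equivOfCardEq hcard)
  let v : Fin 2 → 𝓞 K := ![1, s']
  have h1 : Algebra.discr ℤ v = 4 * D := by
    have e0 : Algebra.trace ℤ (𝓞 K) 1 = 2 := by simpa using htr 1 0
    have e1 : Algebra.trace ℤ (𝓞 K) s' = 0 := by simpa using htr 0 1
    have e2 : Algebra.trace ℤ (𝓞 K) (D : 𝓞 K) = 2 * D := by simpa using htr D 0
    rw [Algebra.discr_def, Matrix.det_fin_two]
    simp only [Algebra.traceMatrix_apply, Algebra.traceForm_apply, v, Matrix.cons_val_zero,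
      Matrix.cons_val_one, mul_one, one_mul, hs', e0, e1, e2]
    ring
  have h2 := Algebra.discr_of_matrix_vecMul (A := ℤ) b (b.toMatrix v)
  rw [Module.Basis.toMatrix_map_vecMul, h1, discr_eq_discr K b] at h2
  refine Nat.le_of_dvd (by omega) ?_
  refine Int.natCast_dvd_natCast.1 ?_
  rw [Int.natAbs_dvd]
  exact ⟨_, by push_cast; rw [h2, mul_comm]⟩

/-- A set that covers every point at most `N` times under lattice translations has measure at
most `N` times the covolume. -/
theorem MeasureTheory.IsAddFundamentalDomain.measure_le_of_card_le {E L : Type*}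
    [MeasurableSpace E] {μ : Measure E} {F S : Set E} [AddGroup L] [Countable L] [AddAction L E]
    [MeasurableConstVAdd L E] [VAddInvariantMeasure L E μ]
    (fund : IsAddFundamentalDomain L F μ) (hS : MeasurableSet S) (N : ℕ)
    (hN : ∀ (x : E) (s : Finset L), (∀ g ∈ s, x ∈ g +ᵥ S) → s.card ≤ N) : μ S ≤ N * μ F := by
  classical
  have hm (g : L) : MeasurableSet (g +ᵥ S) := hS.const_vadd g
  calc μ S = ∑' g : L, μ ((g +ᵥ S) ∩ F) := fund.measure_eq_tsum S
    _ = ∑' g : L, ∫⁻ x in F, (g +ᵥ S).indicator 1 x ∂μ := by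
        refine tsum_congr fun g => ?_
        rw [lintegral_indicator_one (hm g), Measure.restrict_apply (hm g)]
    _ = ∫⁻ x in F, ∑' g : L, (g +ᵥ S).indicator 1 x ∂μ :=
        (lintegral_tsum fun g => (measurable_one.indicator (hm g)).aemeasurable).symm
    _ ≤ ∫⁻ _ in F, N ∂μ := by
        refine lintegral_mono fun x => ?_
        rw [ENNReal.tsum_eq_iSup_sum]
        refine iSup_le fun s => ?_
        simp only [Set.indicator_apply, Pi.one_apply]
        rw [Finset.sum_boole]
        exact_mod_cast hN x _ fun g hg => (Finset.mem_filter.1 hg).2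
    _ = N * μ F := by rw [setLIntegral_const]

namespace NumberField

variable (L : Type*) [Field L] [NumberField L]

open mixedEmbedding in
theorem prod_le_ncard_mul_sqrt_discr [IsTotallyReal L] (r : InfinitePlace L → NNReal)
    (hfin : {x : 𝓞 L | ∀ w : InfinitePlace L, w x ≤ r w}.Finite) :
    (∏ w, (r w : ℝ)) ≤ {x : 𝓞 L | ∀ w : InfinitePlace L, w x ≤ r w}.ncard * √|(discr L : ℝ)| := by
  classical
  have : VAddInvariantMeasure (mixedEmbedding.integerLattice L) (mixedSpace L) volume :=
    inferInstanceAs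
      (VAddInvariantMeasure (mixedEmbedding.integerLattice L).toAddSubgroup (mixedSpace L) volume)
  have hmeas : MeasurableSet (convexBodyLT L (fun w => r w / 2)) := by
    refine MeasurableSet.prod ?_ ?_ <;>
    exact MeasurableSet.univ_pi fun _ => measurableSet_ball
  have key := (fundamentalDomain_integerLattice L).measure_le_of_card_le (μ := volume) hmeas
    {x : 𝓞 L | ∀ w : InfinitePlace L, w x ≤ r w}.ncard ?_
  · rw [volume_fundamentalDomain_latticeBasis, convexBodyLT_volume,
      IsTotallyReal.nrComplexPlaces_eq_zero] at key
    have h := ENNReal.toReal_mono (by finiteness) key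
    simp only [pow_zero, one_mul, IsTotallyReal.mult_eq, pow_one, ENNReal.toReal_mul,
      ENNReal.toReal_natCast] at h
    have hc : InfinitePlace.nrRealPlaces L = Fintype.card (InfinitePlace L) := by
      rw [InfinitePlace.card_eq_nrRealPlaces_add_nrComplexPlaces,
        IsTotallyReal.nrComplexPlaces_eq_zero, add_zero]
    have hf : ((convexBodyLTFactor L : NNReal) : ℝ) = 2 ^ Fintype.card (InfinitePlace L) := by
      simp [convexBodyLTFactor, hc, IsTotallyReal.nrComplexPlaces_eq_zero]
    simp only [ENNReal.coe_toReal, hf] at h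
    simpa [Finset.prod_div_distrib, mul_div_cancel₀, Int.norm_eq_abs] using h
  · intro x s hs
    rcases s.eq_empty_or_nonempty with rfl | ⟨g₀, hg₀⟩
    · simp
    have hex (g : mixedEmbedding.integerLattice L) : ∃ y : 𝓞 L, mixedEmbedding L y = g := by
      obtain ⟨y, hy⟩ := g.2
      exact ⟨y, hy⟩
    choose y hy using hex
    rw [← Finset.card_image_of_injective s (f := fun g => y g - y g₀) fun a b hab => by
      have : y a = y b := sub_left_injective hab
      exact Subtype.ext (by rw [← hy, ← hy, this]), ← Set.ncard_coe_finset]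
    refine Set.ncard_le_ncard (fun z hz => ?_) hfin
    obtain ⟨g, hg, rfl⟩ := Finset.mem_image.1 (Finset.mem_coe.1 hz)
    obtain ⟨u, hu, hux⟩ := hs g hg
    obtain ⟨v, hv, hvx⟩ := hs g₀ hg₀
    have h1 : mixedEmbedding L (y g - y g₀ : 𝓞 L) = v + -u := by
      have e := map_sub ((mixedEmbedding L).comp (algebraMap (𝓞 L) L)) (y g) (y g₀)
      have e' : mixedEmbedding L (y g - y g₀ : 𝓞 L) =
        mixedEmbedding L (y g) - mixedEmbedding L (y g₀) := e
      rw [e', hy, hy]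
      have e1 : (g : mixedSpace L) + u = x := hux
      have e2 : (g₀ : mixedSpace L) + v = x := hvx
      rw [← sub_eq_add_neg, sub_eq_sub_iff_add_eq_add, e1, add_comm, e2]
    have h2 : mixedEmbedding L (y g - y g₀ : 𝓞 L) ∈ convexBodyLT L r := by
      have hu' := convexBodyLT_neg_mem L _ u hu
      rw [h1]
      simp only [Set.mem_prod, Set.mem_pi, Set.mem_univ, mem_ball_zero_iff, forall_true_left,
        NNReal.coe_div, NNReal.coe_ofNat] at hv hu' ⊢
      constructor <;> intro w
      · exact (norm_add_le _ _).trans_lt ((add_lt_add (hv.1 w) (hu'.1 w)).trans_eq (add_halves _))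
      · exact (norm_add_le _ _).trans_lt ((add_lt_add (hv.2 w) (hu'.2 w)).trans_eq (add_halves _))
    exact fun w => ((convexBodyLT_mem L r).1 h2 w).le

end NumberField

end

section

open NumberField Pointwise

theorem IsQuadraticTower.exists_embeddings {D : ℕ} (hD : ¬ IsSquare D) {L : Type} [Field L]
    [NumberField L] {G : Subgroup (L ≃ₐ[ℚ] L)} (h : IsQuadraticTower D G) :
    ∃ σ : Fin (Nat.card G) × Bool → 𝓞 L →+* ℝ, (∀ w, Function.Injective (σ w)) ∧
      (∀ x, x ≠ 0 → 1 ≤ ∏ w, |σ w x|) ∧ ∀ r : Fin (Nat.card G) × Bool → ℝ, (∀ w, 0 < r w) →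
        ∏ w, r w ≤ (4 * D : ℝ) ^ Nat.card G * (BoxCount.box σ r).ncard := by
  have := h.isTotallyReal
  have : NeZero (Nat.card G) := ⟨Nat.card_pos.ne'⟩
  have hcard : Fintype.card (Fin (Nat.card G) × Bool) = Fintype.card (InfinitePlace L) := by
    rw [InfinitePlace.card_eq_nrRealPlaces_add_nrComplexPlaces,
      IsTotallyReal.nrComplexPlaces_eq_zero, add_zero, ← IsTotallyReal.finrank, h.finrank_eq]
    simp [mul_comm]
  let e := Fintype.equivOfCardEq hcard
  let σ : Fin (Nat.card G) × Bool → 𝓞 L →+* ℝ := fun p =>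
    (InfinitePlace.embedding_of_isReal (IsTotallyReal.isReal (e p))).comp (algebraMap (𝓞 L) L)
  have hσw (p x) : |σ p x| = e p (x : L) :=
    InfinitePlace.norm_embedding_of_isReal (IsTotallyReal.isReal (e p)) _
  have hσ (x : 𝓞 L) (hx : x ≠ 0) : 1 ≤ ∏ w, |σ w x| := by
    simp_rw [hσw]
    rw [e.prod_comp (fun w => w (x : L))]
    have h1 := InfinitePlace.prod_eq_abs_norm (x : L)
    simp only [IsTotallyReal.mult_eq, pow_one] at h1
    rw [h1, ← Algebra.coe_norm_int]
    have h2 : Algebra.norm ℤ x ≠ 0 := Algebra.norm_ne_zero_iff.2 hx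
    exact_mod_cast Int.one_le_abs h2
  refine ⟨σ, fun w => ?_, hσ, fun r hr => ?_⟩
  · exact (RingHom.injective (InfinitePlace.embedding_of_isReal
      (IsTotallyReal.isReal (e w)))).comp RingOfIntegers.coe_injective
  have hfin := (BoxCount.box_finite_and_ncard_le hσ (r := r) (t := fun _ => 1) (fun w => (hr w).le)
    (fun _ => one_pos) (by simp)).1
  let ρ : InfinitePlace L → NNReal := fun w => ⟨r (e.symm w), (hr _).le⟩
  have hbox : {x : 𝓞 L | ∀ w : InfinitePlace L, w x ≤ ρ w} = BoxCount.box σ r := by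
    ext x
    refine ⟨fun hx p => ?_, fun hx w => ?_⟩
    · rw [hσw]
      refine (hx (e p)).trans_eq ?_
      change r (e.symm (e p)) = r p
      rw [e.symm_apply_apply]
    · have := hx (e.symm w)
      rwa [hσw, e.apply_symm_apply] at this
  have key := prod_le_ncard_mul_sqrt_discr L ρ (hbox ▸ hfin)
  rw [hbox] at key
  have hprod : ∏ w, (ρ w : ℝ) = ∏ p, r p := e.symm.prod_comp r
  have hd : |(discr L : ℝ)| ≤ (4 * D) ^ Nat.card G := by
    obtain ⟨s, hs⟩ := h.exists_sqrt_fixedField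
    have h1 := QuadraticField.natAbs_discr_le h.finrank_fixedField hD hs
    have h2 := Nat.pow_le_pow_left h1 (Nat.card G)
    rw [← h.isEtale.natAbs_discr] at h2
    have h3 : ((discr L).natAbs : ℝ) ≤ (4 * D) ^ Nat.card G := by exact_mod_cast h2
    rwa [Nat.cast_natAbs, Int.cast_abs] at h3
  have h1 : 1 ≤ |(discr L : ℝ)| := by exact_mod_cast Int.one_le_abs (discr_ne_zero L)
  have hsq : √|(discr L : ℝ)| ≤ (4 * D) ^ Nat.card G :=
    (Real.sqrt_le_iff.2 ⟨by linarith, by nlinarith⟩).trans hd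
  rw [hprod] at key
  refine key.trans ?_
  rw [mul_comm]
  exact mul_le_mul_of_nonneg_right hsq (Nat.cast_nonneg _)

theorem Real.le_rpow_two_sub_of_mul_le_sq {a b W : ℝ} {m : ℕ} (hW : 1 < W) (ha : 0 < a)
    (haW : a ≤ W ^ m) (h : b * 2 ^ m ≤ a ^ 2) : b ≤ a ^ (2 - Real.log 2 / Real.log W) := by
  have hlog := Real.log_pos hW
  have hc : 0 ≤ Real.log 2 / Real.log W := div_nonneg (Real.log_nonneg one_le_two) hlog.le
  have h1 : a ^ (Real.log 2 / Real.log W) ≤ 2 ^ m := by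
    refine (Real.rpow_le_rpow ha.le haW hc).trans_eq ?_
    rw [← Real.rpow_natCast W m, ← Real.rpow_mul (by linarith), mul_comm, Real.rpow_mul (by linarith),
      Real.rpow_natCast, Real.rpow_def_of_pos (by linarith), mul_div_cancel₀ _ hlog.ne',
      Real.exp_log two_pos]
  rw [Real.rpow_sub ha, Real.rpow_two, le_div_iff₀ (Real.rpow_pos_of_pos ha _)]
  rcases le_total b 0 with hb | hb
  · exact (mul_nonpos_of_nonpos_of_nonneg hb (Real.rpow_pos_of_pos ha _).le).trans (sq_nonneg a)
  · exact (mul_le_mul_of_nonneg_left h1 hb).trans h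

end

/-- **Sum-product counterexamples over ℝ.** There exists an absolute constant `c > 0`
such that there are arbitrarily large finite `A ⊆ ℝ` with
`max(|A+A|, |AA|) ≤ |A| ^ (2 - c)`. -/
theorem statement0 :
    ∃ c : ℝ, 0 < c ∧
      ∀ N : ℕ, ∃ A : Set ℝ, A.Finite ∧ N ≤ A.ncard ∧
        max ((A + A).ncard : ℝ) ((A * A).ncard : ℝ) ≤ (A.ncard : ℝ) ^ ((2 : ℝ) - c) := by
  obtain ⟨D, hD, hL⟩ := IsQuadraticTower.exists_large
  have hD1 : (1 : ℝ) ≤ D := by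
    rcases Nat.eq_zero_or_pos D with rfl | h
    · exact absurd IsSquare.zero hD
    · exact_mod_cast h
  set K : ℝ := 64 * (4 * D) ^ 2 with hK
  have hK1 : 1 ≤ K := by nlinarith
  let T : ℕ := 64 * (64 * (4 * D) ^ 2) ^ 2
  have hTK : (T : ℝ) = 64 * K ^ 2 := by simp [T, hK]
  obtain ⟨R, hR⟩ : ∃ R : ℝ, R = 4 ^ T := ⟨_, rfl⟩
  have hT64 : (64 : ℝ) ≤ T := by nlinarith
  have hT1 : 1 ≤ T := by
    have : (1 : ℝ) ≤ T := by linarith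
    exact_mod_cast this
  have hR1 : 1 ≤ R := hR ▸ one_le_pow₀ (by norm_num)
  have hR2 : 2 ^ T ≤ R := hR ▸ pow_le_pow_left₀ (by norm_num) (by norm_num) _
  have hRR : 1 ≤ R ^ 2 := one_le_pow₀ hR1
  set W : ℝ := T * (16 * R ^ 2) with hWd
  have hW : 1 < W := by nlinarith
  have hKT : T / K = 64 * K := by
    rw [hTK]
    field_simp
  refine ⟨Real.log 2 / Real.log W, div_pos (Real.log_pos one_lt_two) (Real.log_pos hW), fun N => ?_⟩
  obtain ⟨L, _, _, G, hG, hN⟩ := hL N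
  have : NeZero (Nat.card G) := ⟨Nat.card_pos.ne'⟩
  obtain ⟨σ, hinj, hσ, hlow⟩ := hG.exists_embeddings hD
  generalize Nat.card G = m at *
  set U := BoxCount.unionBox σ T R with hU
  have hge : (64 * K * R ^ 2) ^ m ≤ (U.ncard : ℝ) := by
    have := BoxCount.le_ncard_unionBox hσ hT1 hR2 (by positivity : (0 : ℝ) < 4 * D) hlow
    rwa [← hK, mul_div_right_comm, hKT] at this
  have hle : (U.ncard : ℝ) ≤ W ^ m := BoxCount.ncard_unionBox_le hσ T hR1
  have hpos : (0 : ℝ) < U.ncard := lt_of_lt_of_le (by positivity) hge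
  have hsq : (4096 * K ^ 2 * R ^ 4) ^ m ≤ (U.ncard : ℝ) ^ 2 := by
    refine Eq.trans_le ?_ (pow_le_pow_left₀ (by positivity) hge 2)
    rw [← pow_mul, mul_comm m 2, pow_mul, mul_pow, mul_pow]
    ring
  let φ := σ (0, true)
  have hφ : Function.Injective φ := hinj _
  refine ⟨φ '' U, (BoxCount.unionBox_finite hσ T hR1).image φ, ?_, ?_⟩
  · rw [Set.ncard_image_of_injective U hφ]
    have h1 : (2 : ℝ) ^ m ≤ (64 * K * R ^ 2) ^ m :=
      pow_le_pow_left₀ (by norm_num) (by nlinarith) _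
    have h2 : (m : ℝ) ≤ 2 ^ m := by exact_mod_cast Nat.lt_two_pow_self.le
    have h3 : (m : ℝ) ≤ U.ncard := h2.trans (h1.trans hge)
    exact hN.trans (by exact_mod_cast h3)
  · rw [← Set.image_add φ, ← Set.image_mul φ, Set.ncard_image_of_injective _ hφ,
      Set.ncard_image_of_injective _ hφ, Set.ncard_image_of_injective _ hφ]
    refine max_le (Real.le_rpow_two_sub_of_mul_le_sq hW hpos hle ?_)
      (Real.le_rpow_two_sub_of_mul_le_sq hW hpos hle ?_)
    · refine le_trans ?_ hsq
      refine (mul_le_mul_of_nonneg_right (BoxCount.ncard_add_le hσ T hR1) (by positivity)).trans ?_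
      rw [← mul_pow]
      refine pow_le_pow_left₀ (by positivity) ?_ _
      have h1 : R ^ 3 ≤ R ^ 4 := pow_le_pow_right₀ hR1 (by norm_num)
      have h2 : 1 ≤ K ^ 2 := one_le_pow₀ hK1
      have h3 : 36 * R ^ 2 * 4 ^ T * 2 = 72 * R ^ 3 := by
        rw [← hR]
        ring
      rw [h3]
      nlinarith [pow_pos (by linarith : 0 < R) 4]
    · refine le_trans ?_ hsq
      refine (mul_le_mul_of_nonneg_right (BoxCount.ncard_mul_le hσ T hR1) (by positivity)).trans ?_
      rw [← mul_pow]
      refine pow_le_pow_left₀ (by positivity) (le_of_eq ?_) _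
      rw [hTK]
      ring
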